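/- For every p ≥ 6 there exist a constant δ_p > 0, a constant C, and an integer L₀ ≥ 0, depending only on γ and p, such that for every integer j ≥ 1, every l ∈ ℕ with l ≥ L₀, and every Schwartz function f on ℝ², the local smoothing estimate (∫₁² ‖m_j^l(u,D) f‖_{L^p(ℝ²)}^p du)^{1/p} ≤ C 2^{−(1/p + δ_p) j} ‖f‖_{L^p(ℝ²)} holds; in particular the constant C is uniform in l. -/

import Mathlib

set_option linter.unusedVariables false

open MeasureTheory Set Filter ENNReal NNReal

/-- The rescaled curve `γ_l(t) = γ(2^{-l} t)/γ(2^{-l})`. -/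
noncomputable def gammaZ (γ : ℝ → ℝ) (l : ℤ) (t : ℝ) : ℝ :=
  γ ((2 : ℝ) ^ (-l) * t) / γ ((2 : ℝ) ^ (-l))

/-- The Fourier transform on `ℝ²`. -/
noncomputable def ft (f : ℝ × ℝ → ℂ) (ξ : ℝ × ℝ) : ℂ :=
  ∫ x : ℝ × ℝ, Complex.exp (-2 * Real.pi * Complex.I * (x.1 * ξ.1 + x.2 * ξ.2)) * f x

/-- The inverse Fourier transform on `ℝ²`. -/
noncomputable def ftInv (f : ℝ × ℝ → ℂ) (x : ℝ × ℝ) : ℂ :=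
  ∫ ξ : ℝ × ℝ, Complex.exp (2 * Real.pi * Complex.I * (x.1 * ξ.1 + x.2 * ξ.2)) * f ξ

/-- The Fourier multiplier operator `a(D)f = (a f̂)^∨` with symbol `a`. -/
noncomputable def op (a : ℝ × ℝ → ℂ) (f : ℝ × ℝ → ℂ) : ℝ × ℝ → ℂ :=
  ftInv (fun ξ => a ξ * ft f ξ)

/-- The localized multiplier `m_j^l(u,ξ)`. -/
noncomputable def mjl (γ φ : ℝ → ℝ) (j l : ℕ) (u : ℝ) (ξ : ℝ × ℝ) : ℂ :=
  ((φ ((2 : ℝ) ^ (-(j : ℤ)) * ξ.1) * φ ((2 : ℝ) ^ (-(j : ℤ)) * ξ.2) : ℝ) : ℂ) *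
    ∫ t : ℝ, Complex.exp (Complex.I * ξ.1 * t) *
      Complex.exp (Complex.I * ξ.2 * u * gammaZ γ (l : ℤ) t) * (φ t : ℂ) / t


/-- uniformly bounded families with `n` derivatives; `v` = vanishing at the end points -/
def UB {ι : Type} (α β : ℝ) (v : Prop) : ℕ → (ι → ℝ → ℂ) → Prop
  | 0, a => (∃ C, ∀ i, ∀ t ∈ Icc α β, ‖a i t‖ ≤ C) ∧ (v → ∀ i, a i α = 0 ∧ a i β = 0) ∧
      (∀ i, ContinuousOn (a i) (Icc α β))
  | n + 1, a => (∃ C, ∀ i, ∀ t ∈ Icc α β, ‖a i t‖ ≤ C) ∧ (v → ∀ i, a i α = 0 ∧ a i β = 0) ∧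
      ∃ a' : ι → ℝ → ℂ, (∀ i, ∀ t ∈ Icc α β, HasDerivAt (a i) (a' i t) t) ∧ UB α β v n a'

section UBsec
variable {ι : Type} {α β : ℝ} {v : Prop}

theorem UB.bd {n : ℕ} {a : ι → ℝ → ℂ} (h : UB α β v n a) :
    ∃ C, 0 ≤ C ∧ ∀ i, ∀ t ∈ Icc α β, ‖a i t‖ ≤ C := by
  have : ∃ C, ∀ i, ∀ t ∈ Icc α β, ‖a i t‖ ≤ C := by
    cases n with
    | zero => exact h.1
    | succ n => exact h.1
  obtain ⟨C, hC⟩ := this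
  exact ⟨|C|, abs_nonneg _, fun i t ht => (hC i t ht).trans (le_abs_self _)⟩

theorem UB.van {n : ℕ} {a : ι → ℝ → ℂ} (h : UB α β v n a) (hv : v) :
    ∀ i, a i α = 0 ∧ a i β = 0 := by
  cases n with
  | zero => exact h.2.1 hv
  | succ n => exact h.2.1 hv

theorem UB.cont {n : ℕ} {a : ι → ℝ → ℂ} (h : UB α β v n a) (i : ι) :
    ContinuousOn (a i) (Icc α β) := by
  cases n with
  | zero => exact h.2.2 i
  | succ n =>
    obtain ⟨_, _, a', ha, _⟩ := h
    exact fun t ht => (ha i t ht).continuousAt.continuousWithinAt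

theorem UB.zero_of {n : ℕ} {a : ι → ℝ → ℂ} (h : UB α β v n a) : UB α β v 0 a := by
  obtain ⟨C, _, hC⟩ := h.bd
  exact ⟨⟨C, hC⟩, h.van, h.cont⟩

theorem UB.pred : ∀ {n : ℕ} {a : ι → ℝ → ℂ}, UB α β v (n + 1) a → UB α β v n a
  | 0, _, h => h.zero_of
  | n + 1, a, ⟨h1, h2, a', h3, h4⟩ => ⟨h1, h2, a', h3, UB.pred h4⟩

theorem UB.mono {n m : ℕ} (hnm : m ≤ n) {a : ι → ℝ → ℂ} (h : UB α β v n a) : UB α β v m a := by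
  induction n, hnm using Nat.le_induction with
  | base => exact h
  | succ n _ ih => exact ih h.pred

theorem UB.weak : ∀ {n : ℕ} {a : ι → ℝ → ℂ}, UB α β v n a → UB α β False n a
  | 0, _, h => ⟨h.1, fun h => h.elim, h.2.2⟩
  | n + 1, a, ⟨h1, _, a', h3, h4⟩ => ⟨h1, fun h => h.elim, a', h3, UB.weak h4⟩

theorem UB.add : ∀ {n : ℕ} {a b : ι → ℝ → ℂ}, UB α β v n a → UB α β v n b →
    UB α β v n (fun i t => a i t + b i t) := by
  intro n
  induction n with
  | zero =>
    intro a b ha hb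
    obtain ⟨C, _, hC⟩ := ha.bd
    obtain ⟨D, _, hD⟩ := hb.bd
    refine ⟨⟨C + D, fun i t ht => (norm_add_le _ _).trans (add_le_add (hC i t ht) (hD i t ht))⟩,
      fun hv i => ?_, fun i => (ha.cont i).add (hb.cont i)⟩
    simp [(ha.van hv i).1, (ha.van hv i).2, (hb.van hv i).1, (hb.van hv i).2]
  | succ n ih =>
    intro a b ha hb
    obtain ⟨C, _, hC⟩ := ha.bd
    obtain ⟨D, _, hD⟩ := hb.bd
    refine ⟨⟨C + D, fun i t ht => (norm_add_le _ _).trans (add_le_add (hC i t ht) (hD i t ht))⟩,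
      fun hv i => ?_, ?_⟩
    · simp [(ha.van hv i).1, (ha.van hv i).2, (hb.van hv i).1, (hb.van hv i).2]
    · obtain ⟨_, _, a', ha', hA⟩ := ha
      obtain ⟨_, _, b', hb', hB⟩ := hb
      exact ⟨_, fun i t ht => (ha' i t ht).add (hb' i t ht), ih hA hB⟩

theorem UB.mul : ∀ {n : ℕ} {a b : ι → ℝ → ℂ}, UB α β v n a → UB α β False n b →
    UB α β v n (fun i t => a i t * b i t) := by
  intro n
  induction n with
  | zero =>
    intro a b ha hb
    obtain ⟨C, hC0, hC⟩ := ha.bd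
    obtain ⟨D, _, hD⟩ := hb.bd
    refine ⟨⟨C * D, fun i t ht => (norm_mul_le _ _).trans
      (mul_le_mul (hC i t ht) (hD i t ht) (norm_nonneg _) hC0)⟩,
      fun hv i => ?_, fun i => (ha.cont i).mul (hb.cont i)⟩
    simp [(ha.van hv i).1, (ha.van hv i).2]
  | succ n ih =>
    intro a b ha hb
    obtain ⟨C, hC0, hC⟩ := ha.bd
    obtain ⟨D, _, hD⟩ := hb.bd
    refine ⟨⟨C * D, fun i t ht => (norm_mul_le _ _).trans
      (mul_le_mul (hC i t ht) (hD i t ht) (norm_nonneg _) hC0)⟩,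
      fun hv i => ?_, ?_⟩
    · simp [(ha.van hv i).1, (ha.van hv i).2]
    · have ha1 := ha.pred
      have hb1 := hb.pred
      obtain ⟨_, _, a', ha', hA⟩ := ha
      obtain ⟨_, _, b', hb', hB⟩ := hb
      exact ⟨_, fun i t ht => (ha' i t ht).mul (hb' i t ht), (ih hA hb1).add (ih ha1 hB)⟩

theorem UB.const : ∀ (n : ℕ) {c : ι → ℂ} {C : ℝ}, (∀ i, ‖c i‖ ≤ C) →
    UB α β False n (fun i _ => c i)
  | 0, _, C, h => ⟨⟨C, fun i _ _ => h i⟩, fun h => h.elim, fun _ => continuousOn_const⟩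
  | n + 1, c, C, h => ⟨⟨C, fun i _ _ => h i⟩, fun h => h.elim, fun _ _ => 0,
      fun i t _ => hasDerivAt_const t (c i), UB.const n (c := fun _ => 0) (C := 0) (by simp)⟩

theorem UB.smul {n : ℕ} {c : ι → ℂ} {C : ℝ} (h : ∀ i, ‖c i‖ ≤ C) {a : ι → ℝ → ℂ}
    (ha : UB α β v n a) : UB α β v n (fun i t => c i * a i t) := by
  have := ha.mul (UB.const n h)
  simpa [mul_comm] using this

theorem UB.inv : ∀ {n : ℕ} {a : ι → ℝ → ℂ} {c : ℝ}, 0 < c → (∀ i, ∀ t ∈ Icc α β, c ≤ ‖a i t‖) →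
    UB α β False n a → UB α β False n (fun i t => (a i t)⁻¹) := by
  intro n
  induction n with
  | zero =>
    intro a c hc h ha
    refine ⟨⟨c⁻¹, fun i t ht => ?_⟩, fun h => h.elim, fun i => (ha.cont i).inv₀ fun t ht => ?_⟩
    · rw [norm_inv]; exact inv_anti₀ hc (h i t ht)
    · exact norm_pos_iff.1 (hc.trans_le (h i t ht))
  | succ n ih =>
    intro a c hc h ha
    have ha1 := ih hc h ha.pred
    obtain ⟨_, _, a', ha', hA⟩ := ha
    refine ⟨⟨c⁻¹, fun i t ht => ?_⟩, fun h => h.elim,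
      fun i t => (-1) * (a' i t * ((a i t)⁻¹ * (a i t)⁻¹)), fun i t ht => ?_, ?_⟩
    · rw [norm_inv]; exact inv_anti₀ hc (h i t ht)
    · have h0 : a i t ≠ 0 := norm_pos_iff.1 (hc.trans_le (h i t ht))
      exact ((ha' i t ht).fun_inv h0).congr_deriv (by field_simp)
    · exact UB.smul (c := fun _ => -1) (C := 1) (by simp) (hA.mul (ha1.mul ha1))

/-- modulated bump -/
noncomputable def EE (N κ1 κ2 : ℝ) (σ τ : ℝ → ℂ) (w1 w2 : ℝ) : ℂ :=
  Complex.exp (((N ^ 2 * (κ1 * w1 + κ2 * w2) : ℝ) : ℂ) * Complex.I) * (N ^ 2 : ℝ) * σ (N * w1) *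
    τ (N * w2)

/-- the oscillatory kernel -/
noncomputable def KK (α β N κ1 κ2 : ℝ) (Γ1 Γ2 : ℝ → ℝ) (a : ℝ → ℂ) (σ τ : ℝ → ℂ)
    (z1 z2 : ℝ) : ℂ :=
  ∫ t in α..β, a t * EE N κ1 κ2 σ τ (z1 + Γ1 t) (z2 + Γ2 t)

theorem EE_cont (N κ1 κ2 : ℝ) (σ τ : SchwartzMap ℝ ℂ) :
    Continuous (fun w : ℝ × ℝ => EE N κ1 κ2 σ τ w.1 w.2) := by
  unfold EE
  have := σ.continuous
  have := τ.continuous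
  fun_prop

theorem EE_deriv (N κ1 κ2 : ℝ) (σ τ : SchwartzMap ℝ ℂ) {x y : ℝ → ℝ} {x' y' t : ℝ}
    (hx : HasDerivAt x x' t) (hy : HasDerivAt y y' t) :
    HasDerivAt (fun t => EE N κ1 κ2 σ τ (x t) (y t))
      (Complex.I * N ^ 2 * ((κ1 * x' + κ2 * y' : ℝ) : ℂ) * EE N κ1 κ2 σ τ (x t) (y t) +
       N * x' * EE N κ1 κ2 (SchwartzMap.derivCLM ℂ ℂ σ) τ (x t) (y t) +
       N * y' * EE N κ1 κ2 σ (SchwartzMap.derivCLM ℂ ℂ τ) (x t) (y t)) t := by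
  have e1 := ((((hx.const_mul κ1).fun_add (hy.const_mul κ2)).const_mul (N ^ 2)).ofReal_comp.mul_const
      Complex.I).cexp
  have s1 := (σ.differentiableAt (x := N * x t)).hasDerivAt.scomp t (hx.const_mul N)
  have s2 := (τ.differentiableAt (x := N * y t)).hasDerivAt.scomp t (hy.const_mul N)
  refine (((e1.mul_const ((N ^ 2 : ℝ) : ℂ)).fun_mul s1).fun_mul s2).congr_deriv ?_
  simp only [EE, Function.comp_apply, SchwartzMap.derivCLM_apply, Complex.real_smul]
  push_cast
  ring

/-- hypotheses on phases -/
structure PhaseFam {ι : Type} (α β : ℝ) (n : ℕ) (N : ι → ℝ) (Γ1 Γ2 Γ1' Γ2' : ι → ℝ → ℝ) :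
    Prop where
  hαβ : α ≤ β
  hN : ∀ i, 1 ≤ N i
  hd1 : ∀ i, ∀ t ∈ Icc α β, HasDerivAt (Γ1 i) (Γ1' i t) t
  hd2 : ∀ i, ∀ t ∈ Icc α β, HasDerivAt (Γ2 i) (Γ2' i t) t
  hu1 : UB α β False n (fun i t => (Γ1' i t : ℂ))
  hu2 : UB α β False n (fun i t => (Γ2' i t : ℂ))

variable {N : ι → ℝ} {κ1 κ2 : ι → ℝ} {Γ1 Γ2 Γ1' Γ2' : ι → ℝ → ℝ} {n : ℕ}

theorem KK_ii (hP : PhaseFam α β n N Γ1 Γ2 Γ1' Γ2') (i : ι) {a : ℝ → ℂ}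
    (ha : ContinuousOn a (Icc α β)) (σ τ : SchwartzMap ℝ ℂ) (κ1 κ2 z1 z2 : ℝ) :
    IntervalIntegrable (fun t => a t * EE (N i) κ1 κ2 σ τ (z1 + Γ1 i t) (z2 + Γ2 i t))
      volume α β := by
  have h1 : ContinuousOn (Γ1 i) (Icc α β) :=
    fun t ht => (hP.hd1 i t ht).continuousAt.continuousWithinAt
  have h2 : ContinuousOn (Γ2 i) (Icc α β) :=
    fun t ht => (hP.hd2 i t ht).continuousAt.continuousWithinAt
  have h3 : ContinuousOn (fun t => (z1 + Γ1 i t, z2 + Γ2 i t)) (Icc α β) :=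
    (h1.const_add z1).prodMk (h2.const_add z2)
  have h4 := (EE_cont (N i) κ1 κ2 σ τ).comp_continuousOn h3
  have h5 := ha.mul h4
  exact h5.intervalIntegrable_of_Icc hP.hαβ

theorem KK_ibp (hP : PhaseFam α β n N Γ1 Γ2 Γ1' Γ2') (i : ι) {a a' : ℝ → ℂ}
    (ha : ∀ t ∈ Icc α β, HasDerivAt a (a' t) t) (ha' : ContinuousOn a' (Icc α β))
    (h0 : a α = 0) (h1 : a β = 0) (σ τ : SchwartzMap ℝ ℂ) (κ1 κ2 z1 z2 : ℝ) :
    (N i : ℂ) * KK α β (N i) κ1 κ2 (Γ1 i) (Γ2 i)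
      (fun t => a t * ((κ1 * Γ1' i t + κ2 * Γ2' i t : ℝ) : ℂ)) σ τ z1 z2 =
    Complex.I * ((N i)⁻¹ : ℝ) * KK α β (N i) κ1 κ2 (Γ1 i) (Γ2 i) a' σ τ z1 z2 +
    Complex.I * KK α β (N i) κ1 κ2 (Γ1 i) (Γ2 i) (fun t => a t * (Γ1' i t : ℂ))
      (SchwartzMap.derivCLM ℂ ℂ σ) τ z1 z2 +
    Complex.I * KK α β (N i) κ1 κ2 (Γ1 i) (Γ2 i) (fun t => a t * (Γ2' i t : ℂ))
      σ (SchwartzMap.derivCLM ℂ ℂ τ) z1 z2 := by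
  have hN : (N i : ℂ) ≠ 0 := by
    have := hP.hN i
    exact_mod_cast (by linarith : N i ≠ 0)
  have hac : ContinuousOn a (Icc α β) := fun t ht => (ha t ht).continuousAt.continuousWithinAt
  have hp : ContinuousOn (fun t => a t * ((κ1 * Γ1' i t + κ2 * Γ2' i t : ℝ) : ℂ)) (Icc α β) := by
    have hG1 := hP.hu1.cont i
    have hG2 := hP.hu2.cont i
    push_cast
    fun_prop
  have i1 := KK_ii hP i ha' σ τ κ1 κ2 z1 z2
  have i2 := (KK_ii hP i hp σ τ κ1 κ2 z1 z2).const_mul (Complex.I * N i ^ 2)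
  have i3 := (KK_ii hP i (a := fun t => a t * (Γ1' i t : ℂ)) (hac.mul (hP.hu1.cont i))
    (SchwartzMap.derivCLM ℂ ℂ σ) τ κ1 κ2 z1 z2).const_mul (N i : ℂ)
  have i4 := (KK_ii hP i (a := fun t => a t * (Γ2' i t : ℂ)) (hac.mul (hP.hu2.cont i))
    σ (SchwartzMap.derivCLM ℂ ℂ τ) κ1 κ2 z1 z2).const_mul (N i : ℂ)
  have key := intervalIntegral.integral_eq_sub_of_hasDerivAt (fun t ht => ?_)
    (((i1.add i2).add i3).add i4) (f := fun t => a t * EE (N i) κ1 κ2 σ τ (z1 + Γ1 i t) (z2 + Γ2 i t))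
  · rw [intervalIntegral.integral_add ((i1.add i2).add i3) i4,
      intervalIntegral.integral_add (i1.add i2) i3,
      intervalIntegral.integral_add i1 i2, intervalIntegral.integral_const_mul,
      intervalIntegral.integral_const_mul, intervalIntegral.integral_const_mul, h0, h1] at key
    simp only [zero_mul, sub_zero] at key
    unfold KK
    have hI : Complex.I * Complex.I = -1 := Complex.I_mul_I
    rw [Complex.ofReal_inv]
    field_simp
    linear_combination (-Complex.I) * key + ((N i : ℂ) ^ 2) * (∫ t in α..β,
      (a t * ((κ1 * Γ1' i t + κ2 * Γ2' i t : ℝ) : ℂ)) *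
      EE (N i) κ1 κ2 σ τ (z1 + Γ1 i t) (z2 + Γ2 i t)) * hI
  · rw [uIcc_of_le hP.hαβ] at ht
    refine ((ha t ht).fun_mul (EE_deriv (N i) κ1 κ2 σ τ ((hP.hd1 i t ht).const_add z1)
      ((hP.hd2 i t ht).const_add z2))).congr_deriv ?_
    ring
end UBsec


section CF
variable {ι : Type} {α β : ℝ}

/-- phases with a critical point -/
structure CritFam (α β : ℝ) (n : ℕ) (N κ1 κ2 e tc c2 : ι → ℝ) (Γ2 Γ2' : ι → ℝ → ℝ)
    (r ρ : ι → ℝ → ℂ) : Prop where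
  hP : PhaseFam α β n N (fun i t => e i * t) Γ2 (fun i _ => e i) Γ2'
  he : ∀ i, |e i| = 1
  hr : ∀ i, ∀ t ∈ Icc α β, ((t - tc i : ℝ) : ℂ) = ((κ1 i * e i + κ2 i * Γ2' i t : ℝ) : ℂ) * r i t
  hρ : ∀ i, ∀ t ∈ Icc α β, ((Γ2 i t - c2 i : ℝ) : ℂ) = ((t - tc i : ℝ) : ℂ) * ρ i t
  ur : UB α β False n r
  uρ : UB α β False n ρ

variable {N κ1 κ2 e tc c2 : ι → ℝ} {Γ2 Γ2' : ι → ℝ → ℝ} {r ρ : ι → ℝ → ℂ} {n : ℕ}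

theorem EE_norm (N κ1 κ2 : ℝ) (σ τ : ℝ → ℂ) (w1 w2 : ℝ) :
    ‖EE N κ1 κ2 σ τ w1 w2‖ = N ^ 2 * ‖σ (N * w1)‖ * ‖τ (N * w2)‖ := by
  simp only [EE, norm_mul, Complex.norm_exp_ofReal_mul_I, one_mul]
  simp

theorem KK_base (h : CritFam α β n N κ1 κ2 e tc c2 Γ2 Γ2' r ρ) {v : Prop} {a : ι → ℝ → ℂ}
    (ha : UB α β v 0 a) (σ τ : SchwartzMap ℝ ℂ) : ∃ C, 0 ≤ C ∧ ∀ i z1 z2,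
    ‖KK α β (N i) (κ1 i) (κ2 i) (fun t => e i * t) (Γ2 i) (a i) σ τ z1 z2‖ ≤ C * N i := by
  obtain ⟨A, hA0, hA⟩ := ha.bd
  obtain ⟨B, hB⟩ := τ.decay 0 0
  simp only [pow_zero, one_mul, norm_iteratedFDeriv_zero] at hB
  have hB0 : 0 ≤ B := (norm_nonneg _).trans (hB.2 0)
  set S := ∫ x, ‖σ x‖
  have hS : 0 ≤ S := integral_nonneg fun _ => norm_nonneg _
  refine ⟨A * B * S, by positivity, fun i z1 z2 => ?_⟩
  have hN : 0 < N i := by linarith [h.hP.hN i]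
  have hσ : Integrable (fun t => ‖σ (N i * (z1 + e i * t))‖) := by
    have h0 : N i * e i ≠ 0 := by
      have := h.he i
      refine mul_ne_zero hN.ne' fun h => ?_
      rw [h] at this; norm_num at this
    have := (((σ.integrable (μ := volume)).norm).comp_add_left (N i * z1)).comp_mul_left' h0
    refine this.congr (Eventually.of_forall fun t => ?_)
    simp only
    ring_nf
  have hσi : ∫ t, ‖σ (N i * (z1 + e i * t))‖ = (N i)⁻¹ * S := by
    have h1 := Measure.integral_comp_mul_left (fun x => ‖σ (N i * z1 + x)‖) (N i * e i)
    rw [integral_add_left_eq_self (fun x => ‖σ x‖) (N i * z1), abs_inv, abs_mul, h.he i, mul_one,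
      abs_of_pos hN, smul_eq_mul] at h1
    rw [← h1]
    congr 1; ext t; ring_nf
  calc _ ≤ ∫ t in α..β, (A * B * N i ^ 2) * ‖σ (N i * (z1 + e i * t))‖ := by
        refine intervalIntegral.norm_integral_le_of_norm_le h.hP.hαβ ?_
          (hσ.const_mul _).intervalIntegrable
        refine Eventually.of_forall fun t ht => ?_
        rw [norm_mul, EE_norm]
        have h1 := hA i t ⟨ht.1.le, ht.2⟩
        have h2 := hB.2 (N i * (z2 + Γ2 i t))
        calc _ ≤ A * (N i ^ 2 * ‖σ (N i * (z1 + e i * t))‖ * B) := by gcongr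
          _ = _ := by ring
    _ ≤ ∫ t, (A * B * N i ^ 2) * ‖σ (N i * (z1 + e i * t))‖ := by
        rw [intervalIntegral.integral_of_le h.hP.hαβ]
        refine setIntegral_le_integral (hσ.const_mul _) (Eventually.of_forall fun t => ?_)
        simp only [Pi.zero_apply]; positivity
    _ = _ := by
        rw [integral_const_mul, hσi]; field_simp

/-- multiplication by the coordinate -/
noncomputable def xmul (σ : SchwartzMap ℝ ℂ) : SchwartzMap ℝ ℂ :=
  SchwartzMap.smulLeftCLM ℂ (fun x : ℝ => (x : ℂ)) σ

theorem xmul_apply (σ : SchwartzMap ℝ ℂ) (x : ℝ) : xmul σ x = x * σ x := by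
  rw [xmul, SchwartzMap.smulLeftCLM_apply_apply]
  · rfl
  · exact Complex.ofRealCLM.hasTemperateGrowth

theorem KK_step (h : CritFam α β n N κ1 κ2 e tc c2 Γ2 Γ2' r ρ) {m : ℕ} (hm : m + 1 ≤ n)
    {a : ι → ℝ → ℂ} (ha : UB α β True (m + 1) a) {ρ' : ι → ℝ → ℂ} (hρ' : UB α β False n ρ') :
    ∃ a' : ι → ℝ → ℂ, UB α β True m a' ∧ ∀ (σ τ : SchwartzMap ℝ ℂ) i z1 z2,
    (N i : ℂ) * KK α β (N i) (κ1 i) (κ2 i) (fun t => e i * t) (Γ2 i)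
      (fun t => a i t * (((t - tc i : ℝ) : ℂ) * ρ' i t)) σ τ z1 z2 =
    KK α β (N i) (κ1 i) (κ2 i) (fun t => e i * t) (Γ2 i) (a' i) σ τ z1 z2 +
    KK α β (N i) (κ1 i) (κ2 i) (fun t => e i * t) (Γ2 i)
      (fun t => Complex.I * (a i t * ρ' i t * r i t * (e i : ℂ))) (SchwartzMap.derivCLM ℂ ℂ σ) τ z1 z2 +
    KK α β (N i) (κ1 i) (κ2 i) (fun t => e i * t) (Γ2 i)
      (fun t => Complex.I * (a i t * ρ' i t * r i t * (Γ2' i t : ℂ))) σ (SchwartzMap.derivCLM ℂ ℂ τ) z1 z2 := by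
  have hb : UB α β True (m + 1) (fun i t => a i t * ρ' i t * r i t) :=
    (ha.mul (hρ'.mono hm)).mul (h.ur.mono hm)
  have hvan := hb.van trivial
  obtain ⟨-, -, b', hb', hB⟩ := hb
  refine ⟨fun i t => (Complex.I * ((N i)⁻¹ : ℝ)) * b' i t, UB.smul (C := 1) (fun i => ?_) hB, ?_⟩
  · have := h.hP.hN i
    simp only [Complex.norm_mul, Complex.norm_I, Complex.norm_real, one_mul]
    rw [Real.norm_of_nonneg (by positivity)]
    exact inv_le_one_of_one_le₀ this
  intro σ τ i z1 z2
  have := KK_ibp h.hP i (hb' i) (hB.cont i) (hvan i).1 (hvan i).2 σ τ (κ1 i) (κ2 i) z1 z2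
  have e1 : KK α β (N i) (κ1 i) (κ2 i) (fun t => e i * t) (Γ2 i)
      (fun t => a i t * (((t - tc i : ℝ) : ℂ) * ρ' i t)) σ τ z1 z2 =
      KK α β (N i) (κ1 i) (κ2 i) (fun t => e i * t) (Γ2 i)
      (fun t => a i t * ρ' i t * r i t * ((κ1 i * e i + κ2 i * Γ2' i t : ℝ) : ℂ)) σ τ z1 z2 := by
    unfold KK
    refine intervalIntegral.integral_congr fun t ht => ?_
    rw [uIcc_of_le h.hP.hαβ] at ht
    simp only
    rw [h.hr i t ht]; ring
  rw [e1, this]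
  unfold KK
  simp only [← intervalIntegral.integral_const_mul, mul_assoc]

theorem KK_mulX (h : CritFam α β n N κ1 κ2 e tc c2 Γ2 Γ2' r ρ) {v : Prop} {a : ι → ℝ → ℂ}
    (ha : UB α β v 0 a) (σ τ : SchwartzMap ℝ ℂ) (i : ι) (z1 z2 : ℝ) :
    ((N i * (z1 + e i * tc i) : ℝ) : ℂ) *
      KK α β (N i) (κ1 i) (κ2 i) (fun t => e i * t) (Γ2 i) (a i) σ τ z1 z2 =
    KK α β (N i) (κ1 i) (κ2 i) (fun t => e i * t) (Γ2 i) (a i) (xmul σ) τ z1 z2 -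
    (N i : ℂ) * KK α β (N i) (κ1 i) (κ2 i) (fun t => e i * t) (Γ2 i)
      (fun t => a i t * (((t - tc i : ℝ) : ℂ) * (e i : ℂ))) σ τ z1 z2 := by
  have i1 := KK_ii h.hP i (ha.cont i) (xmul σ) τ (κ1 i) (κ2 i) z1 z2
  have i2 := (KK_ii h.hP i (a := fun t => a i t * (((t - tc i : ℝ) : ℂ) * (e i : ℂ)))
    ((ha.cont i).mul (by fun_prop)) σ τ (κ1 i) (κ2 i) z1 z2).const_mul (N i : ℂ)
  unfold KK
  rw [← intervalIntegral.integral_const_mul, ← intervalIntegral.integral_const_mul,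
    ← intervalIntegral.integral_sub i1 i2]
  refine intervalIntegral.integral_congr fun t ht => ?_
  simp only [EE, xmul_apply]
  push_cast
  ring

theorem KK_mulY (h : CritFam α β n N κ1 κ2 e tc c2 Γ2 Γ2' r ρ) {v : Prop} {a : ι → ℝ → ℂ}
    (ha : UB α β v 0 a) (σ τ : SchwartzMap ℝ ℂ) (i : ι) (z1 z2 : ℝ) :
    ((N i * (z2 + c2 i) : ℝ) : ℂ) *
      KK α β (N i) (κ1 i) (κ2 i) (fun t => e i * t) (Γ2 i) (a i) σ τ z1 z2 =
    KK α β (N i) (κ1 i) (κ2 i) (fun t => e i * t) (Γ2 i) (a i) σ (xmul τ) z1 z2 -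
    (N i : ℂ) * KK α β (N i) (κ1 i) (κ2 i) (fun t => e i * t) (Γ2 i)
      (fun t => a i t * (((t - tc i : ℝ) : ℂ) * ρ i t)) σ τ z1 z2 := by
  have i1 := KK_ii h.hP i (ha.cont i) σ (xmul τ) (κ1 i) (κ2 i) z1 z2
  have hc := h.uρ.cont i
  have i2 := (KK_ii h.hP i (a := fun t => a i t * (((t - tc i : ℝ) : ℂ) * ρ i t))
    ((ha.cont i).mul (by fun_prop)) σ τ (κ1 i) (κ2 i) z1 z2).const_mul (N i : ℂ)
  unfold KK
  rw [← intervalIntegral.integral_const_mul, ← intervalIntegral.integral_const_mul,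
    ← intervalIntegral.integral_sub i1 i2]
  refine intervalIntegral.integral_congr fun t ht => ?_
  rw [uIcc_of_le h.hP.hαβ] at ht
  simp only [EE, xmul_apply]
  rw [← h.hρ i t ht]
  push_cast
  ring

theorem KK_decay (h : CritFam α β n N κ1 κ2 e tc c2 Γ2 Γ2' r ρ) : ∀ (m : ℕ), m ≤ n →
    ∀ {a : ι → ℝ → ℂ}, UB α β True m a → ∀ σ τ : SchwartzMap ℝ ℂ, ∃ C, 0 ≤ C ∧ ∀ i z1 z2 p q,
    p + q ≤ m → |N i * (z1 + e i * tc i)| ^ p * |N i * (z2 + c2 i)| ^ q *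
    ‖KK α β (N i) (κ1 i) (κ2 i) (fun t => e i * t) (Γ2 i) (a i) σ τ z1 z2‖ ≤ C * N i := by
  intro m
  induction m with
  | zero =>
    intro _ a ha σ τ
    obtain ⟨C, hC0, hC⟩ := KK_base h ha σ τ
    refine ⟨C, hC0, fun i z1 z2 p q hpq => ?_⟩
    obtain ⟨rfl, rfl⟩ : p = 0 ∧ q = 0 := by omega
    simpa using hC i z1 z2
  | succ m ih =>
    intro hm a ha σ τ
    have he' : UB α β False n (fun i (_ : ℝ) => (e i : ℂ)) := UB.const n (C := 1) fun i => by
      simpa using (h.he i).le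
    have aux : ∀ ρ' : ι → ℝ → ℂ, UB α β False n ρ' → ∃ C, 0 ≤ C ∧ ∀ i z1 z2 p q, p + q ≤ m →
        |N i * (z1 + e i * tc i)| ^ p * |N i * (z2 + c2 i)| ^ q *
        ‖(N i : ℂ) * KK α β (N i) (κ1 i) (κ2 i) (fun t => e i * t) (Γ2 i)
          (fun t => a i t * (((t - tc i : ℝ) : ℂ) * ρ' i t)) σ τ z1 z2‖ ≤ C * N i := by
      intro ρ' hρ'
      obtain ⟨a', ha', hst⟩ := KK_step h hm ha hρ'
      have hb := (ha.pred.mul (hρ'.mono (by omega : m ≤ n))).mul (h.ur.mono (by omega : m ≤ n))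
      obtain ⟨C1, h10, h1⟩ := ih (by omega) ha' σ τ
      obtain ⟨C2, h20, h2⟩ := ih (by omega) (UB.smul (c := fun _ => Complex.I) (C := 1) (by simp)
        (hb.mul (he'.mono (by omega : m ≤ n)))) (SchwartzMap.derivCLM ℂ ℂ σ) τ
      obtain ⟨C3, h30, h3⟩ := ih (by omega) (UB.smul (c := fun _ => Complex.I) (C := 1) (by simp)
        (hb.mul (h.hP.hu2.mono (by omega : m ≤ n)))) σ (SchwartzMap.derivCLM ℂ ℂ τ)
      refine ⟨C1 + C2 + C3, by positivity, fun i z1 z2 p q hpq => ?_⟩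
      rw [hst]
      have := h1 i z1 z2 p q hpq
      have := h2 i z1 z2 p q hpq
      have := h3 i z1 z2 p q hpq
      refine (mul_le_mul_of_nonneg_left (norm_add₃_le) (by positivity)).trans ?_
      linarith
    obtain ⟨C0, h00, h0⟩ := ih (by omega) ha.pred σ τ
    obtain ⟨C1, h10, h1⟩ := ih (by omega) ha.pred (xmul σ) τ
    obtain ⟨C2, h20, h2⟩ := ih (by omega) ha.pred σ (xmul τ)
    obtain ⟨C3, h30, h3⟩ := aux _ he'
    obtain ⟨C4, h40, h4⟩ := aux _ h.uρ
    refine ⟨C0 + C1 + C2 + C3 + C4, by positivity, fun i z1 z2 p q hpq => ?_⟩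
    have hN : 0 ≤ N i := by linarith [h.hP.hN i]
    rcases p with _ | p
    · rcases q with _ | q
      · refine (h0 i z1 z2 0 0 (by omega)).trans ?_
        gcongr; linarith
      · have e1 := congrArg norm (KK_mulY h ha.zero_of σ τ i z1 z2)
        rw [norm_mul, Complex.norm_real, Real.norm_eq_abs] at e1
        rw [pow_succ, ← mul_assoc, mul_assoc (_ * _), e1]
        refine (mul_le_mul_of_nonneg_left (norm_sub_le _ _) (by positivity)).trans ?_
        have := h2 i z1 z2 0 q (by omega)
        have := h4 i z1 z2 0 q (by omega)
        nlinarith [mul_nonneg h00 hN, mul_nonneg h10 hN, mul_nonneg h30 hN]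
    · have e1 := congrArg norm (KK_mulX h ha.zero_of σ τ i z1 z2)
      rw [norm_mul, Complex.norm_real, Real.norm_eq_abs] at e1
      rw [pow_succ, mul_right_comm (_ ^ p), mul_assoc (_ * _), e1]
      refine (mul_le_mul_of_nonneg_left (norm_sub_le _ _) (by positivity)).trans ?_
      have := h1 i z1 z2 p q (by omega)
      have := h3 i z1 z2 p q (by omega)
      nlinarith [mul_nonneg h00 hN, mul_nonneg h20 hN, mul_nonneg h40 hN]

/-- decay profile -/
noncomputable def V1 (y : ℝ) : ℝ := (1 + y ^ 2)⁻¹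

theorem KK_bound (h : CritFam α β n N κ1 κ2 e tc c2 Γ2 Γ2' r ρ) (hn : 4 ≤ n)
    {a : ι → ℝ → ℂ} (ha : UB α β True 4 a) (σ τ : SchwartzMap ℝ ℂ) : ∃ C, 0 ≤ C ∧ ∀ i z1 z2,
    ‖KK α β (N i) (κ1 i) (κ2 i) (fun t => e i * t) (Γ2 i) (a i) σ τ z1 z2‖ ≤
      C * N i * (V1 (N i * (z1 + e i * tc i)) * V1 (N i * (z2 + c2 i))) := by
  obtain ⟨C, hC0, hC⟩ := KK_decay h 4 hn ha σ τ
  refine ⟨4 * C, by positivity, fun i z1 z2 => ?_⟩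
  have h1 := hC i z1 z2 0 0 (by omega)
  have h2 := hC i z1 z2 2 0 (by omega)
  have h3 := hC i z1 z2 0 2 (by omega)
  have h4 := hC i z1 z2 2 2 (by omega)
  simp only [sq_abs, pow_zero, one_mul, mul_one] at h1 h2 h3 h4
  unfold V1
  rw [← mul_inv, ← div_eq_mul_inv, le_div_iff₀ (by positivity)]
  nlinarith
end CF


section DDsec
variable {ι : Type} {α' α β β' : ℝ}

/-- divided-difference type average -/
noncomputable def DD (h : ℝ → ℂ) (c : ℝ) (m : ℕ) (t : ℝ) : ℂ :=
  ∫ r in (0:ℝ)..1, (r : ℂ) ^ m * h (c + r * (t - c))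

theorem seg_mem {c t r : ℝ} (hc : c ∈ Icc α β) (ht : t ∈ Icc α β) (hr : r ∈ Icc (0:ℝ) 1) :
    c + r * (t - c) ∈ Icc α β := by
  have := (convex_Icc α β).add_smul_sub_mem hc ht hr
  simpa using this

theorem DD_ii {h : ℝ → ℂ} (hh : ContinuousOn h (Icc α β)) {c t : ℝ} (hc : c ∈ Icc α β)
    (ht : t ∈ Icc α β) (m : ℕ) :
    ContinuousOn (fun r : ℝ => (r : ℂ) ^ m * h (c + r * (t - c))) (Icc 0 1) := by
  refine ContinuousOn.mul (by fun_prop) (hh.comp (by fun_prop) fun r hr => seg_mem hc ht hr)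

theorem UB.dd (h1 : α' < α) (h2 : β < β') {c : ι → ℝ} (hc : ∀ i, c i ∈ Icc α β) :
    ∀ (n m : ℕ) {h : ι → ℝ → ℂ}, UB α' β' False n h → UB α β False n (fun i => DD (h i) (c i) m) := by
  have sub : Icc α β ⊆ Icc α' β' := Icc_subset_Icc h1.le h2.le
  have bd : ∀ (m : ℕ) {h : ι → ℝ → ℂ}, (∃ C, ∀ i, ∀ t ∈ Icc α' β', ‖h i t‖ ≤ C) →
      ∃ C, ∀ i, ∀ t ∈ Icc α β, ‖DD (h i) (c i) m t‖ ≤ C := by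
    rintro m h ⟨C, hC⟩
    refine ⟨C, fun i t ht => ?_⟩
    have := intervalIntegral.norm_integral_le_of_norm_le_const (a := 0) (b := 1) (C := C)
      (f := fun r : ℝ => (r : ℂ) ^ m * h i (c i + r * (t - c i))) ?_
    · simpa [DD] using this
    intro r hr
    rw [uIoc_of_le zero_le_one] at hr
    rw [norm_mul, norm_pow, Complex.norm_real, Real.norm_of_nonneg hr.1.le]
    have := hC i _ (sub (seg_mem (hc i) ht ⟨hr.1.le, hr.2⟩))
    exact (mul_le_of_le_one_left (norm_nonneg _) (pow_le_one₀ hr.1.le hr.2)).trans this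
  intro n
  induction n with
  | zero =>
    intro m h hh
    refine ⟨bd m hh.1, fun h => h.elim, fun i => ?_⟩
    have hab : α' ≤ β' := ((h1.le.trans (hc i).1).trans (hc i).2).trans h2.le
    have hH : Continuous (IccExtend hab ((Icc α' β').domRestrict (h i))) :=
      (continuousOn_iff_continuous_domRestrict.1 (hh.cont i)).Icc_extend'
    have := intervalIntegral.continuous_parametric_intervalIntegral_of_continuous'
      (μ := volume) (f := fun t r : ℝ => (r : ℂ) ^ m *
        IccExtend hab ((Icc α' β').domRestrict (h i)) (c i + r * (t - c i))) (by fun_prop) 0 1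
    refine this.continuousOn.congr fun t ht => ?_
    refine intervalIntegral.integral_congr fun r hr => ?_
    rw [uIcc_of_le zero_le_one] at hr
    rw [IccExtend_of_mem _ _ (sub (seg_mem (hc i) ht hr))]; rfl
  | succ n ih =>
    intro m h hh
    obtain ⟨hb, -, h', hd, hh'⟩ := hh
    refine ⟨bd m hb, fun h => h.elim, fun i => DD (h' i) (c i) (m + 1), fun i t ht => ?_, ih (m+1) hh'⟩
    obtain ⟨C, hC⟩ := hh'.zero_of.1
    have hco : ContinuousOn (h i) (Icc α' β') :=
      fun t ht => (hd i t ht).continuousAt.continuousWithinAt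
    have hci := sub (hc i)
    have hs : Icc α' β' ∈ nhds t := Icc_mem_nhds (h1.trans_le ht.1) (ht.2.trans_lt h2)
    have ii : ∀ {g : ℝ → ℂ}, ContinuousOn g (Icc 0 1) → IntervalIntegrable g volume 0 1 :=
      fun hg => hg.intervalIntegrable_of_Icc zero_le_one
    refine (intervalIntegral.hasDerivAt_integral_of_dominated_loc_of_deriv_le (μ := volume)
      (F := fun t r => (r : ℂ) ^ m * h i (c i + r * (t - c i)))
      (F' := fun t r => (r : ℂ) ^ (m+1) * h' i (c i + r * (t - c i))) (bound := fun _ => C)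
      hs ?_ (ii (DD_ii hco hci (sub ht) m)) ?_ ?_ (by simp) ?_).2
    · filter_upwards [hs] with x hx
      exact (ii (DD_ii hco hci hx m)).def'.aestronglyMeasurable
    · exact (ii (DD_ii (hh'.cont i) hci (sub ht) (m+1))).def'.aestronglyMeasurable
    · refine Eventually.of_forall fun r hr x hx => ?_
      rw [uIoc_of_le zero_le_one] at hr
      rw [norm_mul, norm_pow, Complex.norm_real, Real.norm_of_nonneg hr.1.le]
      exact (mul_le_of_le_one_left (norm_nonneg _) (pow_le_one₀ hr.1.le hr.2)).trans
        (hC i _ (seg_mem hci hx ⟨hr.1.le, hr.2⟩))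
    · refine Eventually.of_forall fun r hr x hx => ?_
      rw [uIoc_of_le zero_le_one] at hr
      have e1 : HasDerivAt (fun x => c i + r * (x - c i)) r x := by
        simpa using (((hasDerivAt_id x).sub_const (c i)).const_mul r).const_add (c i)
      have := (hd i _ (seg_mem hci hx ⟨hr.1.le, hr.2⟩)).scomp x e1
      refine (this.const_mul ((r : ℂ) ^ m)).congr_deriv ?_
      simp only [Complex.real_smul]; ring

theorem DD_eq {f f' : ℝ → ℝ} (hf : ∀ t ∈ Icc α β, HasDerivAt f (f' t) t)
    (hf' : ContinuousOn f' (Icc α β)) {c t : ℝ} (hc : c ∈ Icc α β) (ht : t ∈ Icc α β) :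
    ((f t - f c : ℝ) : ℂ) = ((t - c : ℝ) : ℂ) * DD (fun t => (f' t : ℂ)) c 0 t := by
  have e : ∀ r ∈ uIcc (0:ℝ) 1, HasDerivAt (fun r => f (c + r * (t - c)))
      (f' (c + r * (t - c)) * (t - c)) r := fun r hr => by
    rw [uIcc_of_le zero_le_one] at hr
    have e1 : HasDerivAt (fun r => c + r * (t - c)) (t - c) r := by
      simpa using ((hasDerivAt_id r).mul_const (t - c)).const_add c
    exact (hf _ (seg_mem hc ht hr)).comp r e1
  have hco : ContinuousOn (fun r => f' (c + r * (t - c))) (Icc 0 1) :=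
    hf'.comp (by fun_prop) fun r hr => seg_mem hc ht hr
  have := intervalIntegral.integral_eq_sub_of_hasDerivAt e
    ((hco.mul continuousOn_const).intervalIntegrable_of_Icc zero_le_one)
  simp only [one_mul, zero_mul, add_zero, add_sub_cancel, intervalIntegral.integral_mul_const] at this
  rw [← this]
  simp only [DD, pow_zero, one_mul]
  rw [intervalIntegral.integral_ofReal]
  push_cast; ring

theorem DD_lower {f' : ℝ → ℝ} (hf' : ContinuousOn f' (Icc α β)) {m : ℝ} (hm : 0 ≤ m)
    (hl : ∀ t ∈ Icc α β, m ≤ f' t) {c t : ℝ} (hc : c ∈ Icc α β) (ht : t ∈ Icc α β) :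
    m ≤ ‖DD (fun t => (f' t : ℂ)) c 0 t‖ := by
  simp only [DD, pow_zero, one_mul]
  rw [intervalIntegral.integral_ofReal, Complex.norm_real]
  refine le_trans ?_ (le_abs_self _)
  have hco : ContinuousOn (fun r => f' (c + r * (t - c))) (Icc 0 1) :=
    hf'.comp (by fun_prop) fun r hr => seg_mem hc ht hr
  have := intervalIntegral.integral_mono_on (μ := volume) zero_le_one (f := fun _ => m)
    (g := fun r => f' (c + r * (t - c))) (by simp) (hco.intervalIntegrable_of_Icc zero_le_one)
    fun r hr => hl _ (seg_mem hc ht hr)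
  simpa using this
end DDsec


/-- quantitative curve hypotheses; `g n` is the `n`-th derivative -/
structure Crv (T m B s : ℝ) (g : ℕ → ℝ → ℝ) : Prop where
  hT : 2 ≤ T
  hm : 0 < m
  hs : s = 1 ∨ s = -1
  hd : ∀ n ≤ 9, ∀ t ∈ Icc (1/(2*T)) (2*T), HasDerivAt (g n) (g (n+1) t) t
  hB : ∀ n ≤ 10, ∀ t ∈ Icc (1/(2*T)) (2*T), |g n t| ≤ B
  h1 : ∀ t ∈ Icc (1/(2*T)) (2*T), m ≤ g 1 t
  h2 : ∀ t ∈ Icc (1/(2*T)) (2*T), m ≤ g 2 t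
  h3 : ∀ t ∈ Icc (1/(2*T)) (2*T), m ≤ s * (g 2 t ^ 2 - g 1 t * g 3 t)
  lo : g 1 (1/T) ≤ 1/64
  hi : 64 ≤ g 1 T

/-- package of data extracted from the curve -/
structure Pk (c C s : ℝ) (G E q q1 q2 : ℝ → ℝ) : Prop where
  hs : s = 1 ∨ s = -1
  dG : ∀ y ∈ Ioo (1/64:ℝ) 64, HasDerivAt G (q y / y) y
  dE : ∀ y ∈ Ioo (1/64:ℝ) 64, HasDerivAt E (q y) y
  dq : ∀ y ∈ Ioo (1/64:ℝ) 64, HasDerivAt q (q1 y) y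
  dq1 : ∀ y ∈ Ioo (1/64:ℝ) 64, HasDerivAt q1 (q2 y) y
  bG : ∀ y ∈ Ioo (1/64:ℝ) 64, |G y| ≤ C
  bE : ∀ y ∈ Ioo (1/64:ℝ) 64, |E y| ≤ C
  bq : ∀ y ∈ Ioo (1/64:ℝ) 64, |q y| ≤ C
  bq1 : ∀ y ∈ Ioo (1/64:ℝ) 64, |q1 y| ≤ C
  bq2 : ∀ y ∈ Ioo (1/64:ℝ) 64, |q2 y| ≤ C
  lq : ∀ y ∈ Ioo (1/64:ℝ) 64, c ≤ q y
  lq1 : ∀ y ∈ Ioo (1/64:ℝ) 64, c ≤ s * q1 y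

/-- inverse of the derivative -/
noncomputable def Gi (T : ℝ) (g : ℕ → ℝ → ℝ) (y : ℝ) : ℝ := Function.invFunOn (g 1) (Icc (1/T) T) y

namespace Crv
variable {T m B s : ℝ} {g : ℕ → ℝ → ℝ}

theorem sub (h : Crv T m B s g) : Icc (1/T) T ⊆ Icc (1/(2*T)) (2*T) := by
  have := h.hT
  refine Icc_subset_Icc ?_ (by linarith)
  exact one_div_le_one_div_of_le (by linarith) (by linarith)

theorem le (h : Crv T m B s g) : 1/T ≤ T := by
  have := h.hT
  rw [div_le_iff₀ (by linarith)]; nlinarith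

theorem Gi_spec (h : Crv T m B s g) {y : ℝ} (hy : y ∈ Icc (1/64:ℝ) 64) :
    Gi T g y ∈ Icc (1/T) T ∧ g 1 (Gi T g y) = y := by
  have hc : ContinuousOn (g 1) (Icc (1/T) T) := fun t ht =>
    (h.hd 1 (by norm_num) t (h.sub ht)).continuousAt.continuousWithinAt
  have := intermediate_value_Icc h.le hc (show y ∈ Icc _ _ from ⟨h.lo.trans hy.1, hy.2.trans h.hi⟩)
  exact ⟨Function.invFunOn_mem this, Function.invFunOn_eq this⟩

theorem Gi_deriv (h : Crv T m B s g) {y : ℝ} (hy : y ∈ Ioo (1/64:ℝ) 64) :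
    HasDerivAt (Gi T g) (g 2 (Gi T g y))⁻¹ y := by
  have hm := h.hm
  have lip : ∀ a ∈ Icc (1/T) T, ∀ b ∈ Icc (1/T) T, a ≤ b → m * (b - a) ≤ g 1 b - g 1 a := by
    intro a ha b hb hab
    refine (convex_Icc (1/T) T).mul_sub_le_image_sub_of_le_deriv
      (fun t ht => (h.hd 1 (by norm_num) t (h.sub ht)).continuousAt.continuousWithinAt)
      (fun t ht => (h.hd 1 (by norm_num) t (h.sub (interior_subset ht))).differentiableAt.differentiableWithinAt)
      (fun t ht => ?_) a ha b hb hab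
    rw [(h.hd 1 (by norm_num) t (h.sub (interior_subset ht))).deriv]
    exact h.h2 t (h.sub (interior_subset ht))
  have lip' : ∀ z ∈ Ioo (1/64:ℝ) 64, |Gi T g z - Gi T g y| ≤ m⁻¹ * |z - y| := by
    intro z hz
    obtain ⟨a1, a2⟩ := h.Gi_spec (Ioo_subset_Icc_self hz)
    obtain ⟨b1, b2⟩ := h.Gi_spec (Ioo_subset_Icc_self hy)
    rw [← div_eq_inv_mul, le_div_iff₀ hm]
    rcases le_total (Gi T g z) (Gi T g y) with hh | hh
    · have := lip _ a1 _ b1 hh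
      rw [a2, b2] at this
      rw [abs_of_nonpos (by linarith)]
      have := neg_abs_le (z - y); linarith
    · have := lip _ b1 _ a1 hh
      rw [a2, b2] at this
      rw [abs_of_nonneg (by linarith)]
      have := le_abs_self (z - y); linarith
  have hn : Ioo (1/64:ℝ) 64 ∈ nhds y := Ioo_mem_nhds hy.1 hy.2
  have hc : ContinuousAt (Gi T g) y := by
    refine tendsto_iff_dist_tendsto_zero.2 ?_
    refine squeeze_zero' (g := fun z => m⁻¹ * |z - y|) (Eventually.of_forall fun _ => dist_nonneg) ?_ ?_
    · filter_upwards [hn] with z hz using lip' z hz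
    · have : Tendsto (fun z => m⁻¹ * |z - y|) (nhds y) (nhds (m⁻¹ * |y - y|)) :=
        Continuous.tendsto (by fun_prop) y
      simpa using this
  obtain ⟨b1, b2⟩ := h.Gi_spec (Ioo_subset_Icc_self hy)
  refine HasDerivAt.of_local_left_inverse hc (h.hd 1 (by norm_num) _ (h.sub b1)) ?_ ?_
  · have := h.h2 _ (h.sub b1); linarith
  · filter_upwards [hn] with z hz using (h.Gi_spec (Ioo_subset_Icc_self hz)).2

theorem pk (T m B s : ℝ) : ∃ c C, 0 < c ∧ 0 < C ∧ ∀ g, Crv T m B s g →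
    ∃ q q1 q2, Pk c C s (Gi T g) (fun y => g 0 (Gi T g y)) q q1 q2 := by
  by_cases hm : 0 < m; swap
  · exact ⟨1, 1, one_pos, one_pos, fun g h => (hm h.hm).elim⟩
  set K := |B| + 1 with hK
  have hK1 : 1 ≤ K := by have := abs_nonneg B; linarith
  obtain ⟨C, hC⟩ : ∃ C, C = |T| + K + 64 * m⁻¹ + 2 * K ^ 2 * (m⁻¹) ^ 3 +
    (2 * K ^ 2 * (m⁻¹)^3 + 6 * K ^ 3 * (m⁻¹)^4) * m⁻¹ := ⟨_, rfl⟩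
  have hi : 0 < m⁻¹ := inv_pos.2 hm
  have hCT : |T| ≤ C ∧ K ≤ C ∧ 64 * m⁻¹ ≤ C ∧ 2 * K ^ 2 * (m⁻¹)^3 ≤ C ∧
    (2 * K ^ 2 * (m⁻¹)^3 + 6 * K ^ 3 * (m⁻¹)^4) * m⁻¹ ≤ C := by
    have : 0 ≤ |T| := abs_nonneg _
    have : 0 ≤ 64 * m⁻¹ := by positivity
    have : 0 ≤ 2 * K ^ 2 * (m⁻¹)^3 := by positivity
    have : 0 ≤ (2 * K ^ 2 * (m⁻¹)^3 + 6 * K ^ 3 * (m⁻¹)^4) * m⁻¹ := by positivity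
    refine ⟨?_, ?_, ?_, ?_, ?_⟩ <;> linarith
  obtain ⟨c1, c2, c3, c4, c5⟩ := hCT
  refine ⟨min (m * (K⁻¹) ^ 3) (1/64 * K⁻¹), C, by positivity, by linarith, fun g h => ?_⟩
  have key : ∀ y ∈ Ioo (1/64:ℝ) 64, Gi T g y ∈ Icc (1/(2*T)) (2*T) ∧ g 1 (Gi T g y) = y ∧
      Gi T g y ∈ Icc (1/T) T := fun y hy =>
    have := h.Gi_spec (Ioo_subset_Icc_self hy); ⟨h.sub this.1, this.2, this.1⟩
  have bK : ∀ n ≤ 10, ∀ t ∈ Icc (1/(2*T)) (2*T), |g n t| ≤ K := fun n hn t ht =>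
    (h.hB n hn t ht).trans (by rw [hK]; have := le_abs_self B; linarith)
  have bi : ∀ t ∈ Icc (1/(2*T)) (2*T), 0 < (g 2 t)⁻¹ ∧ (g 2 t)⁻¹ ≤ m⁻¹ ∧ K⁻¹ ≤ (g 2 t)⁻¹ := fun t ht => by
    have := h.h2 t ht
    exact ⟨inv_pos.2 (by linarith), inv_anti₀ hm this,
      inv_anti₀ (by linarith) ((le_abs_self _).trans (bK 2 (by norm_num) t ht))⟩
  have dQ : ∀ t ∈ Icc (1/(2*T)) (2*T), HasDerivAt (fun t => (g 2 t ^ 2 - g 1 t * g 3 t) * (g 2 t)⁻¹ ^ 3)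
     ((g 2 t * g 3 t - g 1 t * g 4 t) * (g 2 t)⁻¹ ^ 3 -
       3 * (g 2 t ^ 2 - g 1 t * g 3 t) * g 3 t * (g 2 t)⁻¹ ^ 4) t := fun t ht => by
    have := h.h2 t ht
    have h0 : g 2 t ≠ 0 := by linarith
    have d1 := h.hd 1 (by norm_num) t ht
    have d2 := h.hd 2 (by norm_num) t ht
    have d3 := h.hd 3 (by norm_num) t ht
    refine (((d2.fun_pow 2).fun_sub (d1.fun_mul d3)).fun_mul ((d2.fun_inv h0).fun_pow 3)).congr_deriv ?_
    norm_num
    field_simp; ring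
  refine ⟨fun y => y * (g 2 (Gi T g y))⁻¹,
    fun y => (g 2 (Gi T g y) ^ 2 - g 1 (Gi T g y) * g 3 (Gi T g y)) * (g 2 (Gi T g y))⁻¹ ^ 3,
    fun y => ((g 2 (Gi T g y) * g 3 (Gi T g y) - g 1 (Gi T g y) * g 4 (Gi T g y)) * (g 2 (Gi T g y))⁻¹ ^ 3 -
       3 * (g 2 (Gi T g y) ^ 2 - g 1 (Gi T g y) * g 3 (Gi T g y)) * g 3 (Gi T g y) * (g 2 (Gi T g y))⁻¹ ^ 4)
       * (g 2 (Gi T g y))⁻¹, h.hs, ?_, ?_, ?_, ?_, ?_, ?_, ?_, ?_, ?_, ?_, ?_⟩ <;> intro y hy <;>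
    obtain ⟨k1, k2, k3⟩ := key y hy <;> obtain ⟨b1, b2, b3⟩ := bi _ k1 <;>
    have y0 : (0:ℝ) < y := lt_trans (by norm_num) hy.1
  · exact (h.Gi_deriv hy).congr_deriv (by field_simp)
  · exact ((h.hd 0 (by norm_num) _ k1).comp y (h.Gi_deriv hy)).congr_deriv (by rw [zero_add, k2])
  · have h0 := (inv_pos.1 b1).ne'
    have := ((h.hd 2 (by norm_num) _ k1).comp y (h.Gi_deriv hy)).fun_inv h0
    refine ((hasDerivAt_id y).fun_mul this).congr_deriv ?_
    simp only [id, Function.comp_apply, k2]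
    field_simp; ring
  · exact (dQ _ k1).comp y (h.Gi_deriv hy)
  · have := h.hT
    refine le_trans ?_ c1
    rw [abs_of_nonneg (le_trans (by positivity) k3.1)]
    exact k3.2.trans (le_abs_self _)
  · exact (bK 0 (by norm_num) _ k1).trans c2
  · rw [abs_of_pos (by positivity)]
    exact (mul_le_mul hy.2.le b2 b1.le (by norm_num)).trans c3
  · refine le_trans ?_ c4
    rw [abs_mul, abs_of_pos (by positivity : 0 < (g 2 (Gi T g y))⁻¹ ^ 3)]
    have : |g 2 (Gi T g y) ^ 2 - g 1 (Gi T g y) * g 3 (Gi T g y)| ≤ 2 * K ^ 2 := by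
      refine (abs_sub _ _).trans ?_
      rw [abs_pow, abs_mul]
      have e1 := bK 2 (by norm_num) _ k1
      have e2 := bK 1 (by norm_num) _ k1
      have e3 := bK 3 (by norm_num) _ k1
      nlinarith [mul_le_mul e2 e3 (abs_nonneg _) (by positivity), mul_le_mul e1 e1 (abs_nonneg _) (by positivity)]
    gcongr
  · refine le_trans ?_ c5
    have e1 := bK 2 (by norm_num) _ k1
    have e2 := bK 1 (by norm_num) _ k1
    have e3 := bK 3 (by norm_num) _ k1
    have e4 := bK 4 (by norm_num) _ k1
    have f1 : |g 2 (Gi T g y) ^ 2 - g 1 (Gi T g y) * g 3 (Gi T g y)| ≤ 2 * K ^ 2 := by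
      refine (abs_sub _ _).trans ?_
      rw [abs_pow, abs_mul]
      nlinarith [mul_le_mul e2 e3 (abs_nonneg _) (by positivity), mul_le_mul e1 e1 (abs_nonneg _) (by positivity)]
    have f2 : |g 2 (Gi T g y) * g 3 (Gi T g y) - g 1 (Gi T g y) * g 4 (Gi T g y)| ≤ 2 * K ^ 2 := by
      refine (abs_sub _ _).trans ?_
      rw [abs_mul, abs_mul]
      nlinarith [mul_le_mul e2 e4 (abs_nonneg _) (by positivity), mul_le_mul e1 e3 (abs_nonneg _) (by positivity)]
    rw [abs_mul, abs_of_pos b1]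
    refine mul_le_mul ?_ b2 b1.le (by positivity)
    refine (abs_sub _ _).trans (add_le_add ?_ ?_)
    · rw [abs_mul, abs_of_pos (by positivity : 0 < (g 2 (Gi T g y))⁻¹ ^ 3)]
      gcongr
    · rw [abs_mul, abs_mul, abs_mul, abs_of_pos (by positivity : 0 < (g 2 (Gi T g y))⁻¹ ^ 4), abs_of_pos (by norm_num : (0:ℝ)<3)]
      calc _ ≤ 3 * (2 * K ^ 2) * K * m⁻¹ ^ 4 := by gcongr
        _ = _ := by ring
  · refine (min_le_right _ _).trans ?_
    exact mul_le_mul hy.1.le b3 (by positivity) y0.le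
  · refine (min_le_left _ _).trans ?_
    rw [← mul_assoc]
    exact mul_le_mul (h.h3 _ k1) (pow_le_pow_left₀ (by positivity) b3 3) (by positivity)
      (h.hm.le.trans (h.h3 _ k1))
end Crv


theorem UB.reidx {ι κ : Type} {α β : ℝ} {v : Prop} (f : κ → ι) : ∀ {n : ℕ} {a : ι → ℝ → ℂ},
    UB α β v n a → UB α β v n (fun i => a (f i))
  | 0, a, h => ⟨h.1.imp fun C hC i => hC _, fun hv i => h.2.1 hv _, fun i => h.2.2 _⟩
  | n + 1, a, h => ⟨h.1.imp fun C hC i => hC _, fun hv i => h.2.1 hv _,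
      h.2.2.elim fun a' h' => ⟨fun i => a' (f i), fun i => h'.1 _, UB.reidx f h'.2⟩⟩

theorem UB.subI {ι : Type} {α β α' β' : ℝ} (h1 : α' ≤ α) (h2 : β ≤ β') :
    ∀ {n : ℕ} {a : ι → ℝ → ℂ}, UB α' β' False n a → UB α β False n a
  | 0, a, h => ⟨h.1.imp fun C hC i t ht => hC i t ⟨h1.trans ht.1, ht.2.trans h2⟩, fun hv => hv.elim,
      fun i => (h.2.2 i).mono (Icc_subset_Icc h1 h2)⟩
  | n + 1, a, h => ⟨h.1.imp fun C hC i t ht => hC i t ⟨h1.trans ht.1, ht.2.trans h2⟩, fun hv => hv.elim,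
      h.2.2.elim fun a' h' => ⟨a', fun i t ht => h'.1 i t ⟨h1.trans ht.1, ht.2.trans h2⟩,
        UB.subI h1 h2 h'.2⟩⟩

/-- parameters of the kernels -/
structure Ix (T m B s : ℝ) where
  g : ℕ → ℝ → ℝ
  hg : Crv T m B s g
  N : ℝ
  hN : 1 ≤ N
  u : ℝ
  hu : u ∈ Icc (1/2:ℝ) 3
  κ1 : ℝ
  κ2 : ℝ
  hκ2 : κ2 ∈ Icc (1/4:ℝ) 4
  hν : κ1 / κ2 ∈ Icc (1/8:ℝ) 8
  ε : ℝ
  hε : ε = 1 ∨ ε = -1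

namespace Ix
variable {T m B s : ℝ}

theorem hy (i : Ix T m B s) : i.κ1 / i.κ2 / i.u ∈ Ioo (1/64:ℝ) 64 := by
  have h1 := i.hu.1; have h2 := i.hu.2; have h3 := i.hν.1; have h4 := i.hν.2
  constructor
  · rw [lt_div_iff₀ (by linarith)]; linarith
  · rw [div_lt_iff₀ (by linarith)]; linarith

/-- critical point -/
noncomputable def tc (i : Ix T m B s) : ℝ := Gi T i.g (i.κ1 / i.κ2 / i.u)

theorem tc_mem (i : Ix T m B s) : i.tc ∈ Icc (1/T) T := (i.hg.Gi_spec (Ioo_subset_Icc_self i.hy)).1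

theorem tc_eq (i : Ix T m B s) : i.κ1 = i.κ2 * (i.u * i.g 1 i.tc) := by
  rw [tc, (i.hg.Gi_spec (Ioo_subset_Icc_self i.hy)).2]
  have h1 := i.hu.1; have h3 := i.hκ2.1
  have : i.u ≠ 0 := by linarith
  have : i.κ2 ≠ 0 := by linarith
  field_simp

/-- kernel -/
noncomputable def K (i : Ix T m B s) (a : ℝ → ℂ) (σ τ : SchwartzMap ℝ ℂ) (z1 z2 : ℝ) : ℂ :=
  KK (1/2) 2 i.N i.κ1 i.κ2 (fun t => -i.ε * t) (fun t => i.ε * i.u * i.g 0 t) a σ τ z1 z2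

/-- centred profile -/
noncomputable def V (i : Ix T m B s) (z1 z2 : ℝ) : ℝ :=
  V1 (i.N * (z1 + -i.ε * i.tc)) * V1 (i.N * (z2 + i.ε * i.u * i.g 0 i.tc))

theorem ubg : ∀ n k, k + n ≤ 9 → UB (1/(2*T)) (2*T) False n (fun (i : Ix T m B s) t => (i.g k t : ℂ))
  | 0, k, h => ⟨⟨B, fun i t ht => by
      rw [Complex.norm_real]; exact i.hg.hB k (by omega) t ht⟩, fun h => h.elim, fun i t ht =>
        ((i.hg.hd k (by omega) t ht).ofReal_comp).continuousAt.continuousWithinAt⟩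
  | n + 1, k, h => ⟨⟨B, fun i t ht => by
      rw [Complex.norm_real]; exact i.hg.hB k (by omega) t ht⟩, fun h => h.elim,
      fun i t => (i.g (k+1) t : ℂ), fun i t ht => (i.hg.hd k (by omega) t ht).ofReal_comp,
      ubg n (k+1) (by omega)⟩

theorem crit (hT : 2 ≤ T) (hm : 0 < m) : ∃ r : Ix T m B s → ℝ → ℂ,
    CritFam (1/2) 2 6 N κ1 κ2 (fun i => -i.ε) tc (fun i => i.ε * i.u * i.g 0 i.tc)
    (fun i t => i.ε * i.u * i.g 0 t) (fun i t => i.ε * i.u * i.g 1 t) r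
    (fun i t => (i.ε * i.u : ℝ) * DD (fun t => (i.g 1 t : ℂ)) i.tc 0 t) := by
  have hTJ : 1/(2*T) < 1/T := one_div_lt_one_div_of_lt (by linarith) (by linarith)
  have hTJ' : T < 2 * T := by linarith
  have j1 : 1/T ≤ 1/2 := one_div_le_one_div_of_le (by norm_num) hT
  have J : Icc (1/2:ℝ) 2 ⊆ Icc (1/T) T := Icc_subset_Icc j1 hT
  have hεu : ∀ i : Ix T m B s, ‖((i.ε * i.u : ℝ) : ℂ)‖ ≤ 3 := fun i => by
    rw [Complex.norm_real, Real.norm_eq_abs, abs_mul, abs_of_nonneg (by linarith [i.hu.1] : 0 ≤ i.u)]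
    have := i.hu.2
    rcases i.hε with h | h <;> simp [h] <;> linarith
  have cont : ∀ (i : Ix T m B s) k, k ≤ 9 → ContinuousOn (i.g k) (Icc (1/T) T) := fun i k hk t ht =>
    (i.hg.hd k hk t (i.hg.sub ht)).continuousAt.continuousWithinAt
  have lowD : ∀ i : Ix T m B s, ∀ t ∈ Icc (1/T) T,
      m ≤ ‖DD (fun t => (i.g 2 t : ℂ)) i.tc 0 t‖ := fun i t ht =>
    DD_lower (cont i 2 (by norm_num)) hm.le (fun t ht => i.hg.h2 t (i.hg.sub ht)) i.tc_mem ht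
  refine ⟨fun i t => ((i.ε * i.u * i.κ2 : ℝ) : ℂ)⁻¹ * (DD (fun t => (i.g 2 t : ℂ)) i.tc 0 t)⁻¹,
    ⟨by norm_num, fun i => i.hN, fun i t _ => ?_, fun i t ht => ?_, ?_, ?_⟩, fun i => ?_, fun i t ht => ?_, fun i t ht => ?_, ?_, ?_⟩
  · simpa using (hasDerivAt_id t).const_mul (-i.ε)
  · simpa using (i.hg.hd 0 (by norm_num) t (i.hg.sub (J ht))).const_mul (i.ε * i.u)
  · exact UB.const (C := 1) 6 fun i => by rcases i.hε with h | h <;> simp [h]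
  · have := UB.smul hεu (UB.subI (hTJ.le.trans j1) (hT.trans hTJ'.le) (ubg (T := T) (m := m) (B := B) (s := s) 6 1 (by norm_num)))
    simpa using this
  · rcases i.hε with h | h <;> simp [h]
  · have e := DD_eq (fun t ht => i.hg.hd 1 (by norm_num) t (i.hg.sub ht)) (cont i 2 (by norm_num)) i.tc_mem (J ht)
    have h0 : DD (fun t => (i.g 2 t : ℂ)) i.tc 0 t ≠ 0 :=
      norm_pos_iff.1 (hm.trans_le (lowD i t (J ht)))
    have h1 : ((i.ε * i.u * i.κ2 : ℝ) : ℂ) ≠ 0 := by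
      rw [Complex.ofReal_ne_zero]
      have := i.hu.1; have := i.hκ2.1
      have : i.ε ≠ 0 := by rcases i.hε with h | h <;> simp [h]
      have : i.u ≠ 0 := by linarith
      have : i.κ2 ≠ 0 := by linarith
      positivity
    have e2 : ((i.κ1 * -i.ε + i.κ2 * (i.ε * i.u * i.g 1 t) : ℝ) : ℂ) =
        ((i.ε * i.u * i.κ2 : ℝ) : ℂ) * ((i.g 1 t - i.g 1 i.tc : ℝ) : ℂ) := by
      rw [← Complex.ofReal_mul]; congr 1
      have := i.tc_eq
      rw [this]; ring
    rw [e2, e]; field_simp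
  · have e := DD_eq (fun t ht => i.hg.hd 0 (by norm_num) t (i.hg.sub ht)) (cont i 1 (by norm_num)) i.tc_mem (J ht)
    rw [show ((i.ε * i.u * i.g 0 t - i.ε * i.u * i.g 0 i.tc : ℝ) : ℂ) =
      ((i.ε * i.u : ℝ) : ℂ) * ((i.g 0 t - i.g 0 i.tc : ℝ) : ℂ) by push_cast; ring, e]
    simp only [zero_add]; ring
  · have := UB.inv hm lowD (UB.dd hTJ hTJ' (fun i : Ix T m B s => i.tc_mem) 6 0 (ubg 6 2 (by norm_num)))
    refine UB.smul (C := 8) (fun i => ?_) (UB.subI j1 hT this)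
    rw [norm_inv, Complex.norm_real, Real.norm_eq_abs, abs_mul, abs_mul,
      abs_of_nonneg (by linarith [i.hu.1] : 0 ≤ i.u), abs_of_nonneg (by linarith [i.hκ2.1] : 0 ≤ i.κ2)]
    have : |i.ε| = 1 := by rcases i.hε with h | h <;> simp [h]
    rw [this, one_mul, inv_le_comm₀ (by have := i.hu.1; have := i.hκ2.1; nlinarith) (by norm_num)]
    have := i.hu.1; have := i.hκ2.1; nlinarith
  · exact UB.smul hεu (UB.subI j1 hT
      (UB.dd hTJ hTJ' (fun i : Ix T m B s => i.tc_mem) 6 0 (ubg 6 1 (by norm_num))))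

/-- the kernel bounds -/
theorem bounds (T m B s : ℝ) {χ : ℝ → ℂ} (hχ : UB (ι := Unit) (1/2) 2 True 6 (fun _ => χ))
    (σ τ : SchwartzMap ℝ ℂ) : ∃ C, 0 ≤ C ∧ ∀ (i : Ix T m B s) z1 z2,
    ‖i.K χ σ τ z1 z2‖ ≤ C * i.N * i.V z1 z2 ∧
    ‖i.K (fun t => χ t * i.g 0 t) σ τ z1 z2‖ ≤ C * i.N * i.V z1 z2 ∧
    ‖(i.N : ℂ) * (i.K (fun t => χ t * i.g 0 t) σ τ z1 z2 - i.g 0 i.tc * i.K χ σ τ z1 z2)‖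
      ≤ C * i.N * i.V z1 z2 := by
  by_cases hT : 2 ≤ T; swap
  · exact ⟨0, le_rfl, fun i => (hT i.hg.hT).elim⟩
  by_cases hm : 0 < m; swap
  · exact ⟨0, le_rfl, fun i => (hm i.hg.hm).elim⟩
  obtain ⟨r, h⟩ := crit (B := B) (s := s) hT hm
  have hTJ : 1/(2*T) < 1/T := one_div_lt_one_div_of_lt (by linarith) (by linarith)
  have hTJ' : T < 2 * T := by linarith
  have j1 : 1/T ≤ 1/2 := one_div_le_one_div_of_le (by norm_num) hT
  have J : Icc (1/2:ℝ) 2 ⊆ Icc (1/T) T := Icc_subset_Icc j1 hT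
  have hχ' : UB (1/2) 2 True 6 (fun (_ : Ix T m B s) => χ) := hχ.reidx (fun _ => ())
  have hg0 := UB.subI (hTJ.le.trans j1) (hT.trans hTJ'.le) (ubg (T := T) (m := m) (B := B) (s := s) 6 0 (by norm_num))
  have hg1 := UB.subI (hTJ.le.trans j1) (hT.trans hTJ'.le) (ubg (T := T) (m := m) (B := B) (s := s) 6 1 (by norm_num))
  have hρ' := UB.subI j1 hT
      (UB.dd hTJ hTJ' (fun i : Ix T m B s => i.tc_mem) 6 0 (ubg 6 1 (by norm_num)))
  obtain ⟨C1, p1, b1⟩ := KK_bound h (by norm_num) (hχ'.mono (by norm_num)) σ τ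
  obtain ⟨C2, p2, b2⟩ := KK_bound h (by norm_num) ((hχ'.mul hg0).mono (by norm_num)) σ τ
  obtain ⟨a', ha', hst⟩ := KK_step h (m := 4) (by norm_num) (hχ'.mono (by norm_num)) hρ'
  obtain ⟨C3, p3, b3⟩ := KK_bound h (by norm_num) ha' σ τ
  have hA := (hχ'.mul hρ').mul h.ur
  have hone : ∀ i : Ix T m B s, ‖(-i.ε : ℂ)‖ ≤ 1 := fun i => by rcases i.hε with h | h <;> simp [h]
  obtain ⟨C4, p4, b4⟩ := KK_bound h (by norm_num) (UB.smul (c := fun _ => Complex.I) (C := 1) (by simp)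
    ((hA.mul (UB.const 6 hone)).mono (m := 4) (by norm_num))) (SchwartzMap.derivCLM ℂ ℂ σ) τ
  obtain ⟨C5, p5, b5⟩ := KK_bound h (by norm_num) (UB.smul (c := fun _ => Complex.I) (C := 1) (by simp)
    ((hA.mul h.hP.hu2).mono (m := 4) (by norm_num))) σ (SchwartzMap.derivCLM ℂ ℂ τ)
  refine ⟨C1 + C2 + C3 + C4 + C5, by positivity, fun i z1 z2 => ?_⟩
  have hN := i.hN
  have hV : 0 ≤ i.N * i.V z1 z2 := by unfold V V1; positivity
  have b1 := b1 i z1 z2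
  have b2 := b2 i z1 z2
  have b3 := b3 i z1 z2
  have b4 := b4 i z1 z2
  have b5 := b5 i z1 z2
  simp only [mul_assoc C1, mul_assoc C2, mul_assoc C3, mul_assoc C4, mul_assoc C5, mul_assoc (_ + C5)] at b1 b2 b3 b4 b5 ⊢
  have n1 := mul_nonneg p1 hV
  have n2 := mul_nonneg p2 hV
  have n3 := mul_nonneg p3 hV
  have n4 := mul_nonneg p4 hV
  have n5 := mul_nonneg p5 hV
  refine ⟨b1.trans ?_, b2.trans ?_, ?_⟩
  · change C1 * (i.N * i.V z1 z2) ≤ _; linarith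
  · change C2 * (i.N * i.V z1 z2) ≤ _; linarith
  have e := hst σ τ i z1 z2
  have e2 : i.K (fun t => χ t * i.g 0 t) σ τ z1 z2 - i.g 0 i.tc * i.K χ σ τ z1 z2 =
      KK (1/2) 2 i.N i.κ1 i.κ2 (fun t => -i.ε * t) (fun t => i.ε * i.u * i.g 0 t)
        (fun t => χ t * (((t - i.tc : ℝ) : ℂ) * DD (fun t => (i.g 1 t : ℂ)) i.tc 0 t)) σ τ z1 z2 := by
    unfold K
    unfold KK
    rw [← intervalIntegral.integral_const_mul, ← intervalIntegral.integral_sub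
      (KK_ii h.hP i ((hχ'.mul hg0).cont i) σ τ _ _ _ _)
      ((KK_ii h.hP i (hχ'.cont i) σ τ _ _ _ _).const_mul _)]
    refine intervalIntegral.integral_congr fun t ht => ?_
    rw [uIcc_of_le (by norm_num)] at ht
    have e := DD_eq (fun t ht => i.hg.hd 0 (by norm_num) t (i.hg.sub ht)) (fun t ht =>
      (i.hg.hd 1 (by norm_num) t (i.hg.sub ht)).continuousAt.continuousWithinAt) i.tc_mem (J ht)
    simp only [zero_add] at e
    simp only
    rw [← e]; push_cast; ring
  rw [e2, e]
  refine (norm_add_le _ _).trans ((add_le_add_left (norm_add_le _ _) _).trans ?_)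
  change _ ≤ (C1 + C2 + C3 + C4 + C5) * (i.N * i.V z1 z2)
  have b3' : _ ≤ C3 * (i.N * i.V z1 z2) := b3
  have b4' : _ ≤ C4 * (i.N * i.V z1 z2) := b4
  have b5' : _ ≤ C5 * (i.N * i.V z1 z2) := b5
  simp only [Complex.ofReal_neg] at *
  linarith
end Ix


theorem V1_cont : Continuous V1 := by
  unfold V1; exact Continuous.inv₀ (by fun_prop) fun x => by positivity
theorem V1_pos (x : ℝ) : 0 < V1 x := by unfold V1; positivity
theorem V1_le (x : ℝ) : V1 x ≤ 1 := by unfold V1; exact inv_le_one_of_one_le₀ (by nlinarith)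
theorem V1_int : Integrable V1 := by unfold V1; exact integrable_inv_one_add_sq
theorem V1_even (x : ℝ) : V1 (-x) = V1 x := by simp [V1]
theorem V1_shift (x a : ℝ) : V1 (x + a) ≤ 2 * (1 + a ^ 2) * V1 x := by
  unfold V1
  rw [← div_eq_mul_inv, inv_eq_one_div, div_le_div_iff₀ (by positivity) (by positivity)]
  nlinarith [sq_nonneg (x + 2 * a), sq_nonneg (a * (x + a)), sq_nonneg (x+a), sq_nonneg a]
theorem V1_integral : ∫ x, V1 x = Real.pi := by unfold V1; exact integral_univ_inv_one_add_sq

/-- first derivative of V1 -/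
noncomputable def V1d (x : ℝ) : ℝ := -2 * x * V1 x ^ 2
/-- second derivative of V1 -/
noncomputable def V1dd (x : ℝ) : ℝ := (6 * x ^ 2 - 2) * V1 x ^ 3

theorem V1_deriv (x : ℝ) : HasDerivAt V1 (V1d x) x := by
  have h0 : 1 + x ^ 2 ≠ 0 := by positivity
  refine (((hasDerivAt_id x).fun_pow 2).const_add 1 |>.fun_inv h0).congr_deriv ?_
  simp only [V1d, V1, id]; norm_num; field_simp
theorem V1d_deriv (x : ℝ) : HasDerivAt V1d (V1dd x) x := by
  have h0 : 1 + x ^ 2 ≠ 0 := by positivity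
  refine (((hasDerivAt_id x).const_mul (-2)).fun_mul ((V1_deriv x).fun_pow 2)).congr_deriv ?_
  simp only [V1d, V1dd, V1, id]; norm_num; field_simp; ring
theorem V1d_cont : Continuous V1d := by have := V1_cont; unfold V1d; fun_prop
theorem V1dd_cont : Continuous V1dd := by have := V1_cont; unfold V1dd; fun_prop
theorem V1d_le (x : ℝ) : |V1d x| ≤ 6 * V1 x := by
  have h := V1_pos x
  unfold V1d
  rw [abs_mul, abs_of_pos (by positivity : 0 < V1 x ^ 2), pow_two, ← mul_assoc]
  refine mul_le_mul_of_nonneg_right ?_ h.le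
  unfold V1
  rw [← div_eq_mul_inv, div_le_iff₀ (by positivity), abs_mul]
  norm_num
  nlinarith [sq_abs x, sq_nonneg (|x| - 1)]
theorem V1dd_le (x : ℝ) : |V1dd x| ≤ 6 * V1 x := by
  have h := V1_pos x
  have h1 := V1_le x
  unfold V1dd
  have : |6 * x ^ 2 - 2| * V1 x ≤ 6 := by
    unfold V1
    rw [← div_eq_mul_inv, div_le_iff₀ (by positivity), abs_le]
    constructor <;> nlinarith [sq_nonneg x]
  rw [abs_mul, abs_of_pos (by positivity : 0 < V1 x ^ 3)]
  calc |6 * x ^ 2 - 2| * V1 x ^ 3 = (|6 * x ^ 2 - 2| * V1 x) * (V1 x * V1 x) := by ring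
    _ ≤ 6 * (V1 x * 1) := by gcongr
    _ = _ := by ring

theorem int_of_V1 {f : ℝ → ℝ} (hf : Continuous f) {C : ℝ} (h : ∀ x, |f x| ≤ C * V1 x) : Integrable f :=
  (V1_int.const_mul C).mono' hf.aestronglyMeasurable (Eventually.of_forall h)

/-- correlation -/
noncomputable def cor (f g : ℝ → ℝ) (a : ℝ) : ℝ := ∫ y, f (a + y) * g y

theorem cor_int {f g : ℝ → ℝ} (hf : Continuous f) (hg : Continuous g) {A B : ℝ}
    (h1 : ∀ x, |f x| ≤ A) (h2 : ∀ x, |g x| ≤ B * V1 x) (a : ℝ) :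
    Integrable (fun y => f (a + y) * g y) := by
  have hA : 0 ≤ A := (abs_nonneg _).trans (h1 0)
  refine (V1_int.const_mul (A * B)).mono' (by fun_prop) (Eventually.of_forall fun y => ?_)
  rw [norm_mul, mul_assoc]
  exact mul_le_mul (h1 _) (h2 _) (abs_nonneg _) hA

theorem V1_six {f : ℝ → ℝ} (h : ∀ x, |f x| ≤ 6 * V1 x) (x : ℝ) : |f x| ≤ 6 :=
  (h x).trans (by linarith [V1_le x])

theorem V1_le6 (x : ℝ) : |V1 x| ≤ 6 * V1 x := by rw [abs_of_pos (V1_pos x)]; linarith [V1_pos x]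

theorem cor_bd {f g : ℝ → ℝ} (hf : Continuous f) (hg : Continuous g)
    (h1 : ∀ x, |f x| ≤ 6 * V1 x) (h2 : ∀ x, |g x| ≤ 6 * V1 x) (a : ℝ) :
    |cor f g a| ≤ 144 * Real.pi * V1 a := by
  have e : ∀ y, V1 (a + y) * V1 y ≤ 2 * V1 a * (V1 y + V1 (a + y)) := fun y => by
    unfold V1
    field_simp
    nlinarith [sq_nonneg (a + 2 * y)]
  have i1 : Integrable (fun y => V1 (a + y)) := V1_int.comp_add_left a
  calc |cor f g a| ≤ ∫ y, 72 * V1 a * (V1 y + V1 (a + y)) := by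
        unfold cor
        rw [← Real.norm_eq_abs]
        refine norm_integral_le_of_norm_le ((V1_int.add i1).const_mul _) (Eventually.of_forall fun y => ?_)
        rw [norm_mul]
        refine (mul_le_mul (h1 _) (h2 _) (abs_nonneg _) (by have := V1_pos (a+y); positivity)).trans ?_
        have := e y; linarith
    _ = _ := by
        rw [integral_const_mul, integral_add V1_int i1, V1_integral, integral_add_left_eq_self (μ := volume) V1 a, V1_integral]
        ring

theorem cor_deriv {f f' g : ℝ → ℝ} (hd : ∀ x, HasDerivAt f (f' x) x) (hf' : Continuous f')
    (hg : Continuous g) (h0 : ∀ x, |f x| ≤ 6 * V1 x) (h1 : ∀ x, |f' x| ≤ 6 * V1 x) (h2 : ∀ x, |g x| ≤ 6 * V1 x) (a : ℝ) :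
    HasDerivAt (cor f g) (cor f' g a) a := by
  have hf : Continuous f := continuous_iff_continuousAt.2 fun x => (hd x).continuousAt
  refine (hasDerivAt_integral_of_dominated_loc_of_deriv_le (μ := volume) (s := univ)
    (F := fun a y => f (a + y) * g y) (F' := fun a y => f' (a + y) * g y)
    (bound := fun y => 6 * (6 * V1 y)) univ_mem (Eventually.of_forall fun x => ?_)
    (cor_int hf hg (V1_six h0) h2 a) ?_ ?_ ((V1_int.const_mul 6).const_mul 6) ?_).2
  · exact Continuous.aestronglyMeasurable (by fun_prop)
  · exact Continuous.aestronglyMeasurable (by fun_prop)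
  · refine Eventually.of_forall fun y x _ => ?_
    rw [norm_mul]
    exact mul_le_mul (V1_six h1 _) (h2 _) (abs_nonneg _) (by norm_num)
  · refine Eventually.of_forall fun y x _ => ?_
    exact ((hd (x + y)).comp_add_const x y).mul_const _

/-- autocorrelation of V1 and derivatives -/
noncomputable def W0 : ℝ → ℝ := cor V1 V1
noncomputable def W1 : ℝ → ℝ := cor V1d V1
noncomputable def W2 : ℝ → ℝ := cor V1dd V1

theorem W0_deriv (a : ℝ) : HasDerivAt W0 (W1 a) a :=
  cor_deriv V1_deriv V1d_cont V1_cont V1_le6 V1d_le V1_le6 a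
theorem W1_deriv (a : ℝ) : HasDerivAt W1 (W2 a) a :=
  cor_deriv V1d_deriv V1dd_cont V1_cont V1d_le V1dd_le V1_le6 a
theorem W0_cont : Continuous W0 := continuous_iff_continuousAt.2 fun x => (W0_deriv x).continuousAt
theorem W1_cont : Continuous W1 := continuous_iff_continuousAt.2 fun x => (W1_deriv x).continuousAt
theorem W2_cont : Continuous W2 := by
  refine continuous_of_dominated (F := fun a y => V1dd (a + y) * V1 y) (bound := fun y => 6 * V1 y)
    (fun a => ?_) (fun a => Eventually.of_forall fun y => ?_) (V1_int.const_mul 6)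
    (Eventually.of_forall fun y => ?_)
  · have := V1dd_cont; have := V1_cont; exact Continuous.aestronglyMeasurable (by fun_prop)
  · rw [norm_mul, Real.norm_of_nonneg (V1_pos y).le]
    exact mul_le_mul_of_nonneg_right (V1_six V1dd_le _) (V1_pos y).le
  · have := V1dd_cont; fun_prop
theorem W0_bd (a : ℝ) : |W0 a| ≤ 144 * Real.pi * V1 a := cor_bd V1_cont V1_cont V1_le6 V1_le6 a
theorem W1_bd (a : ℝ) : |W1 a| ≤ 144 * Real.pi * V1 a := cor_bd V1d_cont V1_cont V1d_le V1_le6 a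
theorem W2_bd (a : ℝ) : |W2 a| ≤ 144 * Real.pi * V1 a := cor_bd V1dd_cont V1_cont V1dd_le V1_le6 a

theorem cor_flip {f g : ℝ → ℝ} (a b : ℝ) : ∫ y, f (a - y) * g (b - y) = cor f g (a - b) := by
  unfold cor
  rw [← integral_sub_left_eq_self (fun y => f (a - b + y) * g y) volume b]
  refine integral_congr_ae (Eventually.of_forall fun y => ?_)
  simp only; congr 2; ring

theorem cor_ibp {f f' g g' : ℝ → ℝ} (hd : ∀ x, HasDerivAt f (f' x) x) (hd' : ∀ x, HasDerivAt g (g' x) x)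
    (hf' : Continuous f') (hg' : Continuous g') (h0 : ∀ x, |f x| ≤ 6 * V1 x)
    (h1 : ∀ x, |f' x| ≤ 6 * V1 x) (h2 : ∀ x, |g x| ≤ 6 * V1 x) (h3 : ∀ x, |g' x| ≤ 6 * V1 x) (a : ℝ) :
    cor f g' a = - cor f' g a := by
  have hf : Continuous f := continuous_iff_continuousAt.2 fun x => (hd x).continuousAt
  have hg : Continuous g := continuous_iff_continuousAt.2 fun x => (hd' x).continuousAt
  exact integral_mul_deriv_eq_deriv_mul_of_integrable (u := fun y => f (a + y)) (v := g)
    (u' := fun y => f' (a + y)) (v' := g') (fun y _ => (hd (a + y)).comp_const_add a y) (fun y _ => hd' y)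
    (cor_int hf hg' (V1_six h0) h3 a) (cor_int hf' hg (V1_six h1) h2 a) (cor_int hf hg (V1_six h0) h2 a)

theorem cor_01 (a : ℝ) : cor V1 V1d a = - W1 a :=
  cor_ibp V1_deriv V1_deriv V1d_cont V1d_cont V1_le6 V1d_le V1_le6 V1d_le a
theorem cor_11 (a : ℝ) : cor V1d V1d a = - W2 a :=
  cor_ibp V1d_deriv V1_deriv V1dd_cont V1d_cont V1d_le V1dd_le V1_le6 V1d_le a


/-- planar profile -/
noncomputable def ze (z : ℝ × ℝ) : ℝ := V1 z.1 * V1 z.2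
theorem ze_cont : Continuous ze := by have := V1_cont; unfold ze; fun_prop
theorem ze_pos (z : ℝ × ℝ) : 0 < ze z := mul_pos (V1_pos _) (V1_pos _)
theorem ze_le (z : ℝ × ℝ) : ze z ≤ 1 := mul_le_one₀ (V1_le _) (V1_pos _).le (V1_le _)
theorem ze_int : Integrable ze := V1_int.mul_prod V1_int
theorem ze_integral : ∫ z, ze z = Real.pi ^ 2 := by
  unfold ze
  rw [Measure.volume_eq_prod, integral_prod_mul, V1_integral, pow_two]
theorem ze_even (z : ℝ × ℝ) : ze (-z) = ze z := by simp [ze, V1_even]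

/-- the geometric input of the Kakeya type estimate -/
structure Kak (c C N e1 e2 a b : ℝ) (c1 c2 t t1 : ℝ → ℝ → ℝ) : Prop where
  hc : 0 < c
  hC : 1 ≤ C
  hN : 1 ≤ N
  he1 : e1 ^ 2 = 1
  he2 : e2 ^ 2 = 1
  hab : a < b
  ha : -8 ≤ a
  hb : b ≤ 8
  cc1 : Continuous (Function.uncurry c1)
  cc2 : Continuous (Function.uncurry c2)
  ct : Continuous (Function.uncurry t)
  ct1 : Continuous (Function.uncurry t1)
  bc1 : ∀ ν u, |c1 ν u| ≤ C
  bc2 : ∀ ν u, |c2 ν u| ≤ C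
  bt : ∀ ν u, |t ν u| ≤ C
  bt1 : ∀ ν u, |t1 ν u| ≤ C
  dc1 : ∀ ν ∈ Ioo a b, ∀ u ∈ Icc (1/2:ℝ) 3, HasDerivAt (fun ν => c1 ν u) (e1 * t ν u) ν
  dc2 : ∀ ν ∈ Ioo a b, ∀ u ∈ Icc (1/2:ℝ) 3, HasDerivAt (fun ν => c2 ν u) (e2 * ν * t ν u) ν
  dt : ∀ ν ∈ Ioo a b, ∀ u ∈ Icc (1/2:ℝ) 3, HasDerivAt (fun ν => t ν u) (t1 ν u) ν
  low : ∀ ν ∈ Icc a b, ∀ u ∈ Icc (1/2:ℝ) 3, ∀ u' ∈ Icc (1/2:ℝ) 3, c * |u - u'| ≤ |t ν u - t ν u'|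
  lip : ∀ ν ∈ Icc a b, ∀ u ∈ Icc (1/2:ℝ) 3, ∀ u' ∈ Icc (1/2:ℝ) 3, |t1 ν u - t1 ν u'| ≤ C * |u - u'|

/-- second directional derivative of the planar autocorrelation -/
noncomputable def DDZ (e1 e2 ν : ℝ) (z : ℝ × ℝ) : ℝ :=
  W2 z.1 * W0 z.2 + 2 * (e1 * e2 * ν) * (W1 z.1 * W1 z.2) + ν ^ 2 * (W0 z.1 * W2 z.2)
noncomputable def DZ (e1 e2 ν : ℝ) (z : ℝ × ℝ) : ℝ :=
  e1 * (W1 z.1 * W0 z.2) + e2 * ν * (W0 z.1 * W1 z.2)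

theorem WW_bd {f g : ℝ → ℝ} (h1 : ∀ a, |f a| ≤ 144 * Real.pi * V1 a) (h2 : ∀ a, |g a| ≤ 144 * Real.pi * V1 a)
    (z : ℝ × ℝ) : |f z.1 * g z.2| ≤ (144 * Real.pi) ^ 2 * ze z := by
  rw [abs_mul]
  have := V1_pos z.1
  refine (mul_le_mul (h1 _) (h2 _) (abs_nonneg _) (by positivity)).trans (le_of_eq ?_)
  unfold ze; ring

theorem abs1 {e : ℝ} (h : e ^ 2 = 1) : |e| = 1 := by
  rw [← Real.sqrt_sq_eq_abs, h, Real.sqrt_one]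

theorem DDZ_bd {e1 e2 ν : ℝ} (h1 : e1 ^ 2 = 1) (h2 : e2 ^ 2 = 1) (hν : |ν| ≤ 8) (z : ℝ × ℝ) :
    |DDZ e1 e2 ν z| ≤ 81 * (144 * Real.pi) ^ 2 * ze z := by
  unfold DDZ
  have a1 := WW_bd W2_bd W0_bd z
  have a2 := WW_bd W1_bd W1_bd z
  have a3 := WW_bd W0_bd W2_bd z
  set X := (144 * Real.pi) ^ 2 * ze z
  refine (abs_add_three _ _ _).trans ?_
  rw [abs_mul (2 * _), abs_mul (ν ^ 2), abs_mul 2, abs_mul (e1 * e2), abs_mul e1, abs1 h1, abs1 h2, abs_pow]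
  have : |ν| ^ 2 ≤ 64 := by nlinarith [abs_nonneg ν]
  have b2 := mul_le_mul hν a2 (abs_nonneg _) (by norm_num)
  have b3 := mul_le_mul this a3 (abs_nonneg _) (by norm_num)
  rw [abs_two, one_mul, one_mul]
  linarith

theorem DZ_bd {e1 e2 ν : ℝ} (h1 : e1 ^ 2 = 1) (h2 : e2 ^ 2 = 1) (hν : |ν| ≤ 8) (z : ℝ × ℝ) :
    |DZ e1 e2 ν z| ≤ 9 * (144 * Real.pi) ^ 2 * ze z := by
  unfold DZ
  have a1 := WW_bd W1_bd W0_bd z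
  have a2 := WW_bd W0_bd W1_bd z
  refine (abs_add_le _ _).trans ?_
  rw [abs_mul e1, abs_mul (e2 * ν), abs_mul e2, abs1 h1, abs1 h2]
  have b2 := mul_le_mul hν a2 (abs_nonneg _) (by norm_num)
  linarith

theorem L1shift {a b K : ℝ} (hab : a ≤ b) {H : ℝ → ℝ × ℝ → ℝ} (hH : Measurable (Function.uncurry H))
    {A : ℝ → ℝ × ℝ} (hA : Measurable A) (hb : ∀ ν ∈ Icc a b, ∀ z, |H ν z| ≤ K * ze (z + A ν)) :
    Integrable (fun z => ∫ ν in a..b, H ν z) ∧ ∫ z, |∫ ν in a..b, H ν z| ≤ K * (b - a) * Real.pi ^ 2 := by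
  have hzm := ze_cont.measurable
  have i0 : ∀ ν, Integrable (fun z => K * ze (z + A ν)) := fun ν => (ze_int.comp_add_right (A ν)).const_mul K
  have v0 : ∀ ν, ∫ z, K * ze (z + A ν) = K * Real.pi ^ 2 := fun ν => by
    rw [integral_const_mul, integral_add_right_eq_self ze (A ν), ze_integral]
  have hm1 : Measurable (fun q : ℝ × (ℝ × ℝ) => K * ze (q.2 + A q.1)) := by fun_prop
  have hK : 0 ≤ K := by
    have := (abs_nonneg _).trans (hb a ⟨le_rfl, hab⟩ 0)
    exact nonneg_of_mul_nonneg_left this (ze_pos _)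
  have i1 : Integrable (fun q : ℝ × (ℝ × ℝ) => K * ze (q.2 + A q.1)) ((volume.restrict (Icc a b)).prod volume) := by
    rw [integrable_prod_iff hm1.aestronglyMeasurable]
    refine ⟨Eventually.of_forall fun ν => i0 ν, ?_⟩
    have : ∀ ν, ∫ z, ‖K * ze (z + A ν)‖ = K * Real.pi ^ 2 := fun ν => by
      rw [← v0 ν]; exact integral_congr_ae (Eventually.of_forall fun z =>
        Real.norm_of_nonneg (mul_nonneg hK (ze_pos _).le))
    simp only [this]; exact integrable_const _
  have i2 : Integrable (Function.uncurry H) ((volume.restrict (Icc a b)).prod volume) := by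
    refine i1.mono' hH.aestronglyMeasurable ?_
    have : ∀ᵐ q ∂((volume.restrict (Icc a b)).prod (volume : Measure (ℝ × ℝ))), q.1 ∈ Icc a b :=
      Measure.quasiMeasurePreserving_fst.ae (ae_restrict_mem measurableSet_Icc)
    filter_upwards [this] with q hq using hb _ hq _
  have ee : ∀ z, ∫ ν in a..b, H ν z = ∫ ν in Icc a b, H ν z := fun z => by
    rw [intervalIntegral.integral_of_le hab, integral_Icc_eq_integral_Ioc]
  simp only [ee]
  refine ⟨i2.integral_prod_right, ?_⟩
  calc ∫ z, |∫ ν in Icc a b, H ν z| ≤ ∫ z, ∫ ν in Icc a b, |H ν z| := by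
        refine integral_mono i2.integral_prod_right.abs i2.abs.integral_prod_right fun z => ?_
        exact abs_integral_le_integral_abs
    _ = ∫ ν in Icc a b, ∫ z, |H ν z| := (integral_integral_swap (f := fun ν z => |H ν z|) i2.abs).symm
    _ ≤ ∫ ν in Icc a b, K * Real.pi ^ 2 := by
        refine setIntegral_mono_on i2.abs.integral_prod_left (integrable_const _) measurableSet_Icc fun ν hν => ?_
        rw [← v0 ν]
        by_cases hi : Integrable (fun z => |H ν z|)
        · exact integral_mono hi (i0 ν) (hb ν hν)
        · rw [integral_undef hi, v0]; positivity
    _ = _ := by rw [setIntegral_const]; simp [hab]; ring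

theorem W0m : Measurable W0 := W0_cont.measurable
theorem W1m : Measurable W1 := W1_cont.measurable
theorem W2m : Measurable W2 := W2_cont.measurable

/-- shift vector -/
noncomputable def shf (N : ℝ) (c1 c2 : ℝ → ℝ → ℝ) (u u' ν : ℝ) : ℝ × ℝ :=
  (N * (c1 ν u - c1 ν u'), N * (c2 ν u - c2 ν u'))

namespace Kak
variable {c C N e1 e2 a b : ℝ} {c1 c2 t t1 : ℝ → ℝ → ℝ}

/-- the kernel -/
noncomputable def M (N e1 e2 a b : ℝ) (c1 c2 t : ℝ → ℝ → ℝ) (u u' : ℝ) (z : ℝ × ℝ) : ℝ :=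
  ∫ ν in a..b, t ν u * t ν u' * DDZ e1 e2 ν (z + shf N c1 c2 u u' ν)

theorem sc {f : ℝ → ℝ → ℝ} (h : Continuous (Function.uncurry f)) (u : ℝ) : Continuous (fun ν => f ν u) :=
  h.comp (by fun_prop : Continuous fun ν => (ν, u))

theorem shf_cont (h : Kak c C N e1 e2 a b c1 c2 t t1) (u u' : ℝ) : Continuous (shf N c1 c2 u u') := by
  have := sc h.cc1 u; have := sc h.cc1 u'; have := sc h.cc2 u; have := sc h.cc2 u'
  unfold shf; fun_prop

theorem abs8 (h : Kak c C N e1 e2 a b c1 c2 t t1) {ν : ℝ} (hν : ν ∈ Icc a b) : |ν| ≤ 8 :=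
  abs_le.2 ⟨h.ha.trans hν.1, hν.2.trans h.hb⟩

theorem M_triv (h : Kak c C N e1 e2 a b c1 c2 t t1) (u u' : ℝ) :
    Integrable (M N e1 e2 a b c1 c2 t u u') ∧
    ∫ z, |M N e1 e2 a b c1 c2 t u u' z| ≤ C ^ 2 * (81 * (144 * Real.pi) ^ 2) * (b - a) * Real.pi ^ 2 := by
  have m1 := (sc h.ct u).measurable
  have m2 := (sc h.ct u').measurable
  have m3 := (h.shf_cont u u').measurable
  have := W0m; have := W1m; have := W2m
  refine L1shift h.hab.le (H := fun ν z => t ν u * t ν u' * DDZ e1 e2 ν (z + shf N c1 c2 u u' ν))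
    ?_ m3 fun ν hν z => ?_
  · generalize shf N c1 c2 u u' = A at m3 ⊢
    unfold DDZ Function.uncurry; fun_prop
  · rw [abs_mul, abs_mul]
    have := h.hC
    have h1 := mul_le_mul (h.bt ν u) (h.bt ν u') (abs_nonneg _) (by linarith)
    rw [pow_two, mul_assoc (C * C)]
    exact mul_le_mul h1 (DDZ_bd h.he1 h.he2 (h.abs8 hν) _) (abs_nonneg _) (by positivity)

theorem DZ_path {e1 e2 ν x' y' : ℝ} {x y : ℝ → ℝ} (hx : HasDerivAt x x' ν) (hy : HasDerivAt y y' ν) :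
    HasDerivAt (fun ν => DZ e1 e2 ν (x ν, y ν)) (e1 * (W2 (x ν) * x' * W0 (y ν) + W1 (x ν) * (W1 (y ν) * y')) +
      (e2 * (W0 (x ν) * W1 (y ν)) + e2 * ν * (W1 (x ν) * x' * W1 (y ν) + W0 (x ν) * (W2 (y ν) * y')))) ν := by
  have a0 := (W0_deriv (x ν)).comp ν hx
  have a1 := (W1_deriv (x ν)).comp ν hx
  have b0 := (W0_deriv (y ν)).comp ν hy
  have b1 := (W1_deriv (y ν)).comp ν hy
  refine (((a1.fun_mul b0).const_mul e1).fun_add (((hasDerivAt_id ν).const_mul e2).fun_mul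
    (a0.fun_mul b1))).congr_deriv ?_
  simp only [Function.comp_apply, id]; ring

theorem M_ibp (h : Kak c C N e1 e2 a b c1 c2 t t1) {u u' : ℝ} (hu : u ∈ Icc (1/2:ℝ) 3)
    (hu' : u' ∈ Icc (1/2:ℝ) 3) (hne : u ≠ u') :
    ∫ z, |M N e1 e2 a b c1 c2 t u u' z| ≤
      C ^ 3 * (c⁻¹ + c⁻¹ ^ 2) * 1000 * (144 * Real.pi) ^ 2 * Real.pi ^ 2 / (N * |u - u'|) := by
  have hC := h.hC; have hc := h.hc; have hN := h.hN; have hab := h.hab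
  have C0 : 0 ≤ C := by linarith
  have hd : 0 < |u - u'| := abs_pos.2 (sub_ne_zero.2 hne)
  set d := |u - u'| with hdd
  set A := shf N c1 c2 u u' with hA
  have cA : Continuous A := h.shf_cont u u'
  have k1 := sc h.ct u; have k2 := sc h.ct u'; have k3 := sc h.ct1 u; have k4 := sc h.ct1 u'
  obtain ⟨co, hco⟩ : ∃ co : ℝ → ℝ, co = fun ν => t ν u * t ν u' / (t ν u - t ν u') := ⟨_, rfl⟩
  obtain ⟨co', hco'⟩ : ∃ co' : ℝ → ℝ, co' = fun ν => (t1 ν u * t ν u' + t ν u * t1 ν u') / (t ν u - t ν u') -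
    t ν u * t ν u' * (t1 ν u - t1 ν u') / (t ν u - t ν u') ^ 2 := ⟨_, rfl⟩
  have m1 := k1.measurable; have m2 := k2.measurable; have m3 := k3.measurable; have m4 := k4.measurable
  have mco : Measurable co := by rw [hco]; fun_prop
  have mco' : Measurable co' := by rw [hco']; fun_prop
  have β0 : ∀ ν ∈ Icc a b, t ν u - t ν u' ≠ 0 := fun ν hν => by
    have := h.low ν hν u hu u' hu'
    rw [← abs_pos]; exact lt_of_lt_of_le (by positivity) this
  have cco : ContinuousOn co (Icc a b) := by
    rw [hco]; exact ContinuousOn.div (by fun_prop) (by fun_prop) β0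
  have cco' : ContinuousOn co' (Icc a b) := by
    rw [hco']
    exact (ContinuousOn.div (by fun_prop) (by fun_prop) β0).sub
      (ContinuousOn.div (by fun_prop) (by fun_prop) fun ν hν => pow_ne_zero 2 (β0 ν hν))
  have tt : ∀ ν, |t ν u * t ν u'| ≤ C ^ 2 := fun ν => by
    rw [abs_mul, pow_two]; exact mul_le_mul (h.bt _ _) (h.bt _ _) (abs_nonneg _) C0
  have bco : ∀ ν ∈ Icc a b, |co ν| ≤ C ^ 2 * c⁻¹ / d := fun ν hν => by
    have := h.low ν hν u hu u' hu'
    simp only [hco]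
    rw [abs_div]
    calc _ ≤ C ^ 2 / (c * d) := div_le_div₀ (by positivity) (tt ν) (by positivity) this
      _ = _ := by field_simp
  have bco' : ∀ ν ∈ Icc a b, |co' ν| ≤ 2 * C ^ 3 * (c⁻¹ + c⁻¹ ^ 2) / d := fun ν hν => by
    have hl := h.low ν hν u hu u' hu'
    have hL := h.lip ν hν u hu u' hu'
    simp only [hco']
    refine (abs_sub _ _).trans ?_
    rw [abs_div, abs_div, abs_pow, abs_mul (_ * _)]
    have e1 : |t1 ν u * t ν u' + t ν u * t1 ν u'| ≤ 2 * C ^ 2 := by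
      refine (abs_add_le _ _).trans ?_
      rw [abs_mul, abs_mul]
      nlinarith [mul_le_mul (h.bt1 ν u) (h.bt ν u') (abs_nonneg _) C0, mul_le_mul (h.bt ν u) (h.bt1 ν u') (abs_nonneg _) C0]
    calc _ ≤ 2 * C ^ 2 / (c * d) + C ^ 2 * (C * d) / (c * d) ^ 2 := by
          refine add_le_add (div_le_div₀ (by positivity) e1 (by positivity) hl) ?_
          refine div_le_div₀ (by positivity) (mul_le_mul (tt ν) hL (abs_nonneg _) (by positivity)) (by positivity) ?_
          gcongr
      _ = (2 * C ^ 2 * c⁻¹ + C ^ 3 * c⁻¹ ^ 2) / d := by field_simp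
      _ ≤ _ := by
          refine div_le_div_of_nonneg_right ?_ hd.le
          have : C ^ 2 ≤ C ^ 3 := pow_le_pow_right₀ hC (by norm_num)
          have : 0 < c⁻¹ := by positivity
          have : 0 ≤ C ^ 3 * c⁻¹ ^ 2 := by positivity
          nlinarith
  have key : ∀ z, N * M N e1 e2 a b c1 c2 t u u' z =
      (co b * DZ e1 e2 b (z + A b) - co a * DZ e1 e2 a (z + A a)) -
      ∫ ν in a..b, (co' ν * DZ e1 e2 ν (z + A ν) + co ν * e2 * (W0 (z + A ν).1 * W1 (z + A ν).2)) := by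
    intro z
    have w0 := W0_cont; have w1 := W1_cont; have w2 := W2_cont
    have cD : Continuous (fun ν => DZ e1 e2 ν (z + A ν)) := by unfold DZ; fun_prop
    have cDD : Continuous (fun ν => DDZ e1 e2 ν (z + A ν)) := by unfold DDZ; fun_prop
    have cR : ContinuousOn (fun ν => co' ν * DZ e1 e2 ν (z + A ν) +
        co ν * e2 * (W0 (z + A ν).1 * W1 (z + A ν).2)) (Icc a b) :=
      (cco'.mul cD.continuousOn).add ((cco.mul continuousOn_const).mul (by fun_prop))
    have cL : ContinuousOn (fun ν => N * (t ν u * t ν u' * DDZ e1 e2 ν (z + A ν))) (Icc a b) := by fun_prop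
    have := intervalIntegral.integral_eq_sub_of_hasDerivAt_of_le hab.le (f := fun ν => co ν * DZ e1 e2 ν (z + A ν))
      (f' := fun ν => N * (t ν u * t ν u' * DDZ e1 e2 ν (z + A ν)) + (co' ν * DZ e1 e2 ν (z + A ν) +
        co ν * e2 * (W0 (z + A ν).1 * W1 (z + A ν).2))) (cco.mul cD.continuousOn) (fun ν hν => ?_)
        ((cL.add cR).intervalIntegrable_of_Icc hab.le)
    · rw [intervalIntegral.integral_add (cL.intervalIntegrable_of_Icc hab.le) (cR.intervalIntegrable_of_Icc hab.le),
        intervalIntegral.integral_const_mul] at this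
      unfold M; linarith
    · have hβ := β0 ν (Ioo_subset_Icc_self hν)
      have d1 := h.dt ν hν u hu
      have d2 := h.dt ν hν u' hu'
      have dco : HasDerivAt co (co' ν) ν := by
        rw [hco, hco']
        refine ((d1.fun_mul d2).fun_div (d1.fun_sub d2) hβ).congr_deriv ?_
        field_simp
      have p1 : HasDerivAt (fun ν => z.1 + N * (c1 ν u - c1 ν u')) (N * (e1 * t ν u - e1 * t ν u')) ν :=
        (((h.dc1 ν hν u hu).fun_sub (h.dc1 ν hν u' hu')).const_mul N).const_add z.1
      have p2 : HasDerivAt (fun ν => z.2 + N * (c2 ν u - c2 ν u')) (N * (e2 * ν * t ν u - e2 * ν * t ν u')) ν :=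
        (((h.dc2 ν hν u hu).fun_sub (h.dc2 ν hν u' hu')).const_mul N).const_add z.2
      have := dco.fun_mul (DZ_path (e1 := e1) (e2 := e2) p1 p2)
      refine this.congr_deriv ?_
      have q : t ν u * t ν u' = co ν * (t ν u - t ν u') := by rw [hco]; field_simp
      rw [q]
      simp only [hA, shf, DDZ, Prod.fst_add, Prod.snd_add, DZ]
      have s1 := h.he1; have s2 := h.he2
      have s1' : e1 * e1 = 1 := by rw [← s1]; ring
      have s2' : e2 * e2 = 1 := by rw [← s2]; ring
      linear_combination (co ν * N * (t ν u - t ν u') * W2 (z.1 + N * (c1 ν u - c1 ν u')) * W0 (z.2 + N * (c2 ν u - c2 ν u'))) * s1' + (co ν * N * (t ν u - t ν u') * ν ^ 2 * W0 (z.1 + N * (c1 ν u - c1 ν u')) * W2 (z.2 + N * (c2 ν u - c2 ν u'))) * s2'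
  obtain ⟨P, hP⟩ : ∃ P, P = (144 * Real.pi) ^ 2 := ⟨_, rfl⟩
  have P0 : 0 ≤ P := by rw [hP]; positivity
  obtain ⟨Q, hQ⟩ : ∃ Q, Q = C ^ 3 * (c⁻¹ + c⁻¹ ^ 2) / d := ⟨_, rfl⟩
  have ci : 0 < c⁻¹ := by positivity
  have Q0 : 0 ≤ Q := by rw [hQ]; positivity
  have bco2 : ∀ ν ∈ Icc a b, |co ν| ≤ Q := fun ν hν => (bco ν hν).trans (by
    rw [hQ]; refine div_le_div_of_nonneg_right ?_ hd.le
    have : C ^ 2 ≤ C ^ 3 := pow_le_pow_right₀ hC (by norm_num)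
    have : 0 ≤ C ^ 3 * c⁻¹ ^ 2 := by positivity
    nlinarith)
  have bco2' : ∀ ν ∈ Icc a b, |co' ν| ≤ 2 * Q := fun ν hν => (bco' ν hν).trans (le_of_eq (by rw [hQ]; ring))
  have hR := L1shift hab.le (K := 19 * Q * P) (A := A) (H := fun ν z => co' ν * DZ e1 e2 ν (z + A ν) + co ν * e2 * (W0 (z + A ν).1 * W1 (z + A ν).2))
    (by have := W0m; have := W1m; have := cA.measurable; unfold DZ Function.uncurry; fun_prop) cA.measurable (fun ν hν z => by
      refine (abs_add_le _ _).trans ?_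
      rw [abs_mul, abs_mul (co ν * e2), abs_mul (co ν), abs1 h.he2, mul_one]
      have x1 := mul_le_mul (bco2' ν hν) (DZ_bd h.he1 h.he2 (h.abs8 hν) (z + A ν)) (abs_nonneg _) (by positivity)
      have x2 := mul_le_mul (bco2 ν hν) (WW_bd W0_bd W1_bd (z + A ν)) (abs_nonneg _) (by positivity)
      rw [← hP] at x1 x2
      linarith)
  have iz : ∀ w : ℝ × ℝ, Integrable (fun z => ze (z + w)) := fun w => ze_int.comp_add_right w
  have vz : ∀ w : ℝ × ℝ, ∫ z, ze (z + w) = Real.pi ^ 2 := fun w => by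
    rw [integral_add_right_eq_self ze w, ze_integral]
  have MI := (h.M_triv u u').1
  have fin : N * ∫ z, |M N e1 e2 a b c1 c2 t u u' z| ≤ 1000 * Q * P * Real.pi ^ 2 := by
    rw [← integral_const_mul]
    calc _ ≤ ∫ z, ((9 * Q * P) * ze (z + A b) + (9 * Q * P) * ze (z + A a)) + |∫ ν in a..b, (co' ν * DZ e1 e2 ν (z + A ν) + co ν * e2 * (W0 (z + A ν).1 * W1 (z + A ν).2))| := by
          refine integral_mono (MI.abs.const_mul N) ((((iz _).const_mul _).add ((iz _).const_mul _)).add hR.1.abs) fun z => ?_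
          simp only
          rw [← abs_of_nonneg (by linarith : 0 ≤ N), ← abs_mul, abs_of_nonneg (by linarith : 0 ≤ N), key z]
          refine (abs_sub _ _).trans (add_le_add ((abs_sub _ _).trans ?_) le_rfl)
          rw [abs_mul, abs_mul]
          have x1 := mul_le_mul (bco2 b ⟨hab.le, le_rfl⟩) (DZ_bd h.he1 h.he2 (h.abs8 ⟨hab.le, le_rfl⟩) (z + A b)) (abs_nonneg _) (by positivity)
          have x2 := mul_le_mul (bco2 a ⟨le_rfl, hab.le⟩) (DZ_bd h.he1 h.he2 (h.abs8 ⟨le_rfl, hab.le⟩) (z + A a)) (abs_nonneg _) (by positivity)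
          rw [← hP] at x1 x2
          linarith
      _ ≤ 18 * Q * P * Real.pi ^ 2 + 19 * Q * P * (b - a) * Real.pi ^ 2 := by
          have i12 : Integrable (fun z => (9 * Q * P) * ze (z + A b) + (9 * Q * P) * ze (z + A a)) :=
            ((iz _).const_mul _).add ((iz _).const_mul _)
          rw [integral_add i12 hR.1.abs, integral_add ((iz _).const_mul _) ((iz _).const_mul _), integral_const_mul, integral_const_mul, vz, vz]
          have := hR.2; linarith
      _ ≤ _ := by
          have : b - a ≤ 16 := by have := h.ha; have := h.hb; linarith
          have : 0 ≤ Q * P * Real.pi ^ 2 := by positivity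
          nlinarith
  rw [hQ, hP] at fin
  rw [le_div_iff₀ (by positivity)]
  have := mul_le_mul_of_nonneg_right fin hd.le
  calc _ = N * (∫ z, |M N e1 e2 a b c1 c2 t u u' z|) * d := by ring
    _ ≤ _ := this
    _ = _ := by field_simp
end Kak


theorem two_mul_le_sq_ennreal (a b : ℝ≥0∞) : a * b ≤ (a ^ 2 + b ^ 2) / 2 := by
  rw [ENNReal.le_div_iff_mul_le (by simp) (by simp)]
  rcases eq_or_ne a ⊤ with rfl | ha
  · simp
  rcases eq_or_ne b ⊤ with rfl | hb
  · simp
  lift a to ℝ≥0 using ha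
  lift b to ℝ≥0 using hb
  norm_cast
  have := two_mul_le_add_sq a b
  calc _ = 2 * a * b := by ring
    _ ≤ _ := this

/-- `T T*` with Schur test -/
theorem TTs {X Y : Type*} [MeasurableSpace X] [MeasurableSpace Y] {μ : Measure X} {η : Measure Y} [SFinite μ] [SFinite η]
    {k : Y → X → ℝ} (hk : Measurable (Function.uncurry k)) {w : X → ℝ} (hw : Measurable w) (hwi : Integrable w μ)
    {A : ℝ≥0∞} (hA : A ≠ ⊤) (hkA : ∀ q q', ∫⁻ y, ‖k y q‖ₑ * ‖k y q'‖ₑ ∂η ≤ A) {Λ : ℝ≥0∞}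
    (hΛ : ∀ᵐ q ∂μ, ∫⁻ q', ‖∫ y, k y q * k y q' ∂η‖ₑ ∂μ ≤ Λ) :
    Integrable (fun y => (∫ q, k y q * w q ∂μ) ^ 2) η ∧
    ENNReal.ofReal (∫ y, (∫ q, k y q * w q ∂μ) ^ 2 ∂η) ≤ Λ * ∫⁻ q, ‖w q‖ₑ ^ 2 ∂μ := by
  set F : Y × (X × X) → ℝ := fun z => (k z.1 z.2.1 * w z.2.1) * (k z.1 z.2.2 * w z.2.2) with hF
  have hk1 : Measurable fun z : Y × X => k z.1 z.2 := hk
  have m1 : Measurable fun z : Y × (X × X) => k z.1 z.2.1 := hk1.comp (by fun_prop : Measurable fun z : Y × (X × X) => (z.1, z.2.1))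
  have m2 : Measurable fun z : Y × (X × X) => k z.1 z.2.2 := hk1.comp (by fun_prop : Measurable fun z : Y × (X × X) => (z.1, z.2.2))
  have hFm : Measurable F := by rw [hF]; fun_prop
  have hFi : Integrable F (η.prod (μ.prod μ)) := by
    refine ⟨hFm.aestronglyMeasurable, ?_⟩
    rw [hasFiniteIntegral_iff_enorm, lintegral_prod_symm _ hFm.enorm.aemeasurable]
    calc _ ≤ ∫⁻ q : X × X, A * (‖w q.1‖ₑ * ‖w q.2‖ₑ) ∂(μ.prod μ) := by
          refine lintegral_mono fun q => ?_
          simp only [hF, enorm_mul]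
          calc _ = ∫⁻ y, (‖k y q.1‖ₑ * ‖k y q.2‖ₑ) * (‖w q.1‖ₑ * ‖w q.2‖ₑ) ∂η := by
                refine lintegral_congr fun y => ?_; ring
            _ = (∫⁻ y, (‖k y q.1‖ₑ * ‖k y q.2‖ₑ) ∂η) * (‖w q.1‖ₑ * ‖w q.2‖ₑ) := lintegral_mul_const' _ _ (by finiteness)
            _ ≤ _ := mul_le_mul_left (hkA _ _) _
      _ = A * ((∫⁻ q, ‖w q‖ₑ ∂μ) * ∫⁻ q, ‖w q‖ₑ ∂μ) := by
          rw [lintegral_const_mul' _ _ hA, lintegral_prod_mul hw.enorm.aemeasurable hw.enorm.aemeasurable]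
      _ < ⊤ := by
          have := hwi.2; rw [hasFiniteIntegral_iff_enorm] at this
          exact mul_lt_top hA.lt_top (mul_lt_top this this)
  have e1 : ∀ y, ∫ q, F (y, q) ∂(μ.prod μ) = (∫ q, k y q * w q ∂μ) ^ 2 := fun y => by
    simp only [hF]; rw [integral_prod_mul (fun q => k y q * w q) (fun q => k y q * w q), pow_two]
  refine ⟨by simpa only [e1] using hFi.integral_prod_left, ?_⟩
  have e2 : ∫ y, (∫ q, k y q * w q ∂μ) ^ 2 ∂η = ∫ q : X × X, (∫ y, k y q.1 * k y q.2 ∂η) * (w q.1 * w q.2) ∂(μ.prod μ) := by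
    simp only [← e1]
    rw [integral_integral_swap (f := fun y q => F (y, q)) hFi]
    refine integral_congr_ae (Eventually.of_forall fun q => ?_)
    simp only [hF]
    rw [← integral_mul_const]
    refine integral_congr_ae (Eventually.of_forall fun y => ?_); simp only; ring
  set G : X → X → ℝ := fun q q' => ∫ y, k y q * k y q' ∂η with hG
  have hGm : Measurable fun z : X × X => G z.1 z.2 := by
    have : StronglyMeasurable fun z : (X × X) × Y => k z.2 z.1.1 * k z.2 z.1.2 := by
      refine Measurable.stronglyMeasurable ((hk1.comp (by fun_prop : Measurable fun z : (X × X) × Y => (z.2, z.1.1))).mul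
        (hk1.comp (by fun_prop : Measurable fun z : (X × X) × Y => (z.2, z.1.2))))
    exact this.integral_prod_right.measurable
  have hGs : ∀ q q', G q q' = G q' q := fun q q' => by simp only [hG, mul_comm]
  rw [e2]
  have hGe := hGm.enorm
  have hG2 : ∀ q, Measurable fun q' => ‖G q q'‖ₑ := fun q => hGe.comp (by fun_prop : Measurable fun q' => (q, q'))
  have hwe := hw.enorm
  calc _ ≤ ∫⁻ q : X × X, ‖G q.1 q.2 * (w q.1 * w q.2)‖ₑ ∂(μ.prod μ) := by
        refine (ENNReal.ofReal_le_ofReal (le_abs_self _)).trans ?_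
        rw [← Real.enorm_eq_ofReal_abs]; exact enorm_integral_le_lintegral_enorm _
    _ ≤ ∫⁻ q : X × X, ((‖G q.1 q.2‖ₑ * ‖w q.1‖ₑ ^ 2) / 2 + (‖G q.1 q.2‖ₑ * ‖w q.2‖ₑ ^ 2) / 2) ∂(μ.prod μ) := by
        refine lintegral_mono fun q => ?_
        rw [enorm_mul, enorm_mul]
        refine (mul_le_mul_right (two_mul_le_sq_ennreal _ _) _).trans (le_of_eq ?_)
        simp only [div_eq_mul_inv]; ring
    _ = (∫⁻ q : X × X, (‖G q.1 q.2‖ₑ * ‖w q.1‖ₑ ^ 2) / 2 ∂(μ.prod μ)) + ∫⁻ q : X × X, (‖G q.1 q.2‖ₑ * ‖w q.2‖ₑ ^ 2) / 2 ∂(μ.prod μ) :=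
        lintegral_add_left (by fun_prop) _
    _ ≤ (Λ * ∫⁻ q, ‖w q‖ₑ ^ 2 ∂μ) / 2 + (Λ * ∫⁻ q, ‖w q‖ₑ ^ 2 ∂μ) / 2 := by
        have key : ∫⁻ q, ∫⁻ q', (‖G q q'‖ₑ * ‖w q‖ₑ ^ 2) / 2 ∂μ ∂μ ≤ (Λ * ∫⁻ q, ‖w q‖ₑ ^ 2 ∂μ) / 2 := by
          rw [div_eq_mul_inv, ← lintegral_const_mul _ (by fun_prop), ← lintegral_mul_const _ (by fun_prop)]
          refine lintegral_mono_ae (hΛ.mono fun q hq => ?_)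
          simp only [div_eq_mul_inv, mul_assoc]
          rw [lintegral_mul_const _ (hG2 q)]
          exact mul_le_mul_left hq _
        refine add_le_add ?_ ?_
        · rw [lintegral_prod _ (by fun_prop)]; exact key
        · rw [lintegral_prod_symm _ (by fun_prop)]
          refine le_trans (le_of_eq ?_) key
          simp only [hGs]
    _ = _ := ENNReal.add_halves _


noncomputable def Dze (e1 e2 ν : ℝ) (z : ℝ × ℝ) : ℝ := e1 * (V1d z.1 * V1 z.2) + e2 * ν * (V1 z.1 * V1d z.2)

theorem Dze_bd {e1 e2 ν : ℝ} (h1 : e1 ^ 2 = 1) (h2 : e2 ^ 2 = 1) (hν : |ν| ≤ 8) (z : ℝ × ℝ) :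
    |Dze e1 e2 ν z| ≤ 54 * ze z := by
  unfold Dze ze
  refine (abs_add_le _ _).trans ?_
  have p1 := V1_pos z.1; have p2 := V1_pos z.2
  rw [abs_mul e1, abs_mul (e2 * ν), abs_mul e2, abs1 h1, abs1 h2, abs_mul, abs_mul, abs_of_pos p1, abs_of_pos p2]
  have b1 := mul_le_mul_of_nonneg_right (V1d_le z.1) p2.le
  have b2 := mul_le_mul_of_nonneg_left (V1d_le z.2) p1.le
  have b3 := mul_le_mul hν b2 (by positivity) (by norm_num)
  linarith

theorem ze_lint (p : ℝ × ℝ) : ∫⁻ y, ‖ze (p - y)‖ₑ = ENNReal.ofReal (Real.pi ^ 2) := by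
  rw [← ze_integral, ← integral_sub_left_eq_self ze volume p, ofReal_integral_eq_lintegral_ofReal (ze_int.comp_sub_left p)
    (Eventually.of_forall fun _ => (ze_pos _).le)]
  exact lintegral_congr fun y => Real.enorm_of_nonneg (ze_pos _).le
theorem ze_lint' (p : ℝ × ℝ) : ∫⁻ y, ‖ze (y + p)‖ₑ = ENNReal.ofReal (Real.pi ^ 2) := by
  rw [← ze_lint (-p)]
  refine lintegral_congr fun y => ?_
  rw [← ze_even]; congr 2; abel

/-- position -/
noncomputable def ps (N : ℝ) (c1 c2 : ℝ → ℝ → ℝ) (ν u : ℝ) : ℝ × ℝ := (N * c1 ν u, N * c2 ν u)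
abbrev P3 := ℝ × (ℝ × ℝ)
noncomputable def kT (N : ℝ) (c1 c2 : ℝ → ℝ → ℝ) (Y q : P3) : ℝ := ze (q.2 + ps N c1 c2 Y.1 q.1 - Y.2)
noncomputable def kQ (N e1 e2 : ℝ) (c1 c2 t : ℝ → ℝ → ℝ) (Y q : P3) : ℝ :=
  N * t Y.1 q.1 * Dze e1 e2 Y.1 (q.2 + ps N c1 c2 Y.1 q.1 - Y.2)
noncomputable def mI (a b : ℝ) : Measure P3 := (volume.restrict (Icc a b)).prod volume
instance (a b : ℝ) : SFinite (mI a b) := by unfold mI; infer_instance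

theorem mI_ae (a b : ℝ) : ∀ᵐ q ∂(mI a b), q.1 ∈ Icc a b :=
  Measure.quasiMeasurePreserving_fst.ae (ae_restrict_mem measurableSet_Icc)

theorem mI_lint {a b : ℝ} {f : P3 → ℝ≥0∞} (hf : Measurable f) {B : ℝ≥0∞}
    (h : ∀ s ∈ Icc a b, ∫⁻ y, f (s, y) ≤ B) : ∫⁻ q, f q ∂(mI a b) ≤ B * ENNReal.ofReal (b - a) := by
  unfold mI; rw [lintegral_prod _ hf.aemeasurable]
  calc _ ≤ ∫⁻ s in Icc a b, B := setLIntegral_mono' measurableSet_Icc h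
    _ = _ := by rw [lintegral_const]; simp

namespace Kak
variable {c C N e1 e2 a b : ℝ} {c1 c2 t t1 : ℝ → ℝ → ℝ}

theorem mes (f : ℝ → ℝ → ℝ) (h : Continuous (Function.uncurry f)) : Measurable (fun z : P3 × P3 => f z.1.1 z.2.1) :=
  h.measurable.comp (by fun_prop : Measurable fun z : P3 × P3 => (z.1.1, z.2.1))

theorem psm (h : Kak c C N e1 e2 a b c1 c2 t t1) :
    Measurable (fun z : P3 × P3 => z.2.2 + ps N c1 c2 z.1.1 z.2.1 - z.1.2) :=
  ((measurable_snd.comp measurable_snd).add (((mes _ h.cc1).const_mul N).prodMk ((mes _ h.cc2).const_mul N))).sub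
    (measurable_snd.comp measurable_fst)
theorem kTm (h : Kak c C N e1 e2 a b c1 c2 t t1) : Measurable (fun z : P3 × P3 => kT N c1 c2 z.1 z.2) :=
  ze_cont.measurable.comp h.psm
theorem kTm2 (h : Kak c C N e1 e2 a b c1 c2 t t1) {α : Type*} [MeasurableSpace α] {f g : α → P3} (hf : Measurable f)
    (hg : Measurable g) : Measurable fun z => kT N c1 c2 (f z) (g z) := by
  have := h.kTm.comp (hf.prodMk hg); exact this
theorem kQm (h : Kak c C N e1 e2 a b c1 c2 t t1) : Measurable (fun z : P3 × P3 => kQ N e1 e2 c1 c2 t z.1 z.2) := by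
  have m0 := mes _ h.ct; have := V1_cont.measurable; have := V1d_cont.measurable
  have m2 := h.psm
  have m3 : Measurable (fun q : ℝ × (ℝ × ℝ) => Dze e1 e2 q.1 q.2) := by unfold Dze; fun_prop
  have m4 := m3.comp ((measurable_fst.comp (measurable_fst (α := P3) (β := P3))).prodMk m2)
  exact (m0.const_mul N).mul m4
theorem kQm2 (h : Kak c C N e1 e2 a b c1 c2 t t1) {α : Type*} [MeasurableSpace α] {f g : α → P3} (hf : Measurable f)
    (hg : Measurable g) : Measurable fun z => kQ N e1 e2 c1 c2 t (f z) (g z) := by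
  have := h.kQm.comp (hf.prodMk hg); exact this

theorem kQ_bd (h : Kak c C N e1 e2 a b c1 c2 t t1) (Y q : P3) (hY : Y.1 ∈ Icc a b) :
    |kQ N e1 e2 c1 c2 t Y q| ≤ (N * C * 54) * kT N c1 c2 Y q := by
  have := h.hN; have := h.hC
  unfold kQ kT
  rw [abs_mul, abs_mul, abs_of_nonneg (by linarith : 0 ≤ N), mul_assoc (N * C)]
  exact mul_le_mul (mul_le_mul_of_nonneg_left (h.bt _ _) (by linarith)) (Dze_bd h.he1 h.he2 (h.abs8 hY) _)
    (abs_nonneg _) (by positivity)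

theorem kT_pos (Y q : P3) : 0 < kT N c1 c2 Y q := ze_pos _
theorem kT_le (Y q : P3) : kT N c1 c2 Y q ≤ 1 := ze_le _

theorem kTY (h : Kak c C N e1 e2 a b c1 c2 t t1) (q : P3) :
    ∫⁻ Y, ‖kT N c1 c2 Y q‖ₑ ∂(mI a b) ≤ ENNReal.ofReal (Real.pi ^ 2) * ENNReal.ofReal (b - a) :=
  mI_lint (f := fun Y => ‖kT N c1 c2 Y q‖ₑ) (h.kTm2 measurable_id measurable_const).enorm fun s hs =>
    (ze_lint (q.2 + ps N c1 c2 s q.1)).le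

theorem kA (h : Kak c C N e1 e2 a b c1 c2 t t1) {k : P3 → P3 → ℝ} {B : ℝ} (hB : 0 ≤ B)
    (hk : ∀ Y q, Y.1 ∈ Icc a b → |k Y q| ≤ B * kT N c1 c2 Y q) (q q' : P3) :
    ∫⁻ Y, ‖k Y q‖ₑ * ‖k Y q'‖ₑ ∂(mI a b) ≤ ENNReal.ofReal (B ^ 2) * (ENNReal.ofReal (Real.pi ^ 2) * ENNReal.ofReal (b - a)) := by
  calc _ ≤ ∫⁻ Y, ENNReal.ofReal (B ^ 2) * ‖kT N c1 c2 Y q‖ₑ ∂(mI a b) := by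
        refine lintegral_mono_ae ((mI_ae a b).mono fun Y hY => ?_)
        rw [← enorm_mul, Real.enorm_eq_ofReal_abs, Real.enorm_eq_ofReal_abs, ← ofReal_mul (by positivity), abs_mul]
        refine ofReal_le_ofReal ?_
        have h1 := hk Y q hY
        have h2 := (hk Y q' hY).trans (mul_le_of_le_one_right hB (kT_le _ _))
        have := kT_pos (N := N) (c1 := c1) (c2 := c2) Y q
        rw [abs_of_pos this]
        calc _ ≤ B * kT N c1 c2 Y q * B := mul_le_mul h1 h2 (abs_nonneg _) (by positivity)
          _ = _ := by ring
    _ = _ * _ := lintegral_const_mul' _ _ (by finiteness)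
    _ ≤ _ := mul_le_mul_right (h.kTY q) _

theorem T_est (h : Kak c C N e1 e2 a b c1 c2 t t1) {w : P3 → ℝ} (hw : Measurable w) (hwi : Integrable w (mI (1/2) 3)) :
    Integrable (fun Y => (∫ q, kT N c1 c2 Y q * w q ∂(mI (1/2) 3)) ^ 2) (mI a b) ∧
    ENNReal.ofReal (∫ Y, (∫ q, kT N c1 c2 Y q * w q ∂(mI (1/2) 3)) ^ 2 ∂(mI a b)) ≤
      ENNReal.ofReal (3 * Real.pi ^ 4 * (b - a)) * ∫⁻ q, ‖w q‖ₑ ^ 2 ∂(mI (1/2) 3) := by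
  have hm := h.kTm
  refine TTs hm hw hwi (A := ENNReal.ofReal (1 ^ 2) * (ENNReal.ofReal (Real.pi ^ 2) * ENNReal.ofReal (b - a))) (by finiteness)
    (h.kA zero_le_one fun Y q _ => by rw [abs_of_pos (kT_pos _ _), one_mul]) (Eventually.of_forall fun q => ?_)
  calc _ ≤ ∫⁻ q', ∫⁻ Y, ‖kT N c1 c2 Y q‖ₑ * ‖kT N c1 c2 Y q'‖ₑ ∂(mI a b) ∂(mI (1/2) 3) := by
        refine lintegral_mono fun q' => (enorm_integral_le_lintegral_enorm _).trans (le_of_eq ?_)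
        simp only [enorm_mul]
    _ = ∫⁻ Y, ∫⁻ q', ‖kT N c1 c2 Y q‖ₑ * ‖kT N c1 c2 Y q'‖ₑ ∂(mI (1/2) 3) ∂(mI a b) := by
        refine lintegral_lintegral_swap (Measurable.aemeasurable ?_)
        exact (h.kTm2 measurable_snd measurable_const).enorm.mul (h.kTm2 measurable_snd measurable_fst).enorm
    _ ≤ ∫⁻ Y, ‖kT N c1 c2 Y q‖ₑ * (ENNReal.ofReal (Real.pi ^ 2) * ENNReal.ofReal (3 - 1/2)) ∂(mI a b) := by
        refine lintegral_mono fun Y => ?_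
        simp only
        rw [lintegral_const_mul' _ _ (by finiteness)]
        refine mul_le_mul_right (mI_lint (f := fun q => ‖kT N c1 c2 Y q‖ₑ) (h.kTm2 measurable_const measurable_id).enorm fun s hs => ?_) _
        simp only [kT, add_sub_assoc]; exact (ze_lint' _).le
    _ ≤ (ENNReal.ofReal (Real.pi ^ 2) * ENNReal.ofReal (b - a)) * (ENNReal.ofReal (Real.pi ^ 2) * ENNReal.ofReal (3 - 1/2)) := by
        rw [lintegral_mul_const' _ _ (by finiteness)]
        exact mul_le_mul_left (h.kTY q) _
    _ ≤ _ := by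
        have := h.hab
        rw [← ofReal_mul (by positivity), ← ofReal_mul (by positivity), ← ofReal_mul (mul_nonneg (by positivity) (by linarith))]
        refine ofReal_le_ofReal ?_
        have : 0 ≤ Real.pi ^ 4 * (b - a) := mul_nonneg (by positivity) (by linarith)
        nlinarith

theorem DzeDze {e1 e2 ν : ℝ} (h1 : e1 ^ 2 = 1) (h2 : e2 ^ 2 = 1) (p p' : ℝ × ℝ) :
    ∫ y, Dze e1 e2 ν (p - y) * Dze e1 e2 ν (p' - y) = - DDZ e1 e2 ν (p - p') := by
  have ki : ∀ f g : ℝ → ℝ, Continuous f → Continuous g → (∀ x, |f x| ≤ 6 * V1 x) → (∀ x, |g x| ≤ 6 * V1 x) → ∀ a b,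
      Integrable (fun y => f (a - y) * g (b - y)) := fun f g hf hg bf bg a b =>
    ((int_of_V1 hf bf).comp_sub_left a).mul_bdd (c := 6) (by fun_prop) (Eventually.of_forall fun y => V1_six bg _)
  have i1 : Integrable (fun y : ℝ × ℝ => (V1d (p.1 - y.1) * V1d (p'.1 - y.1)) * (V1 (p.2 - y.2) * V1 (p'.2 - y.2))) :=
    (ki _ _ V1d_cont V1d_cont V1d_le V1d_le _ _).mul_prod (ki _ _ V1_cont V1_cont V1_le6 V1_le6 _ _)
  have i2 : Integrable (fun y : ℝ × ℝ => (V1d (p.1 - y.1) * V1 (p'.1 - y.1)) * (V1 (p.2 - y.2) * V1d (p'.2 - y.2))) :=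
    (ki _ _ V1d_cont V1_cont V1d_le V1_le6 _ _).mul_prod (ki _ _ V1_cont V1d_cont V1_le6 V1d_le _ _)
  have i3 : Integrable (fun y : ℝ × ℝ => (V1 (p.1 - y.1) * V1d (p'.1 - y.1)) * (V1d (p.2 - y.2) * V1 (p'.2 - y.2))) :=
    (ki _ _ V1_cont V1d_cont V1_le6 V1d_le _ _).mul_prod (ki _ _ V1d_cont V1_cont V1d_le V1_le6 _ _)
  have i4 : Integrable (fun y : ℝ × ℝ => (V1 (p.1 - y.1) * V1 (p'.1 - y.1)) * (V1d (p.2 - y.2) * V1d (p'.2 - y.2))) :=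
    (ki _ _ V1_cont V1_cont V1_le6 V1_le6 _ _).mul_prod (ki _ _ V1d_cont V1d_cont V1d_le V1d_le _ _)
  have v : ∀ f1 g1 f2 g2 : ℝ → ℝ, ∫ y : ℝ × ℝ, (f1 (p.1 - y.1) * g1 (p'.1 - y.1)) * (f2 (p.2 - y.2) * g2 (p'.2 - y.2)) =
      cor f1 g1 (p.1 - p'.1) * cor f2 g2 (p.2 - p'.2) := fun f1 g1 f2 g2 => by
    rw [← cor_flip, ← cor_flip, Measure.volume_eq_prod]
    exact integral_prod_mul (fun y => f1 (p.1 - y) * g1 (p'.1 - y)) (fun y => f2 (p.2 - y) * g2 (p'.2 - y))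
  have s1 : e1 * e1 = 1 := by rw [← h1]; ring
  have s2 : e2 * e2 = 1 := by rw [← h2]; ring
  have e : ∀ y : ℝ × ℝ, Dze e1 e2 ν (p - y) * Dze e1 e2 ν (p' - y) =
      ((V1d (p.1 - y.1) * V1d (p'.1 - y.1)) * (V1 (p.2 - y.2) * V1 (p'.2 - y.2)) +
      (e1 * e2 * ν) * ((V1d (p.1 - y.1) * V1 (p'.1 - y.1)) * (V1 (p.2 - y.2) * V1d (p'.2 - y.2)))) +
      ((e1 * e2 * ν) * ((V1 (p.1 - y.1) * V1d (p'.1 - y.1)) * (V1d (p.2 - y.2) * V1 (p'.2 - y.2))) +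
      ν ^ 2 * ((V1 (p.1 - y.1) * V1 (p'.1 - y.1)) * (V1d (p.2 - y.2) * V1d (p'.2 - y.2)))) := fun y => by
    simp only [Dze, Prod.fst_sub, Prod.snd_sub]
    linear_combination ((V1d (p.1 - y.1) * V1d (p'.1 - y.1)) * (V1 (p.2 - y.2) * V1 (p'.2 - y.2))) * s1 + ν ^ 2 * ((V1 (p.1 - y.1) * V1 (p'.1 - y.1)) * (V1d (p.2 - y.2) * V1d (p'.2 - y.2))) * s2
  simp only [e]
  rw [integral_add (by exact i1.add (i2.const_mul _)) (by exact (i3.const_mul _).add (i4.const_mul _)),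
    integral_add i1 (i2.const_mul _), integral_add (i3.const_mul _) (i4.const_mul _), integral_const_mul,
    integral_const_mul, integral_const_mul, v, v, v, v, cor_01, cor_01, cor_11, cor_11]
  simp only [DDZ, W0, W1, W2, Prod.fst_sub, Prod.snd_sub]; ring
end Kak


theorem log_int {N u : ℝ} (hN : 1 ≤ N) (hu : u ∈ Icc (1/2:ℝ) 3) :
    ∫ s in Icc (1/2:ℝ) 3, (|u - s| + N⁻¹)⁻¹ ≤ 64 * N ^ (1/16:ℝ) := by
  have hi : 0 < N⁻¹ := by positivity
  have cg : Continuous fun s => (|u - s| + N⁻¹)⁻¹ :=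
    Continuous.inv₀ (by fun_prop) fun s => by have := abs_nonneg (u - s); positivity
  have l1 : ∀ r : ℝ, 0 ≤ r → r ≤ 3 → Real.log (r + N⁻¹) - Real.log N⁻¹ ≤ 32 * N ^ (1/16:ℝ) := fun r h0 h3 => by
    rw [← Real.log_div (by positivity) (by positivity)]
    have e : (r + N⁻¹) / N⁻¹ ≤ 4 * N := by
      rw [div_inv_eq_mul, add_mul, inv_mul_cancel₀ (by positivity)]; nlinarith
    calc _ ≤ Real.log (4 * N) := Real.log_le_log (by positivity) e
      _ ≤ (4 * N) ^ (1/16:ℝ) / (1/16) := Real.log_le_rpow_div (by positivity) (by norm_num)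
      _ = 16 * (4:ℝ) ^ (1/16:ℝ) * N ^ (1/16:ℝ) := by rw [Real.mul_rpow (by norm_num) (by linarith)]; ring
      _ ≤ _ := by
        have : (4:ℝ) ^ (1/16:ℝ) ≤ 2 := by
          calc (4:ℝ) ^ (1/16:ℝ) ≤ (4:ℝ) ^ (1/2:ℝ) := Real.rpow_le_rpow_of_exponent_le (by norm_num) (by norm_num)
            _ = 2 := by rw [← Real.sqrt_eq_rpow, show (4:ℝ) = 2 ^ 2 by norm_num, Real.sqrt_sq (by norm_num)]
        have : 0 ≤ N ^ (1/16:ℝ) := by positivity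
        nlinarith
  rw [integral_Icc_eq_integral_Ioc, ← intervalIntegral.integral_of_le (by norm_num),
    ← intervalIntegral.integral_add_adjacent_intervals (b := u) (cg.intervalIntegrable _ _) (cg.intervalIntegrable _ _)]
  have a1 : ∫ s in (1/2)..u, (|u - s| + N⁻¹)⁻¹ = Real.log ((u - 1/2) + N⁻¹) - Real.log N⁻¹ := by
    rw [intervalIntegral.integral_eq_sub_of_hasDerivAt_of_le hu.1 (f := fun s => - Real.log (u - s + N⁻¹))
      (f' := fun s => (|u - s| + N⁻¹)⁻¹) ?_ ?_ (cg.intervalIntegrable _ _)]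
    · simp only [sub_self, zero_add]; ring
    · refine ContinuousOn.neg (ContinuousOn.log (by fun_prop) fun s hs => ?_)
      have := hs.2; apply ne_of_gt; linarith
    · intro s hs
      have h0 : 0 < u - s := sub_pos.2 hs.2
      refine ((((hasDerivAt_id s).const_sub u).add_const N⁻¹).log (ne_of_gt (by simp only [id]; linarith))).neg.congr_deriv ?_
      rw [abs_of_pos h0]; simp only [id]; field_simp
  have a2 : ∫ s in u..3, (|u - s| + N⁻¹)⁻¹ = Real.log ((3 - u) + N⁻¹) - Real.log N⁻¹ := by
    rw [intervalIntegral.integral_eq_sub_of_hasDerivAt_of_le hu.2 (f := fun s => Real.log (s - u + N⁻¹))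
      (f' := fun s => (|u - s| + N⁻¹)⁻¹) ?_ ?_ (cg.intervalIntegrable _ _)]
    · simp only [sub_self, zero_add]
    · refine (ContinuousOn.log (by fun_prop) fun s hs => ?_)
      have := hs.1; apply ne_of_gt; linarith
    · intro s hs
      have h0 : 0 < s - u := sub_pos.2 hs.1
      refine ((((hasDerivAt_id s).sub_const u).add_const N⁻¹).log (ne_of_gt (by simp only [id]; linarith))).congr_deriv ?_
      rw [abs_sub_comm, abs_of_pos h0]; simp only [id]; field_simp
  rw [a1, a2]
  have := l1 (u - 1/2) (by linarith [hu.1]) (by linarith [hu.2])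
  have := l1 (3 - u) (by linarith [hu.2]) (by linarith [hu.1])
  linarith

/-- Kakeya constant -/
noncomputable def KC (c C : ℝ) : ℝ :=
  C ^ 2 * (81 * (144 * Real.pi) ^ 2) * 16 * Real.pi ^ 2 + C ^ 3 * (c⁻¹ + c⁻¹ ^ 2) * 1000 * (144 * Real.pi) ^ 2 * Real.pi ^ 2

namespace Kak
variable {c C N e1 e2 a b : ℝ} {c1 c2 t t1 : ℝ → ℝ → ℝ}

theorem KC0 (h : Kak c C N e1 e2 a b c1 c2 t t1) : 0 ≤ KC c C := by
  have := h.hc; have := h.hC; unfold KC; positivity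

theorem M_min (h : Kak c C N e1 e2 a b c1 c2 t t1) {u u' : ℝ} (hu : u ∈ Icc (1/2:ℝ) 3)
    (hu' : u' ∈ Icc (1/2:ℝ) 3) :
    N ^ 2 * ∫ z, |M N e1 e2 a b c1 c2 t u u' z| ≤ 2 * N * KC c C * (|u - u'| + N⁻¹)⁻¹ := by
  have hC := h.hC; have hc := h.hc; have hN := h.hN; have hab := h.hab
  have K1 : ∫ z, |M N e1 e2 a b c1 c2 t u u' z| ≤ KC c C := (h.M_triv u u').2.trans (by
    unfold KC
    have : b - a ≤ 16 := by have := h.ha; have := h.hb; linarith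
    have : 0 ≤ C ^ 3 * (c⁻¹ + c⁻¹ ^ 2) * 1000 * (144 * Real.pi) ^ 2 * Real.pi ^ 2 := by positivity
    have : C ^ 2 * (81 * (144 * Real.pi) ^ 2) * (b - a) * Real.pi ^ 2 ≤ C ^ 2 * (81 * (144 * Real.pi) ^ 2) * 16 * Real.pi ^ 2 := by gcongr
    linarith)
  have k0 := h.KC0
  have hi : 0 < N⁻¹ := by positivity
  have hd := abs_nonneg (u - u')
  rw [← div_eq_mul_inv, le_div_iff₀ (by positivity)]
  rcases le_or_gt |u - u'| N⁻¹ with hle | hlt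
  · calc _ ≤ N ^ 2 * KC c C * (N⁻¹ + N⁻¹) := by gcongr
      _ = _ := by field_simp; ring
  · have hne : u ≠ u' := fun e => by rw [e, sub_self, abs_zero] at hlt; linarith
    have hp : 0 < |u - u'| := hi.trans hlt
    have K2 : ∫ z, |M N e1 e2 a b c1 c2 t u u' z| ≤ KC c C / (N * |u - u'|) := (h.M_ibp hu hu' hne).trans (by
      refine div_le_div_of_nonneg_right ?_ (by positivity)
      unfold KC
      have : 0 ≤ C ^ 2 * (81 * (144 * Real.pi) ^ 2) * 16 * Real.pi ^ 2 := by positivity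
      linarith)
    calc _ ≤ N ^ 2 * (KC c C / (N * |u - u'|)) * (|u - u'| + |u - u'|) := by gcongr
      _ = _ := by field_simp; ring

theorem kQkQ (h : Kak c C N e1 e2 a b c1 c2 t t1) (q q' : P3) :
    ∫ Y, kQ N e1 e2 c1 c2 t Y q * kQ N e1 e2 c1 c2 t Y q' ∂(mI a b) = - (N ^ 2 * M N e1 e2 a b c1 c2 t q.1 q'.1 (q.2 - q'.2)) := by
  have hi : Integrable (fun Y => kQ N e1 e2 c1 c2 t Y q * kQ N e1 e2 c1 c2 t Y q') (mI a b) := by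
    refine ⟨((h.kQm2 measurable_id measurable_const).mul (h.kQm2 measurable_id measurable_const)).aestronglyMeasurable, ?_⟩
    rw [hasFiniteIntegral_iff_enorm]
    simp only [enorm_mul]
    have := h.hN; have := h.hC
    exact (h.kA (by positivity) h.kQ_bd q q').trans_lt (by finiteness)
  unfold mI at *
  rw [integral_prod _ hi, M, intervalIntegral.integral_of_le h.hab.le, ← integral_Icc_eq_integral_Ioc, ← integral_const_mul,
    ← integral_neg]
  refine integral_congr_ae (Eventually.of_forall fun ν => ?_)
  simp only [kQ]
  have : ∀ y : ℝ × ℝ, N * t ν q.1 * Dze e1 e2 ν (q.2 + ps N c1 c2 ν q.1 - y) * (N * t ν q'.1 * Dze e1 e2 ν (q'.2 + ps N c1 c2 ν q'.1 - y))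
     = (N ^ 2 * (t ν q.1 * t ν q'.1)) * (Dze e1 e2 ν (q.2 + ps N c1 c2 ν q.1 - y) * Dze e1 e2 ν (q'.2 + ps N c1 c2 ν q'.1 - y)) := fun y => by ring
  simp only [this]
  rw [integral_const_mul, DzeDze h.he1 h.he2]
  have e : q.2 + ps N c1 c2 ν q.1 - (q'.2 + ps N c1 c2 ν q'.1) = q.2 - q'.2 + shf N c1 c2 q.1 q'.1 ν := by
    ext <;> simp [ps, shf] <;> ring
  rw [e]; ring

theorem Q_est (h : Kak c C N e1 e2 a b c1 c2 t t1) {w : P3 → ℝ} (hw : Measurable w) (hwi : Integrable w (mI (1/2) 3)) :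
    Integrable (fun Y => (∫ q, kQ N e1 e2 c1 c2 t Y q * w q ∂(mI (1/2) 3)) ^ 2) (mI a b) ∧
    ENNReal.ofReal (∫ Y, (∫ q, kQ N e1 e2 c1 c2 t Y q * w q ∂(mI (1/2) 3)) ^ 2 ∂(mI a b)) ≤
      ENNReal.ofReal (128 * KC c C * (N * N ^ (1/16:ℝ))) * ∫⁻ q, ‖w q‖ₑ ^ 2 ∂(mI (1/2) 3) := by
  have hN := h.hN; have hC := h.hC; have k0 := h.KC0
  refine TTs h.kQm hw hwi (A := _) ?_ (h.kA (B := N * C * 54) (by positivity) h.kQ_bd) ?_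
  · finiteness
  refine (mI_ae (1/2) 3).mono fun q hq => ?_
  simp only [h.kQkQ, enorm_neg]
  have hm : Measurable fun q' : P3 => ‖N ^ 2 * M N e1 e2 a b c1 c2 t q.1 q'.1 (q.2 - q'.2)‖ₑ := by
    have : (fun q' : P3 => ‖N ^ 2 * M N e1 e2 a b c1 c2 t q.1 q'.1 (q.2 - q'.2)‖ₑ) =
      fun q' => ‖∫ Y, kQ N e1 e2 c1 c2 t Y q * kQ N e1 e2 c1 c2 t Y q' ∂(mI a b)‖ₑ := by
      funext q'; rw [h.kQkQ, enorm_neg]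
    rw [this]
    have m2 : StronglyMeasurable fun z : P3 × P3 => kQ N e1 e2 c1 c2 t z.2 q * kQ N e1 e2 c1 c2 t z.2 z.1 :=
      ((h.kQm2 measurable_snd measurable_const).mul (h.kQm2 measurable_snd measurable_fst)).stronglyMeasurable
    exact m2.integral_prod_right.measurable.enorm
  have cg : Continuous fun s => 2 * N * KC c C * (|q.1 - s| + N⁻¹)⁻¹ :=
    continuous_const.mul (Continuous.inv₀ (by fun_prop) fun s => by have := abs_nonneg (q.1 - s); positivity)
  unfold mI at *
  rw [lintegral_prod _ hm.aemeasurable]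
  calc _ ≤ ∫⁻ s in Icc (1/2:ℝ) 3, ENNReal.ofReal (2 * N * KC c C * (|q.1 - s| + N⁻¹)⁻¹) := by
        refine setLIntegral_mono' measurableSet_Icc fun s hs => ?_
        have MI := (h.M_triv q.1 s).1
        have e : ∫⁻ y : ℝ × ℝ, ‖N ^ 2 * M N e1 e2 a b c1 c2 t q.1 s (q.2 - y)‖ₑ =
            ENNReal.ofReal (N ^ 2 * ∫ z, |M N e1 e2 a b c1 c2 t q.1 s z|) := by
          rw [lintegral_sub_left_eq_self (fun z => ‖N ^ 2 * M N e1 e2 a b c1 c2 t q.1 s z‖ₑ) q.2,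
            ← ofReal_integral_norm_eq_lintegral_enorm (MI.const_mul _), ← integral_const_mul]
          congr 2; funext z; rw [Real.norm_eq_abs, abs_mul, abs_of_nonneg (by positivity : 0 ≤ N ^ 2)]
        rw [e]; exact ofReal_le_ofReal (h.M_min hq hs)
    _ = ENNReal.ofReal (∫ s in Icc (1/2:ℝ) 3, 2 * N * KC c C * (|q.1 - s| + N⁻¹)⁻¹) := by
        rw [ofReal_integral_eq_lintegral_ofReal (cg.integrableOn_Icc) (Eventually.of_forall fun s => by
          have := abs_nonneg (q.1 - s); positivity)]
    _ ≤ _ := by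
        refine ofReal_le_ofReal ?_
        rw [integral_const_mul]
        calc _ ≤ 2 * N * KC c C * (64 * N ^ (1/16:ℝ)) := mul_le_mul_of_nonneg_left (log_int hN hq) (by positivity)
          _ = _ := by ring
end Kak


theorem csI {X : Type*} [MeasurableSpace X] {μ : Measure X} [IsFiniteMeasure μ] {f : X → ℝ} (hf : Integrable f μ)
    (hf2 : Integrable (fun x => f x ^ 2) μ) : (∫ x, f x ∂μ) ^ 2 ≤ μ.real univ * ∫ x, f x ^ 2 ∂μ := by
  have h : ∀ m : ℝ, 0 ≤ μ.real univ * (m * m) + (-2 * ∫ x, f x ∂μ) * m + ∫ x, f x ^ 2 ∂μ := fun m => by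
    have h0 : 0 ≤ ∫ x, (f x - m) ^ 2 ∂μ := integral_nonneg fun x => sq_nonneg _
    have e : ∀ x, (f x - m) ^ 2 = f x ^ 2 - ((2 * m) * f x - m ^ 2) := fun x => by ring
    simp only [e] at h0
    rw [integral_sub hf2 (by exact (hf.const_mul _).sub (integrable_const _)), integral_sub (hf.const_mul _) (integrable_const _),
      integral_const_mul, integral_const, smul_eq_mul] at h0
    linarith
  have := discrim_le_zero h
  unfold discrim at this; linarith

theorem sob {a b lam B : ℝ} (h0 : 0 < lam) (hl : lam ≤ b - a) {T Q : ℝ → ℝ} (mT : Measurable T) (mQ : Measurable Q)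
    (bT : ∀ s ∈ Icc a b, |T s| ≤ B) (bQ : ∀ s ∈ Icc a b, |Q s| ≤ B)
    (hTQ : ∀ s ∈ Icc a b, ∀ v ∈ Icc a b, s ≤ v → T v - T s = ∫ x in Icc s v, Q x) {v : ℝ} (hv : v ∈ Icc a b) :
    T v ^ 2 ≤ 2 / lam * (∫ s in Icc a b, T s ^ 2) + 2 * lam * ∫ s in Icc a b, Q s ^ 2 := by
  have I1 : ∀ {f : ℝ → ℝ} {D s v : ℝ}, Measurable f → (∀ s ∈ Icc a b, |f s| ≤ D) → s ∈ Icc a b → v ∈ Icc a b → IntegrableOn f (Icc s v) :=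
    fun hf hb hs hv => Measure.integrableOn_of_bounded (by simp) hf.aestronglyMeasurable
      ((ae_restrict_mem measurableSet_Icc).mono fun x hx => hb x ⟨hs.1.trans hx.1, hx.2.trans hv.2⟩)
  have hab : a ≤ b := by linarith
  have bsq : ∀ {f : ℝ → ℝ}, (∀ s ∈ Icc a b, |f s| ≤ B) → ∀ s ∈ Icc a b, |f s ^ 2| ≤ B ^ 2 := fun hb s hs => by
    rw [abs_pow]; exact pow_le_pow_left₀ (abs_nonneg _) (hb s hs) 2
  have ha' : a ∈ Icc a b := ⟨le_rfl, hab⟩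
  have hb' : b ∈ Icc a b := ⟨hab, le_rfl⟩
  obtain ⟨s0, h1, h2, h3, h4⟩ : ∃ s0, a ≤ s0 ∧ s0 + lam ≤ b ∧ s0 ≤ v ∧ v ≤ s0 + lam := by
    rcases le_total (v - lam) a with h | h
    · exact ⟨a, le_rfl, by linarith, hv.1, by linarith⟩
    · exact ⟨v - lam, h, by linarith [hv.2], by linarith, by linarith⟩
  have Qb : ∀ s ∈ Icc s0 (s0 + lam), (T v - T s) ^ 2 ≤ lam * ∫ s in Icc a b, Q s ^ 2 := by
    have key : ∀ s ∈ Icc a b, ∀ v ∈ Icc a b, s ≤ v → v - s ≤ lam → (T v - T s) ^ 2 ≤ lam * ∫ s in Icc a b, Q s ^ 2 := fun s hs v hv hsv hl => by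
      rw [hTQ s hs v hv hsv]
      refine (csI (I1 mQ bQ hs hv) (I1 (mQ.pow_const 2) (bsq bQ) hs hv)).trans ?_
      refine mul_le_mul (by rw [measureReal_restrict_apply_univ, Real.volume_real_Icc_of_le hsv]; exact hl) ?_ (integral_nonneg fun x => sq_nonneg _) h0.le
      exact setIntegral_mono_set (I1 (mQ.pow_const 2) (bsq bQ) ha' hb') (Eventually.of_forall fun x => sq_nonneg _)
        (Icc_subset_Icc hs.1 hv.2).eventuallyLE
    intro s hs
    have hs' : s ∈ Icc a b := ⟨h1.trans hs.1, hs.2.trans h2⟩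
    rcases le_total s v with h | h
    · exact key s hs' v hv h (by linarith [hs.1])
    · rw [← neg_sq, neg_sub]; exact key v hv s hs' h (by linarith [hs.2])
  have hs0 : s0 ∈ Icc a b := ⟨h1, by linarith⟩
  have hs1 : s0 + lam ∈ Icc a b := ⟨by linarith, h2⟩
  set QQ := ∫ s in Icc a b, Q s ^ 2
  have f1 : ∫ s in Icc s0 (s0 + lam), T v ^ 2 ≤ ∫ s in Icc s0 (s0 + lam), (2 * T s ^ 2 + 2 * (lam * QQ)) := by
    refine setIntegral_mono_on (integrable_const _) (((I1 (mT.pow_const 2) (bsq bT) hs0 hs1).const_mul 2).add (integrable_const _)) measurableSet_Icc fun s hs => ?_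
    have := Qb s hs
    nlinarith [sq_nonneg (T v - 2 * T s)]
  rw [integral_add ((I1 (mT.pow_const 2) (bsq bT) hs0 hs1).const_mul 2) (integrable_const _), integral_const_mul, setIntegral_const, setIntegral_const] at f1
  have f2 : ∫ s in Icc s0 (s0 + lam), T s ^ 2 ≤ ∫ s in Icc a b, T s ^ 2 :=
    setIntegral_mono_set (I1 (mT.pow_const 2) (bsq bT) ha' hb') (Eventually.of_forall fun x => sq_nonneg _)
        (Icc_subset_Icc h1 h2).eventuallyLE
  have e : volume.real (Icc s0 (s0 + lam)) = lam := by simp [h0.le]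
  rw [e, smul_eq_mul, smul_eq_mul] at f1
  have : T v ^ 2 * lam ≤ (2 / lam * (∫ s in Icc a b, T s ^ 2) + 2 * lam * QQ) * lam := by
    have : (2 / lam * (∫ s in Icc a b, T s ^ 2) + 2 * lam * QQ) * lam = 2 * (∫ s in Icc a b, T s ^ 2) + lam * (2 * (lam * QQ)) := by field_simp
    rw [this]; linarith
  exact le_of_mul_le_mul_right this h0

namespace Kak
variable {c C N e1 e2 a b : ℝ} {c1 c2 t t1 : ℝ → ℝ → ℝ}

theorem TQ (h : Kak c C N e1 e2 a b c1 c2 t t1) {w : P3 → ℝ} (hw : Measurable w) (hwi : Integrable w (mI (1/2) 3))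
    (y : ℝ × ℝ) {s v : ℝ} (hs : s ∈ Icc a b) (hv : v ∈ Icc a b) (hsv : s ≤ v) :
    (∫ q, kT N c1 c2 (v, y) q * w q ∂(mI (1/2) 3)) - (∫ q, kT N c1 c2 (s, y) q * w q ∂(mI (1/2) 3)) =
    ∫ x in Icc s v, ∫ q, kQ N e1 e2 c1 c2 t (x, y) q * w q ∂(mI (1/2) 3) := by
  have hN := h.hN; have hC := h.hC
  have iT : ∀ s, Integrable (fun q => kT N c1 c2 (s, y) q * w q) (mI (1/2) 3) := fun s =>
    hwi.bdd_mul (c := 1) (h.kTm2 measurable_const measurable_id).aestronglyMeasurable (Eventually.of_forall fun q => by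
      rw [Real.norm_of_nonneg (kT_pos _ _).le]; exact kT_le _ _)
  have mQ : Measurable fun z : ℝ × P3 => kQ N e1 e2 c1 c2 t (z.1, y) z.2 :=
    h.kQm2 (measurable_fst.prodMk measurable_const) measurable_snd
  have iQ : Integrable (Function.uncurry fun (x : ℝ) (q : P3) => kQ N e1 e2 c1 c2 t (x, y) q * w q) ((volume.restrict (Icc s v)).prod (mI (1/2) 3)) := by
    have i1 : Integrable (fun z : ℝ × P3 => (1:ℝ) * w z.2) ((volume.restrict (Icc s v)).prod (mI (1/2) 3)) :=
      (integrable_const (1:ℝ)).mul_prod hwi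
    simp only [one_mul] at i1
    refine i1.bdd_mul (c := N * C * 54) mQ.aestronglyMeasurable ?_
    have : ∀ᵐ q ∂((volume.restrict (Icc s v)).prod (mI (1/2) 3)), q.1 ∈ Icc s v :=
      Measure.quasiMeasurePreserving_fst.ae (ae_restrict_mem measurableSet_Icc)
    filter_upwards [this] with z hz
    exact (h.kQ_bd _ _ ⟨hs.1.trans hz.1, hz.2.trans hv.2⟩).trans (mul_le_of_le_one_right (by positivity) (kT_le _ _))
  rw [integral_integral_swap iQ, ← integral_sub (iT v) (iT s)]
  refine integral_congr_ae ((mI_ae _ _).mono fun q hq => ?_)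
  simp only
  rw [integral_mul_const, ← sub_mul]
  congr 1
  have k1 := sc h.cc1 q.1; have k2 := sc h.cc2 q.1; have k3 := sc h.ct q.1
  have hV := V1_cont; have hVd := V1d_cont
  rw [integral_Icc_eq_integral_Ioc, ← intervalIntegral.integral_of_le hsv]
  refine (intervalIntegral.integral_eq_sub_of_hasDerivAt_of_le hsv (f := fun ν => kT N c1 c2 (ν, y) q) (Continuous.continuousOn ?_) (fun ν hν => ?_)
    (Continuous.intervalIntegrable ?_ _ _)).symm
  · unfold kT ze ps; fun_prop
  · have hν' : ν ∈ Ioo a b := ⟨hs.1.trans_lt hν.1, hν.2.trans_le hv.2⟩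
    have p1 : HasDerivAt (fun ν => q.2.1 + N * c1 ν q.1 - y.1) (N * (e1 * t ν q.1)) ν :=
      (((h.dc1 ν hν' q.1 hq).const_mul N).const_add q.2.1).sub_const y.1
    have p2 : HasDerivAt (fun ν => q.2.2 + N * c2 ν q.1 - y.2) (N * (e2 * ν * t ν q.1)) ν :=
      (((h.dc2 ν hν' q.1 hq).const_mul N).const_add q.2.2).sub_const y.2
    refine (((V1_deriv _).comp ν p1).fun_mul ((V1_deriv _).comp ν p2)).congr_deriv ?_
    simp [kQ, Dze, ps]; ring
  · unfold kQ Dze ps; fun_prop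

theorem S3 (h : Kak c C N e1 e2 a b c1 c2 t t1) {ι : Type*} (S : Finset ι) {ν : ι → ℝ} (hν : ∀ k ∈ S, ν k ∈ Icc a b)
    {g : ι → ℝ × ℝ → ℝ} (gm : ∀ k, Measurable (g k)) (g0 : ∀ k y, 0 ≤ g k y) {B : ℝ} (gB : ∀ k y, g k y ≤ B)
    (gi : ∀ k, Integrable (g k)) {lam : ℝ} (l0 : 0 < lam) (hl : lam ≤ b - a) :
    Integrable (fun q => (∑ k ∈ S, ∫ y, g k y * kT N c1 c2 (ν k, y) q) ^ 2) (mI (1/2) 3) ∧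
    ∫ q, (∑ k ∈ S, ∫ y, g k y * kT N c1 c2 (ν k, y) q) ^ 2 ∂(mI (1/2) 3) ≤
      (2 / lam * (3 * Real.pi ^ 4 * (b - a)) + 2 * lam * (128 * KC c C * (N * N ^ (1/16:ℝ)))) * ∫ y, (∑ k ∈ S, g k y) ^ 2 := by
  have hN := h.hN; have hC := h.hC; have k0 := h.KC0; have hab := h.hab
  set G : ι → P3 → ℝ := fun k q => ∫ y, g k y * kT N c1 c2 (ν k, y) q with hG
  set w : P3 → ℝ := fun q => ∑ k ∈ S, G k q with hwd
  set R := 2 / lam * (3 * Real.pi ^ 4 * (b - a)) + 2 * lam * (128 * KC c C * (N * N ^ (1/16:ℝ))) with hR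
  have hba : 0 < b - a := by linarith
  have R0 : 0 < R := by positivity
  have mz : ∀ k, Measurable fun z : P3 × (ℝ × ℝ) => g k z.2 * kT N c1 c2 (ν k, z.2) z.1 := fun k =>
    ((gm k).comp measurable_snd).mul (h.kTm2 (measurable_const.prodMk measurable_snd) measurable_fst)
  have Gm : ∀ k, Measurable (G k) := fun k => (mz k).stronglyMeasurable.integral_prod_right.measurable
  have wm : Measurable w := Finset.measurable_sum _ fun k _ => Gm k
  have Fi : ∀ k, Integrable (fun z : P3 × (ℝ × ℝ) => g k z.2 * kT N c1 c2 (ν k, z.2) z.1) ((mI (1/2) 3).prod volume) := fun k => by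
    refine ⟨(mz k).aestronglyMeasurable, ?_⟩
    rw [hasFiniteIntegral_iff_enorm, lintegral_prod_symm _ (mz k).enorm.aemeasurable]
    calc _ ≤ ∫⁻ y, ‖g k y‖ₑ * (ENNReal.ofReal (Real.pi ^ 2) * ENNReal.ofReal (3 - 1/2)) := by
          refine lintegral_mono fun y => ?_
          simp only [enorm_mul]
          rw [lintegral_const_mul' _ _ (by finiteness)]
          refine mul_le_mul_right (mI_lint (f := fun q => ‖kT N c1 c2 (ν k, y) q‖ₑ) (h.kTm2 measurable_const measurable_id).enorm fun s hs => ?_) _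
          simp only [kT, add_sub_assoc]; exact (ze_lint' _).le
      _ < ⊤ := by
          rw [lintegral_mul_const' _ _ (by finiteness)]
          have := (gi k).2; rw [hasFiniteIntegral_iff_enorm] at this
          exact mul_lt_top this (by finiteness)
  have Gi : ∀ k, Integrable (G k) (mI (1/2) 3) := fun k => (Fi k).integral_prod_left
  have wi : Integrable w (mI (1/2) 3) := integrable_finsetSum _ fun k _ => Gi k
  have zi : ∀ k q, Integrable (fun y => kT N c1 c2 (ν k, y) q) := fun k q =>
    ze_int.comp_sub_left (q.2 + ps N c1 c2 (ν k) q.1)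
  have zv : ∀ k q, ∫ y, kT N c1 c2 (ν k, y) q = Real.pi ^ 2 := fun k q => by
    simp only [kT]; rw [integral_sub_left_eq_self ze volume (q.2 + ps N c1 c2 (ν k) q.1), ze_integral]
  have gz : ∀ k q, Integrable (fun y => g k y * kT N c1 c2 (ν k, y) q) := fun k q =>
    (zi k q).bdd_mul (c := B) (gm k).aestronglyMeasurable (Eventually.of_forall fun y => by rw [Real.norm_of_nonneg (g0 k y)]; exact gB k y)
  have Gb : ∀ k q, |G k q| ≤ B * Real.pi ^ 2 := fun k q => by
    rw [abs_of_nonneg (integral_nonneg fun y => mul_nonneg (g0 k y) (kT_pos _ _).le), ← zv k q, ← integral_const_mul]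
    exact integral_mono (gz k q) ((zi k q).const_mul B) fun y => mul_le_mul_of_nonneg_right (gB k y) (kT_pos _ _).le
  have wb : ∀ q, |w q| ≤ S.card * (B * Real.pi ^ 2) := fun q => by
    refine (Finset.abs_sum_le_sum_abs _ _).trans ((Finset.sum_le_sum fun k _ => Gb k q).trans ?_)
    simp
  have w2i : Integrable (fun q => w q ^ 2) (mI (1/2) 3) := by
    simp only [pow_two]; exact wi.bdd_mul (c := S.card * (B * Real.pi ^ 2)) wm.aestronglyMeasurable (Eventually.of_forall wb)
  refine ⟨w2i, ?_⟩
  obtain ⟨iT, eT⟩ := h.T_est wm wi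
  obtain ⟨iQ, eQ⟩ := h.Q_est wm wi
  set T : P3 → ℝ := fun Y => ∫ q, kT N c1 c2 Y q * w q ∂(mI (1/2) 3) with hT
  set Q : P3 → ℝ := fun Y => ∫ q, kQ N e1 e2 c1 c2 t Y q * w q ∂(mI (1/2) 3) with hQ
  set W := ∫ q, w q ^ 2 ∂(mI (1/2) 3) with hW
  have W0 : 0 ≤ W := integral_nonneg fun q => sq_nonneg _
  have eW : ∫⁻ q, ‖w q‖ₑ ^ 2 ∂(mI (1/2) 3) = ENNReal.ofReal W := by
    rw [hW, ofReal_integral_eq_lintegral_ofReal w2i (Eventually.of_forall fun q => sq_nonneg _)]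
    refine lintegral_congr fun q => ?_
    rw [Real.enorm_eq_ofReal_abs, ← ofReal_pow (abs_nonneg _), sq_abs]
  rw [eW, ← ofReal_mul (by positivity), ofReal_le_ofReal_iff (by positivity)] at eT eQ
  have Tm : Measurable T := by
    have : Measurable fun z : P3 × P3 => kT N c1 c2 z.1 z.2 * w z.2 := h.kTm.mul (wm.comp measurable_snd)
    exact this.stronglyMeasurable.integral_prod_right.measurable
  have Qm : Measurable Q := by
    have : Measurable fun z : P3 × P3 => kQ N e1 e2 c1 c2 t z.1 z.2 * w z.2 := h.kQm.mul (wm.comp measurable_snd)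
    exact this.stronglyMeasurable.integral_prod_right.measurable
  set I0 := ∫ q, |w q| ∂(mI (1/2) 3) with hI0
  have I00 : 0 ≤ I0 := integral_nonneg fun q => abs_nonneg _
  have kb : ∀ (k : P3 → ℝ) (D : ℝ), (∀ q, |k q| ≤ D) → |∫ q, k q * w q ∂(mI (1/2) 3)| ≤ D * I0 := fun k D hk => by
    rw [hI0, ← integral_const_mul]
    exact norm_integral_le_of_norm_le (wi.abs.const_mul D) (Eventually.of_forall fun q => by
      rw [Real.norm_eq_abs, abs_mul]; exact mul_le_mul_of_nonneg_right (hk q) (abs_nonneg _))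
  have Tb : ∀ Y, |T Y| ≤ (N * C * 54 + 1) * I0 := fun Y => kb _ _ fun q => by
    rw [abs_of_pos (kT_pos _ _)]; exact (kT_le _ _).trans (by have : 0 ≤ N * C * 54 := by positivity
                                                              linarith)
  have Qb : ∀ Y : P3, Y.1 ∈ Icc a b → |Q Y| ≤ (N * C * 54 + 1) * I0 := fun Y hY => kb _ _ fun q =>
    ((h.kQ_bd _ _ hY).trans (mul_le_of_le_one_right (by positivity) (kT_le _ _))).trans (by linarith)
  set S2 : ℝ × ℝ → ℝ := fun y => 2 / lam * (∫ s in Icc a b, T (s, y) ^ 2) + 2 * lam * ∫ s in Icc a b, Q (s, y) ^ 2 with hS2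
  have S20 : ∀ y, 0 ≤ S2 y := fun y => by
    have h1 : 0 ≤ ∫ s in Icc a b, T (s, y) ^ 2 := integral_nonneg fun _ => sq_nonneg _
    have h2 : 0 ≤ ∫ s in Icc a b, Q (s, y) ^ 2 := integral_nonneg fun _ => sq_nonneg _
    simp only [hS2]; positivity
  have pt : ∀ y, ∀ v ∈ Icc a b, T (v, y) ^ 2 ≤ S2 y := fun y v hv =>
    sob l0 hl (T := fun s => T (s, y)) (Q := fun s => Q (s, y)) (Tm.comp (measurable_id.prodMk measurable_const))
      (Qm.comp (measurable_id.prodMk measurable_const)) (fun s _ => Tb _) (fun s hs => Qb _ hs)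
      (fun s hs v hv hsv => h.TQ wm wi y hs hv hsv) hv
  have iT1 : Integrable (fun y => ∫ s in Icc a b, T (s, y) ^ 2) := iT.integral_prod_right
  have iQ1 : Integrable (fun y => ∫ s in Icc a b, Q (s, y) ^ 2) := iQ.integral_prod_right
  have iS2 : Integrable S2 := (iT1.const_mul _).add (iQ1.const_mul _)
  have vS2 : ∫ y, S2 y ≤ R * W := by
    simp only [hS2]
    rw [integral_add (iT1.const_mul _) (iQ1.const_mul _), integral_const_mul, integral_const_mul]
    have e1 : ∫ y, ∫ s in Icc a b, T (s, y) ^ 2 = ∫ Y, T Y ^ 2 ∂(mI a b) := (integral_prod_symm _ iT).symm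
    have e2 : ∫ y, ∫ s in Icc a b, Q (s, y) ^ 2 = ∫ Y, Q Y ^ 2 ∂(mI a b) := (integral_prod_symm _ iQ).symm
    rw [e1, e2, hR, add_mul, mul_assoc (2 / lam), mul_assoc (2 * lam)]
    exact add_le_add (mul_le_mul_of_nonneg_left eT (by positivity)) (mul_le_mul_of_nonneg_left eQ (by positivity))
  set gs : ℝ × ℝ → ℝ := fun y => ∑ k ∈ S, g k y with hgs
  have gsi : Integrable (fun y => gs y ^ 2) := by
    simp only [pow_two]
    refine (integrable_finsetSum _ fun k _ => gi k).bdd_mul (c := S.card * B) (Finset.measurable_sum _ fun k _ => gm k).aestronglyMeasurable (Eventually.of_forall fun y => ?_)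
    refine (Finset.abs_sum_le_sum_abs _ _).trans ((Finset.sum_le_sum fun k _ => (?_ : _ ≤ B)).trans ?_)
    · rw [abs_of_nonneg (g0 k y)]; exact gB k y
    · simp
  have T1 : ∀ v, Measurable fun y : ℝ × ℝ => T (v, y) := fun v => Tm.comp (measurable_const.prodMk measurable_id)
  have gT : ∀ k, Integrable fun y => g k y * T (ν k, y) := fun k => by
    simp only [mul_comm (g k _)]
    exact (gi k).bdd_mul (T1 _).aestronglyMeasurable (Eventually.of_forall fun y => Tb _)
  have WG : W = ∫ y, ∑ k ∈ S, g k y * T (ν k, y) := by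
    rw [integral_finsetSum _ fun k _ => gT k, hW]
    have : ∀ q, w q ^ 2 = ∑ k ∈ S, w q * G k q := fun q => by rw [← Finset.mul_sum, pow_two]
    simp only [this]
    rw [integral_finsetSum _ fun k _ => (Gi k).bdd_mul wm.aestronglyMeasurable (Eventually.of_forall wb)]
    refine Finset.sum_congr rfl fun k _ => ?_
    simp only [hG, hT, ← integral_const_mul]
    rw [integral_integral_swap]
    · refine integral_congr_ae (Eventually.of_forall fun y => integral_congr_ae (Eventually.of_forall fun q => ?_))
      simp only; ring
    · exact (Fi k).bdd_mul (wm.comp measurable_fst).aestronglyMeasurable (Eventually.of_forall fun z => wb _)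
  have fin : W ≤ ∫ y, (R / 2 * gs y ^ 2 + (2 * R)⁻¹ * S2 y) := by
    rw [WG]
    refine integral_mono (integrable_finsetSum _ fun k _ => gT k) ((gsi.const_mul _).add (iS2.const_mul _)) fun y => ?_
    simp only
    calc _ ≤ ∑ k ∈ S, g k y * √(S2 y) := Finset.sum_le_sum fun k hk =>
          mul_le_mul_of_nonneg_left ((le_abs_self _).trans (Real.abs_le_sqrt (pt y _ (hν k hk)))) (g0 k y)
      _ = gs y * √(S2 y) := by rw [← Finset.sum_mul]
      _ ≤ _ := by
        have := Real.sq_sqrt (S20 y)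
        have h2 := sq_nonneg (R * gs y - √(S2 y))
        have h3 : (2 * R)⁻¹ * (R * gs y - √(S2 y)) ^ 2 = R / 2 * gs y ^ 2 + (2 * R)⁻¹ * S2 y - gs y * √(S2 y) := by
          rw [← this]; simp only [Real.sqrt_sq (Real.sqrt_nonneg _)]; field_simp; ring
        have : 0 ≤ (2 * R)⁻¹ * (R * gs y - √(S2 y)) ^ 2 := by positivity
        linarith
  rw [integral_add (gsi.const_mul _) (iS2.const_mul _), integral_const_mul, integral_const_mul] at fin
  have : (2 * R)⁻¹ * ∫ y, S2 y ≤ W / 2 := by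
    calc _ ≤ (2 * R)⁻¹ * (R * W) := mul_le_mul_of_nonneg_left vS2 (by positivity)
      _ = _ := by field_simp
  linarith
end Kak


theorem sumV1 {a : ℝ} (ha : 0 < a) (ha1 : a ≤ 1) (S : Finset ℤ) (m0 : ℤ) :
    ∑ m ∈ S, V1 (a * ((m - m0 : ℤ) : ℝ)) ≤ 4 * Real.pi / a := by
  have hi : Integrable (fun x : ℝ => V1 (a * (x - m0))) := (V1_int.comp_mul_left' ha.ne').comp_sub_right _
  have h1 : ∀ m : ℤ, V1 (a * ((m - m0 : ℤ) : ℝ)) ≤ 4 * ∫ x in Ioc (m:ℝ) (m+1), V1 (a * (x - m0)) := by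
    intro m
    rw [← integral_const_mul]
    have : ∫ x in Ioc (m:ℝ) (m+1), V1 (a * ((m - m0 : ℤ) : ℝ)) = V1 (a * ((m - m0 : ℤ) : ℝ)) := by simp
    rw [← this]
    refine setIntegral_mono_on (by simp) (hi.integrableOn.const_mul 4) measurableSet_Ioc fun x hx => ?_
    have := V1_shift (a * (x - m0)) (a * (m - x))
    have e : a * (x - m0) + a * (m - x) = a * ((m - m0 : ℤ) : ℝ) := by push_cast; ring
    rw [e] at this
    refine this.trans (mul_le_mul_of_nonneg_right ?_ (V1_pos _).le)
    have h2 : (a * (m - x))^2 ≤ 1 := by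
      have h3 : (m - x)^2 ≤ 1 := by nlinarith [hx.1, hx.2]
      have h4 : a^2 ≤ 1 := by nlinarith
      rw [mul_pow]; nlinarith [sq_nonneg (m-x)]
    linarith
  calc _ ≤ ∑ m ∈ S, 4 * ∫ x in Ioc (m:ℝ) (m+1), V1 (a * (x - m0)) := Finset.sum_le_sum fun m _ => h1 m
    _ = 4 * ∫ x in ⋃ m ∈ S, Ioc (m:ℝ) (m+1), V1 (a * (x - m0)) := by
      rw [integral_biUnion_finset _ (fun m _ => measurableSet_Ioc) _ (fun m _ => hi.integrableOn), Finset.mul_sum]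
      intro i _ j _ hij
      exact (pairwise_disjoint_Ioc_intCast ℝ) hij
    _ ≤ 4 * ∫ x, V1 (a * (x - m0)) := mul_le_mul_of_nonneg_left
        (setIntegral_le_integral hi (Eventually.of_forall fun x => (V1_pos _).le)) (by norm_num)
    _ = 4 * Real.pi / a := by
      rw [integral_sub_right_eq_self (fun x => V1 (a * x)), Measure.integral_comp_mul_left V1, V1_integral,
        abs_of_pos (inv_pos.2 ha), smul_eq_mul]; ring

theorem sep2 {Φ : ℤ → ℝ} {S : Finset ℤ} {c : ℝ} (hc : 0 < c) (hc1 : c ≤ 1)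
    (h : ∀ m ∈ S, ∀ m' ∈ S, 2 * (c * ((m' - m : ℤ):ℝ))^2 ≤ |Φ m' - Φ m|) :
    ∑ m ∈ S, (1 + |Φ m|)⁻¹ ≤ 4 * Real.pi / c := by
  rcases S.eq_empty_or_nonempty with rfl | hS
  · simp; positivity
  obtain ⟨m0, h0, hm⟩ := S.exists_min_image (fun m => |Φ m|) hS
  refine le_trans (Finset.sum_le_sum fun m hmS => ?_) (sumV1 hc hc1 S m0)
  unfold V1
  refine inv_anti₀ (by positivity) ?_
  have := h m0 h0 m hmS
  have h2 := abs_sub (Φ m) (Φ m0)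
  have h3 := hm m hmS
  linarith

theorem sep1 {Φ : ℤ → ℝ} {S : Finset ℤ} {ρ : ℝ} {M : ℕ} (hρ : 0 < ρ) (hρ1 : ρ ≤ 1) (hM : ∀ m ∈ S, ∀ m' ∈ S, |m' - m| ≤ M)
    (h : ∀ m ∈ S, ∀ m' ∈ S, 2 * (ρ * |((m' - m : ℤ):ℝ)|) ≤ |Φ m' - Φ m|) :
    ∑ m ∈ S, (1 + |Φ m|)⁻¹ ≤ 2 / ρ * (1 + Real.log (M+1)) := by
  have hl : 0 ≤ Real.log ((M:ℝ)+1) := Real.log_nonneg (by norm_cast; lia)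
  rcases S.eq_empty_or_nonempty with rfl | hS
  · simp; positivity
  obtain ⟨m0, h0, hm⟩ := S.exists_min_image (fun m => |Φ m|) hS
  have key : ∀ m ∈ S, (1 + |Φ m|)⁻¹ ≤ ρ⁻¹ * (((m - m0).natAbs + 1 : ℕ) : ℝ)⁻¹ := by
    intro m hmS
    rw [← mul_inv]
    refine inv_anti₀ (by positivity) ?_
    have := h m0 h0 m hmS
    have h2 := abs_sub (Φ m) (Φ m0)
    have h3 := hm m hmS
    have h4 : (((m - m0).natAbs : ℕ) : ℝ) = |((m - m0 : ℤ):ℝ)| := by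
      rw [Nat.cast_natAbs]; push_cast; rfl
    push_cast at h4 ⊢
    rw [h4]; push_cast at this
    nlinarith
  have hh : ∑ i ∈ Finset.range (M+1), (((i + 1 : ℕ)) : ℝ)⁻¹ ≤ 1 + Real.log (M+1) := by
    have := harmonic_le_one_add_log (M+1)
    rw [harmonic] at this; push_cast at this ⊢; exact this
  have sub : S ⊆ ((Finset.range (M+1)).image fun i : ℕ => m0 + i) ∪ ((Finset.range (M+1)).image fun i : ℕ => m0 - i) := by
    intro m hmS
    have := hM m0 h0 m hmS
    simp only [Finset.mem_union, Finset.mem_image, Finset.mem_range]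
    rcases le_total m0 m with h | h
    · left; exact ⟨(m - m0).toNat, by have := abs_le.1 this; lia, by have := abs_le.1 this; lia⟩
    · right; exact ⟨(m0 - m).toNat, by have := abs_le.1 this; lia, by have := abs_le.1 this; lia⟩
  calc _ ≤ ∑ m ∈ S, ρ⁻¹ * (((m - m0).natAbs + 1 : ℕ) : ℝ)⁻¹ := Finset.sum_le_sum key
    _ ≤ ∑ m ∈ _, ρ⁻¹ * (((m - m0).natAbs + 1 : ℕ) : ℝ)⁻¹ :=
        Finset.sum_le_sum_of_subset_of_nonneg sub fun _ _ _ => by positivity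
    _ ≤ ∑ m ∈ ((Finset.range (M+1)).image fun i : ℕ => m0 + (i:ℤ)), ρ⁻¹ * (((m - m0).natAbs + 1 : ℕ) : ℝ)⁻¹ +
        ∑ m ∈ ((Finset.range (M+1)).image fun i : ℕ => m0 - (i:ℤ)), ρ⁻¹ * (((m - m0).natAbs + 1 : ℕ) : ℝ)⁻¹ := by
      rw [← Finset.sum_union_inter]
      exact le_add_of_nonneg_right (Finset.sum_nonneg fun _ _ => by positivity)
    _ = ρ⁻¹ * (∑ i ∈ Finset.range (M+1), (((i + 1 : ℕ)) : ℝ)⁻¹) + ρ⁻¹ * (∑ i ∈ Finset.range (M+1), (((i + 1 : ℕ)) : ℝ)⁻¹) := by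
      rw [Finset.sum_image (by intro a _ b _ h; simpa using h), Finset.sum_image (by intro a _ b _ h; simpa using h), Finset.mul_sum]
      simp
    _ ≤ _ := by
      rw [← two_mul, ← mul_assoc, ← div_eq_mul_inv]
      gcongr

theorem quad {d d' : ℝ → ℝ} {I : Set ℝ} (hI : I.OrdConnected) {ms κ s : ℝ}
    (hd : ∀ x ∈ I, HasDerivAt d (d' x) x) (h : ∀ x ∈ I, κ * (x - ms)^2 ≤ s * d' x * (x - ms)) {x x' : ℝ}
    (hx : x ∈ I) (hx' : x' ∈ I) (hs : (ms ≤ x ∧ x ≤ x') ∨ (x' ≤ x ∧ x ≤ ms)) :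
    κ / 2 * ((x' - ms)^2 - (x - ms)^2) ≤ s * (d x' - d x) := by
  have hd2 : ∀ x ∈ I, HasDerivAt (fun x => s * d x - κ / 2 * (x - ms)^2) (s * d' x - κ * (x - ms)) x := fun x hx =>
    (((hd x hx).const_mul s).fun_sub ((((hasDerivAt_id x).sub_const ms).fun_pow 2).const_mul (κ/2))).congr_deriv (by simp; ring)
  rcases hs with ⟨h1, h2⟩ | ⟨h1, h2⟩
  · rcases h2.eq_or_lt with rfl | h2
    · simp
    obtain ⟨ξ, hξ, e⟩ := exists_hasDerivAt_eq_slope _ _ h2 (fun y hy => (hd2 y (hI.out hx hx' hy)).continuousAt.continuousWithinAt)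
      (fun y hy => hd2 y (hI.out hx hx' (Ioo_subset_Icc_self hy)))
    rw [_root_.eq_div_iff (by linarith)] at e
    have := h ξ (hI.out hx hx' (Ioo_subset_Icc_self hξ))
    have h3 : 0 < ξ - ms := by linarith [hξ.1]
    have : 0 ≤ s * d' ξ - κ * (ξ - ms) := by
      by_contra hh
      nlinarith
    nlinarith
  · rcases h1.eq_or_lt with rfl | h1
    · simp
    obtain ⟨ξ, hξ, e⟩ := exists_hasDerivAt_eq_slope _ _ h1 (fun y hy => (hd2 y (hI.out hx' hx hy)).continuousAt.continuousWithinAt)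
      (fun y hy => hd2 y (hI.out hx' hx (Ioo_subset_Icc_self hy)))
    rw [_root_.eq_div_iff (by linarith)] at e
    have := h ξ (hI.out hx' hx (Ioo_subset_Icc_self hξ))
    have h3 : 0 < ms - ξ := by linarith [hξ.2]
    have : s * d' ξ - κ * (ξ - ms) ≤ 0 := by
      by_contra hh
      nlinarith
    nlinarith


/-- homogeneous phase -/
noncomputable def ww (E : ℝ → ℝ) (u x1 x2 : ℝ) : ℝ := x2 * E (x1 / x2 / u)

namespace Pk
variable {c C s : ℝ} {G E q q1 q2 : ℝ → ℝ}

theorem ymem {u ν : ℝ} (hu : u ∈ Icc (1/2:ℝ) 3) (hν : ν ∈ Icc (1/8:ℝ) 8) : ν / u ∈ Ioo (1/64:ℝ) 64 := by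
  have h1 := hu.1; have h2 := hu.2; have h3 := hν.1; have h4 := hν.2
  constructor
  · rw [lt_div_iff₀ (by linarith)]; linarith
  · rw [div_lt_iff₀ (by linarith)]; linarith

theorem q_mono (h : Pk c C s G E q q1 q2) {y y' : ℝ} (hy : y ∈ Ioo (1/64:ℝ) 64) (hy' : y' ∈ Ioo (1/64:ℝ) 64) :
    c * (y - y')^2 ≤ s * (q y - q y') * (y - y') ∧ |q y - q y'| ≤ C * |y - y'| := by
  constructor
  · have key : ∀ a ∈ Ioo (1/64:ℝ) 64, ∀ b ∈ Ioo (1/64:ℝ) 64, a ≤ b → c * (b - a) ≤ s * q b - s * q a := by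
      intro a ha b hb hab
      refine (convex_Ioo (1/64:ℝ) 64).mul_sub_le_image_sub_of_le_deriv (f := fun y => s * q y)
        (fun y hy => ((h.dq y hy).const_mul s).continuousAt.continuousWithinAt)
        (fun y hy => ((h.dq y (interior_subset hy)).const_mul s).differentiableAt.differentiableWithinAt)
        (fun y hy => ?_) a ha b hb hab
      rw [((h.dq y (interior_subset hy)).const_mul s).deriv]
      exact h.lq1 y (interior_subset hy)
    rcases le_total y y' with h1 | h1
    · nlinarith [key y hy y' hy' h1]
    · nlinarith [key y' hy' y hy h1]
  · exact (convex_Ioo (1/64:ℝ) 64).norm_image_sub_le_of_norm_hasDerivWithin_le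
      (fun y hy => (h.dq y hy).hasDerivWithinAt) (fun y hy => h.bq1 y hy) hy' hy

/-- admissible positions in a row -/
def RI (A1 n n' : ℝ) : Set ℝ := {x | x / n ∈ Icc (1/8:ℝ) 8 ∧ (A1 - x) / n' ∈ Icc (1/8:ℝ) 8}

theorem RI_oc {A1 n n' : ℝ} (hn : 0 < n) (hn' : 0 < n') : (RI A1 n n').OrdConnected := by
  refine ⟨fun x hx y hy z hz => ⟨⟨hx.1.1.trans ?_, le_trans ?_ hy.1.2⟩, ⟨hy.2.1.trans ?_, le_trans ?_ hx.2.2⟩⟩⟩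
  all_goals gcongr
  · exact hz.1
  · exact hz.2
  · exact hz.2
  · exact hz.1

theorem row (h : Pk c C s G E q q1 q2) (hc : 0 < c) (hC : 0 < C) {N u A1 n n' : ℝ} (hN : 1 ≤ N) (hu : u ∈ Icc (1/2:ℝ) 3)
    (hn : n ∈ Icc (N/4) (4*N)) (hn' : n' ∈ Icc (N/4) (4*N)) : ∃ d' : ℝ → ℝ,
    (∀ x ∈ RI A1 n n', HasDerivAt (fun x => ww E u x n + ww E u (A1 - x) n') (d' x) x) ∧
    (∀ x ∈ RI A1 n n', c / (18 * N) * (x - n * A1 / (n + n'))^2 ≤ s * d' x * (x - n * A1 / (n + n'))) ∧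
    (∀ x ∈ RI A1 n n', |d' x| ≤ 32 * C / N * |x - n * A1 / (n + n')|) := by
  obtain ⟨n1, n2⟩ := hn; obtain ⟨n3, n4⟩ := hn'; obtain ⟨u1, u2⟩ := id hu
  have p1 : 0 < n := by linarith
  have p2 : 0 < n' := by linarith
  have p3 : 0 < u := by linarith
  have e : ∀ x, x / n / u - (A1 - x) / n' / u = (x - n * A1 / (n + n')) * ((n + n') / (n * n' * u)) := by
    intro x; field_simp; ring
  refine ⟨fun x => (q (x / n / u) - q ((A1 - x) / n' / u)) / u, fun x hx => ?_, fun x hx => ?_, fun x hx => ?_⟩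
  · have a1 := ((h.dE _ (ymem hu hx.1)).comp x (((hasDerivAt_id x).div_const n).div_const u)).const_mul n
    have a2 := ((h.dE _ (ymem hu hx.2)).comp x ((((hasDerivAt_id x).const_sub A1).div_const n').div_const u)).const_mul n'
    refine (a1.fun_add a2).congr_deriv ?_
    field_simp; ring
  all_goals
    have b := h.q_mono (ymem hu hx.1) (ymem hu hx.2)
    rw [e x] at b
    set z := x - n * A1 / (n + n')
    set w := (n + n') / (n * n' * u)
    have hw : 0 < w := by positivity
    have hw1 : w / u = (1/n + 1/n') * (1 / u^2) := by simp only [w]; field_simp; ring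
    have l1 : 1/(4*N) ≤ 1/n := one_div_le_one_div_of_le p1 n2
    have l2 : 1/(4*N) ≤ 1/n' := one_div_le_one_div_of_le p2 n4
    have l3 : 1/n ≤ 1/(N/4) := one_div_le_one_div_of_le (by linarith) n1
    have l4 : 1/n' ≤ 1/(N/4) := one_div_le_one_div_of_le (by linarith) n3
    have l5 : 1/9 ≤ 1/u^2 := one_div_le_one_div_of_le (by positivity) (by nlinarith)
    have l6 : 1/u^2 ≤ 1/(1/4) := one_div_le_one_div_of_le (by norm_num) (by nlinarith)
  · have l7 : 1 / (18 * N) ≤ w / u := by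
      rw [hw1]; calc 1 / (18*N) = (1/(4*N) + 1/(4*N)) * (1/9) := by field_simp; norm_num
        _ ≤ _ := by gcongr
    have b1 : c * z^2 * w ≤ s * (q (x / n / u) - q ((A1 - x) / n' / u)) * z := by
      have := b.1
      refine le_of_mul_le_mul_right ?_ hw
      linarith [this]
    calc _ = c * z^2 * (1 / (18*N)) := by ring
      _ ≤ c * z^2 * (w / u) := by gcongr
      _ = c * z^2 * w / u := by ring
      _ ≤ s * (q (x / n / u) - q ((A1 - x) / n' / u)) * z / u := by gcongr
      _ = _ := by ring
  · have l7 : w / u ≤ 32 / N := by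
      rw [hw1]; calc _ ≤ (1/(N/4) + 1/(N/4)) * (1/(1/4)) := by gcongr
        _ = _ := by field_simp; norm_num
    rw [abs_div, abs_of_pos p3]
    calc _ ≤ C * |z * w| / u := by gcongr; exact b.2
      _ = C * |z| * (w / u) := by rw [abs_mul, abs_of_pos hw]; ring
      _ ≤ C * |z| * (32 / N) := by gcongr
      _ = _ := by ring

theorem ww_lip (h : Pk c C s G E q q1 q2) (hC : 0 < C) {N u a1 a2 b1 b2 : ℝ} (hN : 1 ≤ N) (hu : u ∈ Icc (1/2:ℝ) 3)
    (ha1 : a1 ∈ Icc (3*N/4) (4*N)) (ha2 : a2 ∈ Icc (3*N/4) (4*N)) (hb1 : b1 ∈ Icc (3*N/4) (4*N)) (hb2 : b2 ∈ Icc (3*N/4) (4*N))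
    (h1 : |b1 - a1| ≤ 4) (h2 : |b2 - a2| ≤ 4) : |ww E u b1 b2 - ww E u a1 a2| ≤ 300 * C := by
  obtain ⟨u1, u2⟩ := id hu
  have p3 : 0 < u := by linarith
  have hr : ∀ x ∈ Icc (3*N/4) (4*N), ∀ y ∈ Icc (3*N/4) (4*N), x / y ∈ Icc (1/8:ℝ) 8 := by
    intro x hx y hy
    have : 0 < y := by linarith [hy.1]
    constructor
    · rw [le_div_iff₀ this]; linarith [hx.1, hy.2]
    · rw [div_le_iff₀ this]; linarith [hx.2, hy.1]
  have s1 : |ww E u b1 a2 - ww E u a1 a2| ≤ 2 * C * |b1 - a1| := by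
    refine (convex_Icc (3*N/4) (4*N)).norm_image_sub_le_of_norm_hasDerivWithin_le (f := fun x => ww E u x a2)
      (f' := fun x => q (x / a2 / u) / u) (fun x hx => HasDerivAt.hasDerivWithinAt ?_) (fun x hx => ?_) ha1 hb1
    · have a1 := ((h.dE _ (ymem hu (hr x hx a2 ha2))).comp x (((hasDerivAt_id x).div_const a2).div_const u)).const_mul a2
      refine a1.congr_deriv ?_
      have : a2 ≠ 0 := by linarith [ha2.1]
      field_simp
    · have := h.bq _ (ymem hu (hr x hx a2 ha2))
      rw [Real.norm_eq_abs, abs_div, abs_of_pos p3, div_le_iff₀ p3]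
      nlinarith
  have s2 : |ww E u b1 b2 - ww E u b1 a2| ≤ 65 * C * |b2 - a2| := by
    refine (convex_Icc (3*N/4) (4*N)).norm_image_sub_le_of_norm_hasDerivWithin_le (f := fun x => ww E u b1 x)
      (f' := fun x => E (b1 / x / u) - (b1 / x / u) * q (b1 / x / u)) (fun x hx => HasDerivAt.hasDerivWithinAt ?_) (fun x hx => ?_) ha2 hb2
    · have hx0 : x ≠ 0 := by linarith [hx.1]
      have a1 := (hasDerivAt_id x).fun_mul ((h.dE _ (ymem hu (hr b1 hb1 x hx))).comp x (((hasDerivAt_inv hx0).const_mul b1).div_const u))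
      refine a1.congr_deriv ?_
      simp only [id, Function.comp_apply, div_eq_mul_inv]; field_simp; ring
    · have hy := ymem hu (hr b1 hb1 x hx)
      have e1 := h.bq _ hy
      have e2 := h.bE _ hy
      rw [Real.norm_eq_abs]
      refine (abs_sub _ _).trans ?_
      rw [abs_mul, abs_of_pos (show 0 < b1 / x / u by linarith [hy.1])]
      nlinarith [hy.1, hy.2, abs_nonneg (q (b1 / x / u))]
  have := abs_add_le (ww E u b1 b2 - ww E u b1 a2) (ww E u b1 a2 - ww E u a1 a2)
  rw [sub_add_sub_cancel] at this
  nlinarith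
end Pk

namespace Pk
variable {c C s : ℝ} {G E q q1 q2 : ℝ → ℝ}

theorem sabs (hs : s = 1 ∨ s = -1) (x : ℝ) : s * x ≤ |x| := by
  rcases hs with rfl | rfl
  · simpa using le_abs_self x
  · simpa using neg_le_abs x

/-- separation on one side -/
theorem side (h : Pk c C s G E q q1 q2) {d d' : ℝ → ℝ} {I : Set ℝ} (hI : I.OrdConnected) {ms κ : ℝ} (hκ : 0 ≤ κ)
    (hd : ∀ x ∈ I, HasDerivAt d (d' x) x) (hq : ∀ x ∈ I, κ * (x - ms)^2 ≤ s * d' x * (x - ms)) {r : ℝ} (hr : 0 ≤ r) {x x' : ℝ}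
    (hx : x ∈ I) (hx' : x' ∈ I) (hs : (r ≤ x - ms ∧ r ≤ x' - ms) ∨ (r ≤ ms - x ∧ r ≤ ms - x')) :
    κ / 2 * (x' - x)^2 ≤ |d x' - d x| ∧ κ * r * |x' - x| ≤ |d x' - d x| := by
  have key : ∀ x ∈ I, ∀ x' ∈ I, (r ≤ x - ms ∧ x ≤ x') ∨ (r ≤ ms - x ∧ x' ≤ x) →
      κ / 2 * (x' - x)^2 ≤ |d x' - d x| ∧ κ * r * |x' - x| ≤ |d x' - d x| := by
    intro x hx x' hx' hs
    have h1 := quad hI hd hq hx hx' (hs.imp (fun h => ⟨by linarith [h.1], h.2⟩) (fun h => ⟨h.2, by linarith [h.1]⟩))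
    have h2 := sabs h.hs (d x' - d x)
    have h3 := h1.trans h2
    constructor
    · refine le_trans ?_ h3
      gcongr
      rcases hs with ⟨a, b⟩ | ⟨a, b⟩ <;> nlinarith
    · refine le_trans ?_ h3
      rw [show κ * r * |x' - x| = κ / 2 * (2 * r * |x' - x|) by ring]
      gcongr
      rcases hs with ⟨a, b⟩ | ⟨a, b⟩
      · rw [abs_of_nonneg (by linarith)]; nlinarith
      · rw [abs_of_nonpos (by linarith)]; nlinarith
  rcases hs with ⟨a, b⟩ | ⟨a, b⟩ <;> rcases le_total x x' with e | e
  · exact key x hx x' hx' (Or.inl ⟨a, e⟩)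
  · have := key x' hx' x hx (Or.inl ⟨b, e⟩)
    rwa [abs_sub_comm (d x), abs_sub_comm x, show (x - x')^2 = (x' - x)^2 by ring] at this
  · have := key x' hx' x hx (Or.inr ⟨b, e⟩)
    rwa [abs_sub_comm (d x), abs_sub_comm x, show (x - x')^2 = (x' - x)^2 by ring] at this
  · exact key x hx x' hx' (Or.inr ⟨a, e⟩)

theorem rowN (h : Pk c C s G E q q1 q2) (hc : 0 < c) (hc1 : c ≤ 1) (hC : 0 < C) {N u A1 n n' : ℝ} (hN : 1 ≤ N) (hu : u ∈ Icc (1/2:ℝ) 3)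
    (hn : n ∈ Icc (N/4) (4*N)) (hn' : n' ∈ Icc (N/4) (4*N)) (S : Finset ℤ) (hS : ∀ m ∈ S, (m:ℝ) ∈ RI A1 n n') (d0 : ℝ) :
    ∑ m ∈ S, (1 + |ww E u m n + ww E u (A1 - m) n' - d0|)⁻¹ ≤ 16 * Real.pi * Real.sqrt (18 * N / c) := by
  obtain ⟨d', hd, hq, -⟩ := h.row (A1 := A1) hc hC hN hu hn hn'
  have oc := RI_oc (A1 := A1) (show 0 < n by linarith [hn.1]) (show 0 < n' by linarith [hn'.1])
  set ms := n * A1 / (n + n')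
  set κ := c / (18 * N)
  have hκ : 0 < κ := by positivity
  have hκ1 : κ ≤ 1 := by rw [div_le_one (by positivity)]; linarith
  have hsq := Real.sq_sqrt hκ.le
  have hs0 : 0 < Real.sqrt κ := Real.sqrt_pos.2 hκ
  have hs1 : Real.sqrt κ ≤ 1 := Real.sqrt_le_one.2 hκ1
  have e : 4 * Real.pi / (Real.sqrt κ / 2) + 4 * Real.pi / (Real.sqrt κ / 2) = 16 * Real.pi * Real.sqrt (18 * N / c) := by
    rw [show 18 * N / c = κ⁻¹ by simp [κ], Real.sqrt_inv]; field_simp; norm_num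
  rw [← e, ← Finset.sum_filter_add_sum_filter_not S (fun m : ℤ => ms ≤ m)]
  refine add_le_add (sep2 (by positivity) (by linarith) ?_) (sep2 (by positivity) (by linarith) ?_)
  all_goals
    intro m hm m' hm'
    rw [Finset.mem_filter] at hm hm'
    have := (h.side oc hκ.le hd hq (r := 0) le_rfl (hS m hm.1) (hS m' hm'.1) ?_).1
    · convert this using 1
      · push_cast; rw [mul_pow, div_pow, hsq]; ring
      · congr 1; ring
  · left; constructor <;> linarith [hm.2, hm'.2]
  · right; constructor <;> linarith [hm.2, hm'.2]

theorem rowF (h : Pk c C s G E q q1 q2) (hc : 0 < c) (hc1 : c ≤ 1) (hC : 0 < C) {N u A1 n n' : ℝ} (hN : 1 ≤ N) (hu : u ∈ Icc (1/2:ℝ) 3)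
    (hn : n ∈ Icc (N/4) (4*N)) (hn' : n' ∈ Icc (N/4) (4*N)) (S : Finset ℤ) (hS : ∀ m ∈ S, (m:ℝ) ∈ RI A1 n n') (d0 : ℝ)
    {M : ℕ} (hM : ∀ m ∈ S, ∀ m' ∈ S, |m' - m| ≤ M) (hcard : S.card ≤ M + 1) (hA : A1 / (n + n') ∈ Icc (1/8:ℝ) 8)
    {b θ : ℝ} (hb : 0 < b) (hbC : b ≤ 64 * C) (hθ : 0 < θ) (hθ1 : θ ≤ 1) (hfar : b * N * θ^2 ≤ |d0 - ww E u A1 (n+n')|) :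
    ∑ m ∈ S, (1 + |ww E u m n + ww E u (A1 - m) n' - d0|)⁻¹ ≤
      2 * (M + 1) / (b * N * θ^2) + 144 / (c * Real.sqrt (b / (64 * C)) * θ) * (1 + Real.log (M+1)) := by
  obtain ⟨d', hd, hq, hK⟩ := h.row (A1 := A1) hc hC hN hu hn hn'
  have p1 : 0 < n := by linarith [hn.1]
  have p2 : 0 < n' := by linarith [hn'.1]
  have oc := RI_oc (A1 := A1) p1 p2
  have hms : n * A1 / (n + n') ∈ RI A1 n n' := by
    constructor
    · rwa [show n * A1 / (n + n') / n = A1 / (n + n') by field_simp]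
    · rwa [show (A1 - n * A1 / (n + n')) / n' = A1 / (n + n') by field_simp; ring]
  have hdm : ww E u (n * A1 / (n + n')) n + ww E u (A1 - n * A1 / (n + n')) n' = ww E u A1 (n + n') := by
    unfold ww
    rw [show n * A1 / (n + n') / n = A1 / (n + n') by field_simp, show (A1 - n * A1 / (n + n')) / n' = A1 / (n + n') by field_simp; ring]
    ring
  set ms := n * A1 / (n + n')
  set κ := c / (18 * N) with hκd
  have hκ : 0 < κ := by positivity
  set v := Real.sqrt (b / (64 * C))
  have hv : 0 < v := Real.sqrt_pos.2 (by positivity)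
  have hv2 : v^2 = b / (64*C) := Real.sq_sqrt (by positivity)
  have hv1 : v ≤ 1 := Real.sqrt_le_one.2 (by rw [div_le_one (by positivity)]; exact hbC)
  set r := N * θ * v
  have hr : 0 < r := by positivity
  have hup : ∀ x ∈ RI A1 n n', |ww E u x n + ww E u (A1 - x) n' - ww E u A1 (n+n')| ≤ 32 * C / N * |x - ms| * |x - ms| := by
    intro x hx
    rw [← hdm]
    refine (convex_uIcc ms x).norm_image_sub_le_of_norm_hasDerivWithin_le (f := fun x => ww E u x n + ww E u (A1 - x) n')
      (f' := d') (fun y hy => (hd y (oc.uIcc_subset hms hx hy)).hasDerivWithinAt) (fun y hy => ?_) left_mem_uIcc right_mem_uIcc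
    refine (hK y (oc.uIcc_subset hms hx hy)).trans (mul_le_mul_of_nonneg_left ?_ (by positivity))
    have := abs_sub_left_of_mem_uIcc hy
    exact this
  have hρ : κ * r / 2 = c * v * θ / 36 := by simp only [κ, r]; field_simp; norm_num
  have hρ0 : 0 < κ * r / 2 := by positivity
  have hρ1 : κ * r / 2 ≤ 1 := by
    have : c * v * θ ≤ 1 := mul_le_one₀ (mul_le_one₀ hc1 hv.le hv1) hθ.le hθ1
    rw [hρ]; linarith
  have hD : 0 < b * N * θ^2 := by positivity
  rw [← Finset.sum_filter_add_sum_filter_not S (fun m : ℤ => |(m:ℝ) - ms| < r)]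
  refine add_le_add ?_ ?_
  · have hcd : ((S.filter (fun m : ℤ => |(m:ℝ) - ms| < r)).card : ℝ) ≤ M + 1 := by
      exact_mod_cast (Finset.card_filter_le _ _).trans hcard
    refine (Finset.sum_le_card_nsmul _ _ (2 / (b * N * θ^2)) fun m hm => ?_).trans ?_
    swap
    · rw [nsmul_eq_mul, show 2 * ((M:ℝ) + 1) / (b * N * θ^2) = (M+1) * (2 / (b * N * θ^2)) by ring]
      exact mul_le_mul_of_nonneg_right hcd (by positivity)
    rw [Finset.mem_filter] at hm
    have h1 := hup m (hS m hm.1)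
    have h2 : 32 * C / N * |m - ms| * |m - ms| ≤ b * N * θ^2 / 2 := by
      calc _ ≤ 32 * C / N * r * r := by gcongr <;> exact hm.2.le
        _ = 32 * C * N * θ^2 * v^2 := by simp only [r]; field_simp
        _ = _ := by rw [hv2]; field_simp; norm_num
    have h3 := abs_sub_abs_le_abs_sub (d0 - ww E u A1 (n+n')) (ww E u m n + ww E u (A1 - m) n' - ww E u A1 (n+n'))
    rw [sub_sub_sub_cancel_right, abs_sub_comm d0 (ww E u m n + _)] at h3
    rw [show 2 / (b * N * θ^2) = (b * N * θ^2 / 2)⁻¹ by rw [inv_div]]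
    refine inv_anti₀ (by positivity) (by linarith)
  · rw [← Finset.sum_filter_add_sum_filter_not (S.filter _) (fun m : ℤ => ms ≤ m)]
    have e : 144 / (c * v * θ) * (1 + Real.log (M+1)) = 2 / (κ * r / 2) * (1 + Real.log (M+1)) + 2 / (κ * r / 2) * (1 + Real.log (M+1)) := by
      rw [hρ]; field_simp; ring
    rw [e]
    refine add_le_add (sep1 hρ0 hρ1 (fun m hm m' hm' => hM m ?_ m' ?_) ?_) (sep1 hρ0 hρ1 (fun m hm m' hm' => hM m ?_ m' ?_) ?_)
    any_goals exact Finset.filter_subset _ _ (Finset.filter_subset _ _ hm)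
    any_goals exact Finset.filter_subset _ _ (Finset.filter_subset _ _ hm')
    all_goals
      intro m hm m' hm'
      rw [Finset.mem_filter, Finset.mem_filter, not_lt] at hm hm'
      have := (h.side oc hκ.le hd hq (r := r) hr.le (hS m hm.1.1) (hS m' hm'.1.1) ?_).2
      · convert this using 1
        · push_cast; ring
        · congr 1; ring
    · left
      rw [abs_of_nonneg (by linarith [hm.2])] at hm; rw [abs_of_nonneg (by linarith [hm'.2])] at hm'
      exact ⟨hm.1.2, hm'.1.2⟩
    · right
      rw [abs_of_neg (by linarith [hm.2])] at hm; rw [abs_of_neg (by linarith [hm'.2])] at hm'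
      constructor <;> linarith [hm.1.2, hm'.1.2]
end Pk


/-- boxes of lattice points -/
noncomputable def Kb (lo hi : ℤ) : Finset (ℤ × ℤ) := Finset.Icc lo hi ×ˢ Finset.Icc lo hi
/-- phase at lattice points -/
noncomputable def wk (E : ℝ → ℝ) (u : ℝ) (k : ℤ × ℤ) : ℝ := ww E u k.1 k.2
/-- the weight -/
noncomputable def Wt (E : ℝ → ℝ) (u : ℝ) (k1 k2 k3 k4 : ℤ × ℤ) : ℝ :=
  if k1 + k2 - k3 - k4 ∈ Kb (-4) 4 then (1 + |wk E u k1 + wk E u k2 - wk E u k3 - wk E u k4|)⁻¹ else 0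

theorem cnt_red (E : ℝ → ℝ) (u : ℝ) {lo hi : ℤ} (k3 k4 : ℤ × ℤ) {B : ℝ} (hB : 0 ≤ B)
    (h : ∀ d ∈ Kb (-4) 4, ∀ n ∈ Finset.Icc lo hi, (k3 + k4 + d).2 - n ∈ Finset.Icc lo hi →
      ∑ m ∈ (Finset.Icc lo hi).filter (fun m => (k3 + k4 + d).1 - m ∈ Finset.Icc lo hi),
        (1 + |ww E u m n + ww E u ((k3 + k4 + d).1 - m : ℤ) ((k3 + k4 + d).2 - n : ℤ) - (wk E u k3 + wk E u k4)|)⁻¹ ≤ B) :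
    ∑ k1 ∈ Kb lo hi, ∑ k2 ∈ Kb lo hi, Wt E u k1 k2 k3 k4 ≤ 81 * (hi + 1 - lo).toNat * B := by
  have h1 : ∀ k1, ∑ k2 ∈ Kb lo hi, Wt E u k1 k2 k3 k4 = ∑ d ∈ Kb (-4) 4,
      if k3 + k4 + d - k1 ∈ Kb lo hi then (1 + |wk E u k1 + wk E u (k3 + k4 + d - k1) - (wk E u k3 + wk E u k4)|)⁻¹ else 0 := by
    intro k1
    unfold Wt
    rw [← Finset.sum_filter, ← Finset.sum_filter]
    refine Finset.sum_nbij' (fun k2 => k1 + k2 - k3 - k4) (fun d => k3 + k4 + d - k1) ?_ ?_ ?_ ?_ ?_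
    · intro a ha; rw [Finset.mem_filter] at ha ⊢
      exact ⟨ha.2, by rw [show k3 + k4 + (k1 + a - k3 - k4) - k1 = a by abel]; exact ha.1⟩
    · intro a ha; rw [Finset.mem_filter] at ha ⊢
      exact ⟨ha.2, by rw [show k1 + (k3 + k4 + a - k1) - k3 - k4 = a by abel]; exact ha.1⟩
    · intro a _; abel
    · intro a _; abel
    · intro a _; rw [show k3 + k4 + (k1 + a - k3 - k4) - k1 = a by abel, sub_sub _ (wk E u k3)]
  simp_rw [h1]
  rw [Finset.sum_comm]
  have h2 : ∀ d ∈ Kb (-4) 4, (∑ k1 ∈ Kb lo hi, if k3 + k4 + d - k1 ∈ Kb lo hi then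
      (1 + |wk E u k1 + wk E u (k3 + k4 + d - k1) - (wk E u k3 + wk E u k4)|)⁻¹ else 0) ≤ (hi + 1 - lo).toNat * B := by
    intro d hd
    unfold Kb
    rw [Finset.sum_product_right]
    refine (Finset.sum_le_card_nsmul _ _ B fun n hn => ?_).trans_eq (by simp)
    by_cases hn' : (k3 + k4 + d).2 - n ∈ Finset.Icc lo hi
    · refine le_trans (le_of_eq ?_) (h d hd n hn hn')
      rw [Finset.sum_filter]
      refine Finset.sum_congr rfl fun m _ => ?_
      refine if_congr ?_ rfl rfl
      rw [Finset.mem_product]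
      exact and_iff_left hn'
    · refine le_trans (le_of_eq ?_) hB
      refine Finset.sum_eq_zero fun m _ => ?_
      rw [if_neg]
      rw [Finset.mem_product]
      exact fun hh => hn' hh.2
  refine (Finset.sum_le_card_nsmul _ _ _ h2).trans_eq ?_
  have : (Kb (-4) 4).card = 81 := by unfold Kb; simp
  rw [this, nsmul_eq_mul]; push_cast; ring

namespace Pk
variable {c C s : ℝ} {G E q q1 q2 : ℝ → ℝ}

theorem rat {N x y : ℝ} (hN : 1 ≤ N) {t : ℝ} (ht : 0 < t) (hx : x ∈ Icc (t*(3*N/8)) (t*(2*N))) (hy : y ∈ Icc (t*(3*N/8)) (t*(2*N))) : x / y ∈ Icc (1/8:ℝ) 8 := by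
  have h0 : 0 < t * N := by positivity
  have : 0 < y := by linarith [hy.1]
  constructor
  · rw [le_div_iff₀ this]; linarith [hx.1, hy.2]
  · rw [div_le_iff₀ this]; linarith [hx.2, hy.1]

theorem bxc {N : ℝ} {lo hi : ℤ} (hlo : 3*N/8 ≤ lo) (hhi : (hi:ℝ) ≤ 2*N) {m : ℤ} (hm : m ∈ Finset.Icc lo hi) : (m:ℝ) ∈ Icc (1*(3*N/8)) (1*(2*N)) := by
  rw [Finset.mem_Icc] at hm
  have h1 : (lo:ℝ) ≤ m := by exact_mod_cast hm.1
  have h2 : (m:ℝ) ≤ hi := by exact_mod_cast hm.2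
  constructor <;> linarith

theorem cardb {N : ℝ} (hN : 1 ≤ N) {lo hi : ℤ} (hlo : 3*N/8 ≤ lo) (hhi : (hi:ℝ) ≤ 2*N) : (((hi + 1 - lo).toNat : ℕ):ℝ) ≤ 3 * N := by
  have : (((hi + 1 - lo).toNat : ℤ):ℝ) ≤ 3 * N := by
    rcases le_total 0 (hi + 1 - lo) with h | h
    · rw [Int.toNat_of_nonneg h]; push_cast; linarith
    · rw [Int.toNat_of_nonpos h]; push_cast; linarith
  exact_mod_cast this

theorem rowmem {N : ℝ} (hN : 1 ≤ N) {lo hi : ℤ} (hlo : 3*N/8 ≤ lo) (hhi : (hi:ℝ) ≤ 2*N) {A1 m n n' : ℤ} (hn : n ∈ Finset.Icc lo hi)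
    (hn' : n' ∈ Finset.Icc lo hi) (hm : m ∈ (Finset.Icc lo hi).filter (fun m => A1 - m ∈ Finset.Icc lo hi)) : (m:ℝ) ∈ RI A1 n n' := by
  rw [Finset.mem_filter] at hm
  refine ⟨rat hN one_pos (bxc hlo hhi hm.1) (bxc hlo hhi hn), ?_⟩
  have := rat hN one_pos (bxc hlo hhi hm.2) (bxc hlo hhi hn')
  push_cast at this; exact this

theorem big {N x : ℝ} (hN : 1 ≤ N) (h : x ∈ Icc (1*(3*N/8)) (1*(2*N))) : x ∈ Icc (N/4) (4*N) := ⟨by linarith [h.1], by linarith [h.2]⟩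

theorem cntN (h : Pk c C s G E q q1 q2) (hc : 0 < c) (hc1 : c ≤ 1) (hC : 0 < C) {N u : ℝ} (hN : 1 ≤ N) (hu : u ∈ Icc (1/2:ℝ) 3)
    {lo hi : ℤ} (hlo : 3*N/8 ≤ lo) (hhi : (hi:ℝ) ≤ 2*N) (k3 k4 : ℤ × ℤ) :
    ∑ k1 ∈ Kb lo hi, ∑ k2 ∈ Kb lo hi, Wt E u k1 k2 k3 k4 ≤ 81 * (3 * N) * (16 * Real.pi * Real.sqrt (18 * N / c)) := by
  refine (cnt_red E u k3 k4 (B := 16 * Real.pi * Real.sqrt (18 * N / c)) (by positivity) fun d hd n hn hn' => ?_).trans ?_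
  · have := h.rowN (A1 := (k3 + k4 + d).1) hc hc1 hC hN hu (big hN (bxc hlo hhi hn)) (big hN (bxc hlo hhi hn'))
      _ (fun m hm => rowmem hN hlo hhi hn hn' hm) (wk E u k3 + wk E u k4)
    convert this using 7
    push_cast; rfl
  · have := cardb hN hlo hhi
    gcongr

theorem cntF (h : Pk c C s G E q q1 q2) (hc : 0 < c) (hc1 : c ≤ 1) (hC : 1 ≤ C) {N u : ℝ} (hN : 1 ≤ N) (hu : u ∈ Icc (1/2:ℝ) 3)
    {lo hi : ℤ} (hlo : 3*N/8 ≤ lo) (hhi : (hi:ℝ) ≤ 2*N) {k3 k4 : ℤ × ℤ} (h3 : k3 ∈ Kb lo hi) (h4 : k4 ∈ Kb lo hi)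
    {θ : ℝ} (hθ : 0 < θ) (hθ1 : θ ≤ 1) (hν : θ ≤ |(k3.1:ℝ) / k3.2 - k4.1 / k4.2|) (hbig : 300 * C * 73728 ≤ c * N * θ^2) :
    ∑ k1 ∈ Kb lo hi, ∑ k2 ∈ Kb lo hi, Wt E u k1 k2 k3 k4 ≤ 81 * (3 * N) * (2 * (3 * N) / (c / 73728 * N * θ^2) +
      144 / (c * Real.sqrt (c / 73728 / (64 * C)) * θ) * (1 + Real.log (3 * N))) := by
  unfold Kb at h3 h4
  rw [Finset.mem_product] at h3 h4
  have hloi : lo ≤ hi := by have := Finset.mem_Icc.1 h3.1; lia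
  have hcd := cardb hN hlo hhi
  obtain ⟨M, hM⟩ : ∃ M : ℕ, (hi + 1 - lo).toNat = M + 1 := ⟨(hi - lo).toNat, by lia⟩
  have hMN : (M:ℝ) + 1 ≤ 3 * N := by rw [hM] at hcd; exact_mod_cast hcd
  have hlg : 0 ≤ Real.log (3 * N) := Real.log_nonneg (by linarith)
  have C0 : 0 < C := by linarith
  refine (cnt_red E u k3 k4 (B := 2 * (3 * N) / (c / 73728 * N * θ^2) +
      144 / (c * Real.sqrt (c / 73728 / (64 * C)) * θ) * (1 + Real.log (3 * N))) (by positivity) fun d hd n hn hn' => ?_).trans ?_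
  swap
  · gcongr
  rcases ((Finset.Icc lo hi).filter (fun m => (k3 + k4 + d).1 - m ∈ Finset.Icc lo hi)).eq_empty_or_nonempty with he | ⟨m0, hm0⟩
  · rw [he]; simp only [Finset.sum_empty]; positivity
  rw [Finset.mem_filter] at hm0
  have x1 := bxc hlo hhi hm0.1; have x2 := bxc hlo hhi hm0.2
  have y1 := bxc hlo hhi hn; have y2 := bxc hlo hhi hn'
  have k31 := bxc hlo hhi h3.1; have k32 := bxc hlo hhi h3.2
  have k41 := bxc hlo hhi h4.1; have k42 := bxc hlo hhi h4.2
  have hA : (n:ℝ) + ((k3 + k4 + d).2 - n : ℤ) = ((k3 + k4 + d).2 : ℤ) := by push_cast; ring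
  have aA1 : (((k3 + k4 + d).1 : ℤ) : ℝ) ∈ Icc (3*N/4) (4*N) := by
    push_cast at x2 ⊢; constructor <;> linarith [x1.1, x1.2, x2.1, x2.2]
  have aA2 : (((k3 + k4 + d).2 : ℤ) : ℝ) ∈ Icc (3*N/4) (4*N) := by
    push_cast at y2 ⊢; constructor <;> linarith [y1.1, y1.2, y2.1, y2.2]
  have aB1 : ((k3.1:ℝ) + k4.1) ∈ Icc (3*N/4) (4*N) := by constructor <;> linarith [k31.1, k31.2, k41.1, k41.2]
  have aB2 : ((k3.2:ℝ) + k4.2) ∈ Icc (3*N/4) (4*N) := by constructor <;> linarith [k32.1, k32.2, k42.1, k42.2]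
  have hd' : d ∈ Finset.Icc (-4:ℤ) 4 ×ˢ Finset.Icc (-4:ℤ) 4 := hd
  rw [Finset.mem_product, Finset.mem_Icc, Finset.mem_Icc] at hd'
  have hd1 : |(d.1:ℝ)| ≤ 4 := abs_le.2 ⟨by exact_mod_cast hd'.1.1, by exact_mod_cast hd'.1.2⟩
  have hd2 : |(d.2:ℝ)| ≤ 4 := abs_le.2 ⟨by exact_mod_cast hd'.2.1, by exact_mod_cast hd'.2.2⟩
  have lip := h.ww_lip C0 hN hu aB1 aB2 aA1 aA2 (by simpa using hd1) (by simpa using hd2)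
  -- lower bound
  obtain ⟨d', hdd, hq, -⟩ := h.row (A1 := (k3.1:ℝ) + k4.1) hc C0 hN hu (big hN k32) (big hN k42)
  have p1 : (0:ℝ) < k3.2 := by linarith [k32.1]
  have p2 : (0:ℝ) < k4.2 := by linarith [k42.1]
  have hBr : ((k3.1:ℝ) + k4.1) / (k3.2 + k4.2) ∈ Icc (1/8:ℝ) 8 := by
    refine rat hN (t := 2) (by norm_num) ?_ ?_
    · constructor <;> linarith [aB1.1, aB1.2]
    · constructor <;> linarith [aB2.1, aB2.2]
  have i1 : (k3.1:ℝ) ∈ RI ((k3.1:ℝ) + k4.1) k3.2 k4.2 := by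
    refine ⟨rat hN one_pos k31 k32, ?_⟩
    rw [add_sub_cancel_left]; exact rat hN one_pos k41 k42
  have e1 : (k3.2:ℝ) * (k3.1 + k4.1) / (k3.2 + k4.2) / k3.2 = (k3.1 + k4.1) / (k3.2 + k4.2) := by field_simp
  have e2 : ((k3.1:ℝ) + k4.1 - k3.2 * (k3.1 + k4.1) / (k3.2 + k4.2)) / k4.2 = (k3.1 + k4.1) / (k3.2 + k4.2) := by field_simp; ring
  have i2 : (k3.2:ℝ) * (k3.1 + k4.1) / (k3.2 + k4.2) ∈ RI ((k3.1:ℝ) + k4.1) k3.2 k4.2 := ⟨by rwa [e1], by rwa [e2]⟩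
  have low := quad (RI_oc p1 p2) hdd hq i2 i1 (by rcases le_total ((k3.2:ℝ) * (k3.1 + k4.1) / (k3.2 + k4.2)) k3.1 with h | h; exacts [Or.inl ⟨le_rfl, h⟩, Or.inr ⟨h, le_rfl⟩])
  replace low := low.trans (sabs h.hs _)
  have e3 : ww E u k3.1 k3.2 + ww E u (k3.1 + k4.1 - k3.1) k4.2 - (ww E u ((k3.2:ℝ) * (k3.1 + k4.1) / (k3.2 + k4.2)) k3.2 +
      ww E u (k3.1 + k4.1 - (k3.2:ℝ) * (k3.1 + k4.1) / (k3.2 + k4.2)) k4.2) = wk E u k3 + wk E u k4 - ww E u (k3.1 + k4.1) (k3.2 + k4.2) := by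
    unfold wk ww
    rw [e1, e2, add_sub_cancel_left]; ring
  have e4 : ((k3.1:ℝ) - k3.2 * (k3.1 + k4.1) / (k3.2 + k4.2)) = k3.2 * (k4.2 / (k3.2 + k4.2)) * (k3.1 / k3.2 - k4.1 / k4.2) := by
    field_simp; ring
  simp only [e3, sub_self] at low
  have e5 : N * θ / 32 ≤ |(k3.1:ℝ) - k3.2 * (k3.1 + k4.1) / (k3.2 + k4.2)| := by
    rw [e4, abs_mul, abs_of_pos (by positivity)]
    have : (3/32:ℝ) ≤ k4.2 / (k3.2 + k4.2) := by rw [le_div_iff₀ (by positivity)]; linarith [k42.1, aB2.2]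
    calc N * θ / 32 ≤ (3*N/8) * (3/32) * θ := by nlinarith [mul_pos (show 0 < N by linarith) hθ]
      _ ≤ _ := by gcongr; linarith [k32.1]
  have e6 : (N * θ / 32)^2 ≤ ((k3.1:ℝ) - k3.2 * (k3.1 + k4.1) / (k3.2 + k4.2))^2 := by
    rw [← sq_abs ((k3.1:ℝ) - _)]; gcongr
  have low2 : c / 36864 * N * θ^2 ≤ |wk E u k3 + wk E u k4 - ww E u (k3.1 + k4.1) (k3.2 + k4.2)| := by
    refine le_trans ?_ low
    calc _ = c / (18 * N) / 2 * (N * θ / 32)^2 := by field_simp; norm_num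
      _ ≤ _ := by gcongr; simpa using e6
  have hfar : c / 73728 * N * θ^2 ≤ |wk E u k3 + wk E u k4 - ww E u ((k3 + k4 + d).1 : ℤ) (n + ((k3 + k4 + d).2 - n : ℤ))| := by
    rw [hA]
    have := abs_sub_le (wk E u k3 + wk E u k4) (ww E u ((k3 + k4 + d).1 : ℤ) ((k3 + k4 + d).2 : ℤ)) (ww E u (k3.1 + k4.1) (k3.2 + k4.2))
    linarith
  have := h.rowF (A1 := (k3 + k4 + d).1) hc hc1 C0 hN hu (big hN y1) (big hN y2)
      _ (fun m hm => rowmem hN hlo hhi hn hn' hm) (wk E u k3 + wk E u k4) (M := M) (fun m hm m' hm' => ?_) ?_ ?_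
      (show 0 < c / 73728 by positivity) (by linarith) hθ hθ1 hfar
  · have l1 : Real.log (M + 1) ≤ Real.log (3 * N) := Real.log_le_log (by positivity) hMN
    refine le_trans (le_of_eq ?_) (this.trans ?_)
    · refine Finset.sum_congr rfl fun m _ => ?_
      push_cast; rfl
    · gcongr
  · rw [Finset.mem_filter, Finset.mem_Icc] at hm hm'
    rw [abs_le]; constructor <;> lia
  · refine (Finset.card_filter_le _ _).trans ?_
    rw [Int.card_Icc, hM]
  · rw [hA]
    refine rat hN (t := 2) (by norm_num) ?_ ?_
    · constructor <;> linarith [aA1.1, aA1.2]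
    · constructor <;> linarith [aA2.1, aA2.2]
end Pk

open scoped FourierTransform

/-- the character `e^{ix}` -/
noncomputable def ex (x : ℝ) : ℂ := Complex.exp (x * Complex.I)
theorem ex_norm (x : ℝ) : ‖ex x‖ = 1 := Complex.norm_exp_ofReal_mul_I x
theorem ex_cont : Continuous ex := by unfold ex; fun_prop
theorem ex_add (x y : ℝ) : ex (x + y) = ex x * ex y := by unfold ex; rw [← Complex.exp_add]; push_cast; ring_nf
theorem ex_zero : ex 0 = 1 := by simp [ex]

theorem four_inv {ψ : ℝ → ℂ} (h1 : ContDiff ℝ (⊤ : ℕ∞) ψ) (h2 : HasCompactSupport ψ) :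
    ∃ σ : SchwartzMap ℝ ℂ, (∀ y, σ y = (2 * Real.pi)⁻¹ * ∫ η, ex (y * η) * ψ η) ∧ (∀ η, ∫ y, ex (-(y * η)) * σ y = ψ η) := by
  let S : SchwartzMap ℝ ℂ := h2.toSchwartzMap h1
  have hS : ∀ x, S x = ψ x := fun x => rfl
  have hp : (2 * Real.pi)⁻¹ ≠ 0 := by positivity
  let A : ℝ ≃L[ℝ] ℝ := ContinuousLinearEquiv.unitsEquivAut ℝ (Units.mk0 _ hp)
  have hA : ∀ x, A x = x * (2 * Real.pi)⁻¹ := fun x => rfl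
  let σ : SchwartzMap ℝ ℂ := ((2 * Real.pi)⁻¹ : ℂ) • SchwartzMap.compCLMOfContinuousLinearEquiv ℂ A (𝓕⁻ S)
  have hσ : ∀ y, σ y = ((2 * Real.pi)⁻¹ : ℂ) * (𝓕⁻ S) (y * (2 * Real.pi)⁻¹) := fun y => rfl
  refine ⟨σ, fun y => ?_, fun η => ?_⟩
  · rw [hσ, SchwartzMap.fourierInv_coe, Real.fourierInv_eq']
    refine congrArg₂ (· * ·) (by push_cast; rfl) (integral_congr_ae (Eventually.of_forall fun v => ?_))
    simp only
    rw [hS, smul_eq_mul, ex]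
    congr 3
    simp; field_simp
  · have e : 𝓕 (𝓕⁻ S) = S := FourierTransform.fourier_fourierInv_eq S
    rw [← hS η, ← e, SchwartzMap.fourier_coe, Real.fourier_eq']
    have := Measure.integral_comp_mul_left (fun y => ex (-(y * η)) * σ y) (2 * Real.pi)
    rw [abs_of_pos (by positivity)] at this
    have h3 : ∫ y, ex (-(y * η)) * σ y = (2 * Real.pi) • ∫ x, ex (-(2 * Real.pi * x * η)) * σ (2 * Real.pi * x) := by
      rw [this, smul_smul, mul_inv_cancel₀ (by positivity), one_smul]
    rw [h3, ← integral_smul]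
    congr 1
    ext x
    have h4 : 2 * Real.pi * x * (2 * Real.pi)⁻¹ = x := by field_simp
    rw [hσ, h4, Complex.real_smul, smul_eq_mul, ex]
    have h5 : (Real.pi : ℂ) ≠ 0 := by exact_mod_cast Real.pi_ne_zero
    have h6 : ((-(2 * Real.pi * x * η) : ℝ) : ℂ) * Complex.I = ((-2 * Real.pi * (inner ℝ x η) : ℝ) : ℂ) * Complex.I := by
      congr 2; simp; ring
    rw [h6]; push_cast; field_simp

/-- smooth step -/
noncomputable def bfun (x : ℝ) : ℂ := ((Real.smoothTransition x - Real.smoothTransition (x - 1) : ℝ) : ℂ)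
noncomputable def btil (x : ℝ) : ℂ := ((Real.smoothTransition (x + 1) - Real.smoothTransition (x - 2) : ℝ) : ℂ)

theorem stz {x : ℝ} (h : x ≤ 0) : Real.smoothTransition x = 0 := Real.smoothTransition.zero_of_nonpos h
theorem sto {x : ℝ} (h : 1 ≤ x) : Real.smoothTransition x = 1 := Real.smoothTransition.one_of_one_le h

theorem bfun_smooth : ContDiff ℝ (⊤ : ℕ∞) bfun := by
  have := Real.smoothTransition.contDiff (n := (⊤ : ℕ∞))
  exact Complex.ofRealCLM.contDiff.comp (this.sub (this.comp (contDiff_id.sub contDiff_const)))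
theorem btil_smooth : ContDiff ℝ (⊤ : ℕ∞) btil := by
  have := Real.smoothTransition.contDiff (n := (⊤ : ℕ∞))
  exact Complex.ofRealCLM.contDiff.comp ((this.comp (contDiff_id.add contDiff_const)).sub (this.comp (contDiff_id.sub contDiff_const)))
theorem bfun_zero {x : ℝ} (h : x ∉ Icc (0:ℝ) 2) : bfun x = 0 := by
  rw [mem_Icc, not_and_or, not_le, not_le] at h
  unfold bfun
  rcases h with h | h
  · rw [stz h.le, stz (by linarith)]; simp
  · rw [sto (by linarith), sto (by linarith)]; simp
theorem btil_zero {x : ℝ} (h : x ∉ Icc (-1:ℝ) 3) : btil x = 0 := by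
  rw [mem_Icc, not_and_or, not_le, not_le] at h
  unfold btil
  rcases h with h | h
  · rw [stz (by linarith), stz (by linarith)]; simp
  · rw [sto (by linarith), sto (by linarith)]; simp
theorem bfun_btil (x : ℝ) : bfun x * btil x = bfun x := by
  by_cases h : x ∈ Icc (0:ℝ) 2
  · have : btil x = 1 := by unfold btil; rw [sto (by linarith [h.1]), stz (by linarith [h.2])]; simp
    rw [this, mul_one]
  · rw [bfun_zero h, zero_mul]
theorem bfun_cs : HasCompactSupport bfun := HasCompactSupport.of_support_subset_isCompact isCompact_Icc (fun x hx => by_contra fun h => hx (bfun_zero h))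
theorem btil_cs : HasCompactSupport btil := HasCompactSupport.of_support_subset_isCompact isCompact_Icc (fun x hx => by_contra fun h => hx (btil_zero h))

theorem bfun_sum (lo : ℤ) (n : ℕ) (x : ℝ) : ∑ i ∈ Finset.range n, bfun (x - (lo + i : ℤ)) =
    ((Real.smoothTransition (x - lo) - Real.smoothTransition (x - lo - n) : ℝ) : ℂ) := by
  induction n with
  | zero => simp
  | succ n ih => rw [Finset.sum_range_succ, ih, bfun]; push_cast; ring_nf

theorem bfun_part {lo hi : ℤ} {x : ℝ} (h1 : (lo:ℝ) + 1 ≤ x) (h2 : x ≤ hi + 1) : ∑ k ∈ Finset.Icc lo hi, bfun (x - k) = 1 := by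
  have hl : lo ≤ hi + 1 := by exact_mod_cast (by linarith : (lo:ℝ) ≤ (hi:ℝ) + 1)
  obtain ⟨n, hn⟩ : ∃ n : ℕ, hi + 1 = lo + n := ⟨(hi + 1 - lo).toNat, by lia⟩
  have hn' : (hi:ℝ) + 1 = lo + n := by exact_mod_cast hn
  have e : Finset.Icc lo hi = (Finset.range n).image (fun i : ℕ => lo + (i:ℤ)) := by
    ext k; simp only [Finset.mem_Icc, Finset.mem_image, Finset.mem_range]
    exact ⟨fun h => ⟨(k - lo).toNat, by lia, by lia⟩, fun ⟨i, h, e⟩ => by lia⟩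
  rw [e, Finset.sum_image (by intro a _ b _ h; simpa using h), bfun_sum, sto (by linarith), stz (by linarith)]; simp

/-- the fixed profiles -/
noncomputable def sg : SchwartzMap ℝ ℂ := (four_inv bfun_smooth bfun_cs).choose
noncomputable def sgt : SchwartzMap ℝ ℂ := (four_inv btil_smooth btil_cs).choose
theorem sg_eq (y : ℝ) : sg y = (2 * Real.pi)⁻¹ * ∫ η, ex (y * η) * bfun η := (four_inv bfun_smooth bfun_cs).choose_spec.1 y
theorem sgt_eq (η : ℝ) : ∫ y, ex (-(y * η)) * sgt y = btil η := (four_inv btil_smooth btil_cs).choose_spec.2 η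

theorem cs_int {ψ : ℝ → ℂ} (h1 : Continuous ψ) (h2 : HasCompactSupport ψ) : Integrable ψ := h1.integrable_of_hasCompactSupport h2

theorem ex_mul_int {f : ℝ → ℂ} (hf : Integrable f) {p : ℝ → ℝ} (hp : Continuous p) : Integrable (fun x => ex (p x) * f x) :=
  hf.bdd_mul (c := 1) (ex_cont.comp hp).aestronglyMeasurable (Eventually.of_forall fun x => (ex_norm _).le)

/-- convolution against a function with Fourier representation -/
theorem conv_rep {f ψ : ℝ → ℂ} (hf : Integrable f) (hψ : Continuous ψ) (hc : HasCompactSupport ψ) (x : ℝ) :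
    ∫ y, f y * ∫ η, ex ((x - y) * η) * ψ η = ∫ η, ex (x * η) * (ψ η * ∫ y, ex (-(y * η)) * f y) := by
  simp_rw [← integral_const_mul]
  rw [integral_integral_swap]
  · refine integral_congr_ae (Eventually.of_forall fun η => integral_congr_ae (Eventually.of_forall fun y => ?_))
    simp only
    rw [show (x - y) * η = x * η + -(y * η) by ring, ex_add]; ring
  · have := (hf.mul_prod (cs_int hψ hc)).bdd_mul (c := 1) (f := fun z : ℝ × ℝ => ex ((x - z.1) * z.2))
      (by have := ex_cont; exact (by fun_prop : Continuous fun z : ℝ × ℝ => ex ((x - z.1) * z.2)).aestronglyMeasurable)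
      (Eventually.of_forall fun x => (ex_norm _).le)
    refine this.congr (Eventually.of_forall fun z => ?_)
    simp only [Function.uncurry]; ring

theorem sg_rep (x : ℝ) : ∫ y, sgt y * sg (x - y) = sg x := by
  simp_rw [sg_eq, mul_left_comm (sgt _), integral_const_mul, conv_rep sgt.integrable bfun_smooth.continuous bfun_cs, sgt_eq, bfun_btil]


/-- functions with integrable Fourier data supported in an interval -/
def FS (α β : ℝ) (F : ℝ → ℂ) : Prop :=
  ∃ M : ℝ → ℂ, Integrable M ∧ (∀ η, M η ≠ 0 → η ∈ Icc α β) ∧ ∀ x, F x = ∫ η, ex (x * η) * M η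

theorem ex_star (x : ℝ) : (starRingEnd ℂ) (ex x) = ex (-x) := by
  unfold ex; rw [← Complex.exp_conj]; simp

theorem ex_int2 {X Y : Type*} [MeasurableSpace X] [MeasurableSpace Y] {μ : Measure X} {η : Measure Y} {f : X × Y → ℂ}
    (hf : Integrable f (μ.prod η)) {p : X × Y → ℝ} (hp : Measurable p) : Integrable (fun z => ex (p z) * f z) (μ.prod η) :=
  hf.bdd_mul (c := 1) (ex_cont.measurable.comp hp).aestronglyMeasurable (Eventually.of_forall fun x => (ex_norm _).le)

theorem FS.conj {α β : ℝ} {F : ℝ → ℂ} : FS α β F → FS (-β) (-α) (fun x => (starRingEnd ℂ) (F x)) := by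
  rintro ⟨M, h1, h2, h3⟩
  refine ⟨fun η => (starRingEnd ℂ) (M (-η)), ?_, fun η h => ?_, fun x => ?_⟩
  · exact (LinearIsometryEquiv.integrable_comp_iff Complex.conjLIE).2 h1.comp_neg
  · have := h2 (-η) (fun h' => h (by simp [h'])); constructor <;> linarith [this.1, this.2]
  · beta_reduce
    rw [h3, ← integral_conj, ← integral_neg_eq_self]
    refine integral_congr_ae (.of_forall fun η => ?_)
    simp [ex_star]

theorem FS.mul {α β α' β' : ℝ} {F G : ℝ → ℂ} : FS α β F → FS α' β' G → FS (α + α') (β + β') (fun x => F x * G x) := by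
  rintro ⟨M, h1, h2, h3⟩ ⟨M', g1, g2, g3⟩
  have hi : Integrable (fun p : ℝ × ℝ => M p.2 * M' (p.1 - p.2)) (volume.prod volume) := h1.convolution_integrand (ContinuousLinearMap.mul ℝ ℂ) g1
  refine ⟨fun ζ => ∫ η, M η * M' (ζ - η), hi.integral_prod_left, fun ζ h => ?_, fun x => ?_⟩
  · by_contra hz
    refine h (integral_eq_zero_of_ae (.of_forall fun η => ?_))
    by_contra h0
    have a := h2 η (left_ne_zero_of_mul h0); have b := g2 _ (right_ne_zero_of_mul h0)
    exact hz ⟨by linarith [a.1, b.1], by linarith [a.2, b.2]⟩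
  · simp_rw [← integral_const_mul]
    rw [integral_integral_swap (by
      refine (ex_int2 hi (p := fun z => x * z.1) (by fun_prop)).congr (.of_forall fun z => ?_)
      simp [Function.uncurry]), h3, ← integral_mul_const]
    refine integral_congr_ae (.of_forall fun η => ?_)
    simp only
    rw [g3, ← integral_add_right_eq_self (fun ζ => ex (x * ζ) * (M η * M' (ζ - η))) η, ← integral_const_mul]
    refine integral_congr_ae (.of_forall fun ζ => ?_)
    simp only [add_sub_cancel_right, mul_add, ex_add]; ring

theorem FS.vanish {α β : ℝ} {F : ℝ → ℂ} (hF : FS α β F) (hi : Integrable F) (h0 : 0 < α ∨ β < 0) : ∫ x, F x = 0 := by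
  obtain ⟨M, h1, h2, h3⟩ := hF
  obtain ⟨a, ha⟩ : ∃ a, sgt a ≠ 0 := by
    by_contra! h
    have := sgt_eq 1
    simp only [h, mul_zero, integral_zero] at this
    have h' : btil 1 = 1 := by unfold btil; rw [sto (by norm_num), stz (by norm_num)]; simp
    rw [h'] at this; exact zero_ne_one this
  obtain ⟨d, hd, hd'⟩ : ∃ d > 0, ∀ η, M η ≠ 0 → d ≤ |η| := by
    rcases h0 with h | h
    · exact ⟨α, h, fun η hη => (h2 η hη).1.trans (le_abs_self _)⟩
    · exact ⟨-β, by linarith, fun η hη => by linarith [(h2 η hη).2, neg_abs_le η]⟩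
  have key : ∀ R : ℝ, 0 < R → 3 < R * d → ∫ x, F x * sgt (x / R + a) = 0 := fun R hR hRd => by
    have hs : Integrable fun x => sgt (x / R + a) := (sgt.integrable (μ := volume).comp_add_right a).comp_div hR.ne'
    simp_rw [h3, ← integral_mul_const]
    rw [integral_integral_swap (by
      refine (ex_int2 (hs.mul_prod h1) (p := fun z => z.1 * z.2) (by fun_prop)).congr (.of_forall fun z => ?_)
      simp [Function.uncurry]; ring)]
    refine integral_eq_zero_of_ae (.of_forall fun η => ?_)
    have e : ∀ x, ex (x * η) * M η * sgt (x / R + a) = ex (-(R * a * η)) * M η * (fun y => ex (-(y * -(R * η))) * sgt y) (x / R + a) := fun x => by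
      simp only
      rw [show x * η = -(R * a * η) + -((x / R + a) * -(R * η)) by field_simp; ring, ex_add]; ring
    simp_rw [e]
    rw [integral_const_mul]
    rcases eq_or_ne (M η) 0 with h | h
    · simp [h]
    rw [Measure.integral_comp_div (fun x => (fun y => ex (-(y * -(R * η))) * sgt y) (x + a)), integral_add_right_eq_self (fun y => ex (-(y * -(R * η))) * sgt y) a, sgt_eq, btil_zero]
    · simp
    have : 3 < |-(R * η)| := by rw [abs_neg, abs_mul, abs_of_pos hR]; exact hRd.trans_le (mul_le_mul_of_nonneg_left (hd' η h) hR.le)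
    intro h5
    have := abs_le.2 ⟨(by linarith [h5.1] : -3 ≤ -(R * η)), h5.2⟩
    linarith
  obtain ⟨B, hB⟩ : ∃ B, ∀ x, ‖sgt x‖ ≤ B := by
    obtain ⟨B, _, hB⟩ := sgt.decay 0 0
    exact ⟨B, fun x => by simpa using hB x⟩
  have lim : Tendsto (fun n : ℕ => ∫ x, F x * sgt (x / n + a)) atTop (nhds (∫ x, F x * sgt a)) := by
    refine tendsto_integral_of_dominated_convergence (fun x => ‖F x‖ * B) (fun n => hi.1.mul (sgt.continuous.comp (by fun_prop)).aestronglyMeasurable)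
      (hi.norm.mul_const _) (fun n => .of_forall fun x => ?_) (.of_forall fun x => ?_)
    · rw [norm_mul]; exact mul_le_mul_of_nonneg_left (hB _) (norm_nonneg _)
    · have : Tendsto (fun n : ℕ => x / (n:ℝ) + a) atTop (nhds a) := by simpa using (tendsto_const_div_atTop_nhds_zero_nat x).add_const a
      exact ((sgt.continuous.tendsto a).comp this).const_mul _
  have : ∫ x, F x * sgt a = 0 := by
    refine tendsto_nhds_unique lim (tendsto_const_nhds.congr' ?_)
    obtain ⟨n, hn⟩ := exists_nat_gt (3 / d)
    filter_upwards [eventually_ge_atTop (n + 1)] with k hk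
    have hk' : (n:ℝ) + 1 ≤ k := by exact_mod_cast hk
    have : (0:ℝ) ≤ n := by positivity
    rw [div_lt_iff₀ hd] at hn
    exact (key k (by linarith) (by nlinarith)).symm
  rw [integral_mul_const] at this
  exact (mul_eq_zero.1 this).resolve_right ha

theorem FS.of_int {Ω : Type*} [MeasurableSpace Ω] {μ : Measure Ω} [SFinite μ] {A : Ω → ℂ} (hA : Integrable A μ) {p : Ω → ℝ}
    (hp : Measurable p) (k : ℝ) : FS k (k + 2) (fun x => ∫ ω, A ω * (ex (k * (x + p ω)) * sg (x + p ω)) ∂μ) := by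
  have hb : Integrable fun η => bfun (η - k) := (cs_int bfun_smooth.continuous bfun_cs).comp_sub_right k
  have h := ex_int2 (hb.mul_prod hA) (p := fun z => p z.2 * z.1) (by fun_prop)
  refine ⟨fun η => (2 * Real.pi)⁻¹ * ∫ ω, ex (p ω * η) * (bfun (η - k) * A ω) ∂μ, h.integral_prod_left.const_mul _, fun η hη => ?_, fun x => ?_⟩
  · by_contra h
    refine hη ?_
    have : bfun (η - k) = 0 := bfun_zero fun h' => h ⟨by linarith [h'.1], by linarith [h'.2]⟩
    simp [this]
  · simp_rw [mul_left_comm (ex _)]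
    rw [integral_const_mul]
    simp_rw [← integral_const_mul (ex _)]
    rw [integral_integral_swap (by
      refine (ex_int2 h (p := fun z => x * z.1) (by fun_prop)).congr (.of_forall fun z => ?_)
      simp only [Function.uncurry]; ring), ← integral_const_mul]
    refine integral_congr_ae (.of_forall fun ω => ?_)
    simp only
    rw [sg_eq, ← integral_sub_right_eq_self _ k]
    simp_rw [← integral_const_mul]
    refine integral_congr_ae (.of_forall fun η => ?_)
    simp only
    rw [show ex (x * η) = ex (x * (η - k)) * ex (x * k) by rw [← ex_add]; ring_nf,
      show ex (p ω * η) = ex (p ω * (η - k)) * ex (p ω * k) by rw [← ex_add]; ring_nf,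
      show k * (x + p ω) = x * k + p ω * k by ring, add_mul, ex_add, ex_add]
    push_cast; ring


/-- bounded integrable functions -/
structure BI (A : ℝ) (f : ℝ × ℝ → ℂ) : Prop where
  i : Integrable f
  b : ∀ x, ‖f x‖ ≤ A
/-- kernels -/
structure Kd (C : ℝ) (s : ℝ × ℝ → ℂ) : Prop where
  c : Continuous s
  b : ∀ z, ‖s z‖ ≤ C * ze z
/-- convolution -/
noncomputable def cv (s f : ℝ × ℝ → ℂ) (X : ℝ × ℝ) : ℂ := ∫ Y, s (X - Y) * f Y
/-- modulated product -/
noncomputable def be (k1 k2 : ℝ) (σ τ : SchwartzMap ℝ ℂ) (Z : ℝ × ℝ) : ℂ := ex (k1 * Z.1 + k2 * Z.2) * (σ Z.1 * τ Z.2)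

theorem BI.A0 {A : ℝ} {f : ℝ × ℝ → ℂ} (h : BI A f) : 0 ≤ A := (norm_nonneg _).trans (h.b 0)
theorem Kd.C0 {A : ℝ} {f : ℝ × ℝ → ℂ} (h : Kd A f) : 0 ≤ A :=
  nonneg_of_mul_nonneg_left ((norm_nonneg _).trans (h.b 0)) (ze_pos 0)
theorem Kd.bd {C : ℝ} {s : ℝ × ℝ → ℂ} (h : Kd C s) (z : ℝ × ℝ) : ‖s z‖ ≤ C :=
  (h.b z).trans (mul_le_of_le_one_right h.C0 (ze_le z))
theorem Kd.int {C : ℝ} {s : ℝ × ℝ → ℂ} (h : Kd C s) : Integrable s :=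
  (ze_int.const_mul C).mono' h.c.aestronglyMeasurable (.of_forall h.b)
theorem zeX_int (X : ℝ × ℝ) : Integrable (fun Y => ze (X - Y)) := ze_int.comp_sub_left X
theorem zeX_integral (X : ℝ × ℝ) : ∫ Y, ze (X - Y) = Real.pi ^ 2 := by rw [integral_sub_left_eq_self, ze_integral]
theorem sub_cont (X : ℝ × ℝ) : Continuous fun Y : ℝ × ℝ => X - Y := by fun_prop
theorem Kd.cvi {C A : ℝ} {s f : ℝ × ℝ → ℂ} (h : Kd C s) (hf : BI A f) (X : ℝ × ℝ) : Integrable (fun Y => s (X - Y) * f Y) :=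
  hf.i.bdd_mul (c := C) (h.c.comp (sub_cont X)).aestronglyMeasurable (.of_forall fun Y => h.bd _)
theorem Kd.cvb {C A : ℝ} {s f : ℝ × ℝ → ℂ} (h : Kd C s) (hf : BI A f) (X : ℝ × ℝ) : ‖cv s f X‖ ≤ C * Real.pi ^ 2 * A := by
  calc _ ≤ ∫ Y, C * ze (X - Y) * A := norm_integral_le_of_norm_le (((zeX_int X).const_mul C).mul_const A)
        (.of_forall fun Y => by rw [norm_mul]; exact mul_le_mul (h.b _) (hf.b _) (norm_nonneg _) (mul_nonneg h.C0 (ze_pos _).le))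
    _ = _ := by rw [integral_mul_const, integral_const_mul, zeX_integral]
theorem Kd.cvc {C A : ℝ} {s f : ℝ × ℝ → ℂ} (h : Kd C s) (hf : BI A f) : Continuous (cv s f) := by
  refine continuous_of_dominated (bound := fun Y => C * ‖f Y‖) (fun X => (h.cvi hf X).1) (fun X => .of_forall fun Y => ?_) (hf.i.norm.const_mul C)
    (.of_forall fun Y => (h.c.comp (by fun_prop)).mul continuous_const)
  rw [norm_mul]; exact mul_le_mul_of_nonneg_right (h.bd _) (norm_nonneg _)
theorem conv_intg {s f : ℝ × ℝ → ℂ} (hs : Integrable s) (hf : Integrable f) :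
    Integrable (fun p : (ℝ × ℝ) × (ℝ × ℝ) => s (p.1 - p.2) * f p.2) (volume.prod volume) :=
  (hf.convolution_integrand (ContinuousLinearMap.mul ℝ ℂ) hs).congr (.of_forall fun p => mul_comm _ _)
theorem Kd.cv_bi {C A : ℝ} {s f : ℝ × ℝ → ℂ} (h : Kd C s) (hf : BI A f) : BI (C * Real.pi ^ 2 * A) (cv s f) :=
  ⟨(conv_intg h.int hf.i).integral_prod_left, h.cvb hf⟩
theorem Kd.cvL1 {C A : ℝ} {s f : ℝ × ℝ → ℂ} (h : Kd C s) (hf : BI A f) : ∫ X, ‖cv s f X‖ ≤ C * Real.pi ^ 2 * ∫ Y, ‖f Y‖ := by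
  have hi := conv_intg h.int hf.i
  calc _ ≤ ∫ X, ∫ Y, ‖s (X - Y) * f Y‖ := integral_mono (h.cv_bi hf).i.norm hi.norm.integral_prod_left fun X => norm_integral_le_integral_norm _
    _ = ∫ Y, ∫ X, ‖s (X - Y) * f Y‖ := integral_integral_swap hi.norm
    _ ≤ ∫ Y, C * Real.pi ^ 2 * ‖f Y‖ := by
        refine integral_mono hi.norm.integral_prod_right (hf.i.norm.const_mul _) fun Y => ?_
        simp only [norm_mul]
        rw [integral_mul_const, integral_sub_right_eq_self (fun X => ‖s X‖)]
        refine mul_le_mul_of_nonneg_right ?_ (norm_nonneg _)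
        rw [← ze_integral, ← integral_const_mul]
        exact integral_mono h.int.norm (ze_int.const_mul C) h.b
    _ = _ := integral_const_mul _ _
theorem cv_assoc {C C' A : ℝ} {s s' f : ℝ × ℝ → ℂ} (h : Kd C s) (h' : Kd C' s') (hf : BI A f) (X : ℝ × ℝ) :
    cv s (cv s' f) X = cv (cv s s') f X := by
  unfold cv
  simp_rw [← integral_const_mul]
  rw [integral_integral_swap]
  · refine integral_congr_ae (.of_forall fun W => ?_)
    simp only
    rw [← integral_add_right_eq_self _ W, ← integral_mul_const]
    refine integral_congr_ae (.of_forall fun Y => ?_)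
    simp only [add_sub_cancel_right, sub_add_eq_sub_sub_swap]; ring
  · have := ((h.int.comp_sub_left X).mul_prod hf.i).bdd_mul (c := C') (f := fun z : (ℝ × ℝ) × (ℝ × ℝ) => s' (z.1 - z.2))
      (h'.c.comp (by fun_prop)).aestronglyMeasurable (.of_forall fun z => h'.bd _)
    refine this.congr (.of_forall fun z => ?_)
    simp only [Function.uncurry]; ring

theorem sch_V1 (σ : SchwartzMap ℝ ℂ) : ∃ C, 0 < C ∧ ∀ y, ‖σ y‖ ≤ C * V1 y := by
  obtain ⟨a, ha, h1⟩ := σ.decay 0 0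
  obtain ⟨b, hb, h2⟩ := σ.decay 2 0
  refine ⟨a + b, by positivity, fun y => ?_⟩
  have h1 := h1 y; have h2 := h2 y
  simp only [pow_zero, one_mul, norm_iteratedFDeriv_zero, Real.norm_eq_abs, sq_abs] at h1 h2
  unfold V1; rw [← div_eq_mul_inv, le_div_iff₀ (by positivity)]; linarith
theorem be_cont (k1 k2 : ℝ) (σ τ : SchwartzMap ℝ ℂ) : Continuous (be k1 k2 σ τ) := by
  have := ex_cont; have := σ.continuous; have := τ.continuous; unfold be; fun_prop
theorem be_kd (σ τ : SchwartzMap ℝ ℂ) : ∃ C, 0 < C ∧ ∀ k1 k2, Kd C (be k1 k2 σ τ) := by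
  obtain ⟨a, ha, h1⟩ := sch_V1 σ
  obtain ⟨b, hb, h2⟩ := sch_V1 τ
  refine ⟨a * b, by positivity, fun k1 k2 => ⟨be_cont _ _ _ _, fun z => ?_⟩⟩
  rw [be, norm_mul, ex_norm, one_mul, norm_mul]
  calc _ ≤ (a * V1 z.1) * (b * V1 z.2) := mul_le_mul (h1 _) (h2 _) (norm_nonneg _) (mul_nonneg ha.le (V1_pos _).le)
    _ = _ := by unfold ze; ring
theorem be_rep (k1 k2 : ℝ) (Z : ℝ × ℝ) : cv (be k1 k2 sgt sgt) (be k1 k2 sg sg) Z = be k1 k2 sg sg Z := by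
  have e : ∀ Y : ℝ × ℝ, be k1 k2 sgt sgt (Z - Y) * be k1 k2 sg sg Y = ex (k1 * Z.1 + k2 * Z.2) * ((sgt (Z.1 - Y.1) * sg Y.1) * (sgt (Z.2 - Y.2) * sg Y.2)) := fun Y => by
    unfold be
    rw [show k1 * Z.1 + k2 * Z.2 = (k1 * (Z - Y).1 + k2 * (Z - Y).2) + (k1 * Y.1 + k2 * Y.2) by simp; ring, ex_add (k1 * (Z - Y).1 + k2 * (Z - Y).2)]; simp only [Prod.fst_sub, Prod.snd_sub]; ring
  have r : ∀ x, ∫ y, sgt (x - y) * sg y = sg x := fun x => by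
    rw [← sg_rep, ← integral_sub_left_eq_self _ _ x]; simp
  unfold cv
  simp_rw [e]
  rw [integral_const_mul, Measure.volume_eq_prod, integral_prod_mul (fun y => sgt (Z.1 - y) * sg y) (fun y => sgt (Z.2 - y) * sg y), r, r, be]

/-- `h_k` -/
noncomputable def hk (f : ℝ × ℝ → ℂ) (k1 k2 : ℝ) : ℝ × ℝ → ℂ := cv (be k1 k2 sg sg) f
theorem hk_rep {A : ℝ} {f : ℝ × ℝ → ℂ} (hf : BI A f) (k1 k2 : ℝ) : hk f k1 k2 = cv (be k1 k2 sgt sgt) (hk f k1 k2) := by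
  obtain ⟨C, _, hC⟩ := be_kd sg sg
  obtain ⟨C', _, hC'⟩ := be_kd sgt sgt
  funext X
  rw [hk, cv_assoc (hC' _ _) (hC _ _) hf, funext (be_rep k1 k2)]

theorem cv_deriv {A : ℝ} {h : ℝ × ℝ → ℂ} (hh : BI A h) (k1 k2 : ℝ) (σ τ : SchwartzMap ℝ ℂ) (x y : ℝ) :
    HasDerivAt (fun y => cv (be k1 k2 σ τ) h (x, y)) (Complex.I * k2 * cv (be k1 k2 σ τ) h (x, y) + cv (be k1 k2 σ (SchwartzMap.derivCLM ℂ ℂ τ)) h (x, y)) y := by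
  obtain ⟨C, C0, hC⟩ := be_kd σ τ
  obtain ⟨C', C0', hC'⟩ := be_kd σ (SchwartzMap.derivCLM ℂ ℂ τ)
  have := hasDerivAt_integral_of_dominated_loc_of_deriv_le (μ := volume) (s := univ) (x₀ := y) (bound := fun Y => (|k2| * C + C') * ‖h Y‖)
    (F := fun y Y => be k1 k2 σ τ ((x, y) - Y) * h Y)
    (F' := fun y Y => (Complex.I * k2 * be k1 k2 σ τ ((x, y) - Y) + be k1 k2 σ (SchwartzMap.derivCLM ℂ ℂ τ) ((x, y) - Y)) * h Y)
    univ_mem (.of_forall fun y => ((hC k1 k2).cvi hh (x, y)).1) ((hC k1 k2).cvi hh (x, y))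
    (by
      have := (((hC k1 k2).cvi hh (x, y)).const_mul (Complex.I * k2)).add ((hC' k1 k2).cvi hh (x, y))
      exact (this.congr (.of_forall fun Y => by simp; ring)).1)
    (.of_forall fun Y y' _ => by
      rw [norm_mul]
      refine mul_le_mul_of_nonneg_right ((norm_add_le _ _).trans (add_le_add ?_ ((hC' k1 k2).bd _))) (norm_nonneg _)
      rw [norm_mul, norm_mul, Complex.norm_I, one_mul, Complex.norm_real]
      exact mul_le_mul_of_nonneg_left ((hC k1 k2).bd _) (abs_nonneg _))
    (hh.i.norm.const_mul _)
    (.of_forall fun Y y' _ => by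
      refine HasDerivAt.mul_const ?_ _
      have d1 : HasDerivAt (fun y : ℝ => ex (k1 * (x - Y.1) + k2 * (y - Y.2))) (ex (k1 * (x - Y.1) + k2 * (y' - Y.2)) * (k2 * Complex.I)) y' := by
        unfold ex
        have : HasDerivAt (fun y : ℝ => k1 * (x - Y.1) + k2 * (y - Y.2)) k2 y' := by
          simpa using (((hasDerivAt_id y').sub_const Y.2).const_mul k2).const_add (k1 * (x - Y.1))
        exact (this.ofReal_comp.mul_const Complex.I).cexp
      have d2 : HasDerivAt (fun y : ℝ => τ (y - Y.2)) (SchwartzMap.derivCLM ℂ ℂ τ (y' - Y.2)) y' := by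
        have := (τ.differentiable (y' - Y.2)).hasDerivAt.comp_sub_const y' Y.2
        simpa using this
      refine (d1.fun_mul (d2.const_mul (σ (x - Y.1)))).congr_deriv ?_
      simp only [be, Prod.fst_sub, Prod.snd_sub]; ring)
  refine this.2.congr_deriv ?_
  unfold cv
  rw [← integral_const_mul, ← integral_add (((hC k1 k2).cvi hh (x, y)).const_mul _) ((hC' k1 k2).cvi hh (x, y))]
  refine integral_congr_ae (.of_forall fun Y => ?_)
  simp only; ring


/-- averages along the curve -/
noncomputable def Fo (N e1 e2 : ℝ) (γ : ℝ → ℝ) (u : ℝ) (a : ℝ → ℂ) (h : ℝ × ℝ → ℂ) (X : ℝ × ℝ) : ℂ :=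
  ∫ t in (1/2:ℝ)..2, a t * h (X.1 + N * (e1 * t), X.2 + N * (e2 * u * γ t))

section
variable {N e1 e2 : ℝ} {γ : ℝ → ℝ} {a : ℝ → ℂ} {h : ℝ × ℝ → ℂ}

theorem Fo_cont (hγ : Continuous γ) (ha : Continuous a) (hh : Continuous h) :
    Continuous (fun q : ℝ × (ℝ × ℝ) => Fo N e1 e2 γ q.1 a h q.2) := by
  unfold Fo
  exact intervalIntegral.continuous_parametric_intervalIntegral_of_continuous' (by unfold Function.uncurry; fun_prop) _ _

theorem Fo_b {A : ℝ} (hh : ∀ x, ‖h x‖ ≤ A) {Ba : ℝ} (ha : ∀ t ∈ Icc (1/2:ℝ) 2, ‖a t‖ ≤ Ba) (u : ℝ) (X : ℝ × ℝ) : ‖Fo N e1 e2 γ u a h X‖ ≤ 2 * (Ba * A) := by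
  have b0 : 0 ≤ Ba := (norm_nonneg _).trans (ha 1 (by norm_num))
  have a0 : 0 ≤ A := (norm_nonneg _).trans (hh 0)
  have := intervalIntegral.norm_integral_le_of_norm_le_const (a := 1/2) (b := 2) (C := Ba * A) (f := fun t => a t * h (X.1 + N * (e1 * t), X.2 + N * (e2 * u * γ t))) (fun t ht => by
    rw [uIoc_of_le (by norm_num)] at ht
    rw [norm_mul]; exact mul_le_mul (ha t ⟨ht.1.le, ht.2⟩) (hh _) (norm_nonneg _) b0)
  refine this.trans ?_
  rw [abs_of_pos (by norm_num)]; nlinarith [mul_nonneg b0 a0]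

theorem Fo_deriv {A : ℝ} (hγ : Continuous γ) (ha : Continuous a) (hh : BI A h) (k1 k2 : ℝ) (σ τ : SchwartzMap ℝ ℂ) (X : ℝ × ℝ) (u : ℝ) :
    HasDerivAt (fun u => Fo N e1 e2 γ u a (cv (be k1 k2 σ τ) h) X)
      ((N * e2 : ℝ) * (Complex.I * k2 * Fo N e1 e2 γ u (fun t => a t * γ t) (cv (be k1 k2 σ τ) h) X +
        Fo N e1 e2 γ u (fun t => a t * γ t) (cv (be k1 k2 σ (SchwartzMap.derivCLM ℂ ℂ τ)) h) X)) u := by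
  obtain ⟨C, C0, hC⟩ := be_kd σ τ
  obtain ⟨C', C0', hC'⟩ := be_kd σ (SchwartzMap.derivCLM ℂ ℂ τ)
  set p := cv (be k1 k2 σ τ) h with hp
  set p' := cv (be k1 k2 σ (SchwartzMap.derivCLM ℂ ℂ τ)) h with hp'
  have cp : Continuous p := (hC _ _).cvc hh
  have cp' : Continuous p' := (hC' _ _).cvc hh
  set M := |k2| * (C * Real.pi ^ 2 * A) + C' * Real.pi ^ 2 * A
  have hc : ∀ u, Continuous fun t => a t * p (X.1 + N * (e1 * t), X.2 + N * (e2 * u * γ t)) := fun u => by fun_prop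
  have := intervalIntegral.hasDerivAt_integral_of_dominated_loc_of_deriv_le (μ := volume) (s := univ) (x₀ := u) (a := 1/2) (b := 2)
    (bound := fun t => ‖a t‖ * (|N * e2| * |γ t| * M))
    (F := fun u t => a t * p (X.1 + N * (e1 * t), X.2 + N * (e2 * u * γ t)))
    (F' := fun u t => a t * ((N * (e2 * γ t) : ℝ) * (Complex.I * k2 * p (X.1 + N * (e1 * t), X.2 + N * (e2 * u * γ t)) + p' (X.1 + N * (e1 * t), X.2 + N * (e2 * u * γ t)))))
    univ_mem (.of_forall fun u => (hc u).aestronglyMeasurable) ((hc u).intervalIntegrable _ _)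
    (Continuous.aestronglyMeasurable (by fun_prop))
    (.of_forall fun t _ v _ => by
      rw [norm_mul, norm_mul]
      refine mul_le_mul_of_nonneg_left (mul_le_mul (le_of_eq ?_) ?_ (norm_nonneg _) (by positivity)) (norm_nonneg _)
      · rw [Complex.norm_real, Real.norm_eq_abs, ← abs_mul]; ring_nf
      · refine (norm_add_le _ _).trans (add_le_add ?_ ((hC' k1 k2).cvb hh _))
        rw [norm_mul, norm_mul, Complex.norm_I, one_mul, Complex.norm_real]
        exact mul_le_mul_of_nonneg_left ((hC k1 k2).cvb hh _) (abs_nonneg _))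
    (Continuous.intervalIntegrable (by fun_prop) _ _)
    (.of_forall fun t _ v _ => by
      refine HasDerivAt.const_mul _ ?_
      have d : HasDerivAt (fun v : ℝ => X.2 + N * (e2 * v * γ t)) (N * (e2 * γ t)) v := by
        have := ((((hasDerivAt_id v).const_mul e2).mul_const (γ t)).const_mul N).const_add X.2
        simpa using this
      have := HasDerivAt.scomp v (cv_deriv hh k1 k2 σ τ (X.1 + N * (e1 * t)) (X.2 + N * (e2 * v * γ t))) d
      rw [Complex.real_smul] at this
      exact this)
  refine this.2.congr_deriv ?_
  unfold Fo
  rw [← intervalIntegral.integral_const_mul, ← intervalIntegral.integral_add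
    (Continuous.intervalIntegrable (by fun_prop) _ _) (Continuous.intervalIntegrable (by fun_prop) _ _), ← intervalIntegral.integral_const_mul]
  refine intervalIntegral.integral_congr fun t _ => ?_
  simp only; push_cast; ring

theorem Fo_ker {A : ℝ} (hN : N ≠ 0) (hγ : Continuous γ) (ha : Continuous a) (hh : BI A h) (k1 k2 : ℝ) (σ τ : SchwartzMap ℝ ℂ) (X : ℝ × ℝ) (u : ℝ) :
    Fo N e1 e2 γ u a (cv (be k1 k2 σ τ) h) X = ∫ Y, ((N ^ 2)⁻¹ : ℝ) * KK (1/2) 2 N (k1 / N) (k2 / N) (fun t => e1 * t) (fun t => e2 * u * γ t) a σ τ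
      ((X.1 - Y.1) / N) ((X.2 - Y.2) / N) * h Y := by
  obtain ⟨C, C0, hC⟩ := be_kd σ τ
  have e : ∀ (Y : ℝ × ℝ) t, ((N ^ 2)⁻¹ : ℝ) * EE N (k1 / N) (k2 / N) σ τ ((X.1 - Y.1) / N + e1 * t) ((X.2 - Y.2) / N + e2 * u * γ t) =
      be k1 k2 σ τ ((X.1 + N * (e1 * t), X.2 + N * (e2 * u * γ t)) - Y) := fun Y t => by
    have h1 : ∀ x y s : ℝ, N * ((x - y) / N + s) = x + N * s - y := fun x y s => by field_simp; ring
    unfold EE be ex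
    rw [h1, h1]
    have : N ^ 2 * (k1 / N * ((X.1 - Y.1) / N + e1 * t) + k2 / N * ((X.2 - Y.2) / N + e2 * u * γ t)) =
      k1 * ((X.1 + N * (e1 * t), X.2 + N * (e2 * u * γ t)) - Y).1 + k2 * ((X.1 + N * (e1 * t), X.2 + N * (e2 * u * γ t)) - Y).2 := by
      simp only [Prod.fst_sub, Prod.snd_sub]; field_simp; ring
    rw [this]
    have hN' : (N:ℂ) ≠ 0 := by exact_mod_cast hN
    simp only [Prod.fst_sub, Prod.snd_sub]; push_cast; field_simp
  unfold Fo KK cv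
  simp_rw [← intervalIntegral.integral_const_mul, ← intervalIntegral.integral_mul_const, intervalIntegral.integral_of_le (by norm_num : (1/2:ℝ) ≤ 2), ← integral_const_mul]
  rw [integral_integral_swap]
  · refine integral_congr_ae (.of_forall fun Y => integral_congr_ae (.of_forall fun t => ?_))
    simp only
    rw [← e]; ring
  · have hai : Integrable a (volume.restrict (Ioc (1/2:ℝ) 2)) := (ha.integrableOn_Icc (a := 1/2) (b := 2)).mono_set Ioc_subset_Icc_self
    have := (hai.mul_prod hh.i).bdd_mul (c := C) (f := fun z : ℝ × (ℝ × ℝ) => be k1 k2 σ τ ((X.1 + N * (e1 * z.1), X.2 + N * (e2 * u * γ z.1)) - z.2))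
      ((be_cont k1 k2 σ τ).comp (by fun_prop)).aestronglyMeasurable (.of_forall fun z => (hC k1 k2).bd _)
    refine this.congr (.of_forall fun z => ?_)
    simp only [Function.uncurry]; ring
end

theorem lin_int {χ ψ E : ℝ → ℂ} {c n : ℂ} (h1 : Continuous χ) (h2 : Continuous ψ) (h3 : Continuous E) {x y : ℝ} :
    ∫ t in x..y, (n * (ψ t - c * χ t)) * E t = n * ((∫ t in x..y, ψ t * E t) - c * ∫ t in x..y, χ t * E t) := by
  rw [← intervalIntegral.integral_const_mul, ← intervalIntegral.integral_sub (Continuous.intervalIntegrable (by fun_prop) _ _)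
    (Continuous.intervalIntegrable (by fun_prop) _ _), ← intervalIntegral.integral_const_mul]
  refine intervalIntegral.integral_congr fun t _ => ?_
  ring

namespace Ix
variable {T m B s : ℝ}
/-- mass near the centre -/
noncomputable def S (i : Ix T m B s) (h : ℝ × ℝ → ℂ) (X : ℝ × ℝ) : ℝ :=
  ∫ Y, ze (X + (i.N * (-i.ε * i.tc), i.N * (i.ε * i.u * i.g 0 i.tc)) - Y) * ‖h Y‖

theorem ker_b (i : Ix T m B s) {h : ℝ × ℝ → ℂ} {A : ℝ} (hh : BI A h) {K : ℝ → ℝ → ℂ} {C : ℝ} (hK : ∀ z1 z2, ‖K z1 z2‖ ≤ C * i.N * i.V z1 z2) (X : ℝ × ℝ) :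
    ‖∫ Y, ((i.N ^ 2)⁻¹ : ℝ) * K ((X.1 - Y.1) / i.N) ((X.2 - Y.2) / i.N) * h Y‖ ≤ C * i.N⁻¹ * i.S h X := by
  have hN : i.N ≠ 0 := by linarith [i.hN]
  have N0 : 0 < i.N := by linarith [i.hN]
  unfold S
  rw [← integral_const_mul]
  refine norm_integral_le_of_norm_le ?_ (.of_forall fun Y => ?_)
  · refine Integrable.const_mul (hh.i.norm.bdd_mul (c := 1) (ze_cont.comp (sub_cont _)).aestronglyMeasurable (.of_forall fun Y => ?_)) _
    rw [Function.comp_apply, Real.norm_of_nonneg (ze_pos _).le]; exact ze_le _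
  · rw [norm_mul, norm_mul, Complex.norm_real, Real.norm_of_nonneg (by positivity)]
    have h1 : ∀ x y s : ℝ, i.N * ((x - y) / i.N + s) = x + i.N * s - y := fun x y s => by field_simp; ring
    have := hK ((X.1 - Y.1) / i.N) ((X.2 - Y.2) / i.N)
    unfold V at this
    rw [h1, h1] at this
    calc _ ≤ (i.N ^ 2)⁻¹ * (C * i.N * ze (X + (i.N * (-i.ε * i.tc), i.N * (i.ε * i.u * i.g 0 i.tc)) - Y)) * ‖h Y‖ := by
          gcongr; exact this
      _ = _ := by field_simp

set_option maxHeartbeats 1000000 in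
theorem Fb (T m B s : ℝ) {χ : ℝ → ℂ} (hχ : UB (ι := Unit) (1/2) 2 True 6 (fun _ => χ)) (hc : Continuous χ) :
    ∃ C, 0 < C ∧ ∀ (i : Ix T m B s) (hg : Continuous (i.g 0)) (k1 k2 : ℝ), k1 = i.N * i.κ1 → k2 = i.N * i.κ2 → ∀ {A} {f : ℝ × ℝ → ℂ}, BI A f → ∀ X,
      ‖Fo i.N (-i.ε) i.ε (i.g 0) i.u χ (hk f k1 k2) X‖ ≤ C * i.N⁻¹ * i.S (hk f k1 k2) X ∧
      ∃ dF : ℝ → ℂ, Continuous dF ∧ (∀ u, HasDerivAt (fun u => Fo i.N (-i.ε) i.ε (i.g 0) u χ (hk f k1 k2) X) (dF u) u) ∧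
        ‖dF i.u - Complex.I * (i.ε * i.N * k2 * i.g 0 i.tc : ℝ) * Fo i.N (-i.ε) i.ε (i.g 0) i.u χ (hk f k1 k2) X‖ ≤ C * i.S (hk f k1 k2) X := by
  obtain ⟨C, C0, hC⟩ := bounds T m B s hχ sgt sgt
  obtain ⟨C', C0', hC'⟩ := bounds T m B s hχ sgt (SchwartzMap.derivCLM ℂ ℂ sgt)
  obtain ⟨D, D0, hD⟩ := be_kd sg sg
  obtain ⟨D1, D10, hD1⟩ := be_kd sgt sgt
  obtain ⟨D2, D20, hD2⟩ := be_kd sgt (SchwartzMap.derivCLM ℂ ℂ sgt)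
  refine ⟨4 * C + C' + 1, by positivity, fun i hg k1 k2 e1 e2 A f hf X => ?_⟩
  have N0 : 0 < i.N := by linarith [i.hN]
  have hN : i.N ≠ 0 := N0.ne'
  have q1 : k1 / i.N = i.κ1 := by rw [e1]; field_simp
  have q2 : k2 / i.N = i.κ2 := by rw [e2]; field_simp
  have hb : BI _ (hk f k1 k2) := (hD k1 k2).cv_bi hf
  set h := hk f k1 k2 with hh
  have hr : h = cv (be k1 k2 sgt sgt) h := hk_rep hf k1 k2
  have S0 : 0 ≤ i.S h X := integral_nonneg fun Y => mul_nonneg (ze_pos _).le (norm_nonneg _)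
  have cg : Continuous fun t => χ t * (i.g 0 t : ℂ) := by fun_prop
  have k1e := fun u => Fo_ker (e1 := -i.ε) (e2 := i.ε) hN hg hc hb k1 k2 sgt sgt X u
  have k2e := fun u => Fo_ker (e1 := -i.ε) (e2 := i.ε) hN hg cg hb k1 k2 sgt sgt X u
  have k3e := fun u => Fo_ker (e1 := -i.ε) (e2 := i.ε) hN hg cg hb k1 k2 sgt (SchwartzMap.derivCLM ℂ ℂ sgt) X u
  rw [← hr, q1, q2] at k1e k2e
  rw [q1, q2] at k3e
  have b1 := i.ker_b hb (fun z1 z2 => (hC i z1 z2).1) X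
  have b3 := i.ker_b hb (fun z1 z2 => (hC' i z1 z2).2.1) X
  have b2 := i.ker_b hb (fun z1 z2 => (hC i z1 z2).2.2) X
  have sub : (i.N : ℂ) * (Fo i.N (-i.ε) i.ε (i.g 0) i.u (fun t => χ t * i.g 0 t) h X - i.g 0 i.tc * Fo i.N (-i.ε) i.ε (i.g 0) i.u χ h X) =
      ∫ Y, ((i.N ^ 2)⁻¹ : ℝ) * ((i.N : ℂ) * (i.K (fun t => χ t * i.g 0 t) sgt sgt ((X.1 - Y.1) / i.N) ((X.2 - Y.2) / i.N) -
        i.g 0 i.tc * i.K χ sgt sgt ((X.1 - Y.1) / i.N) ((X.2 - Y.2) / i.N))) * h Y := by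
    have L := fun (E : ℝ → ℂ) (hE : Continuous E) => lin_int (x := 1/2) (y := 2) (c := i.g 0 i.tc) (n := i.N) hc cg hE
    have cA : Continuous fun t => (i.N : ℂ) * (χ t * i.g 0 t - i.g 0 i.tc * χ t) := by fun_prop
    have hcont : Continuous h := (hD k1 k2).cvc hf
    have := Fo_ker (e1 := -i.ε) (e2 := i.ε) hN hg cA hb k1 k2 sgt sgt X i.u
    rw [← hr, q1, q2] at this
    rw [Fo, Fo, ← L _ (by fun_prop), ← Fo, this]
    refine integral_congr_ae (.of_forall fun Y => ?_)
    simp only [K, KK]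
    have := L _ ((EE_cont i.N i.κ1 i.κ2 sgt sgt).comp (by fun_prop : Continuous fun t : ℝ => ((X.1 - Y.1) / i.N + -i.ε * t, (X.2 - Y.2) / i.N + i.ε * i.u * i.g 0 t)))
    simp only [Function.comp_apply] at this
    rw [this]
  refine ⟨?_, _, ?_, fun u => by rw [hr]; exact Fo_deriv hg hc hb k1 k2 sgt sgt X u, ?_⟩
  · rw [k1e]
    exact b1.trans (by gcongr; linarith)
  · have := fun p (hp : Continuous p) => (Fo_cont (N := i.N) (e1 := -i.ε) (e2 := i.ε) hg cg hp).comp (by fun_prop : Continuous fun u : ℝ => (u, X))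
    have h1 := this _ ((hD1 k1 k2).cvc hb)
    have h2 := this _ ((hD2 k1 k2).cvc hb)
    simp only [Function.comp_def] at h1 h2
    fun_prop
  · rw [← hr, show ∀ a b c : ℂ, (i.N * i.ε : ℝ) * (Complex.I * k2 * a + b) - Complex.I * (i.ε * i.N * k2 * i.g 0 i.tc : ℝ) * c =
      (i.ε * (Complex.I * k2)) * (i.N * (a - i.g 0 i.tc * c)) + i.ε * i.N * b by intro a b c; push_cast; ring, sub, k3e]
    have hε : ‖(i.ε : ℂ)‖ = 1 := by rcases i.hε with h | h <;> simp [h]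
    refine (norm_add_le _ _).trans ?_
    rw [norm_mul, norm_mul (_ * _), norm_mul (i.ε : ℂ), norm_mul (i.ε : ℂ), hε, norm_mul, Complex.norm_I, Complex.norm_real, Complex.norm_real]
    have hk2 : ‖k2‖ ≤ 4 * i.N := by
      rw [e2, Real.norm_of_nonneg (mul_nonneg N0.le (by linarith [i.hκ2.1]))]; nlinarith [i.hκ2.2]
    rw [Real.norm_of_nonneg N0.le]
    simp only [one_mul]
    calc _ ≤ 4 * i.N * (C * i.N⁻¹ * i.S h X) + i.N * (C' * i.N⁻¹ * i.S h X) := 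
          add_le_add (mul_le_mul hk2 b2 (norm_nonneg _) (by positivity)) (mul_le_mul_of_nonneg_left b3 N0.le)
      _ = (4 * C + C') * i.S h X := by field_simp
      _ ≤ _ := mul_le_mul_of_nonneg_right (by linarith) S0
end Ix


theorem ex_deriv (m x : ℝ) : HasDerivAt (fun x => ex (m * x)) (Complex.I * m * ex (m * x)) x := by
  unfold ex
  have h : HasDerivAt (fun x : ℝ => ((m * x : ℝ) : ℂ) * Complex.I) (m * Complex.I) x := by
    have := ((hasDerivAt_id x).const_mul m).ofReal_comp.mul_const Complex.I
    simpa using this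
  exact h.cexp.congr_deriv (by ring)

theorem ex_ibp {f f' : ℝ → ℝ} (hd : ∀ x, HasDerivAt f (f' x) x) (hf' : Continuous f') (h0 : ∀ x, |f x| ≤ 6 * V1 x)
    (h1 : ∀ x, |f' x| ≤ 6 * V1 x) (m : ℝ) : Complex.I * m * ∫ x, ex (m * x) * f x = - ∫ x, ex (m * x) * f' x := by
  have hf : Continuous f := continuous_iff_continuousAt.2 fun x => (hd x).continuousAt
  have i1 := ex_mul_int (int_of_V1 hf h0).ofReal (p := fun x => m * x) (by fun_prop)
  have i2 := ex_mul_int (int_of_V1 hf' h1).ofReal (p := fun x => m * x) (by fun_prop)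
  have := integral_mul_deriv_eq_deriv_mul_of_integrable (u := fun y => ex (m * y)) (v := fun y => (f y : ℂ))
    (u' := fun y => Complex.I * m * ex (m * y)) (v' := fun y => (f' y : ℂ)) (fun y _ => ex_deriv m y) (fun y _ => (hd y).ofReal_comp)
    i2 ((i1.const_mul (Complex.I * m)).congr (.of_forall fun x => by simp only [Pi.mul_apply]; exact (mul_assoc _ _ _).symm)) i1
  rw [this, neg_neg, ← integral_const_mul]; simp only [mul_assoc]

theorem V1_hat (m : ℝ) : ‖∫ x, ex (m * x) * V1 x‖ ≤ 7 * Real.pi * V1 m := by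
  have a1 := ex_ibp V1_deriv V1d_cont V1_le6 V1d_le m
  have a2 := ex_ibp V1d_deriv V1dd_cont V1d_le V1dd_le m
  have b1 : ‖∫ x, ex (m * x) * V1 x‖ ≤ Real.pi := by
    rw [← V1_integral]
    refine norm_integral_le_of_norm_le V1_int (.of_forall fun x => ?_)
    rw [norm_mul, ex_norm, one_mul, Complex.norm_real, Real.norm_of_nonneg (V1_pos x).le]
  have b2 : ‖∫ x, ex (m * x) * V1dd x‖ ≤ 6 * Real.pi := by
    rw [← V1_integral, ← integral_const_mul]
    refine norm_integral_le_of_norm_le (V1_int.const_mul 6) (.of_forall fun x => ?_)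
    rw [norm_mul, ex_norm, one_mul, Complex.norm_real]; exact V1dd_le x
  have e : (∫ x, ex (m * x) * V1dd x) = -(m ^ 2 : ℝ) * ∫ x, ex (m * x) * V1 x := by
    push_cast
    linear_combination a2 - Complex.I * m * a1 + (m:ℂ)^2 * (∫ x, ex (m * x) * V1 x) * Complex.I_sq
  rw [e, norm_mul, norm_neg, Complex.norm_real, Real.norm_of_nonneg (by positivity)] at b2
  rw [V1, ← div_eq_mul_inv, le_div_iff₀ (by positivity)]; linarith

theorem ze_hat (m n : ℝ) : ‖∫ z : ℝ × ℝ, ex (m * z.1 + n * z.2) * ze z‖ ≤ 49 * Real.pi ^ 2 * (V1 m * V1 n) := by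
  have : (∫ z : ℝ × ℝ, ex (m * z.1 + n * z.2) * ze z) = (∫ x, ex (m * x) * V1 x) * ∫ x, ex (n * x) * V1 x := by
    rw [Measure.volume_eq_prod, ← integral_prod_mul]
    refine integral_congr_ae (.of_forall fun z => ?_)
    simp only [ze, ex_add]; push_cast; ring
  rw [this, norm_mul]
  calc _ ≤ (7 * Real.pi * V1 m) * (7 * Real.pi * V1 n) := mul_le_mul (V1_hat m) (V1_hat n) (norm_nonneg _) (mul_nonneg (by positivity) (V1_pos _).le)
    _ = _ := by ring

/-- trigonometric polynomial -/
noncomputable def tp (S : Finset (ℤ × ℤ)) (a : ℤ × ℤ → ℂ) (z : ℝ × ℝ) : ℂ := ∑ k ∈ S, a k * ex (k.1 * z.1 + k.2 * z.2)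

theorem tp_cont (S : Finset (ℤ × ℤ)) (a : ℤ × ℤ → ℂ) : Continuous (tp S a) := by
  have := ex_cont; unfold tp; fun_prop

theorem tp_b (S : Finset (ℤ × ℤ)) (a : ℤ × ℤ → ℂ) (z : ℝ × ℝ) : ‖tp S a z‖ ≤ ∑ k ∈ S, ‖a k‖ :=
  (norm_sum_le _ _).trans (Finset.sum_le_sum fun k _ => by rw [norm_mul, ex_norm, mul_one])

theorem V1sq_sum (S : Finset (ℤ × ℤ)) (k : ℤ × ℤ) : ∑ k' ∈ S, V1 ((k'.1 - k.1 : ℤ) : ℝ) * V1 ((k'.2 - k.2 : ℤ) : ℝ) ≤ 16 * Real.pi ^ 2 := by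
  classical
  have h1 := sumV1 one_pos le_rfl (S.image Prod.fst) k.1
  have h2 := sumV1 one_pos le_rfl (S.image Prod.snd) k.2
  simp only [one_mul] at h1 h2
  calc _ ≤ ∑ k' ∈ (S.image Prod.fst) ×ˢ (S.image Prod.snd), V1 ((k'.1 - k.1 : ℤ) : ℝ) * V1 ((k'.2 - k.2 : ℤ) : ℝ) := by
        refine Finset.sum_le_sum_of_subset_of_nonneg (fun x hx => ?_) fun x _ _ => mul_nonneg (V1_pos _).le (V1_pos _).le
        exact Finset.mem_product.2 ⟨Finset.mem_image_of_mem _ hx, Finset.mem_image_of_mem _ hx⟩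
    _ = (∑ m ∈ S.image Prod.fst, V1 ((m - k.1 : ℤ) : ℝ)) * ∑ m ∈ S.image Prod.snd, V1 ((m - k.2 : ℤ) : ℝ) := by
        rw [Finset.sum_mul_sum, Finset.sum_product]
    _ ≤ (4 * Real.pi / 1) * (4 * Real.pi / 1) := mul_le_mul h1 h2 (Finset.sum_nonneg fun _ _ => (V1_pos _).le) (by positivity)
    _ = _ := by ring

theorem tp_L2 (S : Finset (ℤ × ℤ)) (a : ℤ × ℤ → ℂ) : ∫ z, ze z * ‖tp S a z‖ ^ 2 ≤ 784 * Real.pi ^ 4 * ∑ k ∈ S, ‖a k‖ ^ 2 := by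
  have e : ∀ z, ((ze z * ‖tp S a z‖ ^ 2 : ℝ) : ℂ) = ∑ k ∈ S, ∑ k' ∈ S, a k * (starRingEnd ℂ) (a k') * (ex (((k.1 - k'.1 : ℤ):ℝ) * z.1 + ((k.2 - k'.2 : ℤ) : ℝ) * z.2) * ze z) := by
    intro z
    have : (((‖tp S a z‖ ^ 2 : ℝ)) : ℂ) = tp S a z * (starRingEnd ℂ) (tp S a z) := by rw [Complex.mul_conj, Complex.normSq_eq_norm_sq]
    rw [Complex.ofReal_mul, this]; unfold tp
    rw [map_sum, Finset.sum_mul_sum, Finset.mul_sum]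
    refine Finset.sum_congr rfl fun k _ => ?_
    rw [Finset.mul_sum]
    refine Finset.sum_congr rfl fun k' _ => ?_
    rw [map_mul, ex_star, show ((k.1 - k'.1 : ℤ):ℝ) * z.1 + ((k.2 - k'.2 : ℤ) : ℝ) * z.2 = (k.1 * z.1 + k.2 * z.2) + -(k'.1 * z.1 + k'.2 * z.2) by push_cast; ring, ex_add _ (-_)]; ring
  have i0 : ∀ m n : ℝ, Integrable fun z : ℝ × ℝ => ex (m * z.1 + n * z.2) * (ze z : ℂ) := fun m n =>
    ex_int2 ze_int.ofReal (by fun_prop)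
  have h1 : ((∫ z, ze z * ‖tp S a z‖ ^ 2 : ℝ) : ℂ) = ∑ k ∈ S, ∑ k' ∈ S, a k * (starRingEnd ℂ) (a k') *
      ∫ z : ℝ × ℝ, ex (((k.1 - k'.1 : ℤ):ℝ) * z.1 + ((k.2 - k'.2 : ℤ) : ℝ) * z.2) * ze z := by
    rw [← integral_complex_ofReal]; simp_rw [e]
    rw [integral_finsetSum _ fun k _ => integrable_finsetSum _ fun k' _ => (i0 _ _).const_mul _]
    refine Finset.sum_congr rfl fun k _ => ?_
    rw [integral_finsetSum _ fun k' _ => (i0 _ _).const_mul _]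
    simp only [integral_const_mul]
  have h2 : (∫ z, ze z * ‖tp S a z‖ ^ 2) = ‖((∫ z, ze z * ‖tp S a z‖ ^ 2 : ℝ) : ℂ)‖ := by
    rw [Complex.norm_real, Real.norm_of_nonneg (integral_nonneg fun z => mul_nonneg (ze_pos z).le (by positivity))]
  set v : ℤ × ℤ → ℤ × ℤ → ℝ := fun k k' => V1 ((k'.1 - k.1 : ℤ) : ℝ) * V1 ((k'.2 - k.2 : ℤ) : ℝ) with hv
  have v0 : ∀ k k', 0 ≤ v k k' := fun k k' => mul_nonneg (V1_pos _).le (V1_pos _).le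
  have vs : ∀ k k', v k k' = v k' k := fun k k' => by
    simp only [hv]; rw [← V1_even, ← V1_even ((k'.2 - k.2 : ℤ) : ℝ)]; push_cast; simp
  rw [h2, h1]
  calc _ ≤ ∑ k ∈ S, ∑ k' ∈ S, (49 * Real.pi ^ 2 / 2) * (‖a k‖ ^ 2 * v k k' + ‖a k'‖ ^ 2 * v k' k) := by
        refine (norm_sum_le _ _).trans (Finset.sum_le_sum fun k _ => (norm_sum_le _ _).trans (Finset.sum_le_sum fun k' _ => ?_))
        rw [norm_mul, norm_mul, RCLike.norm_conj]
        refine (mul_le_mul_of_nonneg_left (ze_hat _ _) (by positivity)).trans ?_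
        change _ * (_ * v k' k) ≤ _
        rw [vs k k']
        have : ‖a k‖ * ‖a k'‖ ≤ (‖a k‖ ^ 2 + ‖a k'‖ ^ 2) / 2 := by nlinarith [sq_nonneg (‖a k‖ - ‖a k'‖)]
        have h3 : 0 ≤ 49 * Real.pi ^ 2 * v k' k := mul_nonneg (by positivity) (v0 _ _)
        nlinarith [mul_le_mul_of_nonneg_right this h3]
    _ = 49 * Real.pi ^ 2 * ∑ k ∈ S, ‖a k‖ ^ 2 * ∑ k' ∈ S, v k k' := by
        simp_rw [← Finset.mul_sum, Finset.sum_add_distrib]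
        rw [Finset.sum_comm (f := fun k k' => ‖a k'‖ ^ 2 * v k' k)]
        simp_rw [← Finset.mul_sum]; ring
    _ ≤ 49 * Real.pi ^ 2 * ∑ k ∈ S, ‖a k‖ ^ 2 * (16 * Real.pi ^ 2) := by
        gcongr with k hk; exact V1sq_sum S k
    _ = _ := by rw [← Finset.sum_mul]; ring

/-- Bessel-type inequality -/
theorem bessel : ∃ C, 0 < C ∧ ∀ (S : Finset (ℤ × ℤ)) {A : ℝ} {f : ℝ × ℝ → ℂ}, BI A f → ∀ X,
    ∑ k ∈ S, ‖hk f k.1 k.2 X‖ ^ 2 ≤ C * A * ∫ Y, ze (X - Y) * ‖f Y‖ := by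
  obtain ⟨D, D0, hD⟩ := be_kd sg sg
  set E := 784 * Real.pi ^ 4 with hE
  have E0 : 0 < E := by positivity
  refine ⟨D ^ 2 * E, by positivity, fun S A f hf X => ?_⟩
  set a : ℤ × ℤ → ℂ := fun k => (starRingEnd ℂ) (hk f k.1 k.2 X)
  set P := tp S a with hP
  have e : ((∑ k ∈ S, ‖hk f k.1 k.2 X‖ ^ 2 : ℝ) : ℂ) = ∫ Y, be 0 0 sg sg (X - Y) * f Y * P (X - Y) := by
    have : ∀ Y, be 0 0 sg sg (X - Y) * f Y * P (X - Y) = ∑ k ∈ S, a k * (be k.1 k.2 sg sg (X - Y) * f Y) := fun Y => by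
      rw [hP, tp, Finset.mul_sum]
      refine Finset.sum_congr rfl fun k _ => ?_
      unfold be; simp only [zero_mul, add_zero, ex_zero]; ring
    simp_rw [this]
    rw [integral_finsetSum _ fun k _ => ((hD _ _).cvi hf X).const_mul _]
    push_cast
    refine Finset.sum_congr rfl fun k _ => ?_
    rw [integral_const_mul, ← cv, ← hk, mul_comm, Complex.mul_conj, Complex.normSq_eq_norm_sq]; push_cast; rfl
  set B := ∑ k ∈ S, ‖hk f k.1 k.2 X‖ ^ 2 with hB
  have B0 : 0 ≤ B := Finset.sum_nonneg fun _ _ => by positivity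
  have iz : Integrable fun Y => ze (X - Y) * ‖f Y‖ := hf.i.norm.bdd_mul (c := 1) (ze_cont.comp (sub_cont _)).aestronglyMeasurable (.of_forall fun Y => by
    rw [Real.norm_of_nonneg (ze_pos _).le]; exact ze_le _)
  have ip0 : Integrable fun Z => ze Z * ‖P Z‖ ^ 2 := by
    refine ze_int.mul_bdd (c := (∑ k ∈ S, ‖a k‖) ^ 2) ((tp_cont S a).norm.pow 2).aestronglyMeasurable (.of_forall fun Z => ?_)
    rw [norm_pow, norm_norm]; exact pow_le_pow_left₀ (norm_nonneg _) (tp_b S a Z) 2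
  have ip : Integrable fun Y => ze (X - Y) * ‖P (X - Y)‖ ^ 2 := ip0.comp_sub_left X
  have L : ∫ Y, ze (X - Y) * ‖P (X - Y)‖ ^ 2 ≤ E * B := by
    rw [integral_sub_left_eq_self (fun Z => ze Z * ‖P Z‖ ^ 2) volume X]
    refine (tp_L2 S a).trans_eq ?_
    simp only [a, RCLike.norm_conj]; rfl
  have key : B ≤ D ^ 2 * E / 2 * A * (∫ Y, ze (X - Y) * ‖f Y‖) + 1 / (2 * E) * ∫ Y, ze (X - Y) * ‖P (X - Y)‖ ^ 2 := by
    have : B = ‖(B : ℂ)‖ := by rw [Complex.norm_real, Real.norm_of_nonneg B0]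
    rw [this, e, ← integral_const_mul, ← integral_const_mul, ← integral_add (iz.const_mul _) (ip.const_mul _)]
    refine norm_integral_le_of_norm_le ((iz.const_mul _).add (ip.const_mul _)) (.of_forall fun Y => ?_)
    rw [norm_mul, norm_mul]
    have h1 := (hD 0 0).b (X - Y)
    have h2 := hf.b Y
    have z0 := ze_pos (X - Y)
    set x := ‖f Y‖; set y := ‖P (X - Y)‖; set z := ze (X - Y)
    have x0 : 0 ≤ x := norm_nonneg _
    have y0 : 0 ≤ y := norm_nonneg _
    have h3 : D * (x * y) ≤ D ^ 2 * E / 2 * A * x + 1 / (2 * E) * y ^ 2 := by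
      have a1 : D ^ 2 * E / 2 * (x * x) ≤ D ^ 2 * E / 2 * (A * x) := by gcongr
      have a2 : 0 ≤ 1 / (2 * E) * (D * E * x - y) ^ 2 := by positivity
      have a3 : 1 / (2 * E) * (D * E * x - y) ^ 2 = D ^ 2 * E / 2 * (x * x) - D * (x * y) + 1 / (2 * E) * y ^ 2 := by field_simp; ring
      linarith
    calc _ ≤ D * z * x * y := by gcongr
      _ = z * (D * (x * y)) := by ring
      _ ≤ z * (D ^ 2 * E / 2 * A * x + 1 / (2 * E) * y ^ 2) := mul_le_mul_of_nonneg_left h3 z0.le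
      _ = _ := by ring
  have : 1 / (2 * E) * (∫ Y, ze (X - Y) * ‖P (X - Y)‖ ^ 2) ≤ B / 2 := by
    calc _ ≤ 1 / (2 * E) * (E * B) := by gcongr
      _ = _ := by field_simp
  linarith


/-- oscillating functions -/
structure OS (N K : ℝ) (F : ℝ → ℂ) (ω e : ℝ → ℝ) : Prop where
  d : ∃ dF : ℝ → ℂ, ContinuousOn dF (Icc (1/2) 3) ∧ ∀ u ∈ Icc (1/2:ℝ) 3, HasDerivAt F (dF u) u ∧ ‖dF u - Complex.I * ω u * F u‖ ≤ K * N * e u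
  w : ∃ dw : ℝ → ℝ, ContinuousOn dw (Icc (1/2) 3) ∧ ∀ u ∈ Icc (1/2:ℝ) 3, HasDerivAt ω (dw u) u ∧ |dw u| ≤ K * N ^ 2
  b : ∀ u ∈ Icc (1/2:ℝ) 3, ‖F u‖ ≤ e u

namespace OS
variable {N K K' : ℝ} {F F' : ℝ → ℂ} {ω ω' e e' : ℝ → ℝ}
theorem mul (h : OS N K F ω e) (h' : OS N K' F' ω' e') : OS N (K + K') (fun u => F u * F' u) (fun u => ω u + ω' u) (fun u => e u * e' u) := by
  obtain ⟨⟨d, dc, hd⟩, ⟨w, wc, hw⟩, b⟩ := h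
  obtain ⟨⟨d', dc', hd'⟩, ⟨w', wc', hw'⟩, b'⟩ := h'
  refine ⟨⟨fun u => d u * F' u + F u * d' u, ?_, fun u hu => ⟨(hd u hu).1.fun_mul (hd' u hu).1, ?_⟩⟩,
    ⟨fun u => w u + w' u, wc.add wc', fun u hu => ⟨(hw u hu).1.fun_add (hw' u hu).1, ?_⟩⟩, fun u hu => ?_⟩
  · exact (dc.mul fun u hu => (hd' u hu).1.continuousAt.continuousWithinAt).add (ContinuousOn.mul (fun u hu => (hd u hu).1.continuousAt.continuousWithinAt) dc')
  · have e0 : d u * F' u + F u * d' u - Complex.I * (ω u + ω' u : ℝ) * (F u * F' u) =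
      (d u - Complex.I * ω u * F u) * F' u + F u * (d' u - Complex.I * ω' u * F' u) := by push_cast; ring
    rw [e0]
    refine (norm_add_le _ _).trans ?_
    rw [norm_mul, norm_mul]
    have h1 := mul_le_mul (hd u hu).2 (b' u hu) (norm_nonneg _) ((norm_nonneg _).trans (hd u hu).2)
    have h2 := mul_le_mul (b u hu) (hd' u hu).2 (norm_nonneg _) ((norm_nonneg _).trans (b u hu))
    linarith
  · exact (abs_add_le _ _).trans (by linarith [(hw u hu).2, (hw' u hu).2])
  · rw [norm_mul]; exact mul_le_mul (b u hu) (b' u hu) (norm_nonneg _) ((norm_nonneg _).trans (b u hu))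

theorem conj (h : OS N K F ω e) : OS N K (fun u => (starRingEnd ℂ) (F u)) (fun u => - ω u) e := by
  obtain ⟨⟨d, dc, hd⟩, ⟨w, wc, hw⟩, b⟩ := h
  refine ⟨⟨fun u => (starRingEnd ℂ) (d u), Complex.continuous_conj.comp_continuousOn dc, fun u hu => ⟨(hd u hu).1.star, ?_⟩⟩,
    ⟨fun u => - w u, wc.neg, fun u hu => ⟨(hw u hu).1.neg, by rw [abs_neg]; exact (hw u hu).2⟩⟩, fun u hu => by rw [RCLike.norm_conj]; exact b u hu⟩
  rw [← RCLike.norm_conj]; simpa [← sub_eq_add_neg] using (hd u hu).2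

theorem cut_b {u : ℝ} (hu : u ∈ Icc (1/2:ℝ) 3) : |(u - 1/2)^2*(3-u)^2| ≤ 63 ∧ |2*(u-1/2)*(3-u)^2 - 2*(u-1/2)^2*(3-u)| ≤ 63 := by
  have a0 : 0 ≤ u - 1/2 := by linarith [hu.1]
  have b0 : 0 ≤ 3 - u := by linarith [hu.2]
  have h : (u - 1/2) * (3 - u) ≤ 7 := by nlinarith [hu.1, hu.2]
  have h0 := mul_nonneg a0 b0
  constructor
  · rw [← mul_pow, abs_of_nonneg (by positivity)]; nlinarith
  · rw [show 2*(u-1/2)*(3-u)^2 - 2*(u-1/2)^2*(3-u) = (2 * ((u - 1/2) * (3 - u))) * ((3 - u) - (u - 1/2)) by ring, abs_mul, abs_of_nonneg (by positivity)]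
    have : |(3 - u) - (u - 1/2)| ≤ 5/2 := abs_le.2 ⟨by linarith, by linarith⟩
    calc _ ≤ (2 * 7) * (5/2 : ℝ) := by gcongr
      _ ≤ _ := by norm_num

theorem int (h : OS N K F ω e) (hN : 1 ≤ N) (hK : 0 ≤ K) {M : ℝ → ℝ} (hM : ∀ u ∈ Icc (1/2:ℝ) 3, e u ≤ M u)
    (hi : IntervalIntegrable (fun u => (1 + |ω u| / N)⁻¹ * M u) volume (1/2) 3) :
    ‖∫ u in (1/2:ℝ)..3, (((u - 1/2)^2*(3-u)^2 : ℝ) : ℂ) * F u‖ ≤ (300 + 300 * K) * ∫ u in (1/2:ℝ)..3, (1 + |ω u| / N)⁻¹ * M u := by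
  obtain ⟨⟨d, dc, hd⟩, ⟨w, wc, hw⟩, b⟩ := h
  have I2 : ((1/2:ℝ)) ≤ 3 := by norm_num
  have N0 : 0 < N := by linarith
  set c : ℝ → ℝ := fun u => (u - 1/2)^2*(3-u)^2 with hc
  set c' : ℝ → ℝ := fun u => 2*(u-1/2)*(3-u)^2 - 2*(u-1/2)^2*(3-u) with hc'
  have dcut : ∀ u, HasDerivAt c (c' u) u := fun u => by
    have h1 : HasDerivAt (fun u : ℝ => u - 1/2) 1 u := (hasDerivAt_id u).sub_const _
    have h2 : HasDerivAt (fun u : ℝ => 3 - u) (-1) u := (hasDerivAt_id u).const_sub _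
    exact ((h1.fun_pow 2).fun_mul (h2.fun_pow 2)).congr_deriv (by simp [hc']; ring)
  set q : ℝ → ℝ := fun u => ω u / (N^2 + ω u ^ 2) with hq
  set q' : ℝ → ℝ := fun u => w u * (N^2 - ω u ^ 2) / (N^2 + ω u ^ 2)^2 with hq'
  have pos : ∀ u, 0 < N^2 + ω u ^ 2 := fun u => by positivity
  have dq : ∀ u ∈ Icc (1/2:ℝ) 3, HasDerivAt q (q' u) u := fun u hu => by
    have := (hw u hu).1.fun_div (((hw u hu).1.fun_pow 2).const_add (N^2)) (pos u).ne'
    refine this.congr_deriv ?_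
    simp only [hq']; congr 1; push_cast; ring
  set r : ℝ → ℂ := fun u => d u - Complex.I * ω u * F u with hr
  have dW : ∀ u ∈ Icc (1/2:ℝ) 3, HasDerivAt (fun u => ((c u * q u : ℝ) : ℂ) * F u) (((c' u * q u + c u * q' u : ℝ) : ℂ) * F u + ((c u * q u : ℝ) : ℂ) * d u) u :=
    fun u hu => ((dcut u).fun_mul (dq u hu)).ofReal_comp.fun_mul (hd u hu).1
  have Fc : ContinuousOn F (Icc (1/2) 3) := fun u hu => (hd u hu).1.continuousAt.continuousWithinAt
  have ωc : ContinuousOn ω (Icc (1/2) 3) := fun u hu => (hw u hu).1.continuousAt.continuousWithinAt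
  have qc : ContinuousOn q (Icc (1/2) 3) := fun u hu => (dq u hu).continuousAt.continuousWithinAt
  have qc' : ContinuousOn q' (Icc (1/2) 3) := by
    refine ContinuousOn.div (by fun_prop) (by fun_prop) fun u _ => (pow_pos (pos u) 2).ne'
  have cc : Continuous c := by fun_prop
  have cc' : Continuous c' := by fun_prop
  have cW : ContinuousOn (fun u => ((c' u * q u + c u * q' u : ℝ) : ℂ) * F u + ((c u * q u : ℝ) : ℂ) * d u) (Icc (1/2) 3) := by
    have h1 : ContinuousOn (fun u => ((c' u * q u + c u * q' u : ℝ) : ℂ)) (Icc (1/2) 3) := Complex.continuous_ofReal.comp_continuousOn (by fun_prop)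
    have h2 : ContinuousOn (fun u => ((c u * q u : ℝ) : ℂ)) (Icc (1/2) 3) := Complex.continuous_ofReal.comp_continuousOn (by fun_prop)
    fun_prop
  rw [← uIcc_of_le I2] at dW cW Fc
  have z := intervalIntegral.integral_eq_sub_of_hasDerivAt dW cW.intervalIntegrable
  have z1 : c 3 = 0 := by simp [hc]
  have z2 : c (1/2) = 0 := by simp [hc]
  rw [z1, z2] at z
  simp only [zero_mul, Complex.ofReal_zero, sub_zero] at z
  have key : (∫ u in (1/2:ℝ)..3, ((c u : ℝ) : ℂ) * F u) = ∫ u in (1/2:ℝ)..3, (((c u : ℝ) : ℂ) * F u + Complex.I * (((c' u * q u + c u * q' u : ℝ) : ℂ) * F u + ((c u * q u : ℝ) : ℂ) * d u)) := by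
    rw [intervalIntegral.integral_add _ (cW.intervalIntegrable.const_mul _), intervalIntegral.integral_const_mul, z, mul_zero, add_zero]
    exact ((Complex.continuous_ofReal.comp cc).continuousOn.mul Fc).intervalIntegrable
  rw [key, ← intervalIntegral.integral_const_mul]
  refine intervalIntegral.norm_integral_le_of_norm_le I2 (.of_forall fun u hu' => ?_) (hi.const_mul _)
  have hu : u ∈ Icc (1/2:ℝ) 3 := ⟨hu'.1.le, hu'.2⟩
  have p0 := pos u
  have e1 : ((c u : ℝ) : ℂ) * F u + Complex.I * (((c' u * q u + c u * q' u : ℝ) : ℂ) * F u + ((c u * q u : ℝ) : ℂ) * d u) =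
      ((c u * (N^2 / (N^2 + ω u^2)) : ℝ) : ℂ) * F u + Complex.I * (((c' u * q u + c u * q' u : ℝ) : ℂ) * F u) + Complex.I * ((c u * q u : ℝ) : ℂ) * r u := by
    have : c u * (N^2 / (N^2 + ω u^2)) = c u - c u * q u * ω u := by simp only [hq]; field_simp; ring
    rw [this]; simp only [hr]; push_cast
    linear_combination ((c u * q u * ω u * F u : ℂ)) * Complex.I_sq
  rw [e1]
  set x := |ω u| / N with hx
  have x0 : 0 ≤ x := by positivity
  set v := (1 + x)⁻¹ with hv
  have v0 : 0 < v := by positivity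
  have hω : |ω u| = N * x := by rw [hx]; field_simp
  have hω2 : ω u ^ 2 = N^2 * x^2 := by rw [← sq_abs, hω]; ring
  have b1 : N^2 / (N^2 + ω u^2) ≤ 2 * v := by
    rw [hω2, hv, ← div_eq_mul_inv, div_le_div_iff₀ (by positivity) (by positivity)]
    nlinarith [mul_nonneg (sq_nonneg N) (sq_nonneg (x - 1/2)), sq_nonneg N]
  have b2 : |q u| * N ≤ 2 * v := by
    simp only [hq]
    rw [abs_div, abs_of_pos p0, hω, hω2, hv, ← div_eq_mul_inv, div_mul_eq_mul_div, div_le_div_iff₀ (by positivity) (by positivity)]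
    nlinarith [mul_nonneg (sq_nonneg N) (sq_nonneg (x - 1/2)), sq_nonneg N, mul_nonneg (sq_nonneg N) x0]
  have b2' : |q u| ≤ 2 * v := le_trans (le_mul_of_one_le_right (abs_nonneg _) hN) b2
  have b3 : |q' u| ≤ K * (2 * v) := by
    have h1 : |N^2 - ω u^2| ≤ N^2 + ω u^2 := abs_le.2 ⟨by nlinarith [sq_nonneg N, sq_nonneg (ω u)], by nlinarith [sq_nonneg N, sq_nonneg (ω u)]⟩
    simp only [hq']
    rw [abs_div, abs_mul, abs_of_pos (pow_pos p0 2)]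
    calc _ ≤ (K * N^2) * (N^2 + ω u^2) / (N^2 + ω u^2)^2 := by gcongr; exact (hw u hu).2
      _ = K * (N^2 / (N^2 + ω u^2)) := by field_simp
      _ ≤ _ := by gcongr
  obtain ⟨k1, k2⟩ := cut_b hu
  have e0 : 0 ≤ e u := (norm_nonneg _).trans (b u hu)
  have B1 : ‖((c u * (N^2 / (N^2 + ω u^2)) : ℝ) : ℂ) * F u‖ ≤ 63 * (2 * v) * e u := by
    rw [norm_mul, Complex.norm_real, norm_mul, Real.norm_of_nonneg (by positivity : 0 ≤ N^2 / (N^2 + ω u^2))]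
    gcongr
    · exact k1
    · exact b u hu
  have B2 : ‖Complex.I * (((c' u * q u + c u * q' u : ℝ) : ℂ) * F u)‖ ≤ (63 * (2 * v) + 63 * (K * (2 * v))) * e u := by
    rw [norm_mul, Complex.norm_I, one_mul, norm_mul, Complex.norm_real]
    refine mul_le_mul ((norm_add_le _ _).trans ?_) (b u hu) (norm_nonneg _) (by positivity)
    rw [norm_mul, norm_mul]
    exact add_le_add (mul_le_mul k2 b2' (norm_nonneg _) (by norm_num)) (mul_le_mul k1 b3 (norm_nonneg _) (by norm_num))
  have B3 : ‖Complex.I * ((c u * q u : ℝ) : ℂ) * r u‖ ≤ 63 * (2 * v) * (K * e u) := by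
    rw [norm_mul, norm_mul, Complex.norm_I, one_mul, Complex.norm_real, norm_mul]
    calc _ ≤ 63 * |q u| * (K * N * e u) := by
          refine mul_le_mul (mul_le_mul_of_nonneg_right k1 (norm_nonneg _)) (hd u hu).2 (norm_nonneg _) (by positivity)
      _ = 63 * (|q u| * N) * (K * e u) := by ring
      _ ≤ _ := by gcongr
  refine (norm_add₃_le).trans ((add_le_add (add_le_add B1 B2) B3).trans ?_)
  have : v * e u ≤ v * M u := by gcongr; exact hM u hu
  have h0 : 0 ≤ v * e u := by positivity
  nlinarith [mul_le_mul_of_nonneg_left this (by positivity : 0 ≤ 300 + 300 * K), mul_nonneg hK h0]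
end OS


/-- clamp -/
noncomputable def cl (a b x : ℝ) : ℝ := max a (min b x)
theorem cl_cont (a b : ℝ) : Continuous (cl a b) := by unfold cl; fun_prop
theorem cl_mem {a b : ℝ} (h : a ≤ b) (x : ℝ) : cl a b x ∈ Icc a b := ⟨le_max_left _ _, max_le h (min_le_left _ _)⟩
theorem cl_eq {a b x : ℝ} (h : x ∈ Icc a b) : cl a b x = x := by unfold cl; rw [min_eq_right h.2, max_eq_right h.1]
/-- clamped quotient -/
noncomputable def yy (ν u : ℝ) : ℝ := cl (1/8) 8 ν / cl (1/2) 3 u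
/-- lift to clamped variables -/
noncomputable def lf (F : ℝ → ℝ → ℝ → ℝ) (ν u : ℝ) : ℝ := F (cl (1/8) 8 ν) (cl (1/2) 3 u) (yy ν u)

namespace Pk
variable {c C s : ℝ} {G E q q1 q2 : ℝ → ℝ}
theorem mono (h : Pk c C s G E q q1 q2) {c' C' : ℝ} (h1 : c' ≤ c) (h2 : C ≤ C') : Pk c' C' s G E q q1 q2 :=
  ⟨h.hs, h.dG, h.dE, h.dq, h.dq1, fun y hy => (h.bG y hy).trans h2, fun y hy => (h.bE y hy).trans h2, fun y hy => (h.bq y hy).trans h2,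
    fun y hy => (h.bq1 y hy).trans h2, fun y hy => (h.bq2 y hy).trans h2, fun y hy => h1.trans (h.lq y hy), fun y hy => h1.trans (h.lq1 y hy)⟩

theorem yym (ν u : ℝ) : yy ν u ∈ Ioo (1/64:ℝ) 64 := ymem (cl_mem (by norm_num) u) (cl_mem (by norm_num) ν)
theorem nm (ν : ℝ) : cl (1/8) 8 ν ∈ Icc (1/8:ℝ) 8 := cl_mem (by norm_num) ν
theorem um (u : ℝ) : cl (1/2) 3 u ∈ Icc (1/2:ℝ) 3 := cl_mem (by norm_num) u
theorem yyc : Continuous fun p : ℝ × ℝ => yy p.1 p.2 := by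
  unfold yy; refine Continuous.div ((cl_cont _ _).comp continuous_fst) ((cl_cont _ _).comp continuous_snd) fun p => ?_
  have := (um p.2).1; linarith
theorem comp_c {F : ℝ → ℝ} (h : ∀ y ∈ Ioo (1/64:ℝ) 64, ContinuousAt F y) : Continuous fun p : ℝ × ℝ => F (yy p.1 p.2) :=
  continuous_iff_continuousAt.2 fun p => (h _ (yym _ _)).comp_of_eq yyc.continuousAt rfl

theorem lf_eq (F : ℝ → ℝ → ℝ → ℝ) {ν u : ℝ} (hν : ν ∈ Icc (1/8:ℝ) 8) (hu : u ∈ Icc (1/2:ℝ) 3) : lf F ν u = F ν u (ν / u) := by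
  unfold lf yy; rw [cl_eq hν, cl_eq hu]

theorem lf_d {F : ℝ → ℝ → ℝ → ℝ} {a b ν u F' : ℝ} (ha : 1/8 ≤ a) (hb : b ≤ 8) (hν : ν ∈ Ioo a b) (hu : u ∈ Icc (1/2:ℝ) 3)
    (h : HasDerivAt (fun ν => F ν u (ν / u)) F' ν) : HasDerivAt (fun ν => lf F ν u) F' ν := by
  refine h.congr_of_eventuallyEq ?_
  filter_upwards [Ioo_mem_nhds hν.1 hν.2] with x hx
  exact lf_eq F ⟨ha.trans hx.1.le, hx.2.le.trans hb⟩ hu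

theorem kak (h : Pk c C s G E q q1 q2) (hc : 0 < c) (hC : 1 ≤ C) {N e1 e2 a b : ℝ} (hN : 1 ≤ N) (he1 : e1 ^ 2 = 1) (he2 : e2 ^ 2 = 1)
    (ha : 1/8 ≤ a) (hab : a < b) (hb : b ≤ 8) :
    Kak (c / 9) (5000 * C) N e1 e2 a b (lf fun ν u y => e1 * G y) (lf fun ν u y => e2 * u * E y) (lf fun ν u y => q y / ν)
      (lf fun ν u y => (y * q1 y - q y) / ν ^ 2) := by
  have cG := comp_c fun y hy => (h.dG y hy).continuousAt
  have cE := comp_c fun y hy => (h.dE y hy).continuousAt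
  have cq := comp_c fun y hy => (h.dq y hy).continuousAt
  have cq1 := comp_c fun y hy => (h.dq1 y hy).continuousAt
  have cn : Continuous fun p : ℝ × ℝ => cl (1/8) 8 p.1 := (cl_cont _ _).comp continuous_fst
  have cu : Continuous fun p : ℝ × ℝ => cl (1/2) 3 p.2 := (cl_cont _ _).comp continuous_snd
  have cy := yyc
  have n0 : ∀ ν, 0 < cl (1/8) 8 ν := fun ν => by linarith [(nm ν).1]
  have A1 := abs1 he1; have A2 := abs1 he2
  have qb : ∀ ν u, |q (yy ν u)| ≤ C := fun ν u => h.bq _ (yym ν u)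
  have ab : ∀ {ν}, ν ∈ Icc a b → ν ∈ Icc (1/8:ℝ) 8 := fun hν => ⟨ha.trans hν.1, hν.2.trans hb⟩
  have ab' : ∀ {ν}, ν ∈ Ioo a b → ν ∈ Icc (1/8:ℝ) 8 := fun hν => ab ⟨hν.1.le, hν.2.le⟩
  have dy : ∀ {ν u : ℝ}, HasDerivAt (fun ν : ℝ => ν / u) (1 / u) ν := fun {ν u} => (hasDerivAt_id ν).div_const u
  refine ⟨by positivity, by linarith, hN, he1, he2, hab, by linarith, hb, by unfold lf; exact continuous_const.mul cG, ?_, ?_, ?_, fun ν u => ?_, fun ν u => ?_,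
    fun ν u => ?_, fun ν u => ?_, fun ν hν u hu => ?_, fun ν hν u hu => ?_, fun ν hν u hu => ?_, fun ν hν u hu u' hu' => ?_, fun ν hν u hu u' hu' => ?_⟩
  · unfold lf; exact (continuous_const.mul cu).mul cE
  · unfold lf; exact cq.div cn fun p => (n0 _).ne'
  · unfold lf; exact ((cy.mul cq1).sub cq).div (cn.pow 2) fun p => (pow_pos (n0 _) 2).ne'
  · unfold lf; rw [abs_mul, A1]; linarith [h.bG _ (yym ν u)]
  · unfold lf; rw [abs_mul, abs_mul, A2, one_mul, abs_of_nonneg (by linarith [(um u).1])]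
    nlinarith [h.bE _ (yym ν u), (um u).1, (um u).2, abs_nonneg (E (yy ν u))]
  · unfold lf; rw [abs_div, abs_of_pos (n0 _), div_le_iff₀ (n0 _)]
    nlinarith [qb ν u, (nm ν).1]
  · unfold lf; rw [abs_div, abs_of_pos (pow_pos (n0 _) 2), div_le_iff₀ (pow_pos (n0 _) 2)]
    have h1 : |yy ν u * q1 (yy ν u)| ≤ 64 * C := by
      rw [abs_mul, abs_of_pos (by linarith [(yym ν u).1])]
      exact mul_le_mul (yym ν u).2.le (h.bq1 _ (yym ν u)) (abs_nonneg _) (by norm_num)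
    have h2 : 1/64 ≤ cl (1/8) 8 ν ^ 2 := by nlinarith [(nm ν).1]
    have h3 := abs_sub (yy ν u * q1 (yy ν u)) (q (yy ν u))
    nlinarith [qb ν u]
  · have hy := ymem hu (ab' hν)
    have ν0 : 0 < ν := by linarith [(ab' hν).1]
    have u0 : 0 < u := by linarith [hu.1]
    refine lf_d ha hb hν hu ?_
    refine (((h.dG _ hy).comp ν dy).const_mul e1).congr_deriv ?_
    rw [lf_eq _ (ab' hν) hu]; field_simp
  · have hy := ymem hu (ab' hν)
    have ν0 : 0 < ν := by linarith [(ab' hν).1]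
    have u0 : 0 < u := by linarith [hu.1]
    refine lf_d ha hb hν hu ?_
    refine (((h.dE _ hy).comp ν dy).const_mul (e2 * u)).congr_deriv ?_
    rw [lf_eq _ (ab' hν) hu]; field_simp
  · have hy := ymem hu (ab' hν)
    have ν0 : 0 < ν := by linarith [(ab' hν).1]
    have u0 : 0 < u := by linarith [hu.1]
    refine lf_d ha hb hν hu ?_
    refine (((h.dq _ hy).comp ν dy).fun_div (hasDerivAt_id ν) ν0.ne').congr_deriv ?_
    rw [lf_eq _ (ab' hν) hu]; simp only [id, Function.comp_apply]; field_simp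
  · have hy := ymem hu (ab hν); have hy' := ymem hu' (ab hν)
    have ν0 : 0 < ν := by linarith [(ab hν).1]
    have u0 : 0 < u := by linarith [hu.1]
    have u0' : 0 < u' := by linarith [hu'.1]
    rw [lf_eq _ (ab hν) hu, lf_eq _ (ab hν) hu', ← _root_.sub_div, abs_div, abs_of_pos ν0, le_div_iff₀ ν0]
    have h1 := (h.q_mono hy hy').1
    have e : ν / u - ν / u' = ν * ((u' - u) / (u * u')) := by field_simp
    have h2 : c * |ν / u - ν / u'| ≤ |q (ν / u) - q (ν / u')| := by
      rcases eq_or_ne (ν / u) (ν / u') with h0 | h0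
      · rw [h0]; simp
      · have p : 0 < |ν / u - ν / u'| := abs_pos.2 (sub_ne_zero.2 h0)
        refine le_of_mul_le_mul_right ?_ p
        rw [mul_assoc, abs_mul_abs_self, ← sq]
        refine h1.trans ((le_abs_self _).trans_eq ?_)
        rw [abs_mul, abs_mul]; rcases h.hs with h | h <;> simp [h]
    have h3 : |u - u'| / 9 ≤ |(u' - u) / (u * u')| := by
      rw [abs_div, abs_of_pos (mul_pos u0 u0'), abs_sub_comm]
      exact div_le_div_of_nonneg_left (abs_nonneg _) (by positivity) (by nlinarith [hu.2, hu'.2])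
    rw [e, abs_mul, abs_of_pos ν0] at h2
    calc _ = c * (ν * (|u - u'| / 9)) := by ring
      _ ≤ c * (ν * |(u' - u) / (u * u')|) := by gcongr
      _ ≤ _ := h2
  · have hy := ymem hu (ab hν); have hy' := ymem hu' (ab hν)
    have ν8 := (ab hν).1
    have ν0 : 0 < ν := by linarith [(ab hν).1]
    have u0 : 0 < u := by linarith [hu.1]
    have u0' : 0 < u' := by linarith [hu'.1]
    rw [lf_eq _ (ab hν) hu, lf_eq _ (ab hν) hu', ← _root_.sub_div, abs_div, abs_of_pos (pow_pos ν0 2), div_le_iff₀ (pow_pos ν0 2)]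
    have h1 : |(ν / u * q1 (ν / u) - q (ν / u)) - (ν / u' * q1 (ν / u') - q (ν / u'))| ≤ (64 * C) * |ν / u - ν / u'| :=
      (convex_Ioo (1/64:ℝ) 64).norm_image_sub_le_of_norm_hasDerivWithin_le (f := fun y => y * q1 y - q y) (f' := fun y => y * q2 y)
        (fun y hy => (((((hasDerivAt_id y).fun_mul (h.dq1 y hy)).fun_sub (h.dq y hy))).congr_deriv (by simp)).hasDerivWithinAt)
        (fun y hy => by
          rw [norm_mul, Real.norm_of_nonneg (by linarith [hy.1])]
          exact mul_le_mul hy.2.le (h.bq2 y hy) (norm_nonneg _) (by norm_num)) hy' hy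
    have e : ν / u - ν / u' = ν * ((u' - u) / (u * u')) := by field_simp
    have h3 : |(u' - u) / (u * u')| ≤ 4 * |u - u'| := by
      rw [abs_div, abs_of_pos (mul_pos u0 u0'), abs_sub_comm, div_le_iff₀ (by positivity)]
      have : 1 ≤ 4 * (u * u') := by nlinarith [hu.1, hu'.1]
      nlinarith [abs_nonneg (u - u')]
    rw [e, abs_mul, abs_of_pos ν0] at h1
    calc _ ≤ 64 * C * (ν * (4 * |u - u'|)) := h1.trans (by gcongr)
      _ = 32 * (64 * C * |u - u'|) * (ν * (1/8)) := by ring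
      _ ≤ 32 * (64 * C * |u - u'|) * (ν * ν) := by gcongr
      _ ≤ _ := by nlinarith [mul_nonneg (mul_nonneg (by linarith : 0 ≤ C) (abs_nonneg (u - u'))) (sq_nonneg ν)]
end Pk


/-- slope -/
noncomputable def sl (k : ℤ × ℤ) : ℝ := (k.1:ℝ) / k.2
/-- localized masses -/
noncomputable def GG (N ε : ℝ) (G E : ℝ → ℝ) (h : ℤ × ℤ → ℝ × ℝ → ℂ) (k : ℤ × ℤ) (q : P3) : ℝ :=
  ∫ y, ‖h k y‖ ^ 2 * kT N (lf fun ν u y => -ε * G y) (lf fun ν u y => ε * u * E y) (sl k, y) q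

/-- quadrilinear integrand -/
noncomputable def PP (F : ℤ × ℤ → ℝ → ℝ × ℝ → ℂ) (k1 k2 k3 k4 : ℤ × ℤ) (q : P3) : ℂ :=
  F k1 q.1 q.2 * F k2 q.1 q.2 * ((starRingEnd ℂ) (F k3 q.1 q.2) * (starRingEnd ℂ) (F k4 q.1 q.2))

/-- data for the core estimate -/
structure CD (c C s N ε K D : ℝ) (lo hi : ℤ) (G E q q1 q2 : ℝ → ℝ) (h : ℤ × ℤ → ℝ × ℝ → ℂ) (F : ℤ × ℤ → ℝ → ℝ × ℝ → ℂ) (e : ℤ × ℤ → P3 → ℝ) : Prop where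
  pk : Pk c C s G E q q1 q2
  c0 : 0 < c
  cl1 : c ≤ 1
  C1 : 1 ≤ C
  N1 : 1 ≤ N
  hε : ε = 1 ∨ ε = -1
  K0 : 0 ≤ K
  D0 : 0 ≤ D
  hlo : 3*N/8 ≤ lo
  hhi : (hi:ℝ) ≤ 2*N
  hc : ∀ k, Continuous (h k)
  hb : ∃ B, ∀ k y, ‖h k y‖ ≤ B
  hint : ∀ k, Integrable (h k)
  Fc : ∀ k, Continuous fun q : P3 => F k q.1 q.2
  os : ∀ k ∈ Kb lo hi, ∀ X, OS N K (fun u => F k u X) (fun u => ε * N * wk E u k) (fun u => e k (u, X))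
  e2 : ∀ k ∈ Kb lo hi, ∀ q : P3, q.1 ∈ Icc (1/2:ℝ) 3 → e k q ^ 2 ≤ D * GG N ε G E h k q
  orth : ∀ k1 ∈ Kb lo hi, ∀ k2 ∈ Kb lo hi, ∀ k3 ∈ Kb lo hi, ∀ k4 ∈ Kb lo hi, k1 + k2 - k3 - k4 ∉ Kb (-4) 4 → ∀ u,
    Integrable (fun X => PP F k1 k2 k3 k4 (u, X)) → ∫ X, PP F k1 k2 k3 k4 (u, X) = 0

namespace CD
variable {c C s N ε K D : ℝ} {lo hi : ℤ} {G E q q1 q2 : ℝ → ℝ} {h : ℤ × ℤ → ℝ × ℝ → ℂ} {F : ℤ × ℤ → ℝ → ℝ × ℝ → ℂ} {e : ℤ × ℤ → P3 → ℝ}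

theorem sl_mem (H : CD c C s N ε K D lo hi G E q q1 q2 h F e) {k : ℤ × ℤ} (hk : k ∈ Kb lo hi) : sl k ∈ Icc (3/16:ℝ) (16/3) := by
  unfold Kb at hk
  rw [Finset.mem_product] at hk
  have h1 := Pk.bxc H.hlo H.hhi hk.1
  have h2 := Pk.bxc H.hlo H.hhi hk.2
  have := H.N1
  have h3 : (0:ℝ) < k.2 := by linarith [h2.1]
  unfold sl
  constructor
  · rw [le_div_iff₀ h3]; linarith [h1.1, h2.2]
  · rw [div_le_iff₀ h3]; linarith [h1.2, h2.1]

theorem GG0 (k : ℤ × ℤ) (q : P3) : 0 ≤ GG N ε G E h k q := integral_nonneg fun y => mul_nonneg (sq_nonneg _) (Kak.kT_pos _ _).le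

theorem s3 (H : CD c C s N ε K D lo hi G E q q1 q2 h F e) {S : Finset (ℤ × ℤ)} {a b lam : ℝ} (ha : 1/8 ≤ a) (hab : a < b) (hb : b ≤ 8)
    (hS : ∀ k ∈ S, sl k ∈ Icc a b) (l0 : 0 < lam) (hl : lam ≤ b - a) :
    Integrable (fun q => (∑ k ∈ S, GG N ε G E h k q) ^ 2) (mI (1/2) 3) ∧
    ∫ q, (∑ k ∈ S, GG N ε G E h k q) ^ 2 ∂(mI (1/2) 3) ≤
      (2 / lam * (3 * Real.pi ^ 4 * (b - a)) + 2 * lam * (128 * KC (c/9) (5000*C) * (N * N ^ (1/16:ℝ)))) * ∫ y, (∑ k ∈ S, ‖h k y‖^2) ^ 2 := by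
  obtain ⟨B, hB⟩ := H.hb
  have B0 : 0 ≤ B := (norm_nonneg _).trans (hB 0 0)
  have he : ε ^ 2 = 1 := by rcases H.hε with h | h <;> simp [h]
  exact (H.pk.kak H.c0 H.C1 H.N1 (e1 := -ε) (e2 := ε) (by rw [neg_sq, he]) he ha hab hb).S3 S hS (fun k => ((H.hc k).norm.pow 2).measurable) (fun k y => sq_nonneg _)
    (B := B^2) (fun k y => pow_le_pow_left₀ (norm_nonneg _) (hB k y) 2) (fun k => by
      refine ((H.hint k).norm.const_mul B).mono' ((H.hc k).norm.pow 2).aestronglyMeasurable (.of_forall fun y => ?_)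
      show ‖‖h k y‖^2‖ ≤ _
      rw [norm_pow, norm_norm, sq]; exact mul_le_mul_of_nonneg_right (hB k y) (norm_nonneg _)) l0 hl

theorem gsq (H : CD c C s N ε K D lo hi G E q q1 q2 h F e) {k : ℤ × ℤ} (hk : k ∈ Kb lo hi) : Integrable (fun q => GG N ε G E h k q ^ 2) (mI (1/2) 3) := by
  have := (H.s3 (S := {k}) (a := 1/8) (b := 8) (lam := 1) le_rfl (by norm_num) le_rfl (fun k' h' => by
    rw [Finset.mem_singleton.1 h']; exact ⟨by linarith [(H.sl_mem hk).1], by linarith [(H.sl_mem hk).2]⟩) one_pos (by norm_num)).1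
  simpa using this

theorem gm (H : CD c C s N ε K D lo hi G E q q1 q2 h F e) {k : ℤ × ℤ} (hk : k ∈ Kb lo hi) : AEStronglyMeasurable (fun q => GG N ε G E h k q) (mI (1/2) 3) :=
  (Real.continuous_sqrt.comp_aestronglyMeasurable (H.gsq hk).1).congr (.of_forall fun q => Real.sqrt_sq (GG0 _ _))

theorem gmul (H : CD c C s N ε K D lo hi G E q q1 q2 h F e) {k k' : ℤ × ℤ} (hk : k ∈ Kb lo hi) (hk' : k' ∈ Kb lo hi) :
    Integrable (fun q => GG N ε G E h k q * GG N ε G E h k' q) (mI (1/2) 3) := by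
  refine ((H.gsq hk).add (H.gsq hk')).mono' ((H.gm hk).mul (H.gm hk')) (.of_forall fun q => ?_)
  rw [Real.norm_of_nonneg (mul_nonneg (GG0 _ _) (GG0 _ _))]
  show _ ≤ GG N ε G E h k q ^ 2 + GG N ε G E h k' q ^ 2
  nlinarith [sq_nonneg (GG N ε G E h k q - GG N ε G E h k' q), sq_nonneg (GG N ε G E h k q), sq_nonneg (GG N ε G E h k' q)]

theorem e4 (H : CD c C s N ε K D lo hi G E q q1 q2 h F e) {k1 k2 k3 k4 : ℤ × ℤ} (h1 : k1 ∈ Kb lo hi) (h2 : k2 ∈ Kb lo hi) (h3 : k3 ∈ Kb lo hi) (h4 : k4 ∈ Kb lo hi)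
    {Q : P3} (hq : Q.1 ∈ Icc (1/2:ℝ) 3) : e k1 Q * e k2 Q * (e k3 Q * e k4 Q) ≤
      D^2/2 * (GG N ε G E h k1 Q * GG N ε G E h k2 Q + GG N ε G E h k3 Q * GG N ε G E h k4 Q) := by
  have a : ∀ k ∈ Kb lo hi, ∀ k' ∈ Kb lo hi, (e k Q * e k' Q)^2 ≤ D^2 * (GG N ε G E h k Q * GG N ε G E h k' Q) := fun k hk k' hk' => by
    have := mul_le_mul (H.e2 k hk Q hq) (H.e2 k' hk' Q hq) (sq_nonneg _) (mul_nonneg H.D0 (GG0 _ _))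
    rw [mul_pow]; linarith
  nlinarith [a k1 h1 k2 h2, a k3 h3 k4 h4, sq_nonneg (e k1 Q * e k2 Q - e k3 Q * e k4 Q)]

theorem pI (H : CD c C s N ε K D lo hi G E q q1 q2 h F e) {k1 k2 k3 k4 : ℤ × ℤ} (h1 : k1 ∈ Kb lo hi) (h2 : k2 ∈ Kb lo hi) (h3 : k3 ∈ Kb lo hi) (h4 : k4 ∈ Kb lo hi) :
    Integrable (PP F k1 k2 k3 k4) (mI (1/2) 3) ∧ Integrable (fun q => (((q.1 - 1/2)^2*(3-q.1)^2 : ℝ) : ℂ) * PP F k1 k2 k3 k4 q) (mI (1/2) 3) := by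
  have Pc : Continuous (PP F k1 k2 k3 k4) :=
    ((H.Fc k1).mul (H.Fc k2)).mul ((Complex.continuous_conj.comp (H.Fc k3)).mul (Complex.continuous_conj.comp (H.Fc k4)))
  have i1 : Integrable (PP F k1 k2 k3 k4) (mI (1/2) 3) := by
    refine (((H.gmul h1 h2).add (H.gmul h3 h4)).const_mul (D^2/2)).mono' Pc.aestronglyMeasurable ((mI_ae _ _).mono fun q hq => ?_)
    refine le_trans ?_ (H.e4 h1 h2 h3 h4 hq)
    unfold PP
    rw [norm_mul, norm_mul, norm_mul, RCLike.norm_conj, RCLike.norm_conj]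
    have b := fun k hk => (H.os k hk q.2).b q.1 hq
    have b0 := fun k hk => (norm_nonneg _).trans (b k hk)
    exact mul_le_mul (mul_le_mul (b k1 h1) (b k2 h2) (norm_nonneg _) (b0 k1 h1)) (mul_le_mul (b k3 h3) (b k4 h4) (norm_nonneg _) (b0 k3 h3)) (by positivity)
      (mul_nonneg (b0 k1 h1) (b0 k2 h2))
  refine ⟨i1, (i1.norm.const_mul 63).mono' ((Complex.continuous_ofReal.comp (by fun_prop)).mul Pc).aestronglyMeasurable ((mI_ae _ _).mono fun q hq => ?_)⟩
  rw [norm_mul, Complex.norm_real]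
  exact mul_le_mul_of_nonneg_right (OS.cut_b hq).1 (norm_nonneg _)

theorem wtc (H : CD c C s N ε K D lo hi G E q q1 q2 h F e) {k : ℤ × ℤ} (hk : k ∈ Kb lo hi) : Continuous fun u => wk E (cl (1/2) 3 u) k := by
  have N0 : 0 < N := by linarith [H.N1]
  obtain ⟨dw, -, hw⟩ := (H.os k hk 0).w
  have : ContinuousOn (fun u => wk E u k) (Icc (1/2) 3) := by
    have h1 : ContinuousOn (fun u => ε * N * wk E u k) (Icc (1/2) 3) := fun u hu => (hw u hu).1.continuousAt.continuousWithinAt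
    refine (h1.const_smul (ε / N)).congr fun u hu => ?_
    have he : ε * ε = 1 := by rcases H.hε with h | h <;> simp [h]
    show wk E u k = ε / N * (ε * N * wk E u k)
    field_simp; rw [sq, he, mul_one]
  exact this.comp_continuous (cl_cont _ _) fun u => cl_mem (by norm_num) u

theorem Wt01 (E : ℝ → ℝ) (u : ℝ) (k1 k2 k3 k4 : ℤ × ℤ) : 0 ≤ Wt E u k1 k2 k3 k4 ∧ Wt E u k1 k2 k3 k4 ≤ 1 := by
  unfold Wt; split_ifs
  · exact ⟨by positivity, inv_le_one_of_one_le₀ (by linarith [abs_nonneg (wk E u k1 + wk E u k2 - wk E u k3 - wk E u k4)])⟩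
  · norm_num

theorem Wt_symm (E : ℝ → ℝ) (u : ℝ) (k1 k2 k3 k4 : ℤ × ℤ) : Wt E u k1 k2 k3 k4 = Wt E u k3 k4 k1 k2 := by
  unfold Wt
  have : k1 + k2 - k3 - k4 ∈ Kb (-4) 4 ↔ k3 + k4 - k1 - k2 ∈ Kb (-4) 4 := by
    unfold Kb; simp only [Finset.mem_product, Finset.mem_Icc, Prod.fst_add, Prod.fst_sub, Prod.snd_add, Prod.snd_sub]
    constructor <;> rintro ⟨⟨_, _⟩, _, _⟩ <;> refine ⟨⟨?_, ?_⟩, ?_, ?_⟩ <;> lia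
  simp only [this]
  rw [← abs_neg (wk E u k1 + wk E u k2 - wk E u k3 - wk E u k4)]
  congr 5; ring

theorem wI (H : CD c C s N ε K D lo hi G E q q1 q2 h F e) {k1 k2 k3 k4 k k' : ℤ × ℤ} (h1 : k1 ∈ Kb lo hi) (h2 : k2 ∈ Kb lo hi) (h3 : k3 ∈ Kb lo hi) (h4 : k4 ∈ Kb lo hi)
    (hk : k ∈ Kb lo hi) (hk' : k' ∈ Kb lo hi) :
    Integrable (fun q : P3 => Wt E (cl (1/2) 3 q.1) k1 k2 k3 k4 * (GG N ε G E h k q * GG N ε G E h k' q)) (mI (1/2) 3) := by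
  refine (H.gmul hk hk').mono' (AEStronglyMeasurable.mul (Continuous.aestronglyMeasurable ?_) (H.gmul hk hk').1) (.of_forall fun q => ?_)
  · unfold Wt
    split_ifs
    · have c1 := (H.wtc h1).comp (continuous_fst : Continuous (Prod.fst : P3 → ℝ))
      have c2 := (H.wtc h2).comp (continuous_fst : Continuous (Prod.fst : P3 → ℝ))
      have c3 := (H.wtc h3).comp (continuous_fst : Continuous (Prod.fst : P3 → ℝ))
      have c4 := (H.wtc h4).comp (continuous_fst : Continuous (Prod.fst : P3 → ℝ))
      refine Continuous.inv₀ (continuous_const.add (((c1.add c2).sub c3).sub c4).abs) fun q => ?_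
      positivity
    · exact continuous_const
  · have g0 := mul_nonneg (GG0 (N := N) (ε := ε) (G := G) (E := E) (h := h) k q) (GG0 (N := N) (ε := ε) (G := G) (E := E) (h := h) k' q)
    obtain ⟨w0, w1⟩ := Wt01 E (cl (1/2) 3 q.1) k1 k2 k3 k4
    rw [Real.norm_of_nonneg (mul_nonneg w0 g0)]
    exact mul_le_of_le_one_left g0 w1

theorem quad (H : CD c C s N ε K D lo hi G E q q1 q2 h F e) {k1 k2 k3 k4 : ℤ × ℤ} (h1 : k1 ∈ Kb lo hi) (h2 : k2 ∈ Kb lo hi) (h3 : k3 ∈ Kb lo hi) (h4 : k4 ∈ Kb lo hi) :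
    ‖∫ q, (((q.1 - 1/2)^2*(3-q.1)^2 : ℝ) : ℂ) * PP F k1 k2 k3 k4 q ∂(mI (1/2) 3)‖ ≤ (300 + 1200 * K) * (D^2/2) *
      ∫ q, (Wt E (cl (1/2) 3 q.1) k1 k2 k3 k4 * (GG N ε G E h k1 q * GG N ε G E h k2 q) + Wt E (cl (1/2) 3 q.1) k1 k2 k3 k4 * (GG N ε G E h k3 q * GG N ε G E h k4 q)) ∂(mI (1/2) 3) := by
  have g0 := fun (k k' : ℤ × ℤ) (q : P3) => mul_nonneg (GG0 (N := N) (ε := ε) (G := G) (E := E) (h := h) k q) (GG0 (N := N) (ε := ε) (G := G) (E := E) (h := h) k' q)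
  have K0 := H.K0
  have N0 : 0 < N := by linarith [H.N1]
  obtain ⟨i1, i2⟩ := H.pI h1 h2 h3 h4
  have i3 := (H.wI h1 h2 h3 h4 h1 h2).add (H.wI h1 h2 h3 h4 h3 h4)
  by_cases hm : k1 + k2 - k3 - k4 ∈ Kb (-4) 4
  · set M : P3 → ℝ := fun q => (D^2/2) * (GG N ε G E h k1 q * GG N ε G E h k2 q + GG N ε G E h k3 q * GG N ε G E h k4 q) with hM
    have i4 : Integrable (fun q : P3 => Wt E (cl (1/2) 3 q.1) k1 k2 k3 k4 * M q) (mI (1/2) 3) :=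
      (i3.const_mul (D^2/2)).congr (.of_forall fun q => by simp only [hM, Pi.add_apply]; ring)
    have e4 : (300 + 1200 * K) * (D^2/2) * ∫ q, (Wt E (cl (1/2) 3 q.1) k1 k2 k3 k4 * (GG N ε G E h k1 q * GG N ε G E h k2 q) + Wt E (cl (1/2) 3 q.1) k1 k2 k3 k4 * (GG N ε G E h k3 q * GG N ε G E h k4 q)) ∂(mI (1/2) 3)
        = (300 + 1200 * K) * ∫ q, Wt E (cl (1/2) 3 q.1) k1 k2 k3 k4 * M q ∂(mI (1/2) 3) := by
      rw [mul_assoc, ← integral_const_mul]; congr 2; ext q; simp only [hM]; ring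
    rw [e4]
    unfold mI at i2 i4 ⊢
    rw [integral_prod_symm _ i2, integral_prod_symm _ i4, ← integral_const_mul]
    refine norm_integral_le_of_norm_le (i4.integral_prod_right.const_mul _) (i4.prod_left_ae.mono fun X hX => ?_)
    have o := ((H.os k1 h1 X).mul (H.os k2 h2 X)).mul ((H.os k3 h3 X).conj.mul (H.os k4 h4 X).conj)
    have I2 : ((1/2:ℝ)) ≤ 3 := by norm_num
    have ew : ∀ u ∈ Icc (1/2:ℝ) 3, (1 + |ε * N * wk E u k1 + ε * N * wk E u k2 + (-(ε * N * wk E u k3) + -(ε * N * wk E u k4))| / N)⁻¹ * M (u, X) =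
        Wt E (cl (1/2) 3 u) k1 k2 k3 k4 * M (u, X) := fun u hu => by
      rw [cl_eq hu]; unfold Wt; rw [if_pos hm]; congr 3
      rw [show ε * N * wk E u k1 + ε * N * wk E u k2 + (-(ε * N * wk E u k3) + -(ε * N * wk E u k4)) = ε * N * (wk E u k1 + wk E u k2 - wk E u k3 - wk E u k4) by ring, abs_mul, abs_mul,
        abs_of_pos N0]
      have : |ε| = 1 := by rcases H.hε with h | h <;> simp [h]
      rw [this]; field_simp
    have hI : IntervalIntegrable (fun u => (1 + |ε * N * wk E u k1 + ε * N * wk E u k2 + (-(ε * N * wk E u k3) + -(ε * N * wk E u k4))| / N)⁻¹ * M (u, X)) volume (1/2) 3 := by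
      rw [intervalIntegrable_iff_integrableOn_Icc_of_le I2]
      exact (integrableOn_congr_fun ew measurableSet_Icc).2 hX
    have r := o.int H.N1 (by linarith) (M := fun u => M (u, X)) (fun u hu => H.e4 h1 h2 h3 h4 (Q := (u, X)) hu) hI
    rw [intervalIntegral.integral_of_le I2, intervalIntegral.integral_of_le I2, ← integral_Icc_eq_integral_Ioc, ← integral_Icc_eq_integral_Ioc,
      setIntegral_congr_fun measurableSet_Icc ew] at r
    refine r.trans (mul_le_mul_of_nonneg_right (by linarith) (integral_nonneg fun u => mul_nonneg (Wt01 _ _ _ _ _ _).1 ?_))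
    exact mul_nonneg (by positivity) (add_nonneg (g0 _ _ _) (g0 _ _ _))
  · have z : ∫ q, (((q.1 - 1/2)^2*(3-q.1)^2 : ℝ) : ℂ) * PP F k1 k2 k3 k4 q ∂(mI (1/2) 3) = 0 := by
      unfold mI at i1 i2 ⊢
      rw [integral_prod _ i2]
      refine integral_eq_zero_of_ae (i1.prod_right_ae.mono fun u hu => ?_)
      simp only [Pi.zero_apply]
      rw [integral_const_mul, H.orth k1 h1 k2 h2 k3 h3 k4 h4 hm u hu, mul_zero]
    rw [z, norm_zero]
    refine mul_nonneg (by positivity) (integral_nonneg fun q => ?_)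
    exact add_nonneg (mul_nonneg (Wt01 _ _ _ _ _ _).1 (g0 _ _ _)) (mul_nonneg (Wt01 _ _ _ _ _ _).1 (g0 _ _ _))
end CD


theorem near_sum {κ : Type*} [DecidableEq κ] (S : Finset κ) (f : κ → ℤ) {g : κ → ℝ} (g0 : ∀ k, 0 ≤ g k) :
    ∑ b ∈ S ×ˢ S, (if |f b.1 - f b.2| ≤ 1 then g b.1 * g b.2 else 0) ≤ ∑ i ∈ S.image f, (∑ k ∈ S.filter (fun k => f k = i ∨ f k = i + 1), g k) ^ 2 := by
  have e : ∀ i, (∑ k ∈ S.filter (fun k => f k = i ∨ f k = i + 1), g k) ^ 2 = ∑ b ∈ S ×ˢ S, (if (f b.1 = i ∨ f b.1 = i + 1) ∧ (f b.2 = i ∨ f b.2 = i + 1) then g b.1 * g b.2 else 0) := fun i => by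
    rw [sq, Finset.sum_mul_sum, ← Finset.sum_product', ← Finset.filter_product, Finset.sum_filter]
  simp_rw [e]
  rw [Finset.sum_comm]
  refine Finset.sum_le_sum fun b hb => ?_
  rw [Finset.mem_product] at hb
  have n0 : ∀ i ∈ S.image f, 0 ≤ (if (f b.1 = i ∨ f b.1 = i + 1) ∧ (f b.2 = i ∨ f b.2 = i + 1) then g b.1 * g b.2 else 0) := fun i _ => by
    split_ifs; exacts [mul_nonneg (g0 _) (g0 _), le_rfl]
  split_ifs with hn
  · rw [abs_le] at hn
    obtain ⟨i, hi, h1⟩ : ∃ i ∈ S.image f, (f b.1 = i ∨ f b.1 = i + 1) ∧ (f b.2 = i ∨ f b.2 = i + 1) := by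
      rcases le_total (f b.1) (f b.2) with h | h
      · exact ⟨f b.1, Finset.mem_image_of_mem _ hb.1, Or.inl rfl, by lia⟩
      · exact ⟨f b.2, Finset.mem_image_of_mem _ hb.2, by lia, Or.inl rfl⟩
    refine le_trans ?_ (Finset.single_le_sum n0 hi)
    rw [if_pos h1]
  · exact Finset.sum_nonneg n0

theorem ovl_sum {κ : Type*} (S : Finset κ) (f : κ → ℤ) (I : Finset ℤ) {g : κ → ℝ} (g0 : ∀ k, 0 ≤ g k) :
    ∑ i ∈ I, (∑ k ∈ S.filter (fun k => f k = i ∨ f k = i + 1), g k) ^ 2 ≤ 2 * (∑ k ∈ S, g k) ^ 2 := by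
  have A0 : 0 ≤ ∑ k ∈ S, g k := Finset.sum_nonneg fun k _ => g0 k
  have l : ∀ i, ∑ k ∈ S.filter (fun k => f k = i ∨ f k = i + 1), g k ≤ ∑ k ∈ S, g k := fun i => Finset.sum_le_sum_of_subset_of_nonneg (Finset.filter_subset _ _) fun k _ _ => g0 k
  calc _ ≤ ∑ i ∈ I, (∑ k ∈ S, g k) * ∑ k ∈ S.filter (fun k => f k = i ∨ f k = i + 1), g k := Finset.sum_le_sum fun i _ => by
        rw [sq]; exact mul_le_mul_of_nonneg_right (l i) (Finset.sum_nonneg fun k _ => g0 k)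
    _ = (∑ k ∈ S, g k) * ∑ k ∈ S, ∑ i ∈ I, (if f k = i ∨ f k = i + 1 then g k else 0) := by
        rw [← Finset.mul_sum, Finset.sum_comm]; congr 2; ext i; rw [Finset.sum_filter]
    _ ≤ (∑ k ∈ S, g k) * ∑ k ∈ S, 2 * g k := by
        refine mul_le_mul_of_nonneg_left (Finset.sum_le_sum fun k _ => ?_) A0
        calc _ ≤ ∑ i ∈ I, ((if i = f k then g k else 0) + (if i = f k - 1 then g k else 0)) := Finset.sum_le_sum fun i _ => by
              have := g0 k
              split_ifs <;> first | lia | linarith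
          _ ≤ _ := by
              rw [Finset.sum_add_distrib, Finset.sum_ite_eq', Finset.sum_ite_eq']
              have := g0 k
              split_ifs <;> linarith
    _ = _ := by rw [← Finset.mul_sum]; ring

theorem norm4 (z : ℂ) : ((‖z‖^4 : ℝ) : ℂ) = z * z * ((starRingEnd ℂ) z * (starRingEnd ℂ) z) := by
  have : z * z * ((starRingEnd ℂ) z * (starRingEnd ℂ) z) = (z * (starRingEnd ℂ) z)^2 := by ring
  rw [this, Complex.mul_conj, Complex.normSq_eq_norm_sq]; push_cast; ring

namespace CD
variable {c C s N ε K D : ℝ} {lo hi : ℤ} {G E q q1 q2 : ℝ → ℝ} {h : ℤ × ℤ → ℝ × ℝ → ℂ} {F : ℤ × ℤ → ℝ → ℝ × ℝ → ℂ} {e : ℤ × ℤ → P3 → ℝ}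

theorem hsI (H : CD c C s N ε K D lo hi G E q q1 q2 h F e) (S : Finset (ℤ × ℤ)) : Integrable fun y => (∑ k ∈ S, ‖h k y‖^2) ^ 2 := by
  obtain ⟨B, hB⟩ := H.hb
  have B0 : 0 ≤ B := (norm_nonneg _).trans (hB 0 0)
  have cc : Continuous fun y => (∑ k ∈ S, ‖h k y‖^2) := continuous_finsetSum _ fun k _ => (H.hc k).norm.pow 2
  refine ((integrable_finsetSum S fun k _ => (H.hint k).norm.const_mul B).const_mul (∑ k ∈ S, B^2)).mono' (cc.pow 2).aestronglyMeasurable (.of_forall fun y => ?_)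
  rw [Real.norm_of_nonneg (sq_nonneg _), sq]
  refine mul_le_mul (Finset.sum_le_sum fun k _ => pow_le_pow_left₀ (norm_nonneg _) (hB k y) 2) (Finset.sum_le_sum fun k _ => ?_) (Finset.sum_nonneg fun k _ => sq_nonneg _)
    (Finset.sum_nonneg fun k _ => sq_nonneg _)
  rw [sq]; exact mul_le_mul_of_nonneg_right (hB k y) (norm_nonneg _)

theorem expand (F : ℤ × ℤ → ℝ → ℝ × ℝ → ℂ) (S : Finset (ℤ × ℤ)) (q : P3) :
    ((‖∑ k ∈ S, F k q.1 q.2‖^4 : ℝ) : ℂ) = ∑ a ∈ S ×ˢ S, ∑ b ∈ S ×ˢ S, PP F a.1 a.2 b.1 b.2 q := by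
  rw [norm4, map_sum, Finset.sum_mul_sum, Finset.sum_mul_sum, ← Finset.sum_product', ← Finset.sum_product', Finset.sum_mul_sum]; rfl

theorem total (H : CD c C s N ε K D lo hi G E q q1 q2 h F e) {θ MN MF l1 l2 κN κF : ℝ} (t0 : 0 < θ) (t1 : θ ≤ 1/16)
    (m0 : 0 ≤ MN) (f0 : 0 ≤ MF)
    (hN : ∀ u ∈ Icc (1/2:ℝ) 3, ∀ k3 k4, ∑ k1 ∈ Kb lo hi, ∑ k2 ∈ Kb lo hi, Wt E u k1 k2 k3 k4 ≤ MN)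
    (hF : ∀ u ∈ Icc (1/2:ℝ) 3, ∀ k3 ∈ Kb lo hi, ∀ k4 ∈ Kb lo hi, θ ≤ |sl k3 - sl k4| → ∑ k1 ∈ Kb lo hi, ∑ k2 ∈ Kb lo hi, Wt E u k1 k2 k3 k4 ≤ MF)
    (l10 : 0 < l1) (hl1 : l1 ≤ 2 * θ) (l20 : 0 < l2) (hl2 : l2 ≤ 1)
    (hκN : 2 / l1 * (3 * Real.pi ^ 4 * (2 * θ)) + 2 * l1 * (128 * KC (c/9) (5000*C) * (N * N ^ (1/16:ℝ))) ≤ κN)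
    (hκF : 2 / l2 * (3 * Real.pi ^ 4 * (63/8)) + 2 * l2 * (128 * KC (c/9) (5000*C) * (N * N ^ (1/16:ℝ))) ≤ κF) :
    Integrable (fun q : P3 => (q.1 - 1/2)^2*(3-q.1)^2 * ‖∑ k ∈ Kb lo hi, F k q.1 q.2‖^4) (mI (1/2) 3) ∧
    ∫ q, (q.1 - 1/2)^2*(3-q.1)^2 * ‖∑ k ∈ Kb lo hi, F k q.1 q.2‖^4 ∂(mI (1/2) 3) ≤
      (300 + 1200 * K) * D^2 * (MF * κF + 2 * MN * κN) * ∫ y, (∑ k ∈ Kb lo hi, ‖h k y‖^2) ^ 2 := by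
  classical
  have K0 := H.K0
  set S := Kb lo hi with hS
  set g := fun (k : ℤ × ℤ) q => GG N ε G E h k q with hg
  have g0 : ∀ k q, 0 ≤ g k q := fun k q => GG0 k q
  set W := fun (q : P3) (a b : (ℤ × ℤ) × (ℤ × ℤ)) => Wt E (cl (1/2) 3 q.1) a.1 a.2 b.1 b.2 with hW
  set f : ℤ × ℤ → ℤ := fun k => ⌊sl k / θ⌋ with hf
  set I := S.image f with hI
  set Si := fun i : ℤ => S.filter (fun k => f k = i ∨ f k = i + 1) with hSi
  have sect : ∀ i ∈ I, 1/8 ≤ i * θ ∧ (i + 2) * θ ≤ 8 ∧ ∀ k ∈ Si i, sl k ∈ Icc (i * θ) ((i + 2) * θ) := fun i hi => by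
    have fl : ∀ k, (f k : ℝ) * θ ≤ sl k ∧ sl k < (f k + 1) * θ := fun k =>
      ⟨(le_div_iff₀ t0).1 (Int.floor_le _), (div_lt_iff₀ t0).1 (Int.lt_floor_add_one _)⟩
    obtain ⟨k, hk, rfl⟩ := Finset.mem_image.1 hi
    obtain ⟨m1, m2⟩ := H.sl_mem hk
    obtain ⟨f1, f2⟩ := fl k
    refine ⟨by linarith, by linarith, fun k' hk' => ?_⟩
    obtain ⟨g1, g2⟩ := fl k'
    rcases (Finset.mem_filter.1 hk').2 with h | h
    · rw [h] at g1 g2; exact ⟨g1, by linarith⟩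
    · rw [h] at g1 g2; push_cast at g1 g2; exact ⟨by linarith, by linarith⟩
  have sN := fun i hi => H.s3 (S := Si i) (a := i * θ) (b := (i + 2) * θ) (lam := l1) (sect i hi).1 (by linarith) (sect i hi).2.1 (sect i hi).2.2 l10 (by linarith)
  have sF := H.s3 (S := S) (a := 1/8) (b := 8) (lam := l2) le_rfl (by norm_num) le_rfl (fun k hk =>
    ⟨by linarith [(H.sl_mem hk).1], by linarith [(H.sl_mem hk).2]⟩) l20 (by linarith)
  have mem : ∀ {a : (ℤ × ℤ) × (ℤ × ℤ)}, a ∈ S ×ˢ S → a.1 ∈ S ∧ a.2 ∈ S := fun h => Finset.mem_product.1 h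
  -- pointwise
  have pt : ∀ q, ∑ a ∈ S ×ˢ S, ∑ b ∈ S ×ˢ S, (W q a b * (g a.1 q * g a.2 q) + W q a b * (g b.1 q * g b.2 q)) ≤
      2 * (MF * (∑ k ∈ S, g k q)^2 + MN * ∑ i ∈ I, (∑ k ∈ Si i, g k q)^2) := fun q => by
    have e1 : ∑ a ∈ S ×ˢ S, ∑ b ∈ S ×ˢ S, (W q a b * (g a.1 q * g a.2 q) + W q a b * (g b.1 q * g b.2 q)) = 2 * ∑ b ∈ S ×ˢ S, (∑ a ∈ S ×ˢ S, W q a b) * (g b.1 q * g b.2 q) := by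
      have e2 : ∑ a ∈ S ×ˢ S, ∑ b ∈ S ×ˢ S, W q a b * (g a.1 q * g a.2 q) = ∑ a ∈ S ×ˢ S, ∑ b ∈ S ×ˢ S, W q b a * (g a.1 q * g a.2 q) :=
        Finset.sum_congr rfl fun a _ => Finset.sum_congr rfl fun b _ => by rw [hW]; simp only; rw [Wt_symm]
      simp_rw [Finset.sum_add_distrib]
      rw [e2, Finset.sum_comm (s := S ×ˢ S) (t := S ×ˢ S) (f := fun a b => W q a b * (g b.1 q * g b.2 q)), ← two_mul]
      simp_rw [Finset.sum_mul]
    rw [e1]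
    refine mul_le_mul_of_nonneg_left ?_ zero_le_two
    calc _ ≤ ∑ b ∈ S ×ˢ S, (MF * (g b.1 q * g b.2 q) + MN * (if |f b.1 - f b.2| ≤ 1 then g b.1 q * g b.2 q else 0)) := by
          refine Finset.sum_le_sum fun b hb => ?_
          have gg := mul_nonneg (g0 b.1 q) (g0 b.2 q)
          have um := cl_mem (a := 1/2) (b := 3) (by norm_num) q.1
          have eW : ∑ a ∈ S ×ˢ S, W q a b = ∑ k1 ∈ S, ∑ k2 ∈ S, Wt E (cl (1/2) 3 q.1) k1 k2 b.1 b.2 := Finset.sum_product _ _ _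
          rw [eW]
          split_ifs with hn
          · nlinarith [mul_le_mul_of_nonneg_right (hN _ um b.1 b.2) gg, mul_nonneg f0 gg]
          · rw [mul_zero, add_zero]
            refine mul_le_mul_of_nonneg_right (hF _ um _ (mem hb).1 _ (mem hb).2 ?_) gg
            by_contra hc
            push Not at hc
            apply hn
            have : |sl b.1 / θ - sl b.2 / θ| < 1 := by rw [← _root_.sub_div, abs_div, abs_of_pos t0, div_lt_one t0]; exact hc
            rw [abs_lt] at this
            have a1 := Int.floor_le (sl b.1 / θ); have a2 := Int.lt_floor_add_one (sl b.1 / θ)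
            have a3 := Int.floor_le (sl b.2 / θ); have a4 := Int.lt_floor_add_one (sl b.2 / θ)
            have c1 : ((⌊sl b.1 / θ⌋ : ℤ) : ℝ) < (⌊sl b.2 / θ⌋ + 2 : ℤ) := by push_cast; linarith [this.2]
            have c2 : ((⌊sl b.2 / θ⌋ : ℤ) : ℝ) < (⌊sl b.1 / θ⌋ + 2 : ℤ) := by push_cast; linarith [this.1]
            have c1 := Int.cast_lt.1 c1; have c2 := Int.cast_lt.1 c2
            rw [abs_le]; simp only [hf]; constructor <;> lia
      _ = MF * (∑ k ∈ S, g k q)^2 + MN * ∑ b ∈ S ×ˢ S, (if |f b.1 - f b.2| ≤ 1 then g b.1 q * g b.2 q else 0) := by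
          rw [Finset.sum_add_distrib, ← Finset.mul_sum, ← Finset.mul_sum, sq, Finset.sum_mul_sum, ← Finset.sum_product']
      _ ≤ _ := by have := near_sum S f (g := fun k => g k q) (fun k => g0 k q); gcongr
  have ex : ∀ q : P3, (((q.1 - 1/2)^2*(3-q.1)^2 * ‖∑ k ∈ S, F k q.1 q.2‖^4 : ℝ) : ℂ) = ∑ a ∈ S ×ˢ S, ∑ b ∈ S ×ˢ S, (((q.1 - 1/2)^2*(3-q.1)^2 : ℝ) : ℂ) * PP F a.1 a.2 b.1 b.2 q := fun q => by
    rw [Complex.ofReal_mul, expand, Finset.mul_sum]; simp_rw [Finset.mul_sum]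
  have iP : ∀ a ∈ S ×ˢ S, ∀ b ∈ S ×ˢ S, Integrable (fun q : P3 => (((q.1 - 1/2)^2*(3-q.1)^2 : ℝ) : ℂ) * PP F a.1 a.2 b.1 b.2 q) (mI (1/2) 3) := fun a ha b hb =>
    (H.pI (mem ha).1 (mem ha).2 (mem hb).1 (mem hb).2).2
  have iW : ∀ a ∈ S ×ˢ S, ∀ b ∈ S ×ˢ S, Integrable (fun q : P3 => W q a b * (g a.1 q * g a.2 q) + W q a b * (g b.1 q * g b.2 q)) (mI (1/2) 3) := fun a ha b hb =>
    (H.wI (mem ha).1 (mem ha).2 (mem hb).1 (mem hb).2 (mem ha).1 (mem ha).2).add (H.wI (mem ha).1 (mem ha).2 (mem hb).1 (mem hb).2 (mem hb).1 (mem hb).2)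
  have iC : Integrable (fun q : P3 => (((q.1 - 1/2)^2*(3-q.1)^2 * ‖∑ k ∈ S, F k q.1 q.2‖^4 : ℝ) : ℂ)) (mI (1/2) 3) := by
    simp_rw [ex]; exact integrable_finsetSum _ fun a ha => integrable_finsetSum _ fun b hb => iP a ha b hb
  refine ⟨iC.re.congr (.of_forall fun q => Complex.ofReal_re _), ?_⟩
  have J0 : 0 ≤ ∫ q, (q.1 - 1/2)^2*(3-q.1)^2 * ‖∑ k ∈ S, F k q.1 q.2‖^4 ∂(mI (1/2) 3) := integral_nonneg fun q => by positivity
  have H0 : ∀ S' : Finset (ℤ × ℤ), 0 ≤ ∫ y, (∑ k ∈ S', ‖h k y‖^2) ^ 2 := fun S' => integral_nonneg fun q => sq_nonneg _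
  calc _ = ‖∫ q, (((q.1 - 1/2)^2*(3-q.1)^2 * ‖∑ k ∈ S, F k q.1 q.2‖^4 : ℝ) : ℂ) ∂(mI (1/2) 3)‖ := by
        rw [integral_complex_ofReal, Complex.norm_real, Real.norm_of_nonneg J0]
    _ = ‖∑ a ∈ S ×ˢ S, ∑ b ∈ S ×ˢ S, ∫ q, (((q.1 - 1/2)^2*(3-q.1)^2 : ℝ) : ℂ) * PP F a.1 a.2 b.1 b.2 q ∂(mI (1/2) 3)‖ := by
        simp_rw [ex]; rw [integral_finsetSum _ fun a ha => integrable_finsetSum _ fun b hb => iP a ha b hb]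
        congr 1; exact Finset.sum_congr rfl fun a ha => integral_finsetSum _ fun b hb => iP a ha b hb
    _ ≤ ∑ a ∈ S ×ˢ S, ∑ b ∈ S ×ˢ S, (300 + 1200 * K) * (D^2/2) * ∫ q, (W q a b * (g a.1 q * g a.2 q) + W q a b * (g b.1 q * g b.2 q)) ∂(mI (1/2) 3) := by
        refine (norm_sum_le _ _).trans (Finset.sum_le_sum fun a ha => (norm_sum_le _ _).trans (Finset.sum_le_sum fun b hb => ?_))
        exact H.quad (mem ha).1 (mem ha).2 (mem hb).1 (mem hb).2
    _ = (300 + 1200 * K) * (D^2/2) * ∫ q, ∑ a ∈ S ×ˢ S, ∑ b ∈ S ×ˢ S, (W q a b * (g a.1 q * g a.2 q) + W q a b * (g b.1 q * g b.2 q)) ∂(mI (1/2) 3) := by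
        rw [integral_finsetSum _ fun a ha => integrable_finsetSum _ fun b hb => iW a ha b hb, Finset.mul_sum]
        refine Finset.sum_congr rfl fun a ha => ?_
        rw [integral_finsetSum _ fun b hb => iW a ha b hb, Finset.mul_sum]
    _ ≤ (300 + 1200 * K) * (D^2/2) * ∫ q, 2 * (MF * (∑ k ∈ S, g k q)^2 + MN * ∑ i ∈ I, (∑ k ∈ Si i, g k q)^2) ∂(mI (1/2) 3) := by
        refine mul_le_mul_of_nonneg_left (integral_mono (integrable_finsetSum _ fun a ha => integrable_finsetSum _ fun b hb => iW a ha b hb) ?_ pt) (by positivity)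
        exact ((sF.1.const_mul _).add ((integrable_finsetSum _ fun i hi => (sN i hi).1).const_mul _)).const_mul 2
    _ = (300 + 1200 * K) * D^2 * (MF * ∫ q, (∑ k ∈ S, g k q)^2 ∂(mI (1/2) 3) + MN * ∑ i ∈ I, ∫ q, (∑ k ∈ Si i, g k q)^2 ∂(mI (1/2) 3)) := by
        rw [integral_const_mul, integral_add (sF.1.const_mul _) ((integrable_finsetSum _ fun i hi => (sN i hi).1).const_mul _), integral_const_mul, integral_const_mul,
          integral_finsetSum _ fun i hi => (sN i hi).1]
        ring
    _ ≤ (300 + 1200 * K) * D^2 * (MF * (κF * ∫ y, (∑ k ∈ S, ‖h k y‖^2) ^ 2) + MN * (κN * (2 * ∫ y, (∑ k ∈ S, ‖h k y‖^2) ^ 2))) := by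
        have a1 : ∫ q, (∑ k ∈ S, g k q)^2 ∂(mI (1/2) 3) ≤ κF * ∫ y, (∑ k ∈ S, ‖h k y‖^2) ^ 2 :=
          sF.2.trans (mul_le_mul_of_nonneg_right (le_trans (le_of_eq (by norm_num)) hκF) (H0 _))
        have κ0 : 0 ≤ κN := le_trans (by
          have := (H.pk.kak H.c0 H.C1 H.N1 (e1 := -ε) (e2 := ε) (a := 1/8) (b := 8) (by rw [neg_sq]; rcases H.hε with h | h <;> simp [h]) (by rcases H.hε with h | h <;> simp [h]) le_rfl (by norm_num) le_rfl).KC0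
          have := H.N1
          positivity) hκN
        have a2 : ∑ i ∈ I, ∫ q, (∑ k ∈ Si i, g k q)^2 ∂(mI (1/2) 3) ≤ κN * (2 * ∫ y, (∑ k ∈ S, ‖h k y‖^2) ^ 2) := by
          calc _ ≤ ∑ i ∈ I, κN * ∫ y, (∑ k ∈ Si i, ‖h k y‖^2) ^ 2 := Finset.sum_le_sum fun i hi =>
                (sN i hi).2.trans (mul_le_mul_of_nonneg_right (le_trans (le_of_eq (by rw [show ((i:ℝ) + 2) * θ - i * θ = 2 * θ by ring])) hκN) (H0 _))
            _ = κN * ∫ y, ∑ i ∈ I, (∑ k ∈ Si i, ‖h k y‖^2) ^ 2 := by rw [integral_finsetSum _ fun i _ => H.hsI _, Finset.mul_sum]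
            _ ≤ _ := by
                rw [← integral_const_mul (2:ℝ)]
                refine mul_le_mul_of_nonneg_left (integral_mono (integrable_finsetSum _ fun i _ => H.hsI _) ((H.hsI _).const_mul 2) fun y => ?_) κ0
                exact ovl_sum S f I (g := fun k => ‖h k y‖^2) fun k => sq_nonneg _
        gcongr
    _ = _ := by ring

theorem core {c C : ℝ} (c0 : 0 < c) (C1 : 1 ≤ C) : ∃ r0 ≥ (1:ℝ), ∃ A > 0, ∀ {s N ε K D : ℝ} {lo hi : ℤ} {G E q q1 q2 : ℝ → ℝ} {h : ℤ × ℤ → ℝ × ℝ → ℂ} {F : ℤ × ℤ → ℝ → ℝ × ℝ → ℂ} {e : ℤ × ℤ → P3 → ℝ},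
    CD c C s N ε K D lo hi G E q q1 q2 h F e → ∀ r, r0 ≤ r → N = r^32 →
    Integrable (fun q : P3 => (q.1 - 1/2)^2*(3-q.1)^2 * ‖∑ k ∈ Kb lo hi, F k q.1 q.2‖^4) (mI (1/2) 3) ∧
    ∫ q, (q.1 - 1/2)^2*(3-q.1)^2 * ‖∑ k ∈ Kb lo hi, F k q.1 q.2‖^4 ∂(mI (1/2) 3) ≤ A * (1 + K) * D^2 * r^63 * ∫ y, (∑ k ∈ Kb lo hi, ‖h k y‖^2) ^ 2 := by
  have C0 : 0 < C := by linarith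
  have X0 : 0 < 300 * C * 73728 / c := by positivity
  set a1 := 243 * (16 * Real.pi * Real.sqrt (18 / c)) with ha1
  set b1 := 12 * Real.pi^4 + 256 * |KC (c/9) (5000*C)| with hb1
  set a3 := 144 / (c * Real.sqrt (c / 73728 / (64 * C))) with ha3
  set a2 := 243 * (6 / (c / 73728) + a3 * 36) with ha2
  set b2 := 48 * Real.pi^4 + 256 * |KC (c/9) (5000*C)| with hb2
  have p1 : 0 ≤ a1 := by positivity
  have p3 : 0 ≤ a3 := by positivity
  have p2 : 0 ≤ a2 := by positivity
  have p4 : 0 < b1 := by positivity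
  have p5 : 0 < b2 := by positivity
  refine ⟨16 + 300 * C * 73728 / c, by linarith, 1200 * (1 + a2 * b2 + 2 * a1 * b1), by positivity, ?_⟩
  rintro s _ ε K D lo hi G E q q1 q2 h F e H r hr rfl
  have r1 : 1 ≤ r := by linarith
  have r0 : 0 < r := by linarith
  have K0 := H.K0
  have e16 : (r^32) ^ (1/16:ℝ) = r^2 := by
    rw [← Real.rpow_natCast, ← Real.rpow_mul r0.le, ← Real.rpow_natCast r 2]; congr 1; norm_num
  have kk : 128 * KC (c/9) (5000*C) * (r^32 * (r^32) ^ (1/16:ℝ)) ≤ 128 * |KC (c/9) (5000*C)| * r^34 := by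
    rw [e16, ← pow_add]
    exact mul_le_mul_of_nonneg_right (mul_le_mul_of_nonneg_left (le_abs_self _) (by norm_num)) (by positivity)
  have hpow : ∀ {m n : ℕ}, m ≤ n → r^m ≤ r^n := fun h => pow_le_pow_right₀ r1 h
  have T := H.total (θ := (r^4)⁻¹) (MN := a1 * r^48) (MF := a2 * r^40) (l1 := (r^19)⁻¹) (l2 := (r^17)⁻¹) (κN := b1 * r^15) (κF := b2 * r^17) (by positivity)
    (by rw [one_div]; exact inv_anti₀ (by norm_num) (by have := hpow (show 1 ≤ 4 by norm_num); linarith)) (by positivity) (by positivity)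
    (fun u hu k3 k4 => by
      refine (H.pk.cntN H.c0 H.cl1 C0 H.N1 hu H.hlo H.hhi k3 k4).trans (le_of_eq ?_)
      rw [show 18 * r^32 / c = (18 / c) * (r^16)^2 by ring, Real.sqrt_mul (by positivity), Real.sqrt_sq (by positivity)]; ring)
    (fun u hu k3 h3 k4 h4 hθ => by
      refine (H.pk.cntF H.c0 H.cl1 H.C1 H.N1 hu H.hlo H.hhi h3 h4 (by positivity) (inv_le_one_of_one_le₀ (one_le_pow₀ r1)) hθ ?_).trans ?_
      · rw [show c * r^32 * ((r^4)⁻¹)^2 = c * r^24 by field_simp]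
        have h1 := hpow (show 1 ≤ 24 by norm_num)
        have h2 : 300 * C * 73728 / c ≤ r^24 := by linarith
        rw [div_le_iff₀ c0] at h2; linarith
      · have hl : 1 + Real.log (3 * r^32) ≤ 36 * r^4 := by
          rw [Real.log_mul (by norm_num) (by positivity), Real.log_pow]
          have h1 := Real.log_le_sub_one_of_pos r0
          have h2 := Real.log_le_sub_one_of_pos (show (0:ℝ) < 3 by norm_num)
          have h3 := hpow (show 1 ≤ 4 by norm_num)
          push_cast; linarith
        have e1 : 2 * (3 * r^32) / (c / 73728 * r^32 * ((r^4)⁻¹)^2) = 6 / (c/73728) * r^8 := by field_simp; norm_num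
        have e2 : 144 / (c * Real.sqrt (c / 73728 / (64 * C)) * (r^4)⁻¹) = a3 * r^4 := by
          rw [ha3]; rw [← div_div, div_inv_eq_mul]
        rw [e1, e2]
        calc _ ≤ 81 * (3 * r^32) * (6 / (c/73728) * r^8 + a3 * r^4 * (36 * r^4)) := by gcongr
          _ = _ := by rw [ha2]; ring)
    (by positivity) (by
      have : (r^19)⁻¹ ≤ (r^4)⁻¹ := inv_anti₀ (by positivity) (hpow (by norm_num))
      have : 0 < (r^4)⁻¹ := by positivity
      linarith) (by positivity) (inv_le_one_of_one_le₀ (one_le_pow₀ r1))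
    (by
      refine (add_le_add_right (mul_le_mul_of_nonneg_left kk (by positivity)) _).trans (le_of_eq ?_)
      rw [hb1]; field_simp; ring)
    (by
      refine (add_le_add_right (mul_le_mul_of_nonneg_left kk (by positivity)) _).trans ?_
      rw [hb2]
      have : 2 / (r^17)⁻¹ * (3 * Real.pi^4 * (63/8)) + 2 * (r^17)⁻¹ * (128 * |KC (c/9) (5000*C)| * r^34) = (47.25 * Real.pi^4 + 256 * |KC (c/9) (5000*C)|) * r^17 := by field_simp; ring
      rw [this]
      gcongr; norm_num)
  refine ⟨T.1, T.2.trans ?_⟩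
  have H0 : 0 ≤ ∫ y, (∑ k ∈ Kb lo hi, ‖h k y‖^2) ^ 2 := integral_nonneg fun q => sq_nonneg _
  refine mul_le_mul_of_nonneg_right ?_ H0
  have m1 : a2 * r^40 * (b2 * r^17) + 2 * (a1 * r^48) * (b1 * r^15) ≤ (1 + a2 * b2 + 2 * a1 * b1) * r^63 := by
    have h1 := mul_le_mul_of_nonneg_left (hpow (show 57 ≤ 63 by norm_num)) (mul_nonneg p2 p5.le)
    have h2 : 0 < r^63 := by positivity
    have : a2 * r^40 * (b2 * r^17) + 2 * (a1 * r^48) * (b1 * r^15) = a2 * b2 * r^57 + 2 * a1 * b1 * r^63 := by ring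
    rw [this]; linarith
  calc _ ≤ (1200 * (1 + K)) * D^2 * ((1 + a2 * b2 + 2 * a1 * b1) * r^63) := by gcongr; linarith
    _ = _ := by ring
end CD


theorem Fo_fs {N e1 e2 u A : ℝ} {γ : ℝ → ℝ} {a : ℝ → ℂ} {f : ℝ × ℝ → ℂ} (hγ : Continuous γ) (ha : Continuous a) (hf : BI A f) (k1 k2 : ℝ) :
    (∀ y, FS k1 (k1 + 2) fun x => Fo N e1 e2 γ u a (hk f k1 k2) (x, y)) ∧ ∀ x, FS k2 (k2 + 2) fun y => Fo N e1 e2 γ u a (hk f k1 k2) (x, y) := by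
  obtain ⟨C, C0, hC⟩ := sch_V1 sg
  have sb : ∀ y, ‖sg y‖ ≤ C := fun y => (hC y).trans (mul_le_of_le_one_right C0.le (V1_le y))
  set μ : Measure (ℝ × (ℝ × ℝ)) := (volume.restrict (Ioc (1/2:ℝ) 2)).prod volume with hμ
  have ia : Integrable a (volume.restrict (Ioc (1/2:ℝ) 2)) := (ha.integrableOn_Icc (a := 1/2) (b := 2)).mono_set Ioc_subset_Icc_self
  have iA : Integrable (fun w : ℝ × (ℝ × ℝ) => a w.1 * f w.2) μ := ia.mul_prod hf.i
  have g1 : ∀ p : ℝ × (ℝ × ℝ) → ℝ, Continuous p → ∀ k : ℝ, Integrable (fun w : ℝ × (ℝ × ℝ) => ex (k * p w) * sg (p w) * (a w.1 * f w.2)) μ := fun p hp k =>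
    iA.bdd_mul (c := C) ((ex_cont.comp (by fun_prop)).mul (sg.continuous.comp hp)).aestronglyMeasurable (.of_forall fun w => by rw [norm_mul, ex_norm, one_mul]; exact sb _)
  set p1 : ℝ → ℝ × (ℝ × ℝ) → ℝ := fun x w => x + (N * (e1 * w.1) - w.2.1) with hp1
  set p2 : ℝ → ℝ × (ℝ × ℝ) → ℝ := fun y w => y + (N * (e2 * u * γ w.1) - w.2.2) with hp2
  have c1 : ∀ x, Continuous (p1 x) := fun x => by fun_prop
  have c2 : ∀ x, Continuous (p2 x) := fun x => by fun_prop
  have key : ∀ x y, Fo N e1 e2 γ u a (hk f k1 k2) (x, y) = ∫ w, (ex (k1 * p1 x w) * sg (p1 x w)) * (ex (k2 * p2 y w) * sg (p2 y w) * (a w.1 * f w.2)) ∂μ := fun x y => by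
    have i1 : Integrable (fun w => (ex (k1 * p1 x w) * sg (p1 x w)) * (ex (k2 * p2 y w) * sg (p2 y w) * (a w.1 * f w.2))) μ := (g1 _ (c2 y) k2).bdd_mul (c := C) ((ex_cont.comp ((c1 x).const_mul k1)).mul (sg.continuous.comp (c1 x))).aestronglyMeasurable
      (.of_forall fun w => by rw [norm_mul, ex_norm, one_mul]; exact sb _)
    rw [hμ, integral_prod _ i1, Fo, intervalIntegral.integral_of_le (by norm_num)]
    refine integral_congr_ae (.of_forall fun t => ?_)
    simp only [hk, cv]
    rw [← integral_const_mul]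
    refine integral_congr_ae (.of_forall fun Y => ?_)
    simp only [be, hp1, hp2, ex_add, Prod.fst_sub, Prod.snd_sub, add_sub_assoc]
    ring
  constructor
  · intro y
    convert FS.of_int (g1 _ (c2 y) k2) (p := fun w => N * (e1 * w.1) - w.2.1) (by fun_prop) k1 using 2 with x
    rw [key]; exact integral_congr_ae (.of_forall fun w => mul_comm _ _)
  · intro x
    convert FS.of_int (g1 _ (c1 x) k1) (p := fun w => N * (e2 * u * γ w.1) - w.2.2) (by
      have := hγ.measurable; fun_prop) k2 using 2 with y
    rw [key]; exact integral_congr_ae (.of_forall fun w => by simp only [hp2]; ring)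

theorem Fo_orth {N e1 e2 A : ℝ} {γ : ℝ → ℝ} {a : ℝ → ℂ} {f : ℝ × ℝ → ℂ} (hγ : Continuous γ) (ha : Continuous a) (hf : BI A f) {k1 k2 k3 k4 : ℤ × ℤ}
    (hn : k1 + k2 - k3 - k4 ∉ Kb (-4) 4) (u : ℝ)
    (hi : Integrable fun X => PP (fun k u X => Fo N e1 e2 γ u a (hk f k.1 k.2) X) k1 k2 k3 k4 (u, X)) :
    ∫ X, PP (fun k u X => Fo N e1 e2 γ u a (hk f k.1 k.2) X) k1 k2 k3 k4 (u, X) = 0 := by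
  have F := fun k : ℤ × ℤ => Fo_fs (N := N) (e1 := e1) (e2 := e2) (u := u) hγ ha hf k.1 k.2
  have cst : ∀ n : ℤ, n ∉ Finset.Icc (-4) 4 → (0:ℝ) < n - 4 ∨ (n:ℝ) + 4 < 0 := fun n hn => by
    rw [Finset.mem_Icc, not_and_or, not_le, not_le] at hn
    rcases hn with h | h
    · right; have : (n:ℝ) ≤ -5 := by exact_mod_cast (by lia : n ≤ -5)
      linarith
    · left; have : (5:ℝ) ≤ n := by exact_mod_cast (by lia : 5 ≤ n)
      linarith
  unfold Kb at hn
  rw [Finset.mem_product, not_and_or] at hn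
  rcases hn with h | h
  · rw [Measure.volume_eq_prod] at hi ⊢
    rw [integral_prod_symm _ hi]
    refine integral_eq_zero_of_ae (hi.prod_left_ae.mono fun y hy => ?_)
    refine FS.vanish ((((F k1).1 y).mul ((F k2).1 y)).mul (((F k3).1 y).conj.mul ((F k4).1 y).conj)) hy ?_
    have := cst _ h; push_cast [Prod.fst_add, Prod.fst_sub] at this
    rcases this with h | h
    · left; linarith
    · right; linarith
  · rw [Measure.volume_eq_prod] at hi ⊢
    rw [integral_prod _ hi]
    refine integral_eq_zero_of_ae (hi.prod_right_ae.mono fun y hy => ?_)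
    refine FS.vanish ((((F k1).2 y).mul ((F k2).2 y)).mul (((F k3).2 y).conj.mul ((F k4).2 y).conj)) hy ?_
    have := cst _ h; push_cast [Prod.snd_add, Prod.snd_sub] at this
    rcases this with h | h
    · left; linarith
    · right; linarith

theorem ze_cs {A : ℝ} {h : ℝ × ℝ → ℂ} (hh : BI A h) (hc : Continuous h) (X : ℝ × ℝ) : (∫ Y, ze (X - Y) * ‖h Y‖)^2 ≤ Real.pi^2 * ∫ Y, ze (X - Y) * ‖h Y‖^2 := by
  have zc : Continuous fun Y => ze (X - Y) := ze_cont.comp (sub_cont X)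
  have i1 : Integrable fun Y => ze (X - Y) * ‖h Y‖ := hh.i.norm.bdd_mul (c := 1) zc.aestronglyMeasurable (.of_forall fun Y => by
    rw [Real.norm_of_nonneg (ze_pos _).le]; exact ze_le _)
  have i2 : Integrable fun Y => ze (X - Y) * ‖h Y‖^2 := (i1.mul_const A).mono' (zc.mul (hc.norm.pow 2)).aestronglyMeasurable (.of_forall fun Y => by
    rw [Real.norm_of_nonneg (mul_nonneg (ze_pos _).le (sq_nonneg _)), mul_assoc, sq]
    exact mul_le_mul_of_nonneg_left (mul_le_mul_of_nonneg_left (hh.b _) (norm_nonneg _)) (ze_pos _).le)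
  set I1 := ∫ Y, ze (X - Y) * ‖h Y‖ with hI1
  have P0 : 0 < Real.pi^2 := by positivity
  have : 0 ≤ ∫ Y, ze (X - Y) * (‖h Y‖ - I1 / Real.pi^2)^2 := integral_nonneg fun Y => mul_nonneg (ze_pos _).le (sq_nonneg _)
  have e : ∫ Y, ze (X - Y) * (‖h Y‖ - I1 / Real.pi^2)^2 = (∫ Y, ze (X - Y) * ‖h Y‖^2) - 2 * (I1 / Real.pi^2) * I1 + Real.pi^2 * (I1 / Real.pi^2)^2 := by
    have : (fun Y => ze (X - Y) * (‖h Y‖ - I1 / Real.pi^2)^2) = fun Y => (ze (X - Y) * ‖h Y‖^2 - 2 * (I1 / Real.pi^2) * (ze (X - Y) * ‖h Y‖)) + ze (X - Y) * (I1 / Real.pi^2)^2 := by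
      ext Y; ring
    have i3 : Integrable (fun Y => ze (X - Y) * ‖h Y‖^2 - 2 * (I1 / Real.pi^2) * (ze (X - Y) * ‖h Y‖)) := i2.sub (i1.const_mul _)
    rw [this, integral_add i3 ((zeX_int X).mul_const _), integral_sub i2 (i1.const_mul _), integral_const_mul, integral_mul_const, zeX_integral]
  rw [e] at this
  have h2 : Real.pi^2 * (I1 / Real.pi^2)^2 = I1 ^ 2 / Real.pi^2 := by field_simp
  have h3 : 2 * (I1 / Real.pi^2) * I1 = 2 * (I1 ^ 2 / Real.pi^2) := by ring
  rw [h2, h3] at this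
  have h4 : I1^2 / Real.pi^2 ≤ ∫ Y, ze (X - Y) * ‖h Y‖^2 := by linarith
  rw [div_le_iff₀ P0] at h4; linarith

/-- majorant -/
noncomputable def ee (Cb N ε : ℝ) (G E : ℝ → ℝ) (h : ℤ × ℤ → ℝ × ℝ → ℂ) (k : ℤ × ℤ) (q : P3) : ℝ :=
  Cb * N⁻¹ * ∫ Y, ze (q.2 + (N * (-ε * G (sl k / q.1)), N * (ε * q.1 * E (sl k / q.1))) - Y) * ‖h k Y‖

theorem cd_inst (T m B s : ℝ) {χ : ℝ → ℂ} (hχ : UB (ι := Unit) (1/2) 2 True 6 (fun _ => χ)) (hc : Continuous χ) :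
    ∃ c C Cb : ℝ, 0 < c ∧ 1 ≤ C ∧ 0 < Cb ∧ ∀ g, Crv T m B s g → Continuous (g 0) → ∃ q q1 q2 : ℝ → ℝ, ∀ {N ε A : ℝ} {lo hi : ℤ} {f : ℝ × ℝ → ℂ}, 1 ≤ N → (ε = 1 ∨ ε = -1) →
      3*N/8 ≤ lo → (hi:ℝ) ≤ 2*N → BI A f →
      CD c C s N ε (1 + 8 * C) ((Cb * N⁻¹)^2 * Real.pi^2) lo hi (Gi T g) (fun y => g 0 (Gi T g y)) q q1 q2 (fun k => hk f k.1 k.2)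
        (fun k u X => Fo N (-ε) ε (g 0) u χ (hk f k.1 k.2) X) (ee Cb N ε (Gi T g) (fun y => g 0 (Gi T g y)) (fun k => hk f k.1 k.2)) := by
  obtain ⟨c, C, c0, C0, hpk⟩ := Crv.pk T m B s
  obtain ⟨Cb, Cb0, hF⟩ := Ix.Fb T m B s hχ hc
  obtain ⟨C', C0', hbe⟩ := be_kd sg sg
  refine ⟨min c 1, max C 1, Cb, by positivity, le_max_right _ _, Cb0, fun g hg hgc => ?_⟩
  obtain ⟨q, q1, q2, pk⟩ := hpk g hg
  replace pk := pk.mono (min_le_left c 1) (le_max_left C 1)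
  set C1 := max C 1 with hC1
  have C11 : 1 ≤ C1 := le_max_right _ _
  set G := Gi T g with hG
  set E : ℝ → ℝ := fun y => g 0 (G y) with hE
  refine ⟨q, q1, q2, fun {N ε A lo hi f} hN hε hlo hhi hf => ?_⟩
  have N0 : 0 < N := by linarith
  have kb : ∀ k ∈ Kb lo hi, ((k.1:ℝ) ∈ Icc (3*N/8) (2*N)) ∧ ((k.2:ℝ) ∈ Icc (3*N/8) (2*N)) ∧ sl k ∈ Icc (1/8:ℝ) 8 := fun k hk => by
    unfold Kb at hk
    rw [Finset.mem_product, Finset.mem_Icc, Finset.mem_Icc] at hk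
    obtain ⟨⟨a1, a2⟩, a3, a4⟩ := hk
    have b1 : (lo:ℝ) ≤ k.1 := by exact_mod_cast a1
    have b2 : (k.1:ℝ) ≤ hi := by exact_mod_cast a2
    have b3 : (lo:ℝ) ≤ k.2 := by exact_mod_cast a3
    have b4 : (k.2:ℝ) ≤ hi := by exact_mod_cast a4
    have h3 : (0:ℝ) < k.2 := by linarith
    refine ⟨⟨by linarith, by linarith⟩, ⟨by linarith, by linarith⟩, ?_, ?_⟩
    · unfold sl; rw [le_div_iff₀ h3]; linarith
    · unfold sl; rw [div_le_iff₀ h3]; linarith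
  have hcont : ∀ k : ℤ × ℤ, Continuous (hk f k.1 k.2) := fun k => (hbe _ _).cvc hf
  have hbi : ∀ k : ℤ × ℤ, BI (C' * Real.pi^2 * A) (hk f k.1 k.2) := fun k => (hbe _ _).cv_bi hf
  have ym : ∀ k ∈ Kb lo hi, ∀ u ∈ Icc (1/2:ℝ) 3, sl k / u ∈ Ioo (1/64:ℝ) 64 := fun k hk u hu => Pk.ymem hu (kb k hk).2.2
  -- key per-u bounds
  have key : ∀ k ∈ Kb lo hi, ∀ u ∈ Icc (1/2:ℝ) 3, ∀ X, ‖Fo N (-ε) ε (g 0) u χ (hk f k.1 k.2) X‖ ≤ ee Cb N ε G E (fun k => hk f k.1 k.2) k (u, X) ∧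
      ∃ dF : ℝ → ℂ, Continuous dF ∧ (∀ u, HasDerivAt (fun u => Fo N (-ε) ε (g 0) u χ (hk f k.1 k.2) X) (dF u) u) ∧
        ‖dF u - Complex.I * (ε * N * wk E u k : ℝ) * Fo N (-ε) ε (g 0) u χ (hk f k.1 k.2) X‖ ≤ N * ee Cb N ε G E (fun k => hk f k.1 k.2) k (u, X) := fun k hk u hu X => by
    obtain ⟨b1, b2, b3⟩ := kb k hk
    have es : (k.1:ℝ) / N / (k.2 / N) = sl k := by unfold sl; field_simp
    let i : Ix T m B s := ⟨g, hg, N, hN, u, hu, k.1 / N, k.2 / N, ⟨by rw [le_div_iff₀ N0]; linarith [b2.1], by rw [div_le_iff₀ N0]; linarith [b2.2]⟩, by rw [es]; exact b3, ε, hε⟩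
    have et : i.tc = G (sl k / u) := by
      show Gi T g ((k.1:ℝ) / N / (k.2 / N) / u) = _
      rw [es]
    have eS : ∀ X, i.S (_root_.hk f k.1 k.2) X = ∫ Y, ze (X + (N * (-ε * G (sl k / u)), N * (ε * u * E (sl k / u))) - Y) * ‖_root_.hk f k.1 k.2 Y‖ := fun X => by
      unfold Ix.S; rw [et]
    obtain ⟨r1, dF, r2, r3, r4⟩ := hF i hgc k.1 k.2 (by show (k.1:ℝ) = N * (k.1 / N); field_simp) (by show (k.2:ℝ) = N * (k.2 / N); field_simp) hf X
    rw [eS] at r1 r4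
    refine ⟨r1, dF, r2, r3, ?_⟩
    rw [et] at r4
    have ew : ε * N * wk E u k = ε * N * k.2 * g 0 (G (sl k / u)) := by unfold wk ww sl; rw [mul_assoc (ε * N)]
    rw [ew]
    refine r4.trans (le_of_eq ?_)
    unfold ee
    field_simp
  have dw : ∀ k ∈ Kb lo hi, ∀ u ∈ Icc (1/2:ℝ) 3, HasDerivAt (fun u => ε * N * wk E u k) (-(ε * N * k.1 * q (sl k / u) / u^2)) u := fun k hk u hu => by
    have u0 : u ≠ 0 := by linarith [hu.1]
    have k0 : (k.2:ℝ) ≠ 0 := by linarith [(kb k hk).2.1.1]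
    have h1 : HasDerivAt (fun u => sl k / u) (-(sl k / u^2)) u := by
      simpa [div_eq_mul_inv] using (hasDerivAt_inv u0).const_mul (sl k)
    have h2 := (((pk.dE _ (ym k hk u hu)).comp u h1).const_mul (k.2:ℝ)).const_mul (ε * N)
    refine h2.congr_deriv ?_
    unfold sl; field_simp
  refine ⟨pk, by positivity, min_le_right _ _, C11, hN, hε, by linarith, by positivity, hlo, hhi, hcont, ⟨_, fun k => (hbi k).b⟩, fun k => (hbi k).i,
    fun k => Fo_cont hgc hc (hcont k), fun k hk X => ⟨?_, ⟨fun u => -(ε * N * k.1 * q (sl k / u) / u^2), ?_, fun u hu => ⟨dw k hk u hu, ?_⟩⟩, fun u hu => (key k hk u hu X).1⟩,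
    fun k hk Q hQ => ?_, fun k1 _ k2 _ k3 _ k4 _ hn u hi => Fo_orth hgc hc hf hn u hi⟩
  · obtain ⟨-, dF, d1, d2, -⟩ := key k hk 1 ⟨by norm_num, by norm_num⟩ X
    refine ⟨dF, d1.continuousOn, fun u hu => ⟨d2 u, ?_⟩⟩
    obtain ⟨r0, dF', -, d2', r⟩ := key k hk u hu X
    rw [(d2 u).unique (d2' u)]
    refine r.trans ?_
    have := (norm_nonneg _).trans r0
    exact mul_le_mul_of_nonneg_right (by nlinarith) this
  · refine ContinuousOn.neg (ContinuousOn.div (continuousOn_const.mul fun u hu => ?_) (by fun_prop) fun u hu => by have := hu.1; positivity)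
    have u0 : u ≠ 0 := by linarith [hu.1]
    exact ((pk.dq _ (ym k hk u hu)).continuousAt.comp (f := fun u => sl k / u) (by fun_prop (disch := assumption))).continuousWithinAt
  · obtain ⟨b1, b2, b3⟩ := kb k hk
    have u0 : 0 < u := by linarith [hu.1]
    have hq := pk.bq _ (ym k hk u hu)
    have e1 : |ε| = 1 := by rcases hε with h | h <;> simp [h]
    rw [abs_neg, abs_div, abs_mul, abs_mul, abs_mul, e1, one_mul, abs_of_pos N0, abs_of_pos (by linarith [b1.1] : (0:ℝ) < k.1), abs_of_pos (by positivity : 0 < u^2), div_le_iff₀ (by positivity)]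
    have u2 : 1/4 ≤ u^2 := by nlinarith [hu.1]
    calc _ ≤ N * (2 * N) * C1 := by gcongr; exact b1.2
      _ ≤ (8 * C1) * N^2 * (1/4) := by linarith
      _ ≤ _ := by gcongr; linarith
  · obtain ⟨b1, b2, b3⟩ := kb k hk
    have eG : GG N ε G E (fun k => _root_.hk f k.1 k.2) k Q = ∫ Y, ze (Q.2 + (N * (-ε * G (sl k / Q.1)), N * (ε * Q.1 * E (sl k / Q.1))) - Y) * ‖_root_.hk f k.1 k.2 Y‖^2 := by
      unfold GG kT ps
      dsimp only
      rw [Pk.lf_eq _ b3 hQ, Pk.lf_eq _ b3 hQ]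
      exact integral_congr_ae (.of_forall fun Y => mul_comm _ _)
    rw [eG]; unfold ee
    rw [mul_pow, mul_assoc ((Cb * N⁻¹)^2)]
    exact mul_le_mul_of_nonneg_left (ze_cs (hbi k) (hcont k) _) (by positivity)


theorem hk_l4 : ∃ C > 0, ∀ (S : Finset (ℤ × ℤ)) {A : ℝ} {f : ℝ × ℝ → ℂ}, BI A f →
    ∫ y, (∑ k ∈ S, ‖hk f k.1 k.2 y‖^2)^2 ≤ C * A^3 * ∫ y, ‖f y‖ := by
  obtain ⟨C, C0, hC⟩ := bessel
  refine ⟨C^2 * Real.pi^2 * Real.pi^2, by positivity, fun S A f hf => ?_⟩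
  have A0 := hf.A0
  have zk : Kd 1 (fun z => (ze z : ℂ)) := ⟨Complex.continuous_ofReal.comp ze_cont, fun z => by
    rw [Complex.norm_real, Real.norm_of_nonneg (ze_pos z).le, one_mul]⟩
  have nf : BI A (fun y => (‖f y‖ : ℂ)) := ⟨hf.i.norm.ofReal, fun y => by simpa using hf.b y⟩
  have e : ∀ X, cv (fun z => (ze z : ℂ)) (fun y => (‖f y‖ : ℂ)) X = ((∫ Y, ze (X - Y) * ‖f Y‖ : ℝ) : ℂ) := fun X => by
    unfold cv; refine Eq.trans ?_ integral_complex_ofReal; simp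
  have I0 : ∀ X, 0 ≤ ∫ Y, ze (X - Y) * ‖f Y‖ := fun X => integral_nonneg fun Y => mul_nonneg (ze_pos _).le (norm_nonneg _)
  have e' : ∀ X, ‖cv (fun z => (ze z : ℂ)) (fun y => (‖f y‖ : ℂ)) X‖ = ∫ Y, ze (X - Y) * ‖f Y‖ := fun X => by
    rw [e, Complex.norm_real, Real.norm_of_nonneg (I0 X)]
  have b := zk.cvL1 nf
  have i := (zk.cv_bi nf).i.norm
  simp_rw [e'] at b i
  calc _ ≤ ∫ X, C^2 * Real.pi^2 * A^3 * ∫ Y, ze (X - Y) * ‖f Y‖ := by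
        refine integral_mono_of_nonneg (.of_forall fun X => by positivity) (i.const_mul _) (.of_forall fun X => ?_)
        have h1 := hC S hf X
        have h2 := zk.cvb nf X
        rw [e'] at h2
        have s0 : 0 ≤ ∑ k ∈ S, ‖hk f k.1 k.2 X‖^2 := Finset.sum_nonneg fun _ _ => by positivity
        beta_reduce
        calc _ ≤ (C * A * ∫ Y, ze (X - Y) * ‖f Y‖)^2 := pow_le_pow_left₀ s0 h1 2
          _ = C^2 * A^2 * (∫ Y, ze (X - Y) * ‖f Y‖) * ∫ Y, ze (X - Y) * ‖f Y‖ := by ring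
          _ ≤ C^2 * A^2 * (1 * Real.pi^2 * A) * ∫ Y, ze (X - Y) * ‖f Y‖ := mul_le_mul_of_nonneg_right (mul_le_mul_of_nonneg_left h2 (by positivity)) (I0 X)
          _ = _ := by ring
    _ = C^2 * Real.pi^2 * A^3 * ∫ X, ∫ Y, ze (X - Y) * ‖f Y‖ := integral_const_mul _ _
    _ ≤ C^2 * Real.pi^2 * A^3 * (1 * Real.pi^2 * ∫ Y, ‖f Y‖) := by
        refine mul_le_mul_of_nonneg_left (by simpa using b) (by positivity)
    _ = _ := by ring

theorem rt_right (T m B s : ℝ) {χ : ℝ → ℂ} (hχ : UB (ι := Unit) (1/2) 2 True 6 (fun _ => χ)) (hc : Continuous χ) :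
    ∃ r0 ≥ (1:ℝ), ∃ C > 0, ∀ g, Crv T m B s g → Continuous (g 0) → ∀ {r ε A : ℝ} {lo hi : ℤ} {f : ℝ × ℝ → ℂ}, r0 ≤ r → (ε = 1 ∨ ε = -1) →
      3*r^32/8 ≤ lo → (hi:ℝ) ≤ 2*r^32 → BI A f →
      ∫⁻ q, ‖∑ k ∈ Kb lo hi, Fo (r^32) (-ε) ε (g 0) q.1 χ (hk f k.1 k.2) q.2‖ₑ^4 ∂(mI 1 2) ≤ ENNReal.ofReal (C * (r^65)⁻¹ * A^3 * ∫ y, ‖f y‖) := by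
  obtain ⟨c, C, Cb, c0, C1, Cb0, h⟩ := cd_inst T m B s hχ hc
  obtain ⟨r0, hr0, A', A0, hcore⟩ := CD.core c0 C1
  obtain ⟨H, H0, hH⟩ := hk_l4
  refine ⟨r0, hr0, 4 * (A' * (1 + (1 + 8 * C)) * (Cb^4 * Real.pi^4) * H), by positivity, fun g hg gc r ε A lo hi f hr hε hlo hhi hf => ?_⟩
  have r1 : 1 ≤ r := hr0.le.trans hr
  obtain ⟨q, q1, q2, hq⟩ := h g hg gc
  obtain ⟨i, b⟩ := hcore (hq (one_le_pow₀ r1) hε hlo hhi hf) r hr rfl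
  set F : P3 → ℂ := fun q => ∑ k ∈ Kb lo hi, Fo (r^32) (-ε) ε (g 0) q.1 χ (hk f k.1 k.2) q.2 with hF
  have hle : mI 1 2 ≤ mI (1/2) 3 := by
    unfold mI
    exact Measure.prod_mono (Measure.restrict_mono (Icc_subset_Icc (by norm_num) (by norm_num)) le_rfl) le_rfl
  have j0 : ∀ q : P3, 0 ≤ (q.1 - 1/2)^2*(3-q.1)^2 * ‖F q‖^4 := fun q => by positivity
  calc _ ≤ ∫⁻ q, ENNReal.ofReal (4 * ((q.1 - 1/2)^2*(3-q.1)^2 * ‖F q‖^4)) ∂(mI 1 2) := by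
        refine lintegral_mono_ae ((mI_ae 1 2).mono fun q hq => ?_)
        rw [← ofReal_norm, ← ENNReal.ofReal_pow (norm_nonneg _)]
        refine ENNReal.ofReal_le_ofReal ?_
        have h1 : 1/2 ≤ (q.1 - 1/2) * (3 - q.1) := by nlinarith [hq.1, hq.2]
        have : 1 ≤ 4 * ((q.1 - 1/2)^2 * (3-q.1)^2) := by nlinarith
        calc _ = 1 * ‖F q‖^4 := (one_mul _).symm
          _ ≤ 4 * ((q.1 - 1/2)^2 * (3-q.1)^2) * ‖F q‖^4 := by gcongr
          _ = _ := by ring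
    _ ≤ ∫⁻ q, ENNReal.ofReal (4 * ((q.1 - 1/2)^2*(3-q.1)^2 * ‖F q‖^4)) ∂(mI (1/2) 3) := lintegral_mono' hle le_rfl
    _ = ENNReal.ofReal (4 * ∫ q : P3, (q.1 - 1/2)^2*(3-q.1)^2 * ‖F q‖^4 ∂(mI (1/2) 3)) := by
        rw [← ofReal_integral_eq_lintegral_ofReal (i.const_mul 4) (.of_forall fun q => mul_nonneg (by norm_num) (j0 q)), integral_const_mul]
    _ ≤ _ := by
        refine ENNReal.ofReal_le_ofReal ?_
        have r0' : r ≠ 0 := by linarith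
        calc _ ≤ 4 * (A' * (1 + (1 + 8 * C)) * ((Cb * (r^32)⁻¹)^2 * Real.pi^2)^2 * r^63 * (H * A^3 * ∫ y, ‖f y‖)) := by
              refine mul_le_mul_of_nonneg_left (b.trans (mul_le_mul_of_nonneg_left (hH _ hf) (by positivity))) (by norm_num)
          _ = _ := by field_simp



theorem pw_mono {h h' : ℝ → ℝ} {c : ℝ} (hd : ∀ x ∈ Ioo (0:ℝ) 1, HasDerivAt h (h' x) x) (hc : ∀ x ∈ Ioo (0:ℝ) 1, c * h x ≤ x * h' x)
    {x t : ℝ} (hx : x ∈ Ioo (0:ℝ) 1) (h1 : 1 ≤ t) (ht : x * t < 1) : t ^ c * h x ≤ h (x * t) := by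
  have hD : ∀ y ∈ Ioo (0:ℝ) 1, HasDerivAt (fun y => h y * y ^ (-c)) (h' y * y ^ (-c) + h y * (-c * y ^ (-c - 1))) y := fun y hy =>
    (hd y hy).fun_mul (Real.hasDerivAt_rpow_const (Or.inl hy.1.ne'))
  have t0 : 0 < t := by linarith
  have hy : x * t ∈ Ioo (0:ℝ) 1 := ⟨mul_pos hx.1 t0, ht⟩
  have hm : MonotoneOn (fun y => h y * y ^ (-c)) (Ioo (0:ℝ) 1) := by
    refine monotoneOn_of_deriv_nonneg (convex_Ioo 0 1) (fun y hy => (hD y hy).continuousAt.continuousWithinAt)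
      (by rw [interior_Ioo]; exact fun y hy => (hD y hy).differentiableAt.differentiableWithinAt) ?_
    rw [interior_Ioo]; intro y hy
    rw [(hD y hy).deriv, show y ^ (-c) = y * y ^ (-c - 1) by
      rw [Real.rpow_sub_one hy.1.ne']; field_simp [hy.1.ne']]
    have : 0 < y ^ (-c-1) := Real.rpow_pos_of_pos hy.1 _
    nlinarith [hc y hy]
  have := hm hx hy (le_mul_of_one_le_right hx.1.le h1)
  beta_reduce at this
  rw [Real.mul_rpow hx.1.le t0.le, Real.rpow_neg t0.le, Real.rpow_neg hx.1.le] at this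
  have a := Real.rpow_pos_of_pos t0 c
  have b := Real.rpow_pos_of_pos hx.1 c
  calc _ = t ^ c * x ^ c * (h x * (x ^ c)⁻¹) := by field_simp
    _ ≤ t ^ c * x ^ c * (h (x * t) * ((x ^ c)⁻¹ * (t ^ c)⁻¹)) := mul_le_mul_of_nonneg_left this (by positivity)
    _ = _ := by field_simp

theorem mk_crv (γ : ℝ → ℝ)
    (hγ0 : γ 0 = 0)
    (hsmooth : ContDiffOn ℝ (⊤ : ℕ∞) γ (Set.Icc (-1 : ℝ) 1))
    (hmono : StrictMonoOn γ (Set.Icc (0 : ℝ) 1))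
    (hyp1 : ∃ c > (0 : ℝ), ∀ t ∈ Set.Ioc (0 : ℝ) 1,
      c ≤ |deriv (fun s => deriv γ s / deriv (deriv γ) s) t|)
    (hyp2 : ∃ c > (0 : ℝ), ∀ j ∈ ({1, 2} : Set ℕ), ∀ t ∈ Set.Ioc (0 : ℝ) 1,
      c ≤ |t ^ j * iteratedDeriv j γ t / γ t|)
    (hyp3 : ∃ C : ℝ, ∀ j : ℕ, 1 ≤ j → j ≤ 1000 → ∀ t ∈ Set.Ioc (0 : ℝ) 1,
      |t ^ j * iteratedDeriv j γ t / γ t| ≤ C)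
    (hconv : ∀ t ∈ Set.Ioc (0 : ℝ) 1, 0 < iteratedDeriv 2 γ t) :
    ∃ T m B s : ℝ, ∃ L₀ : ℕ, ∀ l : ℕ, L₀ ≤ l → ∃ g, g 0 = gammaZ γ l ∧ Crv T m B s g := by
  obtain ⟨c1, c10, hc1⟩ := hyp1
  obtain ⟨c, c0, hc⟩ := hyp2
  obtain ⟨C', hC'⟩ := hyp3
  set C := max C' 1 with hCd
  have C1 : 1 ≤ C := le_max_right _ _
  set D : ℕ → ℝ → ℝ := fun n => iteratedDeriv n γ with hD
  have D0 : D 0 = γ := iteratedDeriv_zero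
  have dD : ∀ n, ∀ x ∈ Ioo (0:ℝ) 1, HasDerivAt (D n) (D (n+1) x) x := fun n x hx => by
    have h1 : ContDiffOn ℝ (⊤ : ℕ∞) γ (Ioo (-1) 1) := hsmooth.mono Ioo_subset_Icc_self
    have h2 := h1.differentiableOn_iteratedDerivWithin (m := n) (by exact_mod_cast WithTop.coe_lt_top n) isOpen_Ioo.uniqueDiffOn
    have hx' : x ∈ Ioo (-1:ℝ) 1 := ⟨by linarith [hx.1], hx.2⟩
    have h3 : DifferentiableAt ℝ (D n) x := ((h2.congr fun y hy => (iteratedDerivWithin_of_isOpen isOpen_Ioo hy).symm) x hx').differentiableAt (isOpen_Ioo.mem_nhds hx')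
    have := h3.hasDerivAt
    rwa [hD, ← iteratedDeriv_succ] at this
  have ioc : ∀ x ∈ Ioo (0:ℝ) 1, x ∈ Ioc (0:ℝ) 1 := fun x hx => ⟨hx.1, hx.2.le⟩
  have gp : ∀ x ∈ Ioo (0:ℝ) 1, 0 < γ x := fun x hx => by
    have := hmono ⟨le_rfl, zero_le_one⟩ ⟨hx.1.le, hx.2.le⟩ hx.1; rwa [hγ0] at this
  have up : ∀ n ≤ 10, ∀ x ∈ Ioo (0:ℝ) 1, |x^n * D n x| ≤ C * γ x := fun n hn x hx => by
    rcases Nat.eq_zero_or_pos n with h | h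
    · subst h; rw [D0, pow_zero, one_mul, abs_of_pos (gp x hx)]; nlinarith [gp x hx]
    · have := hC' n h (by lia) x (ioc x hx)
      rw [abs_div, abs_of_pos (gp x hx), div_le_iff₀ (gp x hx)] at this
      exact this.trans (mul_le_mul_of_nonneg_right (le_max_left _ _) (gp x hx).le)
  have lw : ∀ n ∈ ({1, 2} : Set ℕ), ∀ x ∈ Ioo (0:ℝ) 1, 0 ≤ D n x → c * γ x ≤ x^n * D n x := fun n hn x hx h => by
    have := hc n hn x (ioc x hx)
    rw [abs_div, abs_of_pos (gp x hx), le_div_iff₀ (gp x hx), abs_of_nonneg (mul_nonneg (pow_nonneg hx.1.le _) h)] at this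
    exact this
  have p1 : ∀ x ∈ Ioo (0:ℝ) 1, 0 ≤ D 1 x := fun x hx => by
    have hg : HasDerivAt γ (D 1 x) x := D0 ▸ dD 0 x hx
    rw [← (hg.hasDerivWithinAt (s := Ioo (0:ℝ) 1)).derivWithin (isOpen_Ioo.uniqueDiffWithinAt hx)]
    exact (hmono.monotoneOn.mono Ioo_subset_Icc_self).derivWithin_nonneg
  have p2 : ∀ x ∈ Ioo (0:ℝ) 1, 0 < D 2 x := fun x hx => hconv x (ioc x hx)
  have l1 : ∀ x ∈ Ioo (0:ℝ) 1, c * γ x ≤ x * D 1 x := fun x hx => by simpa using lw 1 (by simp) x hx (p1 x hx)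
  have l2 : ∀ x ∈ Ioo (0:ℝ) 1, c * γ x ≤ x^2 * D 2 x := fun x hx => lw 2 (by simp) x hx (p2 x hx).le
  have u1 : ∀ x ∈ Ioo (0:ℝ) 1, x * D 1 x ≤ C * γ x := fun x hx => by simpa using (le_abs_self _).trans (up 1 (by norm_num) x hx)
  -- growth
  have g1 : ∀ {x t : ℝ}, x ∈ Ioo (0:ℝ) 1 → 1 ≤ t → x * t < 1 → γ (x * t) ≤ t ^ C * γ x := fun {x t} hx ht h => by
    have := pw_mono (h := fun y => -γ y) (h' := fun y => -D 1 y) (c := C) (fun y hy => (D0 ▸ dD 0 y hy).fun_neg) (fun y hy => by linarith [u1 y hy]) hx ht h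
    linarith
  have g2 : ∀ {x t : ℝ}, x ∈ Ioo (0:ℝ) 1 → 1 ≤ t → x * t < 1 → t ^ (c/C) * D 1 x ≤ D 1 (x * t) := fun {x t} hx ht h =>
    pw_mono (dD 1) (fun y hy => by
      have a := u1 y hy
      have b := l2 y hy
      refine le_of_mul_le_mul_left ?_ hy.1
      calc y * (c / C * D 1 y) = c / C * (y * D 1 y) := by ring
        _ ≤ c / C * (C * γ y) := by gcongr
        _ = c * γ y := by field_simp
        _ ≤ _ := by rw [pow_two, mul_assoc] at b; exact b) hx ht h
  -- sign
  set q : ℝ → ℝ := fun x => D 2 x ^ 2 - D 1 x * D 3 x with hq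
  have qc : ContinuousOn q (Ioo 0 1) := fun x hx => by
    have a := (dD 1 x hx).continuousAt; have b := (dD 2 x hx).continuousAt; have d := (dD 3 x hx).continuousAt
    exact ((b.pow 2).sub (a.mul d)).continuousWithinAt
  have qa : ∀ x ∈ Ioo (0:ℝ) 1, c1 * D 2 x ^ 2 ≤ |q x| := fun x hx => by
    have h := hc1 x (ioc x hx)
    have e1 : deriv γ = D 1 := by rw [hD]; simp [iteratedDeriv_one]
    have e2 : deriv (D 1) = D 2 := by rw [hD]; simp only; rw [← iteratedDeriv_succ]
    rw [e1, e2, ((dD 1 x hx).fun_div (dD 2 x hx) (p2 x hx).ne').deriv, abs_div, abs_of_pos (pow_pos (p2 x hx) 2), le_div_iff₀ (pow_pos (p2 x hx) 2)] at h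
    refine h.trans_eq ?_
    rw [hq]; ring_nf
  have q0 : ∀ x ∈ Ioo (0:ℝ) 1, q x ≠ 0 := fun x hx h => by
    have := qa x hx; rw [h, abs_zero] at this
    nlinarith [mul_pos c10 (pow_pos (p2 x hx) 2)]
  obtain ⟨s, hs, hsq⟩ : ∃ s : ℝ, (s = 1 ∨ s = -1) ∧ ∀ x ∈ Ioo (0:ℝ) 1, s * q x = |q x| := by
    have im := (isPreconnected_Ioo (a := (0:ℝ)) (b := 1)).image q qc
    by_cases h : ∀ x ∈ Ioo (0:ℝ) 1, 0 < q x
    · exact ⟨1, Or.inl rfl, fun x hx => by rw [abs_of_pos (h x hx), one_mul]⟩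
    · push Not at h
      obtain ⟨y, hy, hy0⟩ := h
      refine ⟨-1, Or.inr rfl, fun x hx => ?_⟩
      rcases le_or_gt (q x) 0 with h | h
      · rw [abs_of_nonpos h]; ring
      · obtain ⟨z, hz, hz0⟩ := im.ordConnected.out (mem_image_of_mem q hy) (mem_image_of_mem q hx) ⟨hy0, h.le⟩
        exact absurd hz0 (q0 z hz)
  -- choose T
  have cC : 0 < c / C := by positivity
  set R : ℝ := 64 * (C + 1/c) with hR
  have R1 : 1 ≤ R := by have : 0 < 1 / c := by positivity
                        linarith
  set T : ℝ := max 2 (R ^ (1/(c/C))) with hT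
  have T2 : 2 ≤ T := le_max_left _ _
  have TR : R ≤ T ^ (c/C) := by
    calc R = (R ^ (1/(c/C))) ^ (c/C) := by rw [← Real.rpow_mul (by linarith), one_div_mul_cancel cC.ne', Real.rpow_one]
      _ ≤ _ := Real.rpow_le_rpow (Real.rpow_nonneg (by linarith) _) (le_max_right _ _) cC.le
  set M : ℝ := (2 * T) ^ C with hM
  have M0 : 0 < M := Real.rpow_pos_of_pos (by linarith) _
  set m0 : ℝ := c / (2*T)^2 * M⁻¹ with hm0
  have m00 : 0 < m0 := by positivity
  obtain ⟨L, hL⟩ := exists_pow_lt_of_lt_one (show 0 < 1/(2*T) by positivity) (show (1/2:ℝ) < 1 by norm_num)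
  refine ⟨T, min m0 (c1 * m0^2), (2*T)^10 * (C * M), s, L, fun l hl => ?_⟩
  set a : ℝ := (2:ℝ) ^ (-(l:ℤ)) with ha
  have ha' : a < 1/(2*T) := by
    rw [ha, zpow_neg, zpow_natCast, ← inv_pow, ← one_div]
    exact (pow_le_pow_of_le_one (by norm_num) (by norm_num) hl).trans_lt hL
  have a0 : 0 < a := by positivity
  have a1 : a * (2*T) < 1 := by rwa [lt_div_iff₀ (by linarith)] at ha'
  have aI : a ∈ Ioo (0:ℝ) 1 := ⟨a0, by nlinarith⟩
  have t0 : ∀ t ∈ Icc (1/(2*T)) (2*T), 0 < t := fun t ht => lt_of_lt_of_le (by positivity) ht.1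
  have tI : ∀ t ∈ Icc (1/(2*T)) (2*T), a * t ∈ Ioo (0:ℝ) 1 := fun t ht => ⟨mul_pos a0 (t0 t ht), by nlinarith [ht.2]⟩
  have ga := gp a aI
  have rat : ∀ t ∈ Icc (1/(2*T)) (2*T), γ (a * t) ≤ M * γ a ∧ M⁻¹ * γ a ≤ γ (a * t) := fun t ht => by
    have tp := t0 t ht
    have M1 : 1 ≤ M := Real.one_le_rpow (by linarith) (by linarith)
    rcases le_total 1 t with h | h
    · constructor
      · exact (g1 aI h (tI t ht).2).trans (mul_le_mul_of_nonneg_right (Real.rpow_le_rpow tp.le ht.2 (by linarith)) ga.le)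
      · have : γ a ≤ γ (a * t) := hmono.monotoneOn ⟨a0.le, aI.2.le⟩ ⟨(tI t ht).1.le, (tI t ht).2.le⟩ (le_mul_of_one_le_right a0.le h)
        exact (mul_le_of_le_one_left ga.le (inv_le_one_of_one_le₀ M1)).trans this
    · constructor
      · have : γ (a * t) ≤ γ a := hmono.monotoneOn ⟨(tI t ht).1.le, (tI t ht).2.le⟩ ⟨a0.le, aI.2.le⟩ (mul_le_of_le_one_right a0.le h)
        exact this.trans (le_mul_of_one_le_left ga.le M1)
      · have e : a * t * t⁻¹ = a := by field_simp
        have := g1 (tI t ht) (one_le_inv₀ tp |>.2 h) (by rw [e]; exact aI.2)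
        rw [e] at this
        rw [inv_mul_le_iff₀ M0]
        refine this.trans (mul_le_mul_of_nonneg_right (Real.rpow_le_rpow (by positivity) ?_ (by linarith)) (gp _ (tI t ht)).le)
        rw [inv_le_comm₀ tp (by linarith), ← one_div]; exact ht.1
  have lowb : ∀ n ∈ ({1, 2} : Set ℕ), ∀ t ∈ Icc (1/(2*T)) (2*T), c * γ (a*t) ≤ (a*t)^n * D n (a*t) → m0 ≤ a^n * D n (a * t) / γ a := fun n hn t ht h => by
    have tp := t0 t ht
    have := (rat t ht).2
    rw [le_div_iff₀ ga, hm0]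
    have tn : t^n ≤ (2*T)^2 := by
      rcases hn with h | h
      · rw [h]; nlinarith [ht.2]
      · rw [h]; exact pow_le_pow_left₀ tp.le ht.2 2
    have tn0 : 0 < t^n := by positivity
    have h' : c * (M⁻¹ * γ a) ≤ t^n * (a^n * D n (a*t)) := by
      calc _ ≤ c * γ (a*t) := by gcongr
        _ ≤ _ := h
        _ = _ := by rw [mul_pow]; ring
    have hz : 0 < a^n * D n (a*t) := pos_of_mul_pos_right (lt_of_lt_of_le (by positivity) h') tn0.le
    calc _ = c * (M⁻¹ * γ a) / (2*T)^2 := by ring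
      _ ≤ (2*T)^2 * (a^n * D n (a*t)) / (2*T)^2 := div_le_div_of_nonneg_right (h'.trans (by gcongr)) (by positivity)
      _ = _ := by field_simp
  have b2 : ∀ t ∈ Icc (1/(2*T)) (2*T), m0 ≤ a^2 * D 2 (a * t) / γ a := fun t ht => lowb 2 (by simp) t ht (l2 _ (tI t ht))
  have e1 : (1:ℝ) ∈ Icc (1/(2*T)) (2*T) := ⟨by rw [div_le_iff₀ (by linarith)]; linarith, by linarith⟩
  have la := l1 a aI
  have ua := u1 a aI
  refine ⟨fun n t => a^n * D n (a * t) / γ a, by funext t; simp [D0, gammaZ, ha], T2, by positivity, hs, fun n hn t ht => ?_, fun n hn t ht => ?_,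
    fun t ht => (min_le_left _ _).trans (lowb 1 (by simp) t ht (by simpa using l1 _ (tI t ht))), fun t ht => (min_le_left _ _).trans (b2 t ht), fun t ht => (min_le_right _ _).trans ?_, ?_, ?_⟩
  · have := (((dD n _ (tI t ht)).comp t ((hasDerivAt_id t).const_mul a)).const_mul (a^n)).div_const (γ a)
    refine this.congr_deriv ?_
    rw [pow_succ]; ring
  · have tp := t0 t ht
    have h := up n hn _ (tI t ht)
    rw [mul_pow, abs_mul, abs_of_pos (by positivity : 0 < a^n * t^n)] at h
    rw [abs_div, abs_of_pos ga, abs_mul, abs_of_pos (by positivity : 0 < a^n), div_le_iff₀ ga]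
    have tn : 1 ≤ (2*T)^10 * t^n := by
      have : 1 ≤ 2*T*t := by have := ht.1; rw [div_le_iff₀ (by linarith)] at this; linarith
      calc (1:ℝ) ≤ (2*T*t)^n := one_le_pow₀ this
        _ = (2*T)^n * t^n := mul_pow _ _ _
        _ ≤ _ := by gcongr; linarith
    calc _ = 1 * (a^n * |D n (a*t)|) := by ring
      _ ≤ (2*T)^10 * t^n * (a^n * |D n (a*t)|) := by gcongr
      _ = (2*T)^10 * (a^n * t^n * |D n (a*t)|) := by ring
      _ ≤ (2*T)^10 * (C * (M * γ a)) := mul_le_mul_of_nonneg_left (h.trans (by gcongr; exact (rat t ht).1)) (by positivity)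
      _ = _ := by ring
  · have h := qa _ (tI t ht)
    rw [← hsq _ (tI t ht)] at h
    have hb := b2 t ht
    calc c1 * m0^2 ≤ c1 * (a^2 * D 2 (a * t) / γ a)^2 := by gcongr
      _ = a^4 / γ a^2 * (c1 * D 2 (a*t)^2) := by field_simp
      _ ≤ a^4 / γ a^2 * (s * q (a*t)) := by gcongr
      _ = _ := by rw [hq]; field_simp
  · have e : a * (1/T) * T = a := by field_simp
    have m1 : (1/T) ∈ Icc (1/(2*T)) (2*T) := ⟨by gcongr; linarith, by rw [div_le_iff₀ (by linarith)]; nlinarith⟩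
    have := g2 (t := T) (tI _ m1) (by linarith) (by rw [e]; exact aI.2)
    rw [e] at this
    have h0 := p1 _ (tI _ m1)
    rw [pow_one, div_le_div_iff₀ ga (by norm_num)]
    have hic : 0 < 1 / c := by positivity
    have h64 : 64 * C * D 1 (a * (1/T)) ≤ D 1 a := le_trans (mul_le_mul_of_nonneg_right (le_trans (by linarith) TR) h0) this
    refine le_of_mul_le_mul_left ?_ (by linarith : 0 < C)
    calc _ = a * (64 * C * D 1 (a * (1/T))) := by ring
      _ ≤ a * D 1 a := by gcongr
      _ ≤ _ := by linarith
  · have m1 : T ∈ Icc (1/(2*T)) (2*T) := ⟨by rw [div_le_iff₀ (by linarith)]; nlinarith, by linarith⟩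
    have := g2 aI (by linarith) (tI T m1).2
    rw [pow_one, le_div_iff₀ ga]
    have h0 := p1 a aI
    have h64 : 64 * (1/c) * D 1 a ≤ D 1 (a * T) := le_trans (mul_le_mul_of_nonneg_right (le_trans (by linarith) TR) h0) this
    calc 64 * γ a = 64 * (1/c) * (c * γ a) := by field_simp
      _ ≤ 64 * (1/c) * (a * D 1 a) := by gcongr
      _ = a * (64 * (1/c) * D 1 a) := by ring
      _ ≤ _ := by gcongr

theorem gz_cont (γ : ℝ → ℝ) (hγ0 : γ 0 = 0) (hparity : (∀ t, γ (-t) = γ t) ∨ (∀ t, γ (-t) = -γ t))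
    (hcont : ContinuousOn γ (Set.Ici (0 : ℝ))) : Continuous γ := by
  have h1 : Continuous fun t => γ |t| := hcont.comp_continuous continuous_abs fun t => abs_nonneg t
  rcases hparity with h | h
  · refine h1.congr fun t => ?_
    rcases le_total 0 t with h' | h'
    · rw [abs_of_nonneg h']
    · rw [abs_of_nonpos h', h]
  · have : γ = fun t => if 0 ≤ t then γ |t| else - γ |t| := by
      funext t; split_ifs with h'
      · rw [abs_of_nonneg h']
      · rw [abs_of_neg (not_le.1 h'), h, neg_neg]
    rw [this]
    refine Continuous.if_le h1 h1.neg continuous_const continuous_id fun t ht => ?_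
    rw [← ht]; simp [hγ0]


namespace Ix
variable {T m B s : ℝ}
theorem wph (hT : 2 ≤ T) : PhaseFam (1/2) 2 6 (N (T := T) (m := m) (B := B) (s := s)) (fun i t => i.ε * t) (fun i t => i.ε * i.u * i.g 0 t)
    (fun i _ => i.ε) (fun i t => i.ε * i.u * i.g 1 t) := by
  have j0 : 1/(2*T) ≤ 1/2 := one_div_le_one_div_of_le (by norm_num) (by linarith)
  refine ⟨by norm_num, fun i => i.hN, fun i t _ => ?_, fun i t ht => ?_, ?_, ?_⟩
  · simpa using (hasDerivAt_id t).const_mul i.ε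
  · simpa using (i.hg.hd 0 (by norm_num) t ⟨j0.trans ht.1, ht.2.trans (by linarith)⟩).const_mul (i.ε * i.u)
  · exact UB.const (C := 1) 6 fun i => by rcases i.hε with h | h <;> simp [h]
  · have := UB.smul (c := fun i : Ix T m B s => ((i.ε * i.u : ℝ) : ℂ)) (C := 3) (fun i => by
      rw [Complex.norm_real, Real.norm_eq_abs, abs_mul, abs_of_nonneg (by linarith [i.hu.1] : 0 ≤ i.u)]
      have := i.hu.2
      rcases i.hε with h | h <;> simp [h] <;> linarith) (UB.subI j0 (by linarith : 2 ≤ 2*T) (ubg (T := T) (m := m) (B := B) (s := s) 6 1 (by norm_num)))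
    simpa using this

/-- majorant -/
noncomputable def J (i : Ix T m B s) (z1 z2 : ℝ) : ℝ := ∫ t in (1/2:ℝ)..2, i.N^2 * (V1 (i.N * (z1 + i.ε * t)) * V1 (i.N * (z2 + i.ε * i.u * i.g 0 t)))

theorem wrong (hT : 2 ≤ T) (hm : 0 < m) : ∀ n ≤ 6, ∀ {a : Ix T m B s → ℝ → ℂ}, UB (1/2) 2 True n a → ∀ σ τ : SchwartzMap ℝ ℂ, ∃ C, 0 ≤ C ∧ ∀ i z1 z2,
    i.N^n * ‖KK (1/2) 2 i.N i.κ1 i.κ2 (fun t => i.ε * t) (fun t => i.ε * i.u * i.g 0 t) (a i) σ τ z1 z2‖ ≤ C * i.J z1 z2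
  | 0, _, a, ha, σ, τ => by
    obtain ⟨A, A0, hA⟩ := ha.bd
    obtain ⟨c, c0, hc⟩ := sch_V1 σ
    obtain ⟨d, d0, hd⟩ := sch_V1 τ
    refine ⟨A * (c * d), by positivity, fun i z1 z2 => ?_⟩
    have hP := wph (m := m) (B := B) (s := s) hT
    have c1 : ContinuousOn (fun t => i.ε * i.u * i.g 0 t) (Icc (1/2) 2) := fun t ht => (hP.hd2 i t ht).continuousAt.continuousWithinAt
    rw [pow_zero, one_mul, KK, J, ← intervalIntegral.integral_const_mul]
    refine intervalIntegral.norm_integral_le_of_norm_le (by norm_num) (.of_forall fun t ht => ?_) (ContinuousOn.intervalIntegrable ?_)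
    · rw [norm_mul, EE_norm]
      have h1 := hc (i.N * (z1 + i.ε * t)); have h2 := hd (i.N * (z2 + i.ε * i.u * i.g 0 t))
      calc _ ≤ A * (i.N^2 * ((c * V1 (i.N * (z1 + i.ε * t))) * (d * V1 (i.N * (z2 + i.ε * i.u * i.g 0 t))))) := by
            refine mul_le_mul (hA i t ⟨ht.1.le, ht.2⟩) ?_ (by positivity) A0
            rw [mul_assoc]
            exact mul_le_mul_of_nonneg_left (mul_le_mul h1 h2 (norm_nonneg _) ((norm_nonneg _).trans h1)) (by positivity)
        _ = _ := by ring
    · rw [uIcc_of_le (by norm_num)]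
      have := V1_cont
      exact continuousOn_const.mul (continuousOn_const.mul ((V1_cont.comp (by fun_prop : Continuous fun t => i.N * (z1 + i.ε * t))).continuousOn.mul
        (V1_cont.comp_continuousOn (continuousOn_const.mul (continuousOn_const.add c1)))))
  | n + 1, hn, a, ha, σ, τ => by
    have hP := wph (m := m) (B := B) (s := s) hT
    have j0 : 1/(2*T) ≤ 1/2 := one_div_le_one_div_of_le (by norm_num) (by linarith)
    set q : Ix T m B s → ℝ → ℂ := fun i t => ((i.κ1 * i.ε + i.κ2 * (i.ε * i.u * i.g 1 t) : ℝ) : ℂ) with hq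
    have lb : ∀ i : Ix T m B s, ∀ t ∈ Icc (1/2:ℝ) 2, m/8 ≤ ‖q i t‖ := fun i t ht => by
      have h1 := i.hg.h1 t ⟨j0.trans ht.1, ht.2.trans (by linarith)⟩
      have h2 := i.hu.1; have h3 := i.hκ2.1; have h4 := i.hν.1
      rw [le_div_iff₀ (by linarith)] at h4
      have h5 : m/8 ≤ i.κ1 + i.κ2 * (i.u * i.g 1 t) := by
        have : (1/4:ℝ) * (1/2 * m) ≤ i.κ2 * (i.u * i.g 1 t) := mul_le_mul h3 (mul_le_mul h2 h1 hm.le (by linarith)) (by positivity) (by linarith)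
        linarith
      rw [hq]; beta_reduce
      rw [Complex.norm_real, show i.κ1 * i.ε + i.κ2 * (i.ε * i.u * i.g 1 t) = i.ε * (i.κ1 + i.κ2 * (i.u * i.g 1 t)) by ring, norm_mul, Real.norm_eq_abs, Real.norm_eq_abs]
      rcases i.hε with h | h <;> simp only [h, abs_one, abs_neg, one_mul] <;> exact h5.trans (le_abs_self _)
    have uq : UB (1/2) 2 False 6 q := by
      have := (UB.smul (c := fun i : Ix T m B s => (i.κ1 : ℂ)) (C := 32) (fun i => by
        have h3 := i.hκ2; have h4 := i.hν
        have h5 := h4.1; have h6 := h4.2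
        rw [le_div_iff₀ (by linarith [h3.1])] at h5
        rw [div_le_iff₀ (by linarith [h3.1])] at h6
        rw [Complex.norm_real, Real.norm_of_nonneg (by linarith [h3.1])]; linarith [h3.2]) hP.hu1).add
        (UB.smul (c := fun i : Ix T m B s => (i.κ2 : ℂ)) (C := 4) (fun i => by
          rw [Complex.norm_real, Real.norm_of_nonneg (by linarith [i.hκ2.1])]; exact i.hκ2.2) hP.hu2)
      simpa [hq] using this
    have hb := ha.mul (UB.inv (by positivity) lb (uq.mono hn))
    have hb' := hb
    obtain ⟨_, -, b', hd, ub'⟩ := hb'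
    obtain ⟨C1, c1, h1⟩ := wrong hT hm n (by omega) (a := b') ub' σ τ
    obtain ⟨C2, c2, h2⟩ := wrong hT hm n (by omega) (hb.pred.mul (hP.hu1.mono (by omega))) (SchwartzMap.derivCLM ℂ ℂ σ) τ
    obtain ⟨C3, c3, h3⟩ := wrong hT hm n (by omega) (hb.pred.mul (hP.hu2.mono (by omega))) σ (SchwartzMap.derivCLM ℂ ℂ τ)
    refine ⟨C1 + C2 + C3, by positivity, fun i z1 z2 => ?_⟩
    have N1 := i.hN
    have key := KK_ibp hP i (hd i) (ub'.cont i) (hb.van trivial i).1 (hb.van trivial i).2 σ τ i.κ1 i.κ2 z1 z2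
    have e : KK (1/2) 2 i.N i.κ1 i.κ2 (fun t => i.ε * t) (fun t => i.ε * i.u * i.g 0 t) (fun t => a i t * (q i t)⁻¹ * ((i.κ1 * i.ε + i.κ2 * (i.ε * i.u * i.g 1 t) : ℝ) : ℂ)) σ τ z1 z2
        = KK (1/2) 2 i.N i.κ1 i.κ2 (fun t => i.ε * t) (fun t => i.ε * i.u * i.g 0 t) (a i) σ τ z1 z2 := by
      unfold KK
      refine intervalIntegral.integral_congr fun t ht => ?_
      rw [uIcc_of_le (by norm_num)] at ht
      have : q i t ≠ 0 := norm_pos_iff.1 ((by positivity : 0 < m/8).trans_le (lb i t ht))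
      beta_reduce
      rw [show ((i.κ1 * i.ε + i.κ2 * (i.ε * i.u * i.g 1 t) : ℝ) : ℂ) = q i t from rfl, inv_mul_cancel_right₀ this]
    rw [e] at key
    have k2 := congrArg norm key
    rw [norm_mul, Complex.norm_real, Real.norm_of_nonneg (by linarith)] at k2
    have k3 := norm_add₃_le (a := Complex.I * (i.N⁻¹ : ℝ) * KK (1/2) 2 i.N i.κ1 i.κ2 (fun t => i.ε * t) (fun t => i.ε * i.u * i.g 0 t) (b' i) σ τ z1 z2)
      (b := Complex.I * KK (1/2) 2 i.N i.κ1 i.κ2 (fun t => i.ε * t) (fun t => i.ε * i.u * i.g 0 t) (fun t => a i t * (q i t)⁻¹ * (i.ε : ℂ)) (SchwartzMap.derivCLM ℂ ℂ σ) τ z1 z2)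
      (c := Complex.I * KK (1/2) 2 i.N i.κ1 i.κ2 (fun t => i.ε * t) (fun t => i.ε * i.u * i.g 0 t) (fun t => a i t * (q i t)⁻¹ * ((i.ε * i.u * i.g 1 t : ℝ) : ℂ)) σ (SchwartzMap.derivCLM ℂ ℂ τ) z1 z2)
    simp only [norm_mul, Complex.norm_I, one_mul, Complex.norm_real] at k3
    have k4 := mul_le_mul_of_nonneg_left (k2.le.trans k3) (by positivity : 0 ≤ i.N^n)
    have h1 := h1 i z1 z2; have h2 := h2 i z1 z2; have h3 := h3 i z1 z2
    have ni : ‖i.N⁻¹‖ ≤ 1 := by rw [Real.norm_of_nonneg (by positivity)]; exact inv_le_one_of_one_le₀ N1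
    have := mul_le_mul_of_nonneg_right ni (norm_nonneg (KK (1/2) 2 i.N i.κ1 i.κ2 (fun t => i.ε * t) (fun t => i.ε * i.u * i.g 0 t) (b' i) σ τ z1 z2))
    have := mul_le_mul_of_nonneg_left this (by positivity : 0 ≤ i.N^n)
    calc _ = i.N^n * (i.N * ‖KK (1/2) 2 i.N i.κ1 i.κ2 (fun t => i.ε * t) (fun t => i.ε * i.u * i.g 0 t) (a i) σ τ z1 z2‖) := by ring
      _ ≤ _ := k4
      _ ≤ _ := by rw [mul_add, mul_add, add_mul, add_mul]; linarith
end Ix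


theorem wrong_sup (T m B s : ℝ) {χ : ℝ → ℂ} (hχ : UB (ι := Unit) (1/2) 2 True 6 (fun _ => χ)) (hc : Continuous χ) :
    ∃ C > 0, ∀ g, Crv T m B s g → Continuous (g 0) → ∀ {N ε A u k1 k2 : ℝ} {f : ℝ × ℝ → ℂ}, 1 ≤ N → (ε = 1 ∨ ε = -1) → u ∈ Icc (1:ℝ) 2 →
      k1 ∈ Icc (3*N/8) (2*N) → k2 ∈ Icc (3*N/8) (2*N) → BI A f → ∀ X,
      ‖Fo N ε ε (g 0) u χ (hk f k1 k2) X‖ ≤ C * (N^3)⁻¹ * A := by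
  by_cases hv : 2 ≤ T ∧ 0 < m
  swap
  · exact ⟨1, one_pos, fun g hg => (hv ⟨hg.hT, hg.hm⟩).elim⟩
  obtain ⟨C, C0, h⟩ := Ix.wrong (B := B) (s := s) hv.1 hv.2 3 (by norm_num) (a := fun _ => χ) ((UB.reidx (fun _ => ()) hχ).mono (by norm_num)) sgt sgt
  obtain ⟨D, D0, hD⟩ := be_kd sg sg
  refine ⟨C * (3/2 * Real.pi^2) * (D * Real.pi^2) + 1, by positivity, fun g hg gc N ε A u k1 k2 f hN hε hu h1 h2 hf X => ?_⟩
  have N0 : 0 < N := by linarith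
  have hN' : N ≠ 0 := N0.ne'
  have A0 := hf.A0
  have hb : BI (D * Real.pi^2 * A) (hk f k1 k2) := (hD k1 k2).cv_bi hf
  let i : Ix T m B s := ⟨g, hg, N, hN, u, ⟨by linarith [hu.1], by linarith [hu.2]⟩, k1/N, k2/N,
    ⟨by rw [le_div_iff₀ N0]; linarith [h2.1], by rw [div_le_iff₀ N0]; linarith [h2.2]⟩,
    ⟨by
      rw [div_div_div_cancel_right₀ hN', le_div_iff₀ (by linarith [h2.1])]; linarith [h1.1, h2.2], by
      rw [div_div_div_cancel_right₀ hN', div_le_iff₀ (by linarith [h2.1])]; linarith [h1.2, h2.1]⟩, ε, hε⟩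
  rw [hk_rep hf, Fo_ker hN' gc hc hb]
  have e : ∀ Y, (N^2)⁻¹ * i.J ((X.1-Y.1)/N) ((X.2-Y.2)/N) = ∫ t in (1/2:ℝ)..2, ze ((X.1 + N * (ε * t), X.2 + N * (ε * u * g 0 t)) - Y) := fun Y => by
    unfold Ix.J
    rw [← intervalIntegral.integral_const_mul]
    refine intervalIntegral.integral_congr fun t _ => ?_
    have h1 : ∀ x y s : ℝ, N * ((x - y) / N + s) = x + N * s - y := fun x y s => by field_simp; ring
    simp only [i, h1, ze, Prod.fst_sub, Prod.snd_sub]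
    field_simp
  have ip : Integrable (fun p : ℝ × (ℝ × ℝ) => ze ((X.1 + N * (ε * p.1), X.2 + N * (ε * u * g 0 p.1)) - p.2)) ((volume.restrict (Ioc (1/2:ℝ) 2)).prod volume) := by
    have := ze_cont
    refine (integrable_prod_iff (Continuous.aestronglyMeasurable (f := fun p : ℝ × (ℝ × ℝ) => ze ((X.1 + N * (ε * p.1), X.2 + N * (ε * u * g 0 p.1)) - p.2)) (by fun_prop))).2 ⟨.of_forall fun t => zeX_int (X.1 + N * (ε * t), X.2 + N * (ε * u * g 0 t)), ?_⟩
    simp_rw [Real.norm_of_nonneg (ze_pos _).le, zeX_integral]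
    exact integrable_const _
  have i2 := ip.integral_prod_right
  have e2 : ∫ Y : ℝ × ℝ, (N^2)⁻¹ * i.J ((X.1-Y.1)/N) ((X.2-Y.2)/N) = 3/2 * Real.pi^2 := by
    simp_rw [e, intervalIntegral.integral_of_le (by norm_num : (1/2:ℝ) ≤ 2)]
    rw [← integral_integral_swap ip]
    simp_rw [zeX_integral]
    simp; norm_num
  have i3 : Integrable (fun Y : ℝ × ℝ => (N^2)⁻¹ * i.J ((X.1-Y.1)/N) ((X.2-Y.2)/N)) := by
    simp_rw [e, intervalIntegral.integral_of_le (by norm_num : (1/2:ℝ) ≤ 2)]; exact i2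
  calc _ ≤ ∫ Y : ℝ × ℝ, (N^3)⁻¹ * C * (D * Real.pi^2 * A) * ((N^2)⁻¹ * i.J ((X.1-Y.1)/N) ((X.2-Y.2)/N)) := by
        refine norm_integral_le_of_norm_le (i3.const_mul _) (.of_forall fun Y => ?_)
        rw [norm_mul, norm_mul, Complex.norm_real, Real.norm_of_nonneg (by positivity)]
        have := h i ((X.1-Y.1)/N) ((X.2-Y.2)/N)
        have h3 := mul_le_mul_of_nonneg_left this (by positivity : 0 ≤ (N^3)⁻¹)
        rw [show i.N = N from rfl, inv_mul_cancel_left₀ (by positivity)] at h3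
        calc _ ≤ (N^2)⁻¹ * ((N^3)⁻¹ * (C * i.J ((X.1-Y.1)/N) ((X.2-Y.2)/N))) * (D * Real.pi^2 * A) :=
              mul_le_mul (mul_le_mul_of_nonneg_left h3 (by positivity)) (hb.b Y) (norm_nonneg _) (mul_nonneg (by positivity) ((norm_nonneg _).trans h3))
          _ = _ := by ring
    _ = C * (3/2 * Real.pi^2) * (D * Real.pi^2) * ((N^3)⁻¹ * A) := by rw [integral_const_mul, e2]; ring
    _ ≤ _ := by rw [mul_assoc _ _ A]; refine mul_le_mul_of_nonneg_right (by linarith) (by positivity)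


/-- frequency localisation -/
def LPs (σ : SchwartzMap ℝ ℂ) : Prop := ∃ ψ : ℝ → ℂ, Continuous ψ ∧ (∀ η ∉ Icc (1/2:ℝ) 2, ψ η = 0) ∧ (∀ y, σ y = (2 * Real.pi)⁻¹ * ∫ η, ex (y * η) * ψ η) ∧
  ∀ η, ∫ y, ex (-(y * η)) * σ y = ψ η

theorem lp1 {σ : SchwartzMap ℝ ℂ} (hσ : LPs σ) {N : ℝ} {lo hi : ℤ} (hN : 0 < N) (hlo : (lo:ℝ) + 1 ≤ N/2) (hhi : 2*N ≤ hi + 1) (x : ℝ) :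
    ∑ k ∈ Finset.Icc lo hi, ∫ y, ex (k*(x-y)) * sg (x-y) * σ (N*y) = σ (N*x) := by
  obtain ⟨ψ, hc, hs, h1, h2⟩ := hσ
  have hi' : Integrable (fun y => σ (N*y)) := σ.integrable.comp_mul_left' hN.ne'
  have hcs : ∀ k : ℝ, HasCompactSupport (fun η => bfun (η - k)) := fun k => bfun_cs.comp_homeomorph (Homeomorph.subRight k)
  have e0 : ∀ k y : ℝ, ex (k*y) * sg y = (2*Real.pi)⁻¹ * ∫ η, ex (y*η) * bfun (η - k) := fun k y => by
    rw [sg_eq, ← integral_sub_right_eq_self (fun η => ex (y*η) * bfun η) k, mul_left_comm, ← integral_const_mul]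
    congr 2; funext η; rw [← mul_assoc, ← ex_add]; ring_nf
  have e1 : ∀ η, ∫ y, ex (-(y*η)) * σ (N*y) = (N:ℂ)⁻¹ * ψ (η/N) := fun η => by
    have := Measure.integral_comp_mul_left (fun y => ex (-(y*(η/N))) * σ y) N
    rw [h2, abs_of_pos (by positivity), Complex.real_smul] at this
    push_cast at this
    rw [← this]; congr 1; funext y; congr 3; field_simp
  have e2 : ∀ k : ℤ, ∫ y, ex (k*(x-y)) * sg (x-y) * σ (N*y) = (2*Real.pi)⁻¹ * ∫ η, ex (x*η) * (bfun (η-k) * ((N:ℂ)⁻¹ * ψ (η/N))) := fun k => by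
    simp_rw [e0, ← e1]
    have bc := bfun_smooth.continuous
    rw [← conv_rep (ψ := fun η => bfun (η - k)) hi' (by fun_prop) (hcs k), ← integral_const_mul]
    congr 1; funext y; ring
  simp_rw [e2]
  rw [← Finset.mul_sum, ← integral_finsetSum]
  · simp_rw [← Finset.mul_sum, ← Finset.sum_mul]
    have := Measure.integral_comp_div (fun η => ex (N*x*η) * ψ η) N
    rw [h1, ← inv_mul_cancel_left₀ (Complex.ofReal_ne_zero.2 hN.ne') (∫ η, ex (N*x*η) * ψ η)]
    rw [abs_of_pos hN, Complex.real_smul] at this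
    rw [← this, ← integral_const_mul (N:ℂ)⁻¹]
    congr 2; funext η
    by_cases hη : η/N ∈ Icc (1/2:ℝ) 2
    · have a := hη.1; have b := hη.2
      rw [le_div_iff₀ hN] at a; rw [div_le_iff₀ hN] at b
      rw [bfun_part (by linarith) (by linarith), show N*x*(η/N) = x*η by field_simp]; ring
    · rw [hs _ hη]; simp
  · intro k _
    have bc := bfun_smooth.continuous
    refine ex_mul_int (p := fun η => x * η) ((cs_int (by fun_prop) (hcs k)).mul_bdd (c := sSup (range fun η => ‖(N:ℂ)⁻¹ * ψ (η/N)‖)) (Continuous.aestronglyMeasurable (by fun_prop)) (.of_forall fun η => le_csSup ?_ ⟨η, rfl⟩)) (by fun_prop)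
    obtain ⟨C, hC⟩ := isCompact_Icc.exists_bound_of_continuousOn (s := Icc (1/2:ℝ) 2) hc.continuousOn
    refine ⟨‖(N:ℂ)⁻¹‖ * max C 0, ?_⟩
    rintro _ ⟨η, rfl⟩
    simp only [norm_mul]
    refine mul_le_mul_of_nonneg_left ?_ (norm_nonneg _)
    by_cases hη : η/N ∈ Icc (1/2:ℝ) 2
    · exact (hC _ hη).trans (le_max_left _ _)
    · rw [hs _ hη]; simp

/-- the localised function -/
noncomputable def GF (σ1 σ2 : SchwartzMap ℝ ℂ) (N : ℝ) (F : ℝ × ℝ → ℂ) (X : ℝ × ℝ) : ℂ := cv (be 0 0 σ1 σ2) F (N • X)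

theorem GF_bi {σ1 σ2 : SchwartzMap ℝ ℂ} {C A N : ℝ} (hC : Kd C (be 0 0 σ1 σ2)) {F : ℝ × ℝ → ℂ} (hF : BI A F) (hN : 0 < N) :
    BI (C * Real.pi^2 * A) (GF σ1 σ2 N F) ∧ ∫ X, ‖GF σ1 σ2 N F X‖ ≤ (N^2)⁻¹ * (C * Real.pi^2 * ∫ Y, ‖F Y‖) := by
  refine ⟨⟨(hC.cv_bi hF).i.comp_smul hN.ne', fun x => hC.cvb hF _⟩, ?_⟩
  unfold GF
  rw [Measure.integral_comp_smul volume (fun X => ‖cv (be 0 0 σ1 σ2) F X‖) N]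
  simp only [Module.finrank_prod, Module.finrank_self, smul_eq_mul]
  rw [abs_of_pos (by positivity)]
  exact mul_le_mul_of_nonneg_left (hC.cvL1 hF) (by positivity)

theorem GF_sum {σ1 σ2 : SchwartzMap ℝ ℂ} (h1 : LPs σ1) (h2 : LPs σ2) {A N : ℝ} {F : ℝ × ℝ → ℂ} (hF : BI A F) (hN : 1 ≤ N) {lo hi : ℤ} (hlo : (lo:ℝ) + 1 ≤ N/2) (hhi : 2*N ≤ hi + 1) (X : ℝ × ℝ) :
    ∑ k ∈ Kb lo hi, hk (GF σ1 σ2 N F) k.1 k.2 X = GF σ1 σ2 N F X := by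
  have N0 : 0 < N := by linarith
  obtain ⟨C, C0, hC⟩ := be_kd σ1 σ2
  obtain ⟨D, D0, hD⟩ := be_kd sg sg
  have hF' : BI A (fun Y => F (N • Y)) := ⟨hF.i.comp_smul N0.ne', fun Y => hF.b _⟩
  set kN : ℝ × ℝ → ℂ := fun Z => (N^2 : ℝ) * be 0 0 σ1 σ2 (N • Z) with hkN
  have V : ∀ x, V1 (N*x) ≤ V1 x := fun x => by
    unfold V1; refine inv_anti₀ (by positivity) ?_
    rw [mul_pow]; nlinarith [sq_nonneg x, one_le_pow₀ hN (n := 2)]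
  have bc := be_cont 0 0 σ1 σ2
  have kk : Kd (N^2*C) kN := ⟨by fun_prop, fun Z => by
    rw [hkN]; beta_reduce
    rw [norm_mul, Complex.norm_real, Real.norm_of_nonneg (by positivity), mul_assoc]
    refine mul_le_mul_of_nonneg_left (((hC 0 0).b _).trans (mul_le_mul_of_nonneg_left ?_ C0.le)) (by positivity)
    exact mul_le_mul (V _) (V _) (V1_pos _).le (V1_pos _).le⟩
  have kb : BI (N^2*C) kN := ⟨kk.int, kk.bd⟩
  have eG : ∀ X, GF σ1 σ2 N F X = cv kN (fun Y => F (N • Y)) X := fun X => by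
    have := Measure.integral_comp_smul volume (fun Y => be 0 0 σ1 σ2 (N • X - Y) * F Y) N
    simp only [Module.finrank_prod, Module.finrank_self] at this
    rw [abs_of_pos (by positivity), Complex.real_smul] at this
    unfold GF cv
    rw [hkN]
    simp_rw [mul_assoc, integral_const_mul, smul_sub, this]
    push_cast
    have : (N:ℂ) ≠ 0 := by exact_mod_cast N0.ne'
    field_simp
  have eI : ∀ Z : ℝ × ℝ, ∑ k ∈ Kb lo hi, cv (be k.1 k.2 sg sg) kN Z = kN Z := fun Z => by
    have : ∀ k : ℤ × ℤ, cv (be k.1 k.2 sg sg) kN Z = (N^2 : ℝ) * ((∫ y, ex (k.1*(Z.1-y)) * sg (Z.1-y) * σ1 (N*y)) * ∫ y, ex (k.2*(Z.2-y)) * sg (Z.2-y) * σ2 (N*y)) := fun k => by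
      rw [← integral_prod_mul, ← Measure.volume_eq_prod, ← integral_const_mul]
      unfold cv
      congr 1; funext Y
      rw [hkN]; simp only [be, Prod.fst_sub, Prod.snd_sub, Prod.smul_fst, Prod.smul_snd, smul_eq_mul, zero_mul, add_zero, ex_zero, ex_add, one_mul]; ring
    simp_rw [this]
    rw [← Finset.mul_sum, Kb, Finset.sum_product]
    simp only
    rw [← Finset.sum_mul_sum, lp1 h1 N0 hlo hhi, lp1 h2 N0 hlo hhi, hkN]
    simp [be, ex_zero]
  have eA : ∀ k : ℤ × ℤ, hk (GF σ1 σ2 N F) k.1 k.2 X = cv (cv (be k.1 k.2 sg sg) kN) (fun Y => F (N • Y)) X := fun k => by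
    rw [hk, funext eG, cv_assoc (hD _ _) kk hF']
  simp_rw [eA]
  rw [eG]
  unfold cv
  rw [← integral_finsetSum]
  · refine integral_congr_ae (.of_forall fun Y => ?_)
    beta_reduce
    rw [← Finset.sum_mul, ← eI]; rfl
  · intro k _
    exact hF'.i.bdd_mul (c := D * Real.pi^2 * (N^2*C)) (((hD k.1 k.2).cvc kb).comp (sub_cont X)).aestronglyMeasurable (.of_forall fun Y => (hD k.1 k.2).cvb kb _)


theorem Fo_L4 {N e1 e2 S Ba : ℝ} {γ : ℝ → ℝ} {χ : ℝ → ℂ} {h : ℝ × ℝ → ℂ} (gc : Continuous γ) (hc : Continuous χ) (hh : Continuous h) (hi : Integrable h)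
    (hBa : ∀ t ∈ Icc (1/2:ℝ) 2, ‖χ t‖ ≤ Ba) (hS : ∀ u ∈ Icc (1:ℝ) 2, ∀ X, ‖Fo N e1 e2 γ u χ h X‖ ≤ S) :
    ∫⁻ q, ‖Fo N e1 e2 γ q.1 χ h q.2‖ₑ^4 ∂(mI 1 2) ≤ ENNReal.ofReal (S^3 * (2 * Ba * ∫ y, ‖h y‖)) := by
  have b0 : 0 ≤ Ba := (norm_nonneg _).trans (hBa 1 (by norm_num))
  have S0 : 0 ≤ S := (norm_nonneg _).trans (hS 1 (by norm_num) 0)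
  have hm := (Fo_cont (N := N) (e1 := e1) (e2 := e2) gc hc hh).enorm.measurable
  calc _ ≤ ∫⁻ q, ENNReal.ofReal (S^3) * ‖Fo N e1 e2 γ q.1 χ h q.2‖ₑ ∂(mI 1 2) := by
        refine lintegral_mono_ae ((mI_ae 1 2).mono fun q hq => ?_)
        rw [pow_succ, ENNReal.ofReal_pow S0]
        refine mul_le_mul' (pow_le_pow_left' ?_ 3) le_rfl
        rw [← ofReal_norm]; exact ENNReal.ofReal_le_ofReal (hS _ hq _)
    _ = ENNReal.ofReal (S^3) * ∫⁻ q, ‖Fo N e1 e2 γ q.1 χ h q.2‖ₑ ∂(mI 1 2) := lintegral_const_mul _ hm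
    _ ≤ ENNReal.ofReal (S^3) * (ENNReal.ofReal (2 * Ba * ∫ y, ‖h y‖) * ENNReal.ofReal (2-1)) := by
        refine mul_le_mul' le_rfl (mI_lint hm fun u _ => ?_)
        have e : ∀ X : ℝ × ℝ, ‖Fo N e1 e2 γ u χ h X‖ₑ ≤ ∫⁻ t in Ioc (1/2:ℝ) 2, ‖χ t‖ₑ * ‖h (X + (N * (e1 * t), N * (e2 * u * γ t)))‖ₑ := fun X => by
          unfold Fo
          rw [intervalIntegral.integral_of_le (by norm_num)]
          refine (enorm_integral_le_lintegral_enorm _).trans (le_of_eq ?_)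
          simp_rw [enorm_mul]; rfl
        calc _ ≤ ∫⁻ X : ℝ × ℝ, ∫⁻ t in Ioc (1/2:ℝ) 2, ‖χ t‖ₑ * ‖h (X + (N * (e1 * t), N * (e2 * u * γ t)))‖ₑ := lintegral_mono e
          _ = ∫⁻ t in Ioc (1/2:ℝ) 2, ∫⁻ X : ℝ × ℝ, ‖χ t‖ₑ * ‖h (X + (N * (e1 * t), N * (e2 * u * γ t)))‖ₑ := by
              refine lintegral_lintegral_swap (Measurable.aemeasurable ?_)
              unfold Function.uncurry
              exact (Continuous.enorm (by fun_prop)).measurable.mul (Continuous.enorm (by fun_prop)).measurable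
          _ = ∫⁻ t in Ioc (1/2:ℝ) 2, ‖χ t‖ₑ * ∫⁻ X, ‖h X‖ₑ := by
              refine lintegral_congr fun t => ?_
              rw [lintegral_const_mul _ (Continuous.enorm (by fun_prop)).measurable, lintegral_add_right_eq_self (fun X => ‖h X‖ₑ)]
          _ ≤ ∫⁻ t in Ioc (1/2:ℝ) 2, ENNReal.ofReal Ba * ENNReal.ofReal (∫ X, ‖h X‖) := by
              refine setLIntegral_mono' measurableSet_Ioc fun t ht => mul_le_mul' ?_ (le_of_eq ?_)
              · rw [← ofReal_norm]; exact ENNReal.ofReal_le_ofReal (hBa t ⟨ht.1.le, ht.2⟩)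
              · exact (ofReal_integral_norm_eq_lintegral_enorm hi).symm
          _ ≤ _ := by
              have i0 : 0 ≤ ∫ X, ‖h X‖ := integral_nonneg fun _ => norm_nonneg _
              rw [setLIntegral_const, Real.volume_Ioc, ← ENNReal.ofReal_mul b0, ← ENNReal.ofReal_mul (by positivity)]
              exact ENNReal.ofReal_le_ofReal (by nlinarith [mul_nonneg b0 i0])
    _ = _ := by rw [show (2:ℝ)-1 = 1 by norm_num, ENNReal.ofReal_one, mul_one, ← ENNReal.ofReal_mul (by positivity)]

set_option maxHeartbeats 800000 in
theorem rt4 (T m B s : ℝ) {χ : ℝ → ℂ} (hχ : UB (ι := Unit) (1/2) 2 True 6 (fun _ => χ)) (hc : Continuous χ) {σ1 σ2 : SchwartzMap ℝ ℂ} (h1 : LPs σ1) (h2 : LPs σ2) :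
    ∃ C > 0, ∀ g, Crv T m B s g → Continuous (g 0) → ∀ {N e1 e2 A : ℝ} {F : ℝ × ℝ → ℂ}, 1 ≤ N → (e1 = 1 ∨ e1 = -1) → (e2 = 1 ∨ e2 = -1) → BI A F →
      (∀ u X, ‖Fo N e1 e2 (g 0) u χ (GF σ1 σ2 N F) X‖ ≤ C * A) ∧
      ∫⁻ q, ‖Fo N e1 e2 (g 0) q.1 χ (GF σ1 σ2 N F) q.2‖ₑ^4 ∂(mI 1 2) ≤ ENNReal.ofReal (C * (N^(65/32:ℝ))⁻¹ * A^3 * ((N^2)⁻¹ * ∫ y, ‖F y‖)) := by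
  obtain ⟨r0, hr0, C1, C10, H1⟩ := rt_right T m B s hχ hc
  obtain ⟨C2, C20, H2⟩ := wrong_sup T m B s hχ hc
  obtain ⟨D, D0, hD⟩ := be_kd σ1 σ2
  obtain ⟨Ba, Ba0, hBa'⟩ := hχ.bd
  have hBa : ∀ t ∈ Icc (1/2:ℝ) 2, ‖χ t‖ ≤ Ba := hBa' ()
  set E := D * Real.pi^2 with hE
  have E0 : 0 < E := by positivity
  set N1 := max (r0^32) 16 with hN1
  have N10 : 1 ≤ N1 := le_max_of_le_right (by norm_num)
  set K0 := 8 * Ba^3 * E^3 * (2*Ba*E)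
  set K2 := 64 * C2^3 * E^3 * (2*Ba*E)
  refine ⟨2*(Ba*E) + K0 * N1^(65/32:ℝ) + C1 * E^4 + K2 + 1, by positivity, fun g hg gc N e1 e2 A F hN he1 he2 hF => ?_⟩
  have N0 : 0 < N := by linarith
  have A0 := hF.A0
  obtain ⟨hb, hL⟩ := GF_bi (hD 0 0) hF N0
  rw [← hE] at hb hL
  have hcont : Continuous (GF σ1 σ2 N F) := ((hD 0 0).cvc hF).comp (by fun_prop)
  have sup : ∀ u X, ‖Fo N e1 e2 (g 0) u χ (GF σ1 σ2 N F) X‖ ≤ 2*(Ba*(E*A)) := Fo_b hb.b hBa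
  have i0 : 0 ≤ ∫ y, ‖F y‖ := integral_nonneg fun _ => norm_nonneg _
  have n0 : 0 ≤ K0 * N1^(65/32:ℝ) := by positivity
  have n1 : 0 ≤ K2 := by positivity
  have n2 : 0 ≤ 2*(Ba*E) := by positivity
  have n3 : 0 ≤ C1 * E^4 := by positivity
  set I := (N^2)⁻¹ * ∫ y, ‖F y‖ with hI
  have I0 : 0 ≤ I := by positivity
  have L' : ∫ X, ‖GF σ1 σ2 N F X‖ ≤ E * I := hL.trans (le_of_eq (by rw [hI]; ring))
  have P0 : 0 ≤ (N^(65/32:ℝ))⁻¹ := by positivity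
  have fin : ∀ K, K ≤ 2*(Ba*E) + K0 * N1^(65/32:ℝ) + C1 * E^4 + K2 + 1 → ENNReal.ofReal (K * (N^(65/32:ℝ))⁻¹ * A^3 * I) ≤
      ENNReal.ofReal ((2*(Ba*E) + K0 * N1^(65/32:ℝ) + C1 * E^4 + K2 + 1) * (N^(65/32:ℝ))⁻¹ * A^3 * I) := fun K hK =>
    ENNReal.ofReal_le_ofReal (mul_le_mul_of_nonneg_right (mul_le_mul_of_nonneg_right (mul_le_mul_of_nonneg_right hK P0) (by positivity)) I0)
  constructor
  · intro u X
    refine (sup u X).trans ?_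
    rw [show 2*(Ba*(E*A)) = 2*(Ba*E)*A by ring]
    exact mul_le_mul_of_nonneg_right (by linarith) A0
  by_cases hs : N < N1
  · refine (Fo_L4 gc hc hcont hb.i hBa fun u _ X => sup u X).trans (le_trans (ENNReal.ofReal_le_ofReal ?_) (fin (K0 * N1^(65/32:ℝ)) (by linarith)))
    have : 1 ≤ N1^(65/32:ℝ) * (N^(65/32:ℝ))⁻¹ := by
      rw [← div_eq_mul_inv, one_le_div (by positivity)]
      exact Real.rpow_le_rpow N0.le hs.le (by norm_num)
    calc _ ≤ (2*(Ba*(E*A)))^3 * (2*Ba*(E*I)) := mul_le_mul_of_nonneg_left (mul_le_mul_of_nonneg_left L' (by positivity)) (by positivity)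
      _ = 1 * (K0 * A^3 * I) := by simp only [K0]; ring
      _ ≤ (N1^(65/32:ℝ) * (N^(65/32:ℝ))⁻¹) * (K0 * A^3 * I) := mul_le_mul_of_nonneg_right this (by positivity)
      _ = _ := by ring
  push Not at hs
  have hN16 : 16 ≤ N := (le_max_right _ _).trans hs
  have hNr : r0^32 ≤ N := (le_max_left _ _).trans hs
  set lo : ℤ := ⌊N/2⌋ - 1 with hlo
  set hi : ℤ := ⌊2*N⌋ with hhi
  have l1 : (lo:ℝ) + 1 ≤ N/2 := by rw [hlo]; push_cast; linarith [Int.floor_le (N/2)]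
  have l2 : 3*N/8 ≤ (lo:ℝ) := by rw [hlo]; push_cast; linarith [Int.lt_floor_add_one (N/2)]
  have l3 : 2*N ≤ (hi:ℝ) + 1 := (Int.lt_floor_add_one (2*N)).le
  have l4 : (hi:ℝ) ≤ 2*N := Int.floor_le (2*N)
  obtain ⟨Ds, Ds0, hDs⟩ := be_kd sg sg
  have dec : ∀ u X, Fo N e1 e2 (g 0) u χ (GF σ1 σ2 N F) X = ∑ k ∈ Kb lo hi, Fo N e1 e2 (g 0) u χ (hk (GF σ1 σ2 N F) k.1 k.2) X := fun u X => by
    unfold Fo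
    rw [← intervalIntegral.integral_finsetSum]
    · refine intervalIntegral.integral_congr fun t _ => ?_
      beta_reduce
      rw [← Finset.mul_sum, GF_sum h1 h2 hF hN l1 l3]
    · intro k _
      have : Continuous (hk (GF σ1 σ2 N F) k.1 k.2) := (hDs k.1 k.2).cvc hb
      exact Continuous.intervalIntegrable (by fun_prop) _ _
  by_cases hee : e1 = e2
  · subst hee
    have kin : ∀ k ∈ Finset.Icc lo hi, (k:ℝ) ∈ Icc (3*N/8) (2*N) := fun k h => by
      rw [Finset.mem_Icc] at h
      exact ⟨l2.trans (by exact_mod_cast h.1), le_trans (by exact_mod_cast h.2) l4⟩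
    have card : ((Kb lo hi).card : ℝ) ≤ 4 * N^2 := by
      rw [Kb, Finset.card_product, Int.card_Icc]
      have : (((hi + 1 - lo).toNat : ℕ) : ℝ) ≤ 2*N := by
        have h : (((hi + 1 - lo).toNat : ℕ) : ℝ) = ((((hi + 1 - lo).toNat : ℕ) : ℤ) : ℝ) := by push_cast; rfl
        have hle : lo ≤ hi := by exact_mod_cast (by linarith : (lo:ℝ) ≤ hi)
        rw [h, Int.toNat_of_nonneg (by lia)]; push_cast; linarith
      push_cast
      nlinarith [Nat.cast_nonneg (α := ℝ) (hi + 1 - lo).toNat]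
    refine (Fo_L4 (S := 4*C2*E*A*N⁻¹) gc hc hcont hb.i hBa fun u hu X => ?_).trans (le_trans (ENNReal.ofReal_le_ofReal ?_) (fin K2 (by linarith)))
    · rw [dec]
      refine (norm_sum_le_of_le _ fun k h => H2 g hg gc hN he1 hu (kin _ (Finset.mem_product.1 h).1) (kin _ (Finset.mem_product.1 h).2) hb X).trans ?_
      rw [Finset.sum_const, nsmul_eq_mul]
      refine (mul_le_mul_of_nonneg_right card (by positivity)).trans (le_of_eq ?_)
      field_simp
    · have : (N⁻¹)^3 ≤ (N^(65/32:ℝ))⁻¹ := by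
        rw [inv_pow]; refine inv_anti₀ (by positivity) ?_
        rw [← Real.rpow_natCast N 3]; exact Real.rpow_le_rpow_of_exponent_le hN (by norm_num)
      calc _ ≤ (4*C2*E*A*N⁻¹)^3 * (2*Ba*(E*I)) := mul_le_mul_of_nonneg_left (mul_le_mul_of_nonneg_left L' (by positivity)) (by positivity)
        _ = (N⁻¹)^3 * (K2 * A^3 * I) := by simp only [K2]; ring
        _ ≤ (N^(65/32:ℝ))⁻¹ * (K2 * A^3 * I) := mul_le_mul_of_nonneg_right this (by positivity)
        _ = _ := by ring
  · have he : e1 = -e2 := by rcases he1 with h | h <;> rcases he2 with h' | h' <;> first | exact (hee (h.trans h'.symm)).elim | (rw [h, h']; try norm_num)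
    subst he
    set r := N^(1/32:ℝ) with hr
    have rN : r^32 = N := by rw [hr, ← Real.rpow_natCast, ← Real.rpow_mul N0.le]; norm_num
    have r65 : r^65 = N^(65/32:ℝ) := by rw [hr, ← Real.rpow_natCast, ← Real.rpow_mul N0.le]; norm_num
    have hr0' : r0 ≤ r := le_of_pow_le_pow_left₀ (n := 32) (by norm_num) (by positivity) (by rw [rN]; exact hNr)
    have key := H1 g hg gc hr0' he2 (by rw [rN]; exact l2) (by rw [rN]; exact l4) hb
    rw [rN, r65] at key
    simp_rw [dec]
    refine key.trans (le_trans (ENNReal.ofReal_le_ofReal ?_) (fin (C1*E^4) (by linarith)))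
    refine (mul_le_mul_of_nonneg_left L' (by positivity)).trans (le_of_eq (by ring))


/-- auxiliary weight -/
noncomputable def wt (x : ℝ) : ℝ := if x ≤ 1 then x^2 else 1/x

theorem wt_sum (M : ℕ) : ∀ x : ℝ, 0 < x → ∑ i ∈ Finset.range M, wt (x * (1/2)^i) ≤ if x ≤ 1 then 2*x^2 else 4 - 1/x := by
  induction M with
  | zero =>
    intro x hx
    split_ifs with h
    · simp; positivity
    · have : 1/x ≤ 1 := by rw [div_le_one hx]; linarith
      simp only [Finset.range_zero, Finset.sum_empty]; linarith
  | succ M ih =>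
    intro x hx
    rw [Finset.sum_range_succ']
    have e := ih (x/2) (by positivity)
    have : ∀ i, x * (1/2:ℝ)^(i+1) = x/2 * (1/2)^i := fun i => by rw [pow_succ]; ring
    simp only [this, pow_zero, mul_one]
    unfold wt at e ⊢
    by_cases h : x ≤ 1
    · rw [if_pos h, if_pos h]; rw [if_pos (by linarith)] at e; nlinarith
    · rw [if_neg h, if_neg h]
      push Not at h
      by_cases h2 : x/2 ≤ 1
      · rw [if_pos h2] at e
        have : 1/x * 2 + x^2/2 ≤ 4 := by
          rw [div_mul_eq_mul_div, div_add' _ _ _ hx.ne', div_le_iff₀ hx]; nlinarith [mul_nonneg (sub_nonneg.2 h.le) (by linarith : 0 ≤ 2 - x)]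
        linarith
      · rw [if_neg h2] at e
        have : 1/(x/2) = 2*(1/x) := by field_simp
        linarith

theorem lev {A p : ℝ} (hA : 0 < A) (hp : 6 ≤ p) (M : ℕ) (b : ℕ → ℝ) (b0 : ∀ i, 0 ≤ b i) (hb : ∀ i, b i ≤ A * (1/4)^i) :
    (∑ i ∈ Finset.range M, b i)^p ≤ 8^p * ∑ i ∈ Finset.range M, (A * (1/4)^i)^(p-4) * b i^4 := by
  set L := ∑ i ∈ Finset.range M, b i with hL
  set S := ∑ i ∈ Finset.range M, (A * (1/4)^i)^(p-4) * b i^4 with hS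
  have S0 : 0 ≤ S := Finset.sum_nonneg fun i _ => by have := b0 i; positivity
  rcases (Finset.sum_nonneg fun i _ => b0 i : 0 ≤ L).eq_or_lt with h | h
  · rw [hL, ← h, Real.zero_rpow (by linarith)]; positivity
  set c := L/8 with hc
  have c0 : 0 < c := by positivity
  set x := √(A/c) with hx
  have x0 : 0 < x := Real.sqrt_pos.2 (by positivity)
  have ea : ∀ i : ℕ, A * (1/4)^i = (x * (1/2)^i)^2 * c := fun i => by
    rw [mul_pow, Real.sq_sqrt (by positivity), ← pow_mul, mul_comm i 2, pow_mul]; norm_num; field_simp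
  have key : ∀ i, b i ≤ c * wt (x * (1/2)^i) + (A * (1/4)^i)^(p-4) * b i^4 / c^(p-1) := fun i => by
    have h1 := hb i
    have b0 := b0 i
    rw [ea] at h1 ⊢
    generalize x * (1/2)^i = y at *
    have pos : 0 ≤ (y^2*c)^(p-4) * b i^4 / c^(p-1) := by positivity
    unfold wt
    split_ifs with hy
    · linarith
    · push Not at hy
      rcases le_total (b i) (c * (1/y)) with h2 | h2
      · linarith
      · have : b i ≤ (y^2*c)^(p-4) * b i^4 / c^(p-1) := by
          rw [le_div_iff₀ (by positivity), pow_succ' (b i) 3, mul_left_comm]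
          refine mul_le_mul_of_nonneg_left ?_ b0
          calc c^(p-1) = (y^3 * c^(p-4)) * (c*(1/y))^3 := by
                rw [show p - 1 = (p-4) + (3:ℕ) by push_cast; ring, Real.rpow_add_natCast c0.ne']; field_simp
            _ ≤ (y^2*c)^(p-4) * b i^3 := by
                refine mul_le_mul ?_ (pow_le_pow_left₀ (by positivity) h2 3) (by positivity) (by positivity)
                rw [Real.mul_rpow (by positivity) c0.le, ← Real.rpow_natCast y 2, ← Real.rpow_mul (by linarith), ← Real.rpow_natCast y 3]
                refine mul_le_mul_of_nonneg_right (Real.rpow_le_rpow_of_exponent_le hy.le ?_) (by positivity)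
                push_cast; linarith
        have : 0 ≤ c*(1/y) := by positivity
        linarith
  have h1 : L ≤ c * 4 + S / c^(p-1) := by
    rw [hL, hS, Finset.sum_div]
    refine (Finset.sum_le_sum fun i _ => key i).trans ?_
    rw [Finset.sum_add_distrib, ← Finset.mul_sum]
    have := wt_sum M x x0
    refine add_le_add (mul_le_mul_of_nonneg_left (this.trans ?_) c0.le) le_rfl
    split_ifs
    · nlinarith
    · have : 0 ≤ 1/x := by positivity
      linarith
  have h2 : c ≤ S / c^(p-1) := by linarith
  rw [le_div_iff₀ (by positivity), mul_comm, Real.rpow_sub_one c0.ne', div_mul_cancel₀ _ c0.ne'] at h2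
  calc L^p = 8^p * c^p := by rw [← Real.mul_rpow (by norm_num) c0.le]; congr 1; linarith
    _ ≤ _ := by gcongr

/-- truncation -/
noncomputable def cutf (a : ℝ) (F : ℝ × ℝ → ℂ) (y : ℝ × ℝ) : ℂ := if ‖F y‖ ≤ a then F y else 0

theorem cutf_bi {A a : ℝ} {F : ℝ × ℝ → ℂ} (hF : BI A F) (hm : Measurable F) (ha : 0 ≤ a) : BI a (cutf a F) :=
  ⟨hF.i.mono (Measurable.ite (measurableSet_le hm.norm measurable_const) hm measurable_const).aestronglyMeasurable
    (.of_forall fun y => by unfold cutf; split_ifs <;> simp), fun y => by unfold cutf; split_ifs <;> simpa⟩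

theorem BI.pint {A p : ℝ} {F : ℝ × ℝ → ℂ} (hF : BI A F) (hp : 6 ≤ p) : Integrable (fun y => ‖F y‖^p) := by
  refine (hF.i.norm.const_mul (A^(p-1))).mono' (hF.i.1.norm.aemeasurable.pow_const p).aestronglyMeasurable (.of_forall fun y => ?_)
  rw [Real.norm_of_nonneg (by positivity), show p = (p-1)+1 by ring, Real.rpow_add_one' (norm_nonneg _) (by linarith), show p - 1 + 1 - 1 = p - 1 by ring]
  exact mul_le_mul_of_nonneg_right (Real.rpow_le_rpow (norm_nonneg _) (hF.b y) (by linarith)) (norm_nonneg _)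

theorem interp {α : Type*} [MeasurableSpace α] {μ : Measure α} {T : (ℝ × ℝ → ℂ) → α → ℂ} {C K p : ℝ} (hp : 6 ≤ p) (C1 : 1 ≤ C) (K0 : 0 ≤ K)
    (hT : ∀ A F, BI A F → Measurable (T F)) (hadd : ∀ A B F G, BI A F → BI B G → ∀ q, T (fun y => F y + G y) q = T F q + T G q)
    (hb : ∀ A F, BI A F → ∀ q, ‖T F q‖ ≤ C * A) (h4 : ∀ A F, BI A F → ∫⁻ q, ‖T F q‖ₑ^4 ∂μ ≤ ENNReal.ofReal (K * A^3 * ∫ y, ‖F y‖))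
    {A : ℝ} {F : ℝ × ℝ → ℂ} (hA : 0 < A) (hF : BI A F) (hm : Measurable F) :
    ∫⁻ q, ‖T F q‖ₑ^p ∂μ ≤ ENNReal.ofReal ((8*C)^p * K * 4^(p-1) * ∫ y, ‖F y‖^p) := by
  set a : ℕ → ℝ := fun i => A * (1/4)^i with ha
  have a0 : ∀ i, 0 < a i := fun i => by positivity
  set G : ℕ → ℝ × ℝ → ℂ := fun i => cutf (a i) F with hG
  have Gb : ∀ i, BI (a i) (G i) := fun i => cutf_bi hF hm (a0 i).le
  set D : ℕ → ℝ × ℝ → ℂ := fun i y => G i y - G (i+1) y with hD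
  have aa : ∀ i, a (i+1) = a i / 4 := fun i => by simp only [ha, pow_succ]; ring
  have Db : ∀ i, BI (a i) (D i) := fun i => ⟨(Gb i).i.sub (Gb (i+1)).i, fun y => by
    have h0 := a0 i; have := aa i
    simp only [hD, hG, cutf]; split_ifs <;> simp <;> linarith⟩
  have G0 : G 0 = F := by funext y; simp only [hG, cutf]; rw [if_pos]; simpa [ha] using hF.b y
  have tel : ∀ M q, T F q = (∑ i ∈ Finset.range M, T (D i) q) + T (G M) q := fun M q => by
    induction M with
    | zero => simp [G0]
    | succ M ih =>
      rw [ih, Finset.sum_range_succ, add_assoc, ← hadd _ _ _ _ (Db M) (Gb (M+1)) q]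
      congr 3; funext y; simp [hD]
  set J : ℕ → ℝ := fun i => ∫ y, ‖G i y‖^p with hJ
  have Jd : ∀ i, a i^(p-1) * ∫ y, ‖D i y‖ ≤ 4^(p-1) * (J i - J (i+1)) := fun i => by
    rw [hJ, ← integral_const_mul, ← integral_sub ((Gb i).pint hp) ((Gb (i+1)).pint hp), ← integral_const_mul]
    refine integral_mono ((Db i).i.norm.const_mul _) ((((Gb i).pint hp).sub ((Gb (i+1)).pint hp)).const_mul _) fun y => ?_
    have h0 := a0 i; have := aa i
    have z : (0:ℝ)^p = 0 := Real.zero_rpow (by linarith)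
    simp only [hD, hG, cutf]
    split_ifs with h1 h2 h2
    · simp
    · push Not at h2
      have e : ‖F y‖^p = ‖F y‖^(p-1) * ‖F y‖ := by
        rw [← Real.rpow_add_one' (norm_nonneg _) (by linarith), sub_add_cancel]
      simp only [sub_zero, norm_zero, z]
      rw [e, ← mul_assoc, ← Real.mul_rpow (by norm_num) (norm_nonneg _)]
      refine mul_le_mul_of_nonneg_right (Real.rpow_le_rpow h0.le ?_ (by linarith)) (norm_nonneg _)
      linarith
    · linarith
    · simp
  have main : ∀ M, ∫⁻ q, ‖T F q‖ₑ^p ∂μ ≤ ENNReal.ofReal ((8*C)^p * K * (4^(p-1) * (∫ y, ‖F y‖^p) + a M^(p-1) * ∫ y, ‖F y‖)) := fun M => by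
    set E : ℕ → ℝ × ℝ → ℂ := fun i => if i < M then D i else G i with hE
    have Eb : ∀ i, BI (a i) (E i) := fun i => by simp only [hE]; split_ifs; exacts [Db i, Gb i]
    have te : ∀ q, T F q = ∑ i ∈ Finset.range (M+1), T (E i) q := fun q => by
      rw [tel M q, Finset.sum_range_succ]
      congr 1
      · exact Finset.sum_congr rfl fun i hi => by simp only [hE, if_pos (Finset.mem_range.1 hi)]
      · simp [hE]
    have pt : ∀ q, ‖T F q‖ₑ^p ≤ ∑ i ∈ Finset.range (M+1), ENNReal.ofReal ((8*C)^p * a i^(p-4)) * ‖T (E i) q‖ₑ^4 := fun q => by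
      have := lev hA hp (M+1) (fun i => ‖T (E i) q‖/C) (fun i => by positivity) (fun i => by
        rw [div_le_iff₀ (by positivity), mul_comm]; exact hb _ _ (Eb i) q)
      rw [← Finset.sum_div] at this
      have h2 : ‖T F q‖^p ≤ ∑ i ∈ Finset.range (M+1), (8*C)^p * a i^(p-4) * ‖T (E i) q‖^4 := by
        calc _ ≤ (C * ((∑ i ∈ Finset.range (M+1), ‖T (E i) q‖) / C))^p := by
              refine Real.rpow_le_rpow (norm_nonneg _) ?_ (by linarith)
              rw [mul_div_cancel₀ _ (by positivity), te]; exact norm_sum_le _ _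
          _ ≤ C^p * (8^p * ∑ i ∈ Finset.range (M+1), a i^(p-4) * ‖T (E i) q‖^4) := by
              rw [Real.mul_rpow (by positivity) (by positivity)]
              refine mul_le_mul_of_nonneg_left (this.trans (mul_le_mul_of_nonneg_left (Finset.sum_le_sum fun i _ => mul_le_mul_of_nonneg_left ?_ (Real.rpow_nonneg (a0 i).le _)) (by positivity))) (by positivity)
              rw [div_pow]; exact div_le_self (by positivity) (one_le_pow₀ C1)
          _ = _ := by
              rw [← mul_assoc, Finset.mul_sum, ← Real.mul_rpow (by positivity) (by norm_num), mul_comm C 8]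
              exact Finset.sum_congr rfl fun i _ => by ring
      rw [← ofReal_norm, ENNReal.ofReal_rpow_of_nonneg (norm_nonneg _) (by linarith)]
      refine (ENNReal.ofReal_le_ofReal h2).trans ?_
      rw [ENNReal.ofReal_sum_of_nonneg fun i _ => by have := a0 i; positivity]
      refine Finset.sum_le_sum fun i _ => ?_
      rw [ENNReal.ofReal_mul (by have := a0 i; positivity), ENNReal.ofReal_pow (norm_nonneg _), ofReal_norm]
    refine (lintegral_mono pt).trans ?_
    rw [lintegral_finsetSum _ fun i _ => ((hT _ _ (Eb i)).enorm.pow_const 4).const_mul _]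
    have n0 : ∀ i, 0 ≤ ∫ y, ‖E i y‖ := fun i => integral_nonneg fun y => norm_nonneg _
    have h3 : ∀ i, ∫⁻ q, ENNReal.ofReal ((8*C)^p * a i^(p-4)) * ‖T (E i) q‖ₑ^4 ∂μ ≤ ENNReal.ofReal ((8*C)^p * K * (a i^(p-1) * ∫ y, ‖E i y‖)) := fun i => by
      rw [lintegral_const_mul _ ((hT _ _ (Eb i)).enorm.pow_const 4)]
      refine (mul_le_mul' le_rfl (h4 _ _ (Eb i))).trans (le_of_eq ?_)
      rw [← ENNReal.ofReal_mul (by have := a0 i; positivity), show p - 1 = (p-4) + (3:ℕ) by push_cast; ring, Real.rpow_add_natCast (a0 i).ne']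
      congr 1; ring
    refine (Finset.sum_le_sum fun i _ => h3 i).trans ?_
    rw [← ENNReal.ofReal_sum_of_nonneg fun i _ => by have := a0 i; have := n0 i; positivity, ← Finset.mul_sum]
    refine ENNReal.ofReal_le_ofReal (mul_le_mul_of_nonneg_left ?_ (by positivity))
    rw [Finset.sum_range_succ]
    refine add_le_add ?_ (mul_le_mul_of_nonneg_left (integral_mono (Eb M).i.norm hF.i.norm fun y => ?_) (Real.rpow_nonneg (a0 M).le _))
    · calc _ ≤ ∑ i ∈ Finset.range M, 4^(p-1) * (J i - J (i+1)) := Finset.sum_le_sum fun i hi => by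
            simp only [hE, if_pos (Finset.mem_range.1 hi)]; exact Jd i
        _ = 4^(p-1) * (J 0 - J M) := by rw [← Finset.mul_sum, Finset.sum_range_sub']
        _ ≤ _ := by
          refine mul_le_mul_of_nonneg_left ?_ (by positivity)
          have : 0 ≤ J M := integral_nonneg fun y => by positivity
          have : J 0 = ∫ y, ‖F y‖^p := by simp only [hJ, G0]
          linarith
    · simp only [hE, lt_irrefl, if_false, hG, cutf]; split_ifs <;> simp
  refine ge_of_tendsto (f := fun M => ENNReal.ofReal ((8*C)^p * K * (4^(p-1) * (∫ y, ‖F y‖^p) + a M^(p-1) * ∫ y, ‖F y‖))) (x := atTop) ?_ (.of_forall main)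
  refine (ENNReal.continuous_ofReal.tendsto _).comp ?_
  have h5 : Tendsto a atTop (nhds 0) := by
    have := (tendsto_pow_atTop_nhds_zero_of_lt_one (r := (1/4:ℝ)) (by norm_num) (by norm_num)).const_mul A
    simpa [ha] using this
  have h6 := (h5.rpow_const (p := p-1) (Or.inr (by linarith))).mul_const (∫ y, ‖F y‖)
  rw [Real.zero_rpow (by linarith), zero_mul] at h6
  have := (h6.const_add (4^(p-1) * (∫ y, ‖F y‖^p))).const_mul ((8*C)^p * K)
  rw [add_zero] at this
  convert this using 2; ring


theorem rtp {σ1 σ2 : SchwartzMap ℝ ℂ} {χ : ℝ → ℂ} {p : ℝ} (hp : 6 ≤ p) (T m B s) (hχ : UB (ι := Unit) (1/2) 2 True 6 (fun _ => χ)) (hc : Continuous χ) (h1 : LPs σ1) (h2 : LPs σ2) :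
    ∃ C > 0, ∀ g, Crv T m B s g → Continuous (g 0) → ∀ {N e1 e2 A : ℝ} {F : ℝ × ℝ → ℂ}, 1 ≤ N → (e1 = 1 ∨ e1 = -1) → (e2 = 1 ∨ e2 = -1) → 0 < A → BI A F → Measurable F →
      Continuous (fun q : ℝ × (ℝ × ℝ) => Fo N e1 e2 (g 0) q.1 χ (GF σ1 σ2 N F) q.2) ∧
      ∫⁻ q, ‖Fo N e1 e2 (g 0) q.1 χ (GF σ1 σ2 N F) q.2‖ₑ^p ∂(mI 1 2) ≤ ENNReal.ofReal (C * (N^(65/32:ℝ))⁻¹ * (N^2)⁻¹ * ∫ y, ‖F y‖^p) := by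
  obtain ⟨C, C0, H⟩ := rt4 T m B s hχ hc h1 h2
  obtain ⟨c, c0, hk⟩ := be_kd σ1 σ2
  have GFc : ∀ {N A : ℝ} {F : ℝ × ℝ → ℂ}, BI A F → Continuous (GF σ1 σ2 N F) := fun hF => ((hk 0 0).cvc hF).comp (continuous_const_smul _)
  refine ⟨(8*(C+1))^p * C * 4^(p-1), by positivity, fun g hg gc N e1 e2 A F hN he1 he2 A0 hF hm => ⟨Fo_cont gc hc (GFc hF), ?_⟩⟩
  have := interp (μ := mI 1 2) (T := fun F q => Fo N e1 e2 (g 0) q.1 χ (GF σ1 σ2 N F) q.2) (C := C+1) (K := C * (N^(65/32:ℝ))⁻¹ * (N^2)⁻¹) hp (by linarith) (by positivity)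
    (fun A F hF => (Fo_cont gc hc (GFc hF)).measurable) (fun A B F G hF hG q => by
      have e : GF σ1 σ2 N (fun y => F y + G y) = fun X => GF σ1 σ2 N F X + GF σ1 σ2 N G X := by
        funext X; unfold GF cv; simp_rw [mul_add]
        exact integral_add ((hk 0 0).cvi hF _) ((hk 0 0).cvi hG _)
      have cF := GFc (N := N) hF
      have cG := GFc (N := N) hG
      simp only [e]
      unfold Fo; simp_rw [mul_add (χ _)]
      exact intervalIntegral.integral_add (Continuous.intervalIntegrable (by fun_prop) _ _) (Continuous.intervalIntegrable (by fun_prop) _ _))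
    (fun A F hF q => ((H g hg gc hN he1 he2 hF).1 q.1 q.2).trans (mul_le_mul_of_nonneg_right (by linarith) hF.A0))
    (fun A F hF => ((H g hg gc hN he1 he2 hF).2).trans (ENNReal.ofReal_le_ofReal (le_of_eq (by ring)))) A0 hF hm
  exact this.trans (ENNReal.ofReal_le_ofReal (le_of_eq (by ring)))


/-- sign -/
def sb (b : Bool) : ℝ := cond b 1 (-1)
theorem sb_sq (b : Bool) : sb b * sb b = 1 := by cases b <;> simp [sb]
theorem sb_abs (b : Bool) : |sb b| = 1 := by cases b <;> simp [sb]
theorem sb_or (b : Bool) : sb b = 1 ∨ sb b = -1 := by cases b <;> simp [sb]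

theorem spl {h : ℝ → ℂ} (hi : Integrable h) (h0 : ∀ t, ¬ (1/2 ≤ |t| ∧ |t| ≤ 2) → h t = 0) :
    ∫ t, h t = ∑ b, ∫ t in (1/2:ℝ)..2, h (sb b * t) := by
  have e : ∀ b, ∫ t in (1/2:ℝ)..2, h (sb b * t) = ∫ t in Ioi (0:ℝ), h (sb b * t) := fun b => by
    rw [intervalIntegral.integral_of_le (by norm_num), ← integral_Icc_eq_integral_Ioc]
    refine (setIntegral_eq_of_subset_of_forall_sdiff_eq_zero measurableSet_Ioi (fun t ht => by have := ht.1; simp only [mem_Ioi]; linarith) fun t ht => h0 _ fun h => ht.2 ?_).symm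
    rwa [abs_mul, sb_abs, one_mul, abs_of_pos ht.1] at h
  simp_rw [e]
  rw [← integral_add_compl measurableSet_Ioi hi (s := Ioi 0), compl_Ioi]
  simp only [Fintype.sum_bool, sb, cond_true, cond_false, one_mul, neg_one_mul]
  rw [integral_comp_neg_Ioi, neg_zero]

/-- restriction to the positive axis -/
noncomputable def pp (h : ℝ → ℝ) (t : ℝ) : ℂ := ((if 0 < t then h t else 0 : ℝ) : ℂ)

theorem pp_z {h : ℝ → ℝ} (h0 : ∀ t, ¬ (1/2 ≤ |t| ∧ |t| ≤ 2) → h t = 0) (t : ℝ) (ht : t ∉ Icc (1/2:ℝ) 2) : pp h t = 0 := by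
  unfold pp; split_ifs with h1
  · rw [h0 t (by rw [abs_of_pos h1]; exact ht)]; simp
  · simp

theorem pp_s {h : ℝ → ℝ} (hs : ∀ t ≠ 0, ContDiffAt ℝ (⊤ : ℕ∞) h t) (h0 : ∀ t, ¬ (1/2 ≤ |t| ∧ |t| ≤ 2) → h t = 0) : ContDiff ℝ (⊤ : ℕ∞) (pp h) := by
  refine contDiff_iff_contDiffAt.2 fun t => ?_
  rcases lt_or_ge 0 t with ht | ht
  · refine (Complex.ofRealCLM.contDiff.contDiffAt.comp t (hs t ht.ne')).congr_of_eventuallyEq ?_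
    filter_upwards [Ioi_mem_nhds ht] with y hy
    simp only [pp, if_pos (mem_Ioi.1 hy)]; rfl
  · refine (contDiffAt_const (c := (0:ℂ))).congr_of_eventuallyEq ?_
    filter_upwards [Iio_mem_nhds (by linarith : t < 1/2)] with y hy
    exact pp_z h0 y fun h => not_lt.2 h.1 hy

theorem ub_s (n : ℕ) : ∀ {χ : ℝ → ℂ}, ContDiff ℝ (⊤ : ℕ∞) χ → (∀ t ∉ Icc (1/2:ℝ) 2, χ t = 0) → UB (ι := Unit) (1/2) 2 True n (fun _ => χ) := by
  have key : ∀ {χ : ℝ → ℂ}, ContDiff ℝ (⊤ : ℕ∞) χ → (∀ t ∉ Icc (1/2:ℝ) 2, χ t = 0) → (∃ C, ∀ i : Unit, ∀ t ∈ Icc (1/2:ℝ) 2, ‖χ t‖ ≤ C) ∧ (True → ∀ i : Unit, χ (1/2) = 0 ∧ χ 2 = 0) := fun {χ} hs h0 => by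
    obtain ⟨C, hC⟩ := isCompact_Icc.exists_bound_of_continuousOn (s := Icc (1/2:ℝ) 2) hs.continuous.continuousOn
    have cl : closure (Icc (1/2:ℝ) 2)ᶜ ⊆ {t | χ t = 0} := closure_minimal h0 (isClosed_eq hs.continuous continuous_const)
    refine ⟨⟨C, fun _ => hC⟩, fun _ _ => ⟨cl ?_, cl ?_⟩⟩
    · rw [closure_compl, interior_Icc]; simp
    · rw [closure_compl, interior_Icc]; simp
  induction n with
  | zero => exact fun hs h0 => ⟨(key hs h0).1, (key hs h0).2, fun _ => hs.continuous.continuousOn⟩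
  | succ n ih =>
    intro χ hs h0
    refine ⟨(key hs h0).1, (key hs h0).2, fun _ => deriv χ, fun _ t _ => (hs.differentiable (by simp) t).hasDerivAt, ih (contDiff_infty_iff_deriv.1 hs).2 fun t ht => ?_⟩
    have : χ =ᶠ[nhds t] fun _ => 0 := by
      filter_upwards [isClosed_Icc.isOpen_compl.mem_nhds ht] with y hy using h0 y hy
    rw [this.deriv_eq]; simp

theorem kern {φ : ℝ → ℝ} (hs : ContDiff ℝ (⊤ : ℕ∞) φ) (h0 : ∀ t, ¬ (1/2 ≤ |t| ∧ |t| ≤ 2) → φ t = 0) :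
    ∃ σ : Bool → SchwartzMap ℝ ℂ, (∀ b, LPs (σ b)) ∧ ∀ {M z : ℝ}, 0 < M →
      ∫ ξ, ex (2*Real.pi*(z*ξ)) * φ (M⁻¹*ξ) = (2*Real.pi*M : ℝ) * ∑ b, σ b (2*Real.pi*M*(sb b*z)) := by
  have h0' : ∀ b t, ¬ (1/2 ≤ |t| ∧ |t| ≤ 2) → φ (sb b * t) = 0 := fun b t ht => h0 _ (by rwa [abs_mul, sb_abs, one_mul])
  have ps : ∀ b, ContDiff ℝ (⊤ : ℕ∞) (pp fun t => φ (sb b * t)) := fun b => pp_s (fun t _ => by fun_prop) (h0' b)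
  have cs : ∀ b, HasCompactSupport (pp fun t => φ (sb b * t)) := fun b => HasCompactSupport.intro isCompact_Icc (pp_z (h0' b))
  choose σ s1 s2 using fun b => four_inv (ps b) (cs b)
  refine ⟨σ, fun b => ⟨_, (ps b).continuous, pp_z (h0' b), s1 b, s2 b⟩, fun {M z} hM => ?_⟩
  have hc : Continuous φ := hs.continuous
  have cφ : HasCompactSupport (fun t => (φ t:ℂ)) := HasCompactSupport.intro (K := Icc (-2) 2) isCompact_Icc fun t ht => by
    rw [h0 t fun h => ht (abs_le.1 h.2)]; simp
  have e1 := Measure.integral_comp_mul_left (fun η => ex (2*Real.pi*(z*(M*η))) * φ η) M⁻¹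
  rw [inv_inv, abs_of_pos hM, Complex.real_smul] at e1
  rw [show (fun ξ => ex (2*Real.pi*(z*ξ)) * φ (M⁻¹*ξ)) = fun ξ => ex (2*Real.pi*(z*(M*(M⁻¹*ξ)))) * φ (M⁻¹*ξ) by funext ξ; rw [mul_inv_cancel_left₀ hM.ne'], e1,
    spl (ex_mul_int (f := fun η => (φ η:ℂ)) (cs_int (by fun_prop) cφ) (p := fun η => 2*Real.pi*(z*(M*η))) (by fun_prop)) (fun t ht => by rw [h0 t ht]; simp)]
  rw [Complex.ofReal_mul, mul_comm ((2*Real.pi:ℝ):ℂ), mul_assoc]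
  congr 1
  rw [Finset.mul_sum]
  refine Finset.sum_congr rfl fun b _ => ?_
  rw [s1, ← mul_assoc, ← Complex.ofReal_mul, mul_inv_cancel₀ (by positivity), Complex.ofReal_one, one_mul,
    intervalIntegral.integral_of_le (by norm_num), ← integral_Icc_eq_integral_Ioc, ← setIntegral_eq_integral_of_forall_compl_eq_zero (f := fun η => ex (2*Real.pi*M*(sb b*z)*η) * pp (fun t => φ (sb b * t)) η) (s := Icc (1/2:ℝ) 2) (fun t ht => by rw [pp_z (h0' b) t ht, mul_zero])]
  refine setIntegral_congr_fun measurableSet_Icc fun t ht => ?_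
  simp only [pp, if_pos (by linarith [ht.1] : 0 < t)]
  congr 2; ring


/-- dilation and reflection -/
def dl (a : ℝ) (b1 b2 : Bool) (Y : ℝ × ℝ) : ℝ × ℝ := (sb b1 * (a * Y.1), sb b2 * (a * Y.2))

theorem dl_mp (b1 b2 : Bool) : MeasurePreserving (dl 1 b1 b2) := by
  have A : ∀ b, MeasurePreserving (fun y : ℝ => sb b * (1 * y)) := fun b => by
    cases b
    · simpa [sb] using Measure.measurePreserving_neg (volume : Measure ℝ)
    · simp only [sb, cond_true, one_mul]; exact MeasurePreserving.id (volume : Measure ℝ)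
  exact (A b1).prod (A b2)
theorem dl_inv (b1 b2 : Bool) : Function.Involutive (dl 1 b1 b2) := fun Y => by
  ext <;> simp [dl, ← mul_assoc, sb_sq]
/-- the reflection as an equivalence -/
def dle (b1 b2 : Bool) : (ℝ × ℝ) ≃ᵐ (ℝ × ℝ) := MeasurableEquiv.ofInvolutive (dl 1 b1 b2) (dl_inv b1 b2) (dl_mp b1 b2).measurable
theorem dl_eq (a : ℝ) (b1 b2 : Bool) (Y : ℝ × ℝ) : dl a b1 b2 Y = dl 1 b1 b2 (a • Y) := by simp [dl]

theorem dl_int {E : Type*} [NormedAddCommGroup E] [NormedSpace ℝ E] {a : ℝ} (ha : 0 < a) (b1 b2 : Bool) (G : ℝ × ℝ → E) :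
    ∫ y, G (dl a b1 b2 y) = (a^2)⁻¹ • ∫ y, G y := by
  simp_rw [dl_eq a]
  rw [Measure.integral_comp_smul volume (fun y => G (dl 1 b1 b2 y)) a, ← (show MeasurePreserving (dle b1 b2) volume volume from dl_mp b1 b2).integral_comp' G]
  simp only [Module.finrank_prod, Module.finrank_self]
  rw [abs_of_pos (by positivity)]; rfl

theorem dl_lint {a : ℝ} (ha : 0 < a) (b1 b2 : Bool) {G : ℝ × ℝ → ℝ≥0∞} (hG : Measurable G) :
    ∫⁻ y, G (dl a b1 b2 y) = ENNReal.ofReal ((a^2)⁻¹) * ∫⁻ y, G y := by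
  have m1 := (dl_mp b1 b2).measurable
  simp_rw [dl_eq a]
  rw [← (dl_mp b1 b2).lintegral_comp hG, ← lintegral_map (f := fun y => G (dl 1 b1 b2 y)) (g := fun y => a • y) (hG.comp m1) (by fun_prop), Measure.map_addHaar_smul volume ha.ne', lintegral_smul_measure]
  simp only [Module.finrank_prod, Module.finrank_self]
  rw [abs_of_pos (by positivity)]; rfl

theorem ft_ex (f : ℝ × ℝ → ℂ) (ξ : ℝ × ℝ) : ft f ξ = ∫ y : ℝ × ℝ, ex (-(2*Real.pi*(y.1*ξ.1+y.2*ξ.2))) * f y := by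
  unfold ft ex; congr 1; funext y; congr 2; push_cast; ring

theorem Phi_int {φ : ℝ → ℝ} (hs : ContDiff ℝ (⊤ : ℕ∞) φ) (h0 : ∀ t, ¬ (1/2 ≤ |t| ∧ |t| ≤ 2) → φ t = 0) {M : ℝ} (hM : 0 < M) : Integrable (fun ξ : ℝ × ℝ => (φ (M*ξ.1) : ℂ) * φ (M*ξ.2)) := by
  have hc := hs.continuous
  have : Integrable (fun t => (φ (M*t) : ℂ)) := by
    refine Continuous.integrable_of_hasCompactSupport (by fun_prop) (HasCompactSupport.intro (K := Icc (-(2/M)) (2/M)) isCompact_Icc fun t ht => ?_)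
    rw [h0 _ fun h => ht (abs_le.1 ?_)]; · simp
    have := h.2
    rw [abs_mul, abs_of_pos hM] at this
    rw [le_div_iff₀ hM]; linarith
  exact this.mul_prod this

theorem repP {φ : ℝ → ℝ} (hs : ContDiff ℝ (⊤ : ℕ∞) φ) (h0 : ∀ t, ¬ (1/2 ≤ |t| ∧ |t| ≤ 2) → φ t = 0) {σ : Bool → SchwartzMap ℝ ℂ} (hσ : ∀ {M z : ℝ}, 0 < M →
      ∫ ξ, ex (2*Real.pi*(z*ξ)) * φ (M⁻¹*ξ) = (2*Real.pi*M : ℝ) * ∑ b, σ b (2*Real.pi*M*(sb b*z))) {N : ℝ} (hN : 0 < N) (f : SchwartzMap (ℝ × ℝ) ℂ) (z : ℝ × ℝ) :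
    ∫ ξ : ℝ × ℝ, ex (2*Real.pi*(z.1*ξ.1+z.2*ξ.2)) * ((φ ((N^2)⁻¹*ξ.1) : ℂ) * φ ((N^2)⁻¹*ξ.2) * ft f ξ) =
      ∑ i : Bool × Bool, GF (σ i.1) (σ i.2) N (fun Y => f (dl (2*Real.pi*N^2)⁻¹ i.1 i.2 Y)) (dl (2*Real.pi*N) i.1 i.2 z) := by
  have hM : 0 < N^2 := by positivity
  have hΦ := Phi_int hs h0 (inv_pos.2 hM)
  have ec := ex_cont
  set a := 2*Real.pi*N^2 with ha
  have a0 : 0 < a := by positivity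
  calc _ = ∫ ξ : ℝ × ℝ, ∫ y : ℝ × ℝ, ex (2*Real.pi*((z.1-y.1)*ξ.1+(z.2-y.2)*ξ.2)) * ((φ ((N^2)⁻¹*ξ.1) : ℂ) * φ ((N^2)⁻¹*ξ.2) * f y) := by
        congr 1; funext ξ
        rw [ft_ex, ← integral_const_mul, ← integral_const_mul]
        congr 1; funext y
        rw [show 2*Real.pi*((z.1-y.1)*ξ.1+(z.2-y.2)*ξ.2) = 2*Real.pi*(z.1*ξ.1+z.2*ξ.2) + -(2*Real.pi*(y.1*ξ.1+y.2*ξ.2)) by ring, ex_add]; ring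
    _ = ∫ y : ℝ × ℝ, ∫ ξ : ℝ × ℝ, ex (2*Real.pi*((z.1-y.1)*ξ.1+(z.2-y.2)*ξ.2)) * ((φ ((N^2)⁻¹*ξ.1) : ℂ) * φ ((N^2)⁻¹*ξ.2) * f y) := by
        refine integral_integral_swap ?_
        exact (hΦ.mul_prod f.integrable).bdd_mul (c := 1) (f := fun q : (ℝ × ℝ) × (ℝ × ℝ) => ex (2*Real.pi*((z.1-q.2.1)*q.1.1+(z.2-q.2.2)*q.1.2))) (Continuous.aestronglyMeasurable (by fun_prop)) (.of_forall fun q => (ex_norm _).le)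
    _ = ∫ y : ℝ × ℝ, ∑ i : Bool × Bool, ((a^2 : ℝ) : ℂ) * (σ i.1 (a*(sb i.1*(z.1-y.1))) * σ i.2 (a*(sb i.2*(z.2-y.2))) * f y) := by
        congr 1; funext y
        have := integral_prod_mul (μ := volume) (ν := volume) (fun ξ => ex (2*Real.pi*((z.1-y.1)*ξ)) * φ ((N^2)⁻¹*ξ)) (fun ξ => ex (2*Real.pi*((z.2-y.2)*ξ)) * φ ((N^2)⁻¹*ξ))
        rw [hσ hM, hσ hM, ← ha] at this
        calc _ = (∫ ξ : ℝ × ℝ, (ex (2*Real.pi*((z.1-y.1)*ξ.1)) * φ ((N^2)⁻¹*ξ.1)) * (ex (2*Real.pi*((z.2-y.2)*ξ.2)) * φ ((N^2)⁻¹*ξ.2))) * f y := by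
              rw [← integral_mul_const]; congr 1; funext ξ
              rw [mul_add, ex_add]; ring
          _ = _ := by
              rw [Measure.volume_eq_prod, this, Fintype.sum_prod_type]
              simp only [Fintype.sum_bool]; push_cast; ring
    _ = ∑ i : Bool × Bool, ((a^2 : ℝ) : ℂ) * ∫ y : ℝ × ℝ, σ i.1 (a*(sb i.1*(z.1-y.1))) * σ i.2 (a*(sb i.2*(z.2-y.2))) * f y := by
        rw [integral_finsetSum]
        · simp_rw [integral_const_mul]
        · intro i _
          refine Integrable.const_mul ?_ _
          obtain ⟨c, c0, hc⟩ := be_kd (σ i.1) (σ i.2)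
          have s1 := (σ i.1).continuous; have s2 := (σ i.2).continuous
          refine f.integrable.bdd_mul (c := c) (f := fun y : ℝ × ℝ => σ i.1 (a*(sb i.1*(z.1-y.1))) * σ i.2 (a*(sb i.2*(z.2-y.2)))) (Continuous.aestronglyMeasurable (by fun_prop)) (.of_forall fun y => ?_)
          have := (hc 0 0).bd (a*(sb i.1*(z.1-y.1)), a*(sb i.2*(z.2-y.2)))
          simpa [be, ex_zero] using this
    _ = _ := by
        refine Finset.sum_congr rfl fun i _ => ?_
        have := dl_int a0 i.1 i.2 (fun Y => be 0 0 (σ i.1) (σ i.2) (N • dl (2*Real.pi*N) i.1 i.2 z - Y) * f (dl a⁻¹ i.1 i.2 Y))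
        unfold GF cv
        rw [Complex.real_smul] at this
        rw [← mul_inv_cancel_left₀ (a := ((a^2:ℝ):ℂ)) (Complex.ofReal_ne_zero.2 (by positivity)) (∫ Y, be 0 0 (σ i.1) (σ i.2) (N • dl (2*Real.pi*N) i.1 i.2 z - Y) * f (dl a⁻¹ i.1 i.2 Y)), ← Complex.ofReal_inv, ← this]
        congr 2; funext y
        have e : dl a⁻¹ i.1 i.2 (dl a i.1 i.2 y) = y := by
          ext <;> simp only [dl] <;> rw [← mul_assoc, ← mul_assoc, ← mul_assoc] <;> simp only [mul_assoc, mul_left_comm _ (sb _)] <;> rw [← mul_assoc, sb_sq, one_mul, inv_mul_cancel_left₀ a0.ne']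
        rw [e]
        simp only [be, zero_mul, add_zero, ex_zero, one_mul, dl, Prod.fst_sub, Prod.snd_sub, Prod.smul_fst, Prod.smul_snd, smul_eq_mul]
        congr 3 <;> rw [ha] <;> ring


theorem Fs_bi (f : SchwartzMap (ℝ × ℝ) ℂ) : ∃ A, 0 < A ∧ ∀ {a : ℝ}, 0 < a → ∀ b1 b2, BI A (fun Y => f (dl a b1 b2 Y)) := by
  obtain ⟨A, A0, hA⟩ := f.decay 0 0
  refine ⟨A, A0, fun {a} ha b1 b2 => ⟨?_, fun Y => by have := hA (dl a b1 b2 Y); rwa [pow_zero, one_mul, norm_iteratedFDeriv_zero] at this⟩⟩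
  simp_rw [dl_eq a]
  exact Integrable.comp_smul (f := fun Y => f (dl 1 b1 b2 Y)) ((dl_mp b1 b2).integrable_comp_of_integrable f.integrable) ha.ne'

theorem rep {φ : ℝ → ℝ} (hs : ContDiff ℝ (⊤ : ℕ∞) φ) (h0 : ∀ t, ¬ (1/2 ≤ |t| ∧ |t| ≤ 2) → φ t = 0) {σ : Bool → SchwartzMap ℝ ℂ} (hσ : ∀ {M z : ℝ}, 0 < M →
      ∫ ξ, ex (2*Real.pi*(z*ξ)) * φ (M⁻¹*ξ) = (2*Real.pi*M : ℝ) * ∑ b, σ b (2*Real.pi*M*(sb b*z))) {N : ℝ} (hN : 0 < N) {j l : ℕ} (hj : N^2 = 2^j)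
    {γ : ℝ → ℝ} (gc : Continuous (gammaZ γ l)) {ep : Bool → ℝ} (hep : ∀ b t, gammaZ γ l (sb b * t) = ep b * gammaZ γ l t) (f : SchwartzMap (ℝ × ℝ) ℂ) (u : ℝ) (x : ℝ × ℝ) :
    op (mjl γ φ j l u) f x = ∑ i : (Bool × Bool) × Bool, Fo N (sb i.1.1 * sb i.2) (sb i.1.2 * ep i.2) (gammaZ γ l) u (pp fun t => φ (sb i.2 * t) / (sb i.2 * t))
      (GF (σ i.1.1) (σ i.1.2) N (fun Y => f (dl (2*Real.pi*N^2)⁻¹ i.1.1 i.1.2 Y))) (dl (2*Real.pi*N) i.1.1 i.1.2 x) := by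
  have hM : 0 < N^2 := by positivity
  have ec := ex_cont
  have fc := hs.continuous
  set Γ := gammaZ γ l with hΓ
  have κc : Continuous (fun t => φ t / t) := continuous_iff_continuousAt.2 fun t => by
    by_cases ht : t = 0
    · subst ht
      refine (continuousAt_const (y := (0:ℝ))).congr ?_
      filter_upwards [Ioo_mem_nhds (by norm_num : (-(1/2):ℝ) < 0) (by norm_num : (0:ℝ) < 1/2)] with t ht
      rw [h0 t fun h => not_lt.2 h.1 (abs_lt.2 ht), zero_div]
    · exact fc.continuousAt.div continuousAt_id ht
  have κz : ∀ t, ¬ (1/2 ≤ |t| ∧ |t| ≤ 2) → ((φ t / t : ℝ) : ℂ) = 0 := fun t ht => by rw [h0 t ht]; simp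
  have κs : HasCompactSupport (fun t => ((φ t / t : ℝ) : ℂ)) := HasCompactSupport.intro (K := Icc (-2) 2) isCompact_Icc fun t ht => κz t fun h => ht (abs_le.1 h.2)
  have κi : Integrable (fun t => ((φ t / t : ℝ) : ℂ)) := cs_int (by fun_prop) κs
  have Fi : Integrable (fun ξ : ℝ × ℝ => (φ ((N^2)⁻¹*ξ.1) : ℂ) * φ ((N^2)⁻¹*ξ.2) * ft f ξ) := by
    refine (Phi_int hs h0 (inv_pos.2 hM)).mul_bdd (c := ∫ y, ‖f y‖) (Continuous.aestronglyMeasurable ?_) (.of_forall fun ξ => ?_)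
    · simp_rw [funext (ft_ex f)]
      have := f.continuous
      refine continuous_of_dominated (bound := fun y => ‖f y‖) (fun ξ => Continuous.aestronglyMeasurable (by fun_prop)) (fun ξ => .of_forall fun y => ?_) f.integrable.norm (.of_forall fun y => by fun_prop)
      rw [norm_mul, ex_norm, one_mul]
    · rw [ft_ex]
      refine (norm_integral_le_integral_norm _).trans (le_of_eq ?_)
      simp_rw [norm_mul, ex_norm, one_mul]
  have pp0 := Real.pi_pos.ne'
  have Q := fun t => repP hs h0 hσ hN f (x.1 + t/(2*Real.pi), x.2 + u * Γ t/(2*Real.pi))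
  have Gc : ∀ i : Bool × Bool, Continuous (GF (σ i.1) (σ i.2) N (fun Y => f (dl (2*Real.pi*N^2)⁻¹ i.1 i.2 Y))) := fun i => by
    obtain ⟨c, c0, hk⟩ := be_kd (σ i.1) (σ i.2)
    obtain ⟨A, -, hA⟩ := Fs_bi f
    exact ((hk 0 0).cvc (hA (inv_pos.2 (by positivity)) i.1 i.2)).comp (continuous_const_smul _)
  calc _ = ∫ ξ : ℝ × ℝ, ∫ t, ex (2*Real.pi*((x.1 + t/(2*Real.pi))*ξ.1 + (x.2 + u * Γ t/(2*Real.pi))*ξ.2)) * ((φ ((N^2)⁻¹*ξ.1) : ℂ) * φ ((N^2)⁻¹*ξ.2) * ft f ξ * ((φ t / t : ℝ) : ℂ)) := by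
        unfold op ftInv
        congr 1; funext ξ
        unfold mjl
        beta_reduce
        rw [← hΓ, ← integral_const_mul, ← integral_mul_const, ← integral_const_mul]
        congr 1; funext t
        rw [zpow_neg, zpow_natCast, ← hj, show 2*Real.pi*((x.1 + t/(2*Real.pi))*ξ.1 + (x.2 + u * Γ t/(2*Real.pi))*ξ.2) = 2*Real.pi*(x.1*ξ.1+x.2*ξ.2) + (ξ.1*t + ξ.2*u*Γ t) by field_simp; ring, ex_add, ex_add]
        unfold ex; push_cast
        rw [show 2*(Real.pi:ℂ)*Complex.I*(x.1*ξ.1+x.2*ξ.2) = 2*Real.pi*(x.1*ξ.1+x.2*ξ.2)*Complex.I by ring, show Complex.I*ξ.1*t = ξ.1*t*Complex.I by ring, show Complex.I*ξ.2*u*Γ t = ξ.2*u*Γ t*Complex.I by ring]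
        ring
    _ = ∫ t, ∫ ξ : ℝ × ℝ, ex (2*Real.pi*((x.1 + t/(2*Real.pi))*ξ.1 + (x.2 + u * Γ t/(2*Real.pi))*ξ.2)) * ((φ ((N^2)⁻¹*ξ.1) : ℂ) * φ ((N^2)⁻¹*ξ.2) * ft f ξ * ((φ t / t : ℝ) : ℂ)) := by
        refine integral_integral_swap ?_
        exact (Fi.mul_prod κi).bdd_mul (c := 1) (f := fun q : (ℝ × ℝ) × ℝ => ex (2*Real.pi*((x.1 + q.2/(2*Real.pi))*q.1.1 + (x.2 + u * Γ q.2/(2*Real.pi))*q.1.2))) (Continuous.aestronglyMeasurable (by fun_prop)) (.of_forall fun q => (ex_norm _).le)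
    _ = ∫ t, ((φ t / t : ℝ) : ℂ) * ∑ i : Bool × Bool, GF (σ i.1) (σ i.2) N (fun Y => f (dl (2*Real.pi*N^2)⁻¹ i.1 i.2 Y)) (dl (2*Real.pi*N) i.1 i.2 (x.1 + t/(2*Real.pi), x.2 + u * Γ t/(2*Real.pi))) := by
        congr 1; funext t
        rw [← Q t, ← integral_const_mul]
        congr 1; funext ξ; ring
    _ = _ := by
        have dc : ∀ i : Bool × Bool, Continuous (dl (2*Real.pi*N) i.1 i.2) := fun i => by unfold dl; fun_prop
        have hc : Continuous fun t => ((φ t / t : ℝ) : ℂ) * ∑ i : Bool × Bool, GF (σ i.1) (σ i.2) N (fun Y => f (dl (2*Real.pi*N^2)⁻¹ i.1 i.2 Y)) (dl (2*Real.pi*N) i.1 i.2 (x.1 + t/(2*Real.pi), x.2 + u * Γ t/(2*Real.pi))) :=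
          (Complex.continuous_ofReal.comp κc).mul (continuous_finsetSum _ fun i _ => (Gc i).comp ((dc i).comp (by fun_prop)))
        rw [spl (cs_int hc κs.mul_right) (fun t ht => by rw [κz t ht, zero_mul]), Fintype.sum_prod_type_right]
        refine Finset.sum_congr rfl fun b _ => ?_
        simp_rw [Finset.mul_sum]
        rw [intervalIntegral.integral_finsetSum]
        · refine Finset.sum_congr rfl fun i _ => ?_
          unfold Fo
          refine intervalIntegral.integral_congr fun t ht => ?_
          rw [uIcc_of_le (by norm_num)] at ht
          simp only [pp, if_pos (by linarith [ht.1] : 0 < t), hep]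
          congr 2
          simp only [dl, Prod.mk.injEq]
          constructor <;> field_simp
        · intro i _
          exact Continuous.intervalIntegrable ((Complex.continuous_ofReal.comp (κc.comp (continuous_const_mul _))).mul ((Gc i).comp ((dc i).comp (by fun_prop)))) _ _


theorem lp_pow {p : ℝ} (hp : 6 ≤ p) (h : ℝ × ℝ → ℂ) : (eLpNorm h (ENNReal.ofReal p) volume).toReal^p = (∫⁻ x, ‖h x‖ₑ^p).toReal := by
  have p0 : 0 < p := by linarith
  rw [eLpNorm_eq_lintegral_rpow_enorm_toReal (by simpa using p0) ENNReal.ofReal_ne_top, ENNReal.toReal_ofReal p0.le, ENNReal.toReal_rpow, ← ENNReal.rpow_mul, one_div_mul_cancel p0.ne', ENNReal.rpow_one]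

theorem fin_ineq {γ φ : ℝ → ℝ} (hs : ContDiff ℝ (⊤ : ℕ∞) φ) (h0 : ∀ t, ¬ (1/2 ≤ |t| ∧ |t| ≤ 2) → φ t = 0) (hparity : (∀ t, γ (-t) = γ t) ∨ (∀ t, γ (-t) = -γ t)) (gc : Continuous γ)
    {p : ℝ} (hp : 6 ≤ p) (T m B s : ℝ) : ∃ C, 0 < C ∧ ∀ j l : ℕ, (∃ g, g 0 = gammaZ γ l ∧ Crv T m B s g) → ∀ f : SchwartzMap (ℝ × ℝ) ℂ,
      ∫⁻ u in Icc (1:ℝ) 2, ∫⁻ x, ‖op (mjl γ φ j l u) f x‖ₑ^p ≤ ENNReal.ofReal (C * 2^(-(65/64*(j:ℝ))) * ∫ y, ‖f y‖^p) := by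
  obtain ⟨σ, σL, hσ⟩ := kern hs h0
  have h0' : ∀ b t, ¬ (1/2 ≤ |t| ∧ |t| ≤ 2) → φ (sb b * t) / (sb b * t) = 0 := fun b t ht => by
    rw [h0 _ (by rwa [abs_mul, sb_abs, one_mul]), zero_div]
  have ps : ∀ b, ContDiff ℝ (⊤ : ℕ∞) (pp fun t => φ (sb b * t) / (sb b * t)) := fun b => pp_s (fun t ht => by
    have : sb b ≠ 0 := fun h => by have := sb_sq b; simp [h] at this
    exact ContDiffAt.div (by fun_prop) (by fun_prop) (mul_ne_zero this ht)) (h0' b)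
  choose C C0 H using fun i : (Bool × Bool) × Bool => rtp hp T m B s (ub_s 6 (ps i.2) (pp_z (h0' i.2))) (ps i.2).continuous (σL i.1.1) (σL i.1.2)
  have S0 : 0 < ∑ i, C i := Finset.sum_pos (fun i _ => C0 i) Finset.univ_nonempty
  refine ⟨8^(p-1) * ∑ i, C i, by positivity, fun j l hg f => ?_⟩
  obtain ⟨g, hg0, hg⟩ := hg
  have Γc : Continuous (gammaZ γ l) := by unfold gammaZ; fun_prop
  obtain ⟨ep, epo, hep⟩ : ∃ ep : Bool → ℝ, (∀ b, ep b = 1 ∨ ep b = -1) ∧ ∀ b t, gammaZ γ l (sb b * t) = ep b * gammaZ γ l t := by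
    rcases hparity with h | h
    · exact ⟨fun _ => 1, fun _ => Or.inl rfl, fun b t => by cases b <;> simp [gammaZ, sb, h]⟩
    · exact ⟨sb, sb_or, fun b t => by cases b <;> simp [gammaZ, sb, h, neg_div]⟩
  set N : ℝ := 2^((j:ℝ)/2) with hN
  have N0 : 0 < N := by positivity
  have N1 : 1 ≤ N := Real.one_le_rpow (by norm_num) (by positivity)
  have hj : N^2 = 2^j := by rw [hN, ← Real.rpow_natCast, ← Real.rpow_mul (by norm_num), ← Real.rpow_natCast]; congr 1; push_cast; ring
  have hN65 : (N^(65/32:ℝ))⁻¹ = 2^(-(65/64*(j:ℝ))) := by rw [hN, ← Real.rpow_mul (by norm_num), ← Real.rpow_neg (by norm_num)]; congr 1; ring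
  obtain ⟨A, A0, hA⟩ := Fs_bi f
  have a0 : 0 < (2*Real.pi*N^2)⁻¹ := by positivity
  have sg2 : ∀ a b : ℝ, (a = 1 ∨ a = -1) → (b = 1 ∨ b = -1) → (a*b = 1 ∨ a*b = -1) := by
    rintro a b (rfl|rfl) (rfl|rfl) <;> simp
  set F : (Bool × Bool) × Bool → ℝ × ℝ → ℂ := fun i Y => f (dl (2*Real.pi*N^2)⁻¹ i.1.1 i.1.2 Y) with hF
  have dlm : ∀ a b1 b2, Continuous (dl a b1 b2) := fun a b1 b2 => by unfold dl; fun_prop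
  have R := fun i => H i g hg (hg0 ▸ Γc) N1 (sg2 _ _ (sb_or i.1.1) (sb_or i.2)) (sg2 _ _ (sb_or i.1.2) (epo i.2)) A0 (hA a0 i.1.1 i.1.2) (f.continuous.comp (dlm _ _ _)).measurable
  rw [hg0] at R
  set W : (Bool × Bool) × Bool → ℝ × (ℝ × ℝ) → ℂ := fun i q => Fo N (sb i.1.1 * sb i.2) (sb i.1.2 * ep i.2) (gammaZ γ l) q.1 (pp fun t => φ (sb i.2 * t) / (sb i.2 * t)) (GF (σ i.1.1) (σ i.1.2) N (F i)) q.2 with hW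
  have Wm : ∀ i, Measurable fun q => ‖W i q‖ₑ^p := fun i => (R i).1.measurable.enorm.pow_const p
  have e0 : ∀ u x, ‖op (mjl γ φ j l u) f x‖ₑ^p ≤ 8^(p-1) * ∑ i, ‖W i (u, dl (2*Real.pi*N) i.1.1 i.1.2 x)‖ₑ^p := fun u x => by
    rw [rep hs h0 hσ N0 hj Γc hep f u x]
    refine (ENNReal.rpow_le_rpow (enorm_sum_le _ _) (by linarith)).trans ((ENNReal.rpow_sum_le_const_mul_sum_rpow _ _ (by linarith)).trans (le_of_eq ?_))
    simp [hW, hF]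
  have e1 : ∀ u, ∫⁻ x, ‖op (mjl γ φ j l u) f x‖ₑ^p ≤ 8^(p-1) * ∑ i, ENNReal.ofReal (((2*Real.pi*N)^2)⁻¹) * ∫⁻ x, ‖W i (u, x)‖ₑ^p := fun u => by
    have mm : ∀ i, Measurable fun x => ‖W i (u, x)‖ₑ^p := fun i => (Wm i).comp (by fun_prop)
    refine (lintegral_mono (e0 u)).trans (le_of_eq ?_)
    have mm2 : ∀ i : (Bool × Bool) × Bool, Measurable fun x => ‖W i (u, dl (2*Real.pi*N) i.1.1 i.1.2 x)‖ₑ^p := fun i => (mm i).comp (dlm _ _ _).measurable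
    rw [lintegral_const_mul _ (Finset.measurable_fun_sum _ fun i _ => mm2 i), lintegral_finsetSum _ fun i _ => mm2 i]
    congr 1; exact Finset.sum_congr rfl fun i _ => dl_lint (by positivity) _ _ (mm i)
  have ml : ∀ i, Measurable fun u => ∫⁻ x, ‖W i (u, x)‖ₑ^p := fun i => (Wm i).lintegral_prod_right'
  have I0 : 0 ≤ ∫ y, ‖f y‖^p := integral_nonneg fun y => by positivity
  calc _ ≤ ∫⁻ u in Icc (1:ℝ) 2, 8^(p-1) * ∑ i, ENNReal.ofReal (((2*Real.pi*N)^2)⁻¹) * ∫⁻ x, ‖W i (u, x)‖ₑ^p := lintegral_mono e1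
    _ = 8^(p-1) * ∑ i, ENNReal.ofReal (((2*Real.pi*N)^2)⁻¹) * ∫⁻ q, ‖W i q‖ₑ^p ∂(mI 1 2) := by
        rw [lintegral_const_mul _ (Finset.measurable_fun_sum _ fun i _ => (ml i).const_mul _), lintegral_finsetSum _ fun i _ => (ml i).const_mul _]
        congr 1
        refine Finset.sum_congr rfl fun i _ => ?_
        rw [lintegral_const_mul _ (ml i)]; unfold mI; rw [lintegral_prod _ (Wm i).aemeasurable]
    _ ≤ 8^(p-1) * ∑ i, ENNReal.ofReal (C i * 2^(-(65/64*(j:ℝ))) * ∫ y, ‖f y‖^p) := by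
        refine mul_le_mul' le_rfl (Finset.sum_le_sum fun i _ => (mul_le_mul' le_rfl (R i).2).trans (le_of_eq ?_))
        rw [← ENNReal.ofReal_mul (by positivity), dl_int a0 i.1.1 i.1.2 (fun y => ‖f y‖^p), hN65, smul_eq_mul]
        congr 1; field_simp
    _ = _ := by
        rw [← ENNReal.ofReal_sum_of_nonneg fun i _ => by have := C0 i; positivity, ← Finset.sum_mul, ← Finset.sum_mul,
          show (8:ℝ≥0∞)^(p-1) = ENNReal.ofReal (8^(p-1)) by rw [← ENNReal.ofReal_rpow_of_pos (by norm_num)]; norm_num, ← ENNReal.ofReal_mul (by positivity)]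
        congr 1; ring

theorem fin_conc {p C : ℝ} (hp : 6 ≤ p) (C0 : 0 < C) {j : ℕ} {f : SchwartzMap (ℝ × ℝ) ℂ} {G : ℝ → ℝ × ℝ → ℂ}
    (h : ∫⁻ u in Icc (1:ℝ) 2, ∫⁻ x, ‖G u x‖ₑ^p ≤ ENNReal.ofReal (C * 2^(-(65/64*(j:ℝ))) * ∫ y, ‖f y‖^p)) :
    (∫ u in Set.Icc (1 : ℝ) 2, (eLpNorm (G u) (ENNReal.ofReal p) volume).toReal ^ p) ^ (1 / p) ≤
        C^(1/p) * (2 : ℝ) ^ (-((1 / p + 1/(64*p)) * (j : ℝ))) * (eLpNorm (⇑f) (ENNReal.ofReal p) volume).toReal := by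
  have p0 : 0 < p := by linarith
  have I0 : 0 ≤ ∫ y, ‖f y‖^p := integral_nonneg fun y => by positivity
  obtain ⟨A, A0, hA⟩ := Fs_bi f
  have hB : BI A f := by simpa [dl, sb] using hA one_pos true true
  have hf : ∫ y, ‖f y‖^p = (eLpNorm (⇑f) (ENNReal.ofReal p) volume).toReal^p := by
    rw [lp_pow hp, integral_eq_lintegral_of_nonneg_ae (.of_forall fun y => by positivity) (hB.pint hp).1]
    congr 2; funext y
    rw [← ofReal_norm, ENNReal.ofReal_rpow_of_nonneg (norm_nonneg _) p0.le]
  have hE : ∫ u in Set.Icc (1 : ℝ) 2, (eLpNorm (G u) (ENNReal.ofReal p) volume).toReal ^ p ≤ C * 2^(-(65/64*(j:ℝ))) * ∫ y, ‖f y‖^p := by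
    simp_rw [lp_pow hp (G _)]
    by_cases hi : IntegrableOn (fun u => (∫⁻ x, ‖G u x‖ₑ^p).toReal) (Icc (1:ℝ) 2)
    · refine (ENNReal.ofReal_le_ofReal_iff (by positivity)).1 ?_
      rw [ofReal_integral_eq_lintegral_ofReal hi (.of_forall fun u => ENNReal.toReal_nonneg)]
      exact (lintegral_mono fun u => ENNReal.ofReal_toReal_le).trans h
    · rw [integral_undef hi]; positivity
  refine (Real.rpow_le_rpow (integral_nonneg fun u => by positivity) hE (by positivity)).trans (le_of_eq ?_)
  rw [hf, Real.mul_rpow (by positivity) (by positivity), Real.mul_rpow C0.le (by positivity), ← Real.rpow_mul (by norm_num), ← Real.rpow_mul ENNReal.toReal_nonneg, mul_one_div_cancel p0.ne', Real.rpow_one]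
  congr 3; field_simp; ring


/-- Local smoothing estimate for `m_j^l(u,D)`, uniform in `l`. -/
theorem mjl_local_smoothing
    (γ : ℝ → ℝ)
    (hγ0 : γ 0 = 0)
    (hsmooth : ContDiffOn ℝ (⊤ : ℕ∞) γ (Set.Icc (-1 : ℝ) 1))
    (hparity : (∀ t, γ (-t) = γ t) ∨ (∀ t, γ (-t) = -γ t))
    (hmono : StrictMonoOn γ (Set.Icc (0 : ℝ) 1))
    (hyp1 : ∃ c > (0 : ℝ), ∀ t ∈ Set.Ioc (0 : ℝ) 1,
      c ≤ |deriv (fun s => deriv γ s / deriv (deriv γ) s) t|)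
    (hyp2 : ∃ c > (0 : ℝ), ∀ j ∈ ({1, 2} : Set ℕ), ∀ t ∈ Set.Ioc (0 : ℝ) 1,
      c ≤ |t ^ j * iteratedDeriv j γ t / γ t|)
    (hyp3 : ∃ C : ℝ, ∀ j : ℕ, 1 ≤ j → j ≤ 1000 → ∀ t ∈ Set.Ioc (0 : ℝ) 1,
      |t ^ j * iteratedDeriv j γ t / γ t| ≤ C)
    (hγ1 : γ 1 = 1)
    (hconv : ∀ t ∈ Set.Ioc (0 : ℝ) 1, 0 < iteratedDeriv 2 γ t)
    (hext : ∀ t : ℝ, 1 ≤ t → γ t = (γ t⁻¹)⁻¹)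
    (hcont : ContinuousOn γ (Set.Ici (0 : ℝ)))
    (hmono2 : StrictMonoOn γ (Set.Ici (0 : ℝ)))
    (hsurj : γ '' Set.Ici (0 : ℝ) = Set.Ici (0 : ℝ))
    (φ : ℝ → ℝ) (hφs : ContDiff ℝ (⊤ : ℕ∞) φ) (hφc : HasCompactSupport φ)
    (hφsupp : Function.support φ ⊆ {t : ℝ | 1/2 ≤ |t| ∧ |t| ≤ 2})
    (hφsum : ∀ t : ℝ, t ≠ 0 → HasSum (fun k : ℤ => φ ((2 : ℝ) ^ (-k) * t)) 1)
    (p : ℝ) (hp : 6 ≤ p) :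
    ∃ δ C : ℝ, 0 < δ ∧ 0 < C ∧ ∃ L₀ : ℕ,
      ∀ j : ℕ, 1 ≤ j → ∀ l : ℕ, L₀ ≤ l → ∀ f : SchwartzMap (ℝ × ℝ) ℂ,
        (∫ u in Set.Icc (1 : ℝ) 2,
            (eLpNorm (op (mjl γ φ j l u) (⇑f)) (ENNReal.ofReal p) volume).toReal ^ p)
          ^ (1 / p) ≤
        C * (2 : ℝ) ^ (-((1 / p + δ) * (j : ℝ))) *
          (eLpNorm (⇑f) (ENNReal.ofReal p) volume).toReal := by
  obtain ⟨T, m, B, s, L₀, hL⟩ := mk_crv γ hγ0 hsmooth hmono hyp1 hyp2 hyp3 hconv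
  have h0 : ∀ t, ¬ (1/2 ≤ |t| ∧ |t| ≤ 2) → φ t = 0 := fun t ht => by
    by_contra h; exact ht (hφsupp h)
  have p0 : 0 < p := by linarith
  obtain ⟨C, C0, H⟩ := fin_ineq hφs h0 hparity (gz_cont γ hγ0 hparity hcont) hp T m B s
  exact ⟨1/(64*p), C^(1/p), by positivity, by positivity, L₀, fun j _ l hl f => fin_conc hp C0 (H j l (hL l hl) f)⟩
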